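/- Let p and q be prime numbers and let r and s be nonnegative integers. Let H be a semisimple Hopf algebra over ℂ of dimension p^r q^s, and let V be a simple left H-module. Then the dimension of V over ℂ divides the dimension of H over ℂ (Kaplansky's sixth conjecture holds for H). -/

import Mathlib

universe u v w
open Module
open Finset (add_sum_erase dvd_sum exists_ne_zero_of_sum_ne_zero mem_filter mem_image_of_mem
  mem_inter mem_univ mul_sum single_le_sum smul_sum subset_univ sum_add_distrib sum_bij sum_comm
  sum_congr sum_div sum_eq_single sum_eq_zero sum_eq_zero_iff sum_filter sum_le_sum_of_subset
  sum_mul sum_pair sum_subset)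
open LinearMap (comp_assoc comp_id id_comp lTensor_comp_apply lTensor_smul mulLeft mulLeft_apply
  mulLeft_one mulRight mulRight_apply mulRight_one rTensor_comp_apply toMatrix_comp trace_conj')
open Fintype (card_fin equivFin sum_prod_type sum_sigma)
open Algebra.TensorProduct (includeRight one_def tmul_mul_tmul)
set_option linter.unusedSectionVars false
noncomputable section
variable {N : Type v} [Ring N] [Algebra ℂ N] {Δ : Type u} [Monoid Δ]

/-- A linear category with traces, realised inside a single `ℂ`-algebra `N`: morphisms are
elements of `N` and composition is multiplication. -/
structure LCat (N : Type v) [Ring N] [Algebra ℂ N] (O : Type u) where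
  one : O -> N
  Hom : O -> O -> Submodule ℂ N
  one_mem : ∀ X, one X ∈ Hom X X
  comp_mem : ∀ {X Y Z s t}, s ∈ Hom Y Z -> t ∈ Hom X Y -> s * t ∈ Hom X Z
  comp_one : ∀ {X Y t}, t ∈ Hom X Y -> t * one X = t
  one_comp : ∀ {X Y t}, t ∈ Hom X Y -> one Y * t = t
  fin : ∀ X Y, FiniteDimensional ℂ (Hom X Y)
  tr : O -> N →ₗ[ℂ] ℂ
  tr_comm : ∀ {X Y s t}, s ∈ Hom Y X -> t ∈ Hom X Y -> tr X (s * t) = tr Y (t * s)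
  tr_nondeg : ∀ {X Y t}, t ∈ Hom X Y -> (∀ s ∈ Hom Y X, tr X (s * t) = 0) -> t = 0
  tr_nilp : ∀ {X t}, t ∈ Hom X X -> IsNilpotent t -> tr X t = 0
  gen : ∃ S : Finset O, ∀ X Y, ∀ s ∈ Hom X Y, s ≠ 0 -> ∃ G ∈ S, ∃ t ∈ Hom G X, s * t ≠ 0

namespace LCat
variable {O : Type u} (C : LCat N O)

/-- Every idempotent endomorphism splits. -/
class Split : Prop where
  split : ∀ {X e}, e ∈ C.Hom X X -> e * e = e ->
    ∃ Y s t, s ∈ C.Hom Y X ∧ t ∈ C.Hom X Y ∧ t * s = C.one Y ∧ s * t = e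

/-- The maps `s k : Y k -> X` and `s' k : X -> Y k` exhibit `X` as the direct sum of the `Y k`. -/
structure IsSum {ι : Type*} [Fintype ι] (X : O) (Y : ι -> O) (s s' : ι -> N) : Prop where
  mem : ∀ k, s k ∈ C.Hom (Y k) X
  mem' : ∀ k, s' k ∈ C.Hom X (Y k)
  same : ∀ k, s' k * s k = C.one (Y k)
  diff : ∀ k l, k ≠ l -> s' k * s l = 0
  sum : ∑ k, s k * s' k = C.one X

def Iso (X Y : O) : Prop := ∃ s t, s ∈ C.Hom X Y ∧ t ∈ C.Hom Y X ∧ t * s = C.one X ∧ s * t = C.one Y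

def Simple (X : O) : Prop := C.one X ≠ 0 ∧ ∀ t ∈ C.Hom X X, ∃ c : ℂ, t = c • C.one X

structure Additive {A : Type*} [AddCommMonoid A] (f : O -> A) : Prop where
  sum : ∀ {ι : Type} [Fintype ι] {X : O} {Y : ι -> O} {s s' : ι -> N}, C.IsSum X Y s s' ->
    f X = ∑ k, f (Y k)

/-- Multiplicity space dimension. -/
def hd (X Y : O) : ℕ := finrank ℂ (C.Hom X Y)

variable {C}

instance (X Y : O) : FiniteDimensional ℂ (C.Hom X Y) := C.fin X Y

lemma one_mul_one (X : O) : C.one X * C.one X = C.one X := C.comp_one (C.one_mem X)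

lemma Iso.refl (X : O) : C.Iso X X := ⟨_, _, C.one_mem X, C.one_mem X, one_mul_one X, one_mul_one X⟩

lemma Iso.symm {X Y : O} (h : C.Iso X Y) : C.Iso Y X := by
  obtain ⟨s, t, hs, ht, h1, h2⟩ := h; exact ⟨t, s, ht, hs, h2, h1⟩

lemma Iso.trans {X Y Z : O} (h : C.Iso X Y) (h' : C.Iso Y Z) : C.Iso X Z := by
  obtain ⟨s, t, hs, ht, h1, h2⟩ := h; obtain ⟨a, b, ha, hb, h3, h4⟩ := h'
  refine ⟨a * s, t * b, C.comp_mem ha hs, C.comp_mem ht hb, ?_, ?_⟩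
  . rw [mul_assoc, <- mul_assoc b, h3, C.one_comp hs, h1]
  . rw [mul_assoc, <- mul_assoc s, h2, C.one_comp hb, h4]

lemma Iso.isSum {X Y : O} (h : C.Iso X Y) : ∃ s s' : Unit -> N, C.IsSum X (fun _ => Y) s s' := by
  obtain ⟨s, t, hs, ht, h1, h2⟩ := h
  exact ⟨fun _ => t, fun _ => s, fun _ => ht, fun _ => hs, fun _ => h2,
    fun k l h => (h rfl).elim, by simpa using h1⟩

lemma Additive.iso {A : Type*} [AddCommMonoid A] {f : O -> A} (hf : C.Additive f) {X Y : O}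
    (h : C.Iso X Y) : f X = f Y := by
  obtain ⟨s, s', hs⟩ := h.isSum; simpa using hf.sum hs

/-- Schur's lemma. -/
lemma Simple.iso_of_ne_zero {X Y : O} (hX : C.Simple X) (hY : C.Simple Y) {s : N}
    (hs : s ∈ C.Hom X Y) (h0 : s ≠ 0) : C.Iso X Y := by
  by_contra hn
  refine h0 (C.tr_nondeg hs fun t ht => ?_)
  by_contra htr
  obtain ⟨c, hc⟩ := hX.2 _ (C.comp_mem ht hs); obtain ⟨d, hd⟩ := hY.2 _ (C.comp_mem hs ht)
  have hc0 : c ≠ 0 := by rintro rfl; rw [hc] at htr; simp at htr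
  have h2 : C.tr Y (s * t) ≠ 0 := by rwa [<- C.tr_comm ht hs]
  have hd0 : d ≠ 0 := by rintro rfl; rw [hd] at h2; simp at h2
  have e1 : s * t * s = c • s := by rw [mul_assoc, hc, mul_smul_comm, C.comp_one hs]
  have e2 : s * t * s = d • s := by rw [hd, smul_mul_assoc, C.one_comp hs]
  have hcd : c = d := by
    have : (c - d) • s = 0 := by rw [sub_smul, <- e1, <- e2, sub_self]
    rcases smul_eq_zero.1 this with h | h
    . exact sub_eq_zero.1 h
    . exact (h0 h).elim
  refine hn ⟨s, c⁻¹ • t, hs, Submodule.smul_mem _ _ ht, ?_, ?_⟩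
  . rw [smul_mul_assoc, hc, smul_smul, inv_mul_cancel₀ hc0, one_smul]
  . rw [mul_smul_comm, hd, smul_smul, hcd, inv_mul_cancel₀ hd0, one_smul]

lemma Simple.tr_one_ne_zero {X : O} (hX : C.Simple X) : C.tr X (C.one X) ≠ 0 := by
  intro h; refine hX.1 (C.tr_nondeg (C.one_mem X) fun s hs => ?_); obtain ⟨c, rfl⟩ := hX.2 s hs
  rw [smul_mul_assoc, one_mul_one, map_smul, h, smul_zero]

lemma hd_self_of_simple {X : O} (hX : C.Simple X) : C.hd X X = 1 := by
  rw [hd, finrank_eq_one_iff_of_nonzero' ⟨C.one X, C.one_mem X⟩ (fun h => hX.1 (by simpa using h))]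
  rintro ⟨t, ht⟩; obtain ⟨c, hc⟩ := hX.2 t ht; exact ⟨c, by simp [hc]⟩

lemma hd_eq_zero {X Y : O} : C.hd X Y = 0 ↔ ∀ t ∈ C.Hom X Y, t = 0 := by
  rw [hd, Submodule.finrank_eq_zero, Submodule.eq_bot_iff]

lemma hd_simple_ne {X Y : O} (hX : C.Simple X) (hY : C.Simple Y) (h : ¬ C.Iso X Y) :
    C.hd X Y = 0 := by
  rw [hd_eq_zero]; intro t ht; by_contra h0; exact h (hX.iso_of_ne_zero hY ht h0)

namespace IsSum
variable {ι : Type*} [Fintype ι] {X : O} {Y : ι -> O} {s s' : ι -> N}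

lemma expand_left (h : C.IsSum X Y s s') {Z : O} {t : N} (ht : t ∈ C.Hom Z X) :
    ∑ k, s k * (s' k * t) = t := by
  simp_rw [<- mul_assoc, <- sum_mul, h.sum, C.one_comp ht]

lemma expand_right (h : C.IsSum X Y s s') {Z : O} {t : N} (ht : t ∈ C.Hom X Z) :
    ∑ k, t * s k * s' k = t := by
  simp_rw [mul_assoc, <- mul_sum, h.sum, C.comp_one ht]

lemma proj_sum (h : C.IsSum X Y s s') {t : ι -> N} (Z : O) (ht : ∀ k, t k ∈ C.Hom Z (Y k))
    (k : ι) : s' k * ∑ l, s l * t l = t k := by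
  classical
  rw [mul_sum, sum_eq_single k]
  . rw [<- mul_assoc, h.same, C.one_comp (ht k)]
  . intro l _ hl; rw [<- mul_assoc, h.diff _ _ hl.symm, zero_mul]
  . simp

lemma sum_incl (h : C.IsSum X Y s s') {t : ι -> N} (Z : O) (ht : ∀ k, t k ∈ C.Hom (Y k) Z)
    (k : ι) : (∑ l, t l * s' l) * s k = t k := by
  classical
  rw [sum_mul, sum_eq_single k]
  . rw [mul_assoc, h.same, C.comp_one (ht k)]
  . intro l _ hl; rw [mul_assoc, h.diff _ _ hl, mul_zero]
  . simp

lemma hd_left (h : C.IsSum X Y s s') (Z : O) : C.hd Z X = ∑ k, C.hd Z (Y k) := by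
  simp_rw [hd, <- finrank_pi_fintype ℂ]; refine LinearEquiv.finrank_eq ?_; exact
    { toFun := fun t k => ⟨s' k * t, C.comp_mem (h.mem' k) t.2⟩
      map_add' := fun a b => by ext k; simp [mul_add]
      map_smul' := fun a b => by ext k; simp
      invFun := fun f => ⟨∑ k, s k * f k, Submodule.sum_mem _ fun k _ =>
        C.comp_mem (h.mem k) (f k).2⟩
      left_inv := fun t => by ext; exact h.expand_left t.2
      right_inv := fun f => by ext k; exact h.proj_sum Z (fun k => (f k).2) k }

lemma hd_right (h : C.IsSum X Y s s') (Z : O) : C.hd X Z = ∑ k, C.hd (Y k) Z := by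
  simp_rw [hd, <- finrank_pi_fintype ℂ]; refine LinearEquiv.finrank_eq ?_; exact
    { toFun := fun t k => ⟨t * s k, C.comp_mem t.2 (h.mem k)⟩
      map_add' := fun a b => by ext k; simp [add_mul]
      map_smul' := fun a b => by ext k; simp
      invFun := fun f => ⟨∑ k, f k * s' k, Submodule.sum_mem _ fun k _ =>
        C.comp_mem (f k).2 (h.mem' k)⟩
      left_inv := fun t => by ext; exact h.expand_right t.2
      right_inv := fun f => by ext k; exact h.sum_incl Z (fun k => (f k).2) k }

lemma tr_eq (h : C.IsSum X Y s s') {t : N} (ht : t ∈ C.Hom X X) :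
    C.tr X t = ∑ k, C.tr (Y k) (s' k * t * s k) := by
  conv_lhs => rw [<- h.expand_left ht, map_sum]
  exact sum_congr rfl fun k _ => C.tr_comm (h.mem k) (C.comp_mem (h.mem' k) ht)

lemma sigma (h : C.IsSum X Y s s') {κ : ι -> Type*} [∀ i, Fintype (κ i)]
    {Z : ∀ i, κ i -> O} {t t' : ∀ i, κ i -> N} (ht : ∀ i, C.IsSum (Y i) (Z i) (t i) (t' i)) :
    C.IsSum (ι := Σ i, κ i) X (fun p => Z p.1 p.2) (fun p => s p.1 * t p.1 p.2)
      (fun p => t' p.1 p.2 * s' p.1) where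
  mem p := C.comp_mem (h.mem _) ((ht _).mem _)
  mem' p := C.comp_mem ((ht _).mem' _) (h.mem' _)
  same p := by rw [mul_assoc, <- mul_assoc (s' _), h.same, C.one_comp ((ht _).mem _), (ht _).same]
  diff := by
    rintro ⟨i, k⟩ ⟨j, l⟩ hne; by_cases hij : i = j
    . subst hij; have : k ≠ l := fun h => hne (by rw [h])
      rw [mul_assoc, <- mul_assoc (s' _), h.same, C.one_comp ((ht _).mem _), (ht _).diff _ _ this]
    . rw [mul_assoc, <- mul_assoc (s' _), h.diff _ _ hij, zero_mul, mul_zero]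
  sum := by
    rw [sum_sigma, <- h.sum]; refine sum_congr rfl fun i _ => ?_
    have : ∀ k, s i * t i k * (t' i k * s' i) = s i * (t i k * t' i k) * s' i := fun k => by
      simp [mul_assoc]
    simp_rw [this, <- sum_mul, <- mul_sum, (ht i).sum, mul_assoc, C.one_comp (h.mem' i)]

lemma reindex (h : C.IsSum X Y s s') {κ : Type*} [Fintype κ] (e : κ ≃ ι) :
    C.IsSum X (Y ∘ e) (s ∘ e) (s' ∘ e) where
  mem k := h.mem _
  mem' k := h.mem' _
  same k := h.same _
  diff k l hkl := h.diff _ _ (e.injective.ne hkl)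
  sum := by rw [<- h.sum]; exact Equiv.sum_comp e (fun k => s k * s' k)

lemma replace (h : C.IsSum X Y s s') {Z : ι -> O} (hZ : ∀ i, C.Iso (Y i) (Z i)) :
    ∃ t t', C.IsSum X Z t t' := by
  choose a b ha hb hab hba using hZ
  refine ⟨fun i => s i * b i, fun i => a i * s' i, fun i => C.comp_mem (h.mem i) (hb i),
    fun i => C.comp_mem (ha i) (h.mem' i), fun i => ?_, fun i j hij => ?_, ?_⟩
  . rw [mul_assoc, <- mul_assoc (s' i), h.same, C.one_comp (hb i), hba]
  . rw [mul_assoc, <- mul_assoc (s' i), h.diff _ _ hij, zero_mul, mul_zero]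
  . rw [<- h.sum]; refine sum_congr rfl fun i _ => ?_
    rw [mul_assoc, <- mul_assoc (b i), hab, C.one_comp (h.mem' i)]

end IsSum

lemma Additive.sum_eq {A : Type*} [AddCommMonoid A] {f : O -> A} (hf : C.Additive f) {ι : Type*}
    [Fintype ι] {X : O} {Y : ι -> O} {s s' : ι -> N} (h : C.IsSum X Y s s') :
    f X = ∑ k, f (Y k) :=
  (hf.sum (h.reindex (equivFin ι).symm)).trans
    (Equiv.sum_comp (equivFin ι).symm fun k => f (Y k))

lemma add_hd_left (Z : O) : C.Additive (fun X => C.hd Z X) := ⟨fun h => h.hd_left Z⟩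
lemma add_hd_right (Z : O) : C.Additive (fun X => C.hd X Z) := ⟨fun h => h.hd_right Z⟩

lemma add_tr_one : C.Additive (fun X => C.tr X (C.one X)) := by
  refine ⟨fun h => ?_⟩
  refine (h.tr_eq (C.one_mem _)).trans ?_
  refine sum_congr rfl fun k _ => ?_
  rw [C.comp_one (h.mem' k), h.same]

open Polynomial in
/-- An endomorphism that is not nilpotent divides a nonzero idempotent. -/
lemma exists_idempotent {X : O} {v : N} (hv : v ∈ C.Hom X X) (hn : ¬ IsNilpotent v) :
    ∃ y, y * v ∈ C.Hom X X ∧ y * v * (y * v) = y * v ∧ y * v ≠ 0 := by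
  have hm : ∀ P : ℂ[X], aeval v P * v ∈ C.Hom X X := fun P => by
    induction P using Polynomial.induction_on' with
    | add p q hp hq => rw [map_add, add_mul]; exact add_mem hp hq
    | monomial n c =>
      rw [aeval_monomial, <- Algebra.smul_def, smul_mul_assoc]; refine Submodule.smul_mem _ _ ?_
      induction n with
      | zero => simpa using hv
      | succ n ih => rw [pow_succ', mul_assoc]; exact C.comp_mem hv ih
  obtain ⟨P, h0, hP⟩ : ∃ P : ℂ[X], P ≠ 0 ∧ aeval v P * v = 0 := by
    by_contra! h
    let f := ((mulRight ℂ v) ∘ₗ (aeval v).toLinearMap).codRestrict (C.Hom X X) hm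
    exact not_finite (Module.Finite.of_injective f ((injective_iff_map_eq_zero f).2 fun P hP =>
      by_contra fun h' => h P h' congr(Subtype.val $hP)))
  obtain ⟨R, hPR, hR⟩ := exists_eq_pow_rootMultiplicity_mul_and_not_dvd P h0 0
  rw [map_zero, sub_zero] at hPR hR; rw [X_dvd_iff] at hR; generalize rootMultiplicity 0 P = n at hPR
  set q := Polynomial.C (-(R.coeff 0)⁻¹) * R.divX
  set y := aeval (R := ℂ) v q
  have hc : Commute y v := by simpa using (Commute.all q .X).map (aeval v)
  have h1 : y * v ^ (n + 2) = v ^ (n + 1) := by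
    have h : q * .X ^ (n + 2) - .X ^ (n + 1) = Polynomial.C (-(R.coeff 0)⁻¹) * (P * .X) := by
      have : Polynomial.C (R.coeff 0)⁻¹ * Polynomial.C (R.coeff 0) = 1 := by
        rw [<- Polynomial.C_mul, inv_mul_cancel₀ hR, Polynomial.C_1]
      simp only [q, hPR, map_neg]
      linear_combination .X ^ (n + 1) * this - Polynomial.C (R.coeff 0)⁻¹ * .X ^ (n + 1) * divX_mul_X_add R
    simpa [hP, sub_eq_zero] using congr(aeval v $h)
  have h2 : ∀ k, y ^ k * v ^ (n + 1 + k) = v ^ (n + 1) := fun k => by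
    induction k with
    | zero => simp
    | succ k ih =>
      rw [pow_succ, mul_assoc, <- add_assoc, add_right_comm _ k, pow_add _ _ k, ← mul_assoc y, h1, ← pow_add, ih]
  have h3 : y ^ (n + 1) * v ^ n * v = (y * v) ^ (n + 1) := by rw [hc.mul_pow, mul_assoc, pow_succ v]
  have h4 : (y * v) ^ (n + 1) * v ^ (n + 1) = v ^ (n + 1) := by
    rw [hc.mul_pow, mul_assoc, ← pow_add, h2]
  refine ⟨y ^ (n + 1) * v ^ n, by simpa using hm (q ^ (n + 1) * .X ^ n), ?_, fun h => hn ⟨n + 1, ?_⟩⟩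
  · rw [h3]
    nth_rw 1 [hc.mul_pow]
    rw [mul_assoc, ((hc.symm.mul_right (.refl v)).pow_pow _ _).eq, h4, hc.mul_pow]
  · rw [<- h4, <- h3, h, zero_mul]

lemma simple_of_no_idempotent {X : O} (h0 : C.one X ≠ 0)
    (hid : ∀ e ∈ C.Hom X X, e * e = e -> e = 0 ∨ e = C.one X) : C.Simple X := by
  refine ⟨h0, fun t ht => ?_⟩
  have : Nontrivial (C.Hom X X) := ⟨⟨C.one X, C.one_mem X⟩, 0, fun h => h0 congr(Subtype.val $h)⟩
  obtain ⟨c, hc⟩ := End.exists_eigenvalue ((mulLeft ℂ t).restrict fun x (hx : x ∈ C.Hom X X) => C.comp_mem ht hx)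
  obtain ⟨⟨w, hw⟩, h⟩ := hc.exists_hasEigenvector
  have h1 : t * w = c • w := congr(Subtype.val $(h.apply_eq_smul))
  have hu := sub_mem ht (Submodule.smul_mem _ c (C.one_mem X))
  refine ⟨c, sub_eq_zero.1 (C.tr_nondeg hu fun s hs => by_contra fun htr => h.2 (Subtype.ext ?_))⟩
  obtain ⟨y, hy, h2, h3⟩ := exists_idempotent (C.comp_mem hs hu) fun h => htr (C.tr_nilp (C.comp_mem hs hu) h)
  change w = 0
  rw [<- C.one_comp hw, <- (hid _ hy h2).resolve_left h3, mul_assoc, mul_assoc, sub_mul, h1, smul_mul_assoc,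
    C.one_comp hw, sub_self, mul_zero, mul_zero]

lemma exists_isSum_simple [C.Split] (X : O) : ∃ (n : ℕ) (Y : Fin n -> O) (s s' : Fin n -> N),
    (∀ k, C.Simple (Y k)) ∧ C.IsSum X Y s s' := by
  induction hd' : C.hd X X using Nat.strong_induction_on generalizing X with
  | _ n ih =>
    by_cases h0 : C.one X = 0
    . exact ⟨0, Fin.elim0, Fin.elim0, Fin.elim0, fun k => k.elim0,
        ⟨fun k => k.elim0, fun k => k.elim0, fun k => k.elim0, fun k => k.elim0, by simp [h0]⟩⟩
    by_cases hid : ∀ e ∈ C.Hom X X, e * e = e -> e = 0 ∨ e = C.one X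
    . exact ⟨1, fun _ => X, fun _ => C.one X, fun _ => C.one X,
        fun _ => simple_of_no_idempotent h0 hid,
        ⟨fun _ => C.one_mem X, fun _ => C.one_mem X, fun _ => one_mul_one X,
          fun k l hkl => (hkl (Subsingleton.elim _ _)).elim, by simp [one_mul_one]⟩⟩
    push Not at hid
    obtain ⟨e, he, hee, he0, he1⟩ := hid; have hfm := Submodule.sub_mem _ (C.one_mem X) he
    have hff : (C.one X - e) * (C.one X - e) = C.one X - e := by
      rw [mul_sub, sub_mul, sub_mul, one_mul_one, C.comp_one he, C.one_comp he, hee]; abel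
    obtain ⟨Y, s, s', hs, hs', h1, h2⟩ := Split.split he hee
    obtain ⟨Y₂, t, t', ht, ht', h3, h4⟩ := Split.split hfm hff; have hst : s' * t = 0 := by
      have : s' * e * (C.one X - e) * t = 0 := by
        rw [mul_assoc s', mul_sub, C.comp_one he, hee, sub_self, mul_zero, zero_mul]
      rwa [<- h2, <- mul_assoc, h1, C.one_comp hs', mul_assoc, h2, <- h4, mul_assoc, h3,
        C.comp_one ht] at this
    have hts : t' * s = 0 := by
      have : t' * (C.one X - e) * e * s = 0 := by
        rw [mul_assoc t', sub_mul, C.one_comp he, hee, sub_self, mul_zero, zero_mul]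
      rwa [<- h4, <- mul_assoc, h3, C.one_comp ht', mul_assoc, <- h2, mul_assoc, h1,
        C.comp_one hs] at this
    have hsum : C.IsSum X (fun b => cond b Y Y₂) (fun b => cond b s t)
        (fun b => cond b s' t') :=
      ⟨by rintro (_ | _) <;> assumption, by rintro (_ | _) <;> assumption,
        by rintro (_ | _) <;> assumption,
        by rintro (_ | _) (_ | _) h <;> first | exact (h rfl).elim | assumption,
        by simp [h2, h4]⟩
    have hdX : C.hd X X = C.hd Y Y + C.hd Y₂ Y + (C.hd Y Y₂ + C.hd Y₂ Y₂) := by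
      simp [hsum.hd_left X, hsum.hd_right]
    have hY : C.hd Y Y ≠ 0 := fun h => he0 (by
      rw [<- h2, <- C.comp_one hs, hd_eq_zero.1 h _ (C.one_mem Y), mul_zero, zero_mul])
    have hY₂ : C.hd Y₂ Y₂ ≠ 0 := fun h => he1 (sub_eq_zero.1 (by
      rw [<- h4, <- C.comp_one ht, hd_eq_zero.1 h _ (C.one_mem Y₂), mul_zero, zero_mul])).symm
    obtain ⟨n1, A, a, a', hA, ha⟩ := ih _ (by omega) Y rfl
    obtain ⟨n2, B, b, b', hB, hb⟩ := ih _ (by omega) Y₂ rfl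
    have hall := hsum.sigma (κ := fun x => Fin (cond x n1 n2))
      (Z := fun x => Bool.rec B A x) (t := fun x => Bool.rec b a x)
      (t' := fun x => Bool.rec b' a' x) (by rintro (_ | _) <;> assumption)
    refine ⟨_, _, _, _, ?_, hall.reindex (equivFin _).symm⟩
    intro k; simp only [Function.comp]; generalize (equivFin _).symm k = z; rcases z with ⟨_ | _, j⟩
    . exact hB j
    . exact hA j

/-- Isomorphism of simple objects. -/
instance simpleSetoid (C : LCat N O) : Setoid {X : O // C.Simple X} where
  r X Y := C.Iso X Y
  iseqv := ⟨fun _ => Iso.refl _, Iso.symm, Iso.trans⟩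

/-- The set of isomorphism classes of simple objects. -/
def Irr (C : LCat N O) : Type u := Quotient (simpleSetoid C)

def rep (i : C.Irr) : O := (Quotient.out i).1
lemma rep_simple (i : C.Irr) : C.Simple (rep i) := (Quotient.out i).2

def cls (X : O) (h : C.Simple X) : C.Irr := Quotient.mk _ ⟨X, h⟩

lemma cls_eq_iff {X : O} {h : C.Simple X} {i : C.Irr} : cls X h = i ↔ C.Iso X (rep i) := by
  constructor
  . intro hi; have : (⟨X, h⟩ : {X : O // C.Simple X}) ≈ Quotient.out i := by
      rw [<- hi]; exact Setoid.symm (Quotient.mk_out _)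
    exact this
  . intro hi; rw [<- Quotient.out_eq i]; exact Quotient.sound hi

lemma iso_rep_cls {X : O} (h : C.Simple X) : C.Iso X (rep (cls X h)) := cls_eq_iff.1 rfl

lemma cls_rep (i : C.Irr) : cls (rep i) (rep_simple i) = i := cls_eq_iff.2 (Iso.refl _)

lemma iso_rep_iff {i j : C.Irr} : C.Iso (rep i) (rep j) ↔ i = j := by
  rw [<- cls_eq_iff (h := rep_simple i), cls_rep]

lemma hd_rep_rep [DecidableEq C.Irr] (i j : C.Irr) :
    C.hd (rep i) (rep j) = if i = j then 1 else 0 := by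
  split_ifs with h
  . rw [h]; exact hd_self_of_simple (rep_simple j)
  . exact hd_simple_ne (rep_simple i) (rep_simple j) (fun h' => h (iso_rep_iff.1 h'))

section split
variable [C.Split]

lemma exists_dec (X : O) : ∃ (n : ℕ) (l : Fin n -> C.Irr) (s s' : Fin n -> N),
    C.IsSum X (fun k => rep (l k)) s s' := by
  obtain ⟨n, Y, s, s', hY, h⟩ := C.exists_isSum_simple X
  obtain ⟨t, t', ht⟩ := h.replace (fun k => iso_rep_cls (hY k)); exact ⟨n, _, t, t', ht⟩

instance : Finite C.Irr := by
  obtain ⟨S, hS⟩ := C.gen; choose n l s s' h using C.exists_dec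
  have : ∀ i, ∃ G : S, ∃ k : Fin (n G), l G k = i := by
    intro i; obtain ⟨G, hG, t, ht, hne⟩ := hS _ _ _ (C.one_mem (rep i)) (rep_simple i).1
    rw [C.one_comp ht] at hne; refine ⟨⟨G, hG⟩, ?_⟩; by_contra hk
    push Not at hk
    apply hne
    rw [<- (h G).expand_right ht]; refine sum_eq_zero fun k _ => ?_
    rw [hd_eq_zero.1 (hd_simple_ne (rep_simple _) (rep_simple i)
      (fun h' => hk k (iso_rep_iff.1 h'))) _ (C.comp_mem ht ((h G).mem k)), zero_mul]
  refine Finite.of_surjective (fun p : Σ G : S, Fin (n G) => l p.1 p.2) fun i => ?_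
  obtain ⟨G, k, hk⟩ := this i; exact ⟨⟨G, k⟩, hk⟩

instance : Fintype C.Irr := Fintype.ofFinite _
instance : DecidableEq C.Irr := Classical.decEq _

lemma IsSum.hd_rep {X : O} {n : ℕ} {l : Fin n -> C.Irr} {s s' : Fin n -> N}
    (h : C.IsSum X (fun k => rep (l k)) s s') (i : C.Irr) :
    C.hd (rep i) X = (Finset.univ.filter fun k => l k = i).card := by
  rw [h.hd_left, Finset.card_filter]; refine sum_congr rfl fun k _ => ?_
  simp [hd_rep_rep, eq_comm]

lemma Additive.eq_sum {A : Type*} [AddCommMonoid A] {f : O -> A} (hf : C.Additive f) (X : O) :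
    f X = ∑ i : C.Irr, C.hd (rep i) X • f (rep i) := by
  obtain ⟨n, l, s, s', h⟩ := C.exists_dec X
  rw [hf.sum h, <- Finset.sum_fiberwise_of_maps_to (g := l) (t := Finset.univ) (by simp)]
  refine sum_congr rfl fun i _ => ?_
  rw [h.hd_rep, sum_congr rfl, Finset.sum_const]; intro k hk; rw [(mem_filter.1 hk).2]

lemma hd_eq_sum (X Y : O) : C.hd X Y = ∑ i : C.Irr, C.hd (rep i) X * C.hd (rep i) Y := by
  simpa using (add_hd_right Y).eq_sum X

lemma hd_comm (X Y : O) : C.hd X Y = C.hd Y X := by rw [hd_eq_sum, hd_eq_sum Y]; simp_rw [mul_comm]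

lemma simple_of_hd_self {X : O} (h : C.hd X X = 1) : C.Simple X := by
  have h0 : C.one X ≠ 0 := by
    intro h0
    have := hd_eq_zero.2 (fun t (ht : t ∈ C.Hom X X) => by rw [<- C.comp_one ht, h0, mul_zero])
    omega
  refine ⟨h0, fun t ht => ?_⟩
  obtain ⟨c, hc⟩ := (finrank_eq_one_iff_of_nonzero' (⟨C.one X, C.one_mem X⟩ : C.Hom X X)
    (fun h => h0 (by simpa using h))).1 h ⟨t, ht⟩
  exact ⟨c, by simpa using (congrArg Subtype.val hc).symm⟩

lemma exists_hd_ne_zero {X : O} (h : C.one X ≠ 0) : ∃ i : C.Irr, C.hd (rep i) X ≠ 0 := by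
  by_contra hcon
  push Not at hcon
  have : C.hd X X = 0 := by rw [hd_eq_sum]; simp [hcon]
  exact h (hd_eq_zero.1 this _ (C.one_mem X))

lemma cls_of_hd_ne_zero {X : O} (hX : C.Simple X) {i : C.Irr} (h : C.hd (rep i) X ≠ 0) :
    cls X hX = i := by
  rw [cls_eq_iff]; by_contra hn; exact h (by rw [hd_comm]; exact hd_simple_ne hX (rep_simple i) hn)

end split
end LCat

/-- A strict fusion category realised inside an algebra `N`: the objects form a monoid, the object
`a` acts on `N` by `ρ a`, and `t ⊗ s = t * ρ a s` for `t : a ⟶ b`. -/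
structure Fus (N : Type v) [Ring N] [Algebra ℂ N] (Δ : Type u) [Monoid Δ] extends LCat N Δ where
  ρ : Δ -> N →ₙₐ[ℂ] N
  ρ_one : ∀ x, ρ 1 x = x
  ρ_mul : ∀ a b x, ρ (a * b) x = ρ a (ρ b x)
  one_eq : ∀ a, one a = ρ a 1
  nat : ∀ {a b t}, t ∈ Hom a b -> ∀ x, t * ρ a x = ρ b x * t
  lw : ∀ {a b t}, t ∈ Hom a b -> ∀ c, ρ c t ∈ Hom (c * a) (c * b)
  rw : ∀ {a b t}, t ∈ Hom a b -> ∀ c, t * ρ a (one c) ∈ Hom (a * c) (b * c)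
  unit : ∀ t ∈ Hom 1 1, ∃ c : ℂ, t = c • (1 : N)
  one_ne : (1 : N) ≠ 0
  tr_unit : tr 1 1 = 1
  sum : ∀ {n : ℕ} (Y : Fin n -> Δ), ∃ X s s', toLCat.IsSum X Y s s'
  rat : ∀ a, ∃ r : ℚ, 0 ≤ r ∧ tr a (one a) = r
  cj : Δ -> Δ
  cv : Δ -> N
  ev : Δ -> N
  cv' : Δ -> N
  ev' : Δ -> N
  cv_mem : ∀ a, cv a ∈ Hom 1 (cj a * a)
  ev_mem : ∀ a, ev a ∈ Hom (a * cj a) 1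
  cv'_mem : ∀ a, cv' a ∈ Hom 1 (a * cj a)
  ev'_mem : ∀ a, ev' a ∈ Hom (cj a * a) 1
  zig : ∀ a, ev a * ρ a (cv a) = one a
  zag : ∀ a, ρ (cj a) (ev a) * cv a = one (cj a)
  zig' : ∀ a, ev' a * ρ (cj a) (cv' a) = one (cj a)
  zag' : ∀ a, ρ a (ev' a) * cv' a = one a
  tr_left : ∀ {a b t}, t ∈ Hom (a * b) (a * b) -> tr (a * b) t = tr b (ev' a * ρ (cj a) t * cv a)
  tr_left' : ∀ {a b t}, t ∈ Hom (cj a * b) (cj a * b) ->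
    tr (cj a * b) t = tr b (ev a * ρ a t * cv' a)
  tr_right : ∀ {a b t}, t ∈ Hom (b * a) (b * a) ->
    tr (b * a) t = tr b (ρ b (ev a) * t * ρ b (cv' a))
  tr_right' : ∀ {a b t}, t ∈ Hom (b * cj a) (b * cj a) ->
    tr (b * cj a) t = tr b (ρ b (ev' a) * t * ρ b (cv a))

namespace Fus
open LCat
variable (C : Fus N Δ)

lemma one_one : C.one 1 = 1 := by rw [C.one_eq, C.ρ_one]
lemma one_mem_one : (1 : N) ∈ C.Hom 1 1 := by
  have := C.one_mem 1
  rwa [C.one_one] at this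
protected lemma one_mul (a b : Δ) : C.one (a * b) = C.ρ a (C.one b) := by
  rw [C.one_eq, C.ρ_mul, <- C.one_eq]

lemma unit_simple : C.Simple 1 := by
  refine ⟨by rw [C.one_one]; exact C.one_ne, fun t ht => ?_⟩
  rw [C.one_one]; exact C.unit t ht

variable {C}
section mem
variable {a b c e x y : Δ} {s t : N}

lemma lw_eq (ht : t ∈ C.Hom a b) (c : Δ) (h1 : x = c * a) (h2 : y = c * b) :
    C.ρ c t ∈ C.Hom x y := by
  subst h1 h2; exact C.lw ht c

lemma rw_eq (ht : t ∈ C.Hom a b) (c : Δ) (h1 : x = a * c) (h2 : y = b * c) :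
    t * C.ρ a (C.one c) ∈ C.Hom x y := by
  subst h1 h2; exact C.rw ht c

/-- Composition after whiskering the left factor on the right. -/
lemma comp_w (hs : s ∈ C.Hom b c) (ht : t ∈ C.Hom a x) (e : Δ) (h1 : x = b * e)
    (h2 : y = c * e) : s * t ∈ C.Hom a y := by
  subst h1 h2; have := C.comp_mem (C.rw hs e) ht
  rwa [mul_assoc, <- C.one_mul, C.one_comp ht] at this

/-- Composition after whiskering the right factor on the right. -/
lemma w_comp (hs : s ∈ C.Hom x c) (ht : t ∈ C.Hom a b) (e : Δ) (h1 : x = b * e)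
    (h2 : y = a * e) : s * t ∈ C.Hom y c := by
  subst h1 h2; have := C.comp_mem hs (C.rw ht e)
  rwa [C.nat ht, <- C.one_mul, <- mul_assoc, C.comp_one hs] at this

lemma nat_one (ht : t ∈ C.Hom 1 b) (z : N) : t * z = C.ρ b z * t := by
  have := C.nat ht z
  rwa [C.ρ_one] at this

lemma nat_to_one (ht : t ∈ C.Hom a 1) (z : N) : t * C.ρ a z = z * t := by
  have := C.nat ht z
  rwa [C.ρ_one] at this

lemma comp_ρ_one (ht : t ∈ C.Hom (a * b) c) : t * C.ρ a 1 = t := by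
  have h1 := (C.one_eq a).symm
  have h2 : C.one (a * b) * C.one a = C.one (a * b) := by
    rw [C.one_mul, C.one_eq a, <- map_mul, mul_one]
  rw [h1, <- C.comp_one ht, mul_assoc, h2]

lemma ρ_one_comp (ht : t ∈ C.Hom c (a * b)) : C.ρ a 1 * t = t := by
  have h1 := (C.one_eq a).symm
  have h2 : C.one a * C.one (a * b) = C.one (a * b) := by
    rw [C.one_mul, C.one_eq a, <- map_mul, one_mul]
  rw [h1, <- C.one_comp ht, <- mul_assoc, h2]

end mem

/-- Partial trace over the left factor `a`. -/
def ltr (C : Fus N Δ) (a : Δ) (t : N) : N := C.ev' a * C.ρ (C.cj a) t * C.cv a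

/-- Partial trace over the right factor `a`, with `b` on the left of the source and `c` of the target. -/
def rtr (C : Fus N Δ) (b c a : Δ) (t : N) : N := C.ρ c (C.ev a) * t * C.ρ b (C.cv' a)

section
variable {a b c e : Δ} {s t : N}

lemma ltr_mem (ht : t ∈ C.Hom (a * b) (a * c)) : C.ltr a t ∈ C.Hom b c := by
  unfold ltr; rw [mul_assoc]
  refine comp_w (C.ev'_mem a) (w_comp (C.lw ht (C.cj a)) (C.cv_mem a) b ?_ ?_) c ?_ ?_ <;>
    simp [mul_assoc]

lemma tr_ltr (ht : t ∈ C.Hom (a * b) (a * b)) : C.tr (a * b) t = C.tr b (C.ltr a t) := C.tr_left ht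

lemma tr_rtr (ht : t ∈ C.Hom (b * a) (b * a)) : C.tr (b * a) t = C.tr b (C.rtr b b a t) :=
  C.tr_right ht

lemma ltr_smul (z : ℂ) : C.ltr a (z • t) = z • C.ltr a t := by simp [ltr]
lemma ltr_sum {ι : Type*} (S : Finset ι) (f : ι -> N) :
    C.ltr a (∑ i ∈ S, f i) = ∑ i ∈ S, C.ltr a (f i) := by
  simp [ltr, map_sum, mul_sum, sum_mul]

lemma ltr_mul_right : C.ltr a (t * C.ρ a s) = C.ltr a t * s := by
  simp [ltr, map_mul, mul_assoc]; rw [nat_one (C.cv_mem a) s, C.ρ_mul]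

lemma ltr_mul_left : C.ltr a (C.ρ a s * t) = s * C.ltr a t := by
  simp [ltr, map_mul, <- mul_assoc]; rw [<- nat_to_one (C.ev'_mem a) s, C.ρ_mul]

def d (C : Fus N Δ) (a : Δ) : ℂ := C.tr a (C.one a)

lemma ev'_cv (a : Δ) : C.ev' a * C.cv a = C.d a • (1 : N) := by
  obtain ⟨z, hz⟩ := C.unit (C.ev' a * C.cv a) (C.comp_mem (C.ev'_mem a) (C.cv_mem a))
  have h := C.tr_left (b := 1) (by simpa using C.one_mem a)
  have h2 : C.ev' a * C.ρ (C.cj a) (C.one a) * C.cv a = C.ev' a * C.cv a := by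
    rw [<- C.one_mul, C.comp_one (C.ev'_mem a)]
  rw [h2, hz, map_smul, C.tr_unit, mul_one, smul_eq_mul, mul_one] at h; rw [hz, d, h]

lemma ev_cv' (a : Δ) : C.ev a * C.cv' a = C.d a • (1 : N) := by
  obtain ⟨z, hz⟩ := C.unit (C.ev a * C.cv' a) (C.comp_mem (C.ev_mem a) (C.cv'_mem a))
  have h := C.tr_right (b := 1) (by simpa using C.one_mem a)
  rw [C.ρ_one, C.ρ_one, C.one_eq, comp_ρ_one (C.ev_mem a), hz, map_smul, C.tr_unit, one_mul,
    smul_eq_mul, mul_one] at h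
  rw [hz, d, C.one_eq, h]

lemma d_cj (a : Δ) : C.d (C.cj a) = C.d a := by
  have h := C.tr_left' (a := a) (b := 1) (by simpa using C.one_mem _)
  rwa [<- C.one_mul, C.comp_one (C.ev_mem a), ev_cv', map_smul, C.tr_unit, mul_one, smul_eq_mul,
    mul_one] at h

lemma ltr_one_mul (a : Δ) (t : N) : C.ltr a (C.ρ a t) = C.d a • t := by
  have : C.ltr a (C.ρ a t) = C.ev' a * C.ρ (C.cj a * a) t * C.cv a := by rw [ltr, C.ρ_mul]
  rw [this, nat_to_one (C.ev'_mem a), mul_assoc, ev'_cv, mul_smul_comm, mul_one]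

lemma d_mul (a b : Δ) : C.d (a * b) = C.d a * C.d b := by
  unfold d; rw [tr_ltr (C.one_mem _), C.one_mul, ltr_one_mul, map_smul]; rfl

lemma d_one : C.d 1 = 1 := by rw [d, C.one_one, C.tr_unit]

lemma add_d : C.Additive C.d := add_tr_one

lemma _root_.LCat.IsSum.lw {ι : Type*} [Fintype ι] {X : Δ} {Y : ι -> Δ} {s s' : ι -> N}
    (h : C.IsSum X Y s s') (c : Δ) :
    C.IsSum (c * X) (fun k => c * Y k) (fun k => C.ρ c (s k)) (fun k => C.ρ c (s' k)) where
  mem k := C.lw (h.mem k) c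
  mem' k := C.lw (h.mem' k) c
  same k := by rw [<- map_mul, h.same, C.one_mul]
  diff k l hkl := by rw [<- map_mul, h.diff k l hkl, map_zero]
  sum := by simp_rw [<- map_mul, <- map_sum, h.sum, C.one_mul]

lemma _root_.LCat.IsSum.rw {ι : Type*} [Fintype ι] {X : Δ} {Y : ι -> Δ} {s s' : ι -> N}
    (h : C.IsSum X Y s s') (c : Δ) :
    C.IsSum (X * c) (fun k => Y k * c) (fun k => s k * C.ρ (Y k) (C.one c))
      (fun k => s' k * C.ρ X (C.one c)) where
  mem k := C.rw (h.mem k) c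
  mem' k := C.rw (h.mem' k) c
  same k := by
    rw [mul_assoc, <- mul_assoc _ (s k), <- C.nat (h.mem k), mul_assoc, <- map_mul, one_mul_one,
      <- mul_assoc, h.same, C.one_mul, C.one_eq, <- map_mul, one_mul]
  diff k l hkl := by
    rw [mul_assoc, <- mul_assoc _ (s l), <- C.nat (h.mem l), mul_assoc, <- map_mul, one_mul_one,
      <- mul_assoc, h.diff k l hkl, zero_mul]
  sum := by
    have : ∀ k, s k * C.ρ (Y k) (C.one c) * (s' k * C.ρ X (C.one c))
        = s k * s' k * C.ρ X (C.one c) := fun k => by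
      rw [mul_assoc, <- mul_assoc _ (s' k), <- C.nat (h.mem' k), mul_assoc, <- map_mul, one_mul_one,
        <- mul_assoc]
    simp_rw [this, <- sum_mul, h.sum, C.one_mul, C.one_eq, <- map_mul, one_mul]

lemma add_mul_left {A : Type*} [AddCommMonoid A] {f : Δ -> A} (hf : C.Additive f) (c : Δ) :
    C.Additive (fun x => f (c * x)) := ⟨fun h => hf.sum (h.lw c)⟩
lemma add_mul_right {A : Type*} [AddCommMonoid A] {f : Δ -> A} (hf : C.Additive f) (c : Δ) :
    C.Additive (fun x => f (x * c)) := ⟨fun h => hf.sum (h.rw c)⟩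

lemma hd_mul_left (a b c : Δ) : C.hd (a * b) c = C.hd b (C.cj a * c) := by
  refine LinearEquiv.finrank_eq ?_
  exact
    { toFun := fun t => ⟨C.ρ (C.cj a) t * C.cv a,
        w_comp (C.lw t.2 _) (C.cv_mem a) b (by simp [mul_assoc]) (by simp)⟩
      map_add' := fun s t => by ext; simp [add_mul]
      map_smul' := fun z t => by ext; simp
      invFun := fun t => ⟨C.ev a * C.ρ a t,
        comp_w (C.ev_mem a) (C.lw t.2 a) c (by simp [mul_assoc]) (by simp)⟩
      left_inv := fun t => by
        ext; simp [map_mul, <- mul_assoc]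
        rw [<- C.ρ_mul, nat_to_one (C.ev_mem a), mul_assoc, C.zig, C.one_eq, comp_ρ_one t.2]
      right_inv := fun t => by
        ext; simp [map_mul, mul_assoc]
        rw [<- C.ρ_mul, <- nat_one (C.cv_mem a), <- mul_assoc, C.zag, C.one_eq, ρ_one_comp t.2] }

lemma hd_mul_left' (a b c : Δ) : C.hd (C.cj a * b) c = C.hd b (a * c) := by
  refine LinearEquiv.finrank_eq ?_
  exact
    { toFun := fun t => ⟨C.ρ a t * C.cv' a,
        w_comp (C.lw t.2 _) (C.cv'_mem a) b (by simp [mul_assoc]) (by simp)⟩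
      map_add' := fun s t => by ext; simp [add_mul]
      map_smul' := fun z t => by ext; simp
      invFun := fun t => ⟨C.ev' a * C.ρ (C.cj a) t,
        comp_w (C.ev'_mem a) (C.lw t.2 _) c (by simp [mul_assoc]) (by simp)⟩
      left_inv := fun t => by
        ext; simp [map_mul, <- mul_assoc]
        rw [<- C.ρ_mul, nat_to_one (C.ev'_mem a), mul_assoc, C.zig', C.one_eq, comp_ρ_one t.2]
      right_inv := fun t => by
        ext; simp [map_mul, mul_assoc]
        rw [<- C.ρ_mul, <- nat_one (C.cv'_mem a), <- mul_assoc, C.zag', C.one_eq, ρ_one_comp t.2] }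

lemma hd_mul_right (a b c : Δ) : C.hd (b * a) c = C.hd b (c * C.cj a) := by
  refine LinearEquiv.finrank_eq ?_
  exact
    { toFun := fun t => ⟨t * C.ρ b (C.cv' a),
        comp_w t.2 (lw_eq (C.cv'_mem a) b (mul_one b).symm rfl) (C.cj a) (by simp [mul_assoc]) rfl⟩
      map_add' := fun s t => by ext; simp [add_mul]
      map_smul' := fun z t => by ext; simp
      invFun := fun t => ⟨C.ρ c (C.ev' a) * (t * C.ρ b (C.one a)),
        C.comp_mem (lw_eq (C.ev'_mem a) c rfl (mul_one c).symm) (rw_eq t.2 a rfl (by simp [mul_assoc]))⟩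
      left_inv := fun t => by
        ext; simp [<- mul_assoc]
        rw [<- C.nat t.2, mul_assoc, mul_assoc, C.ρ_mul, <- map_mul, <- map_mul, <- mul_assoc, C.zag',
          one_mul_one, <- C.one_mul, C.comp_one t.2]
      right_inv := fun t => by
        ext; simp [mul_assoc]; have h1 : C.one a * C.cv' a = C.cv' a := by
          rw [C.one_eq]; exact ρ_one_comp (C.cv'_mem a)
        rw [<- map_mul, h1, C.nat t.2, <- mul_assoc, C.ρ_mul, <- map_mul, C.zig', <- C.one_mul,
          C.one_comp t.2] }

lemma hd_mul_right' (a b c : Δ) : C.hd (b * C.cj a) c = C.hd b (c * a) := by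
  refine LinearEquiv.finrank_eq ?_
  exact
    { toFun := fun t => ⟨t * C.ρ b (C.cv a),
        comp_w t.2 (lw_eq (C.cv_mem a) b (mul_one b).symm rfl) a (by simp [mul_assoc]) rfl⟩
      map_add' := fun s t => by ext; simp [add_mul]
      map_smul' := fun z t => by ext; simp
      invFun := fun t => ⟨C.ρ c (C.ev a) * (t * C.ρ b (C.one (C.cj a))),
        C.comp_mem (lw_eq (C.ev_mem a) c rfl (mul_one c).symm) (rw_eq t.2 _ rfl (by simp [mul_assoc]))⟩
      left_inv := fun t => by
        ext; simp [<- mul_assoc]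
        rw [<- C.nat t.2, mul_assoc, mul_assoc, C.ρ_mul, <- map_mul, <- map_mul, <- mul_assoc, C.zag,
          one_mul_one, <- C.one_mul, C.comp_one t.2]
      right_inv := fun t => by
        ext; simp [mul_assoc]; have h1 : C.one (C.cj a) * C.cv a = C.cv a := by
          rw [C.one_eq]; exact ρ_one_comp (C.cv_mem a)
        rw [<- map_mul, h1, C.nat t.2, <- mul_assoc, C.ρ_mul, <- map_mul, C.zig, <- C.one_mul,
          C.one_comp t.2] }
end
end Fus

section numeric
open Polynomial

lemma norm_le_of_eigenvector {ι : Type*} [Fintype ι] (M : ι -> ι -> ℕ) (d : ι -> ℝ)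
    (hd : ∀ i, 0 < d i) {D : ℝ} (hM : ∀ i, ∑ j, M i j * d j = D * d i) {w : ι -> ℂ} (hw : w ≠ 0)
    {z : ℂ} (hz : ∀ i, ∑ j, M i j * w j = z * w i) : ‖z‖ ≤ D := by
  obtain ⟨i₁, hi₁⟩ := Function.ne_iff.1 hw
  obtain ⟨i, -, hi⟩ := Finset.exists_max_image Finset.univ (fun i => ‖w i‖ / d i) ⟨i₁, by simp⟩
  set m := ‖w i‖ / d i with hm
  have hle := fun j => (div_le_iff₀ (hd j)).1 (hi j (by simp))
  have hmpos := lt_of_lt_of_le (div_pos (norm_pos_iff.2 hi₁) (hd i₁)) (hi i₁ (by simp))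
  have hwi : ‖w i‖ = m * d i := by rw [hm, div_mul_cancel₀ _ (hd i).ne']
  have h1 : ‖z‖ * (m * d i) ≤ D * (m * d i) := by
    rw [<- hwi, <- norm_mul, <- hz i, hwi]
    calc ‖∑ j, (M i j : ℂ) * w j‖ ≤ ∑ j, ‖(M i j : ℂ) * w j‖ := norm_sum_le _ _
      _ ≤ ∑ j, M i j * (m * d j) := by
        refine Finset.sum_le_sum fun j _ => ?_
        rw [norm_mul, Complex.norm_natCast]
        exact mul_le_mul_of_nonneg_left (hle j) (Nat.cast_nonneg _)
      _ = m * ∑ j, M i j * d j := by rw [mul_sum]; exact sum_congr rfl fun j _ => by ring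
      _ = D * (m * d i) := by rw [hM]; ring
  exact le_of_mul_le_mul_right h1 (mul_pos hmpos (hd i))

open IntermediateField in
lemma norm_eq_one_of_isIntegral {α : ℂ} (hα : IsIntegral ℤ α) (Q : ℚ[X]) (hQ : aeval α Q = 0)
    (hb : ∀ z : ℂ, aeval z Q = 0 -> ‖z‖ ≤ 1) : α = 0 ∨ ‖α‖ = 1 := by
  refine or_iff_not_imp_left.2 fun h0 => ?_
  have := adjoin.finiteDimensional (K := ℚ) hα.tower_top
  have : NumberField ℚ⟮α⟯ := ⟨⟩
  have hi := (algebraMap ℚ⟮α⟯ ℂ).injective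
  obtain ⟨n, hn, h⟩ := NumberField.Embeddings.pow_eq_one_of_norm_le_one ℚ⟮α⟯ ℂ
    (x := AdjoinSimple.gen ℚ α) (fun h => h0 (by simpa using congr(algebraMap _ ℂ $h)))
    ((isIntegral_algebraMap_iff hi).1 hα) fun φ => hb _ (by
      change aeval (φ.toRatAlgHom _) Q = 0
      rw [aeval_algHom_apply, (aeval_algebraMap_eq_zero_iff ℂ _ Q).1 hQ, map_zero])
  exact Complex.norm_eq_one_of_pow_eq_one (by simpa using congr(algebraMap _ ℂ $h)) hn.ne'

lemma exists_int_of_isIntegral {q : ℚ} (h : IsIntegral ℤ (q : ℂ)) : ∃ m : ℤ, (m : ℚ) = q := by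
  have h1 : IsIntegral ℤ (algebraMap ℚ ℂ q) := by simpa using h
  rw [isIntegral_algebraMap_iff (algebraMap ℚ ℂ).injective] at h1
  obtain ⟨m, hm⟩ := IsIntegrallyClosed.isIntegral_iff.1 h1; exact ⟨m, by simpa using hm⟩
end numeric

lemma LCat.isSum_of_card {N : Type v} [Ring N] [Algebra ℂ N] {O : Type u} {C : LCat N O}
    [C.Split] {ι : Type*} [Fintype ι] {X : O} {l : ι -> C.Irr} {s s' : ι -> N}
    (mem : ∀ k, s k ∈ C.Hom (LCat.rep (l k)) X) (mem' : ∀ k, s' k ∈ C.Hom X (LCat.rep (l k)))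
    (same : ∀ k, s' k * s k = C.one (LCat.rep (l k))) (diff : ∀ k m, k ≠ m -> s' k * s m = 0)
    (card : ∀ i, C.hd (LCat.rep i) X ≤ (Finset.univ.filter fun k => l k = i).card) :
    C.IsSum X (fun k => LCat.rep (l k)) s s' := by
  classical
  set e := C.one X - ∑ k, s k * s' k with he
  have hmem : e ∈ C.Hom X X := Submodule.sub_mem _ (C.one_mem X)
    (Submodule.sum_mem _ fun k _ => C.comp_mem (mem k) (mem' k))
  have hse : ∀ k, s' k * e = 0 := by
    intro k
    rw [he, mul_sub, C.comp_one (mem' k), mul_sum, sum_eq_single k, <- mul_assoc,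
      same, C.one_comp (mem' k), sub_self]
    . intro m _ hm; rw [<- mul_assoc, diff k m hm.symm, zero_mul]
    . simp
  have hes : ∀ k, e * s k = 0 := by
    intro k
    rw [he, sub_mul, C.one_comp (mem k), sum_mul, sum_eq_single k, mul_assoc,
      same, C.comp_one (mem k), sub_self]
    . intro m _ hm; rw [mul_assoc, diff m k hm, mul_zero]
    . simp
  have hee : e * e = e := by
    have h1 : (∑ k, s k * s' k) * e = 0 := by
      rw [sum_mul]; exact sum_eq_zero fun k _ => by rw [mul_assoc, hse, mul_zero]
    calc e * e = (C.one X - ∑ k, s k * s' k) * e := rfl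
      _ = e := by rw [sub_mul, C.one_comp hmem, h1, sub_zero]
  obtain ⟨Y, t, t', ht, ht', h1, h2⟩ := LCat.Split.split hmem hee
  have hst : ∀ k, s' k * t = 0 := fun k => by
    rw [<- C.comp_one ht, <- h1, <- mul_assoc, <- mul_assoc, mul_assoc _ t t', h2, hse, zero_mul]
  have hts : ∀ k, t' * s k = 0 := fun k => by
    rw [<- C.one_comp ht', <- h1, mul_assoc, mul_assoc, <- mul_assoc t t', h2, hes, mul_zero]
  have hall : C.IsSum (ι := Option ι) X (fun o => o.elim Y fun k => LCat.rep (l k))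
      (fun o => o.elim t s) (fun o => o.elim t' s') := by
    refine ⟨?_, ?_, ?_, ?_, ?_⟩
    . rintro (_ | k); exacts [ht, mem k]
    . rintro (_ | k); exacts [ht', mem' k]
    . rintro (_ | k); exacts [h1, same k]
    . rintro (_ | k) (_ | m) h
      . exact (h rfl).elim
      . exact hts m
      . exact hst k
      . exact diff k m (fun h' => h (by rw [h']))
    . rw [Fintype.sum_option]; simp [Option.elim]; rw [h2, he]; abel
  have hY : C.one Y = 0 := by
    by_contra hY
    obtain ⟨i, hi⟩ := LCat.exists_hd_ne_zero hY; have h3 := hall.hd_left (LCat.rep i)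
    rw [Fintype.sum_option] at h3
    have h4 : ∑ k, C.hd (LCat.rep i) (LCat.rep (l k)) = (Finset.univ.filter fun k => l k = i).card := by
      rw [Finset.card_filter]; refine sum_congr rfl fun k _ => ?_
      simp [LCat.hd_rep_rep, eq_comm]
    simp [Option.elim] at h3; have := card i; omega
  have he0 : e = 0 := by rw [<- h2, <- C.comp_one ht, hY, mul_zero, zero_mul]
  exact ⟨mem, mem', same, diff, (sub_eq_zero.1 he0).symm⟩

namespace Fus
open LCat
variable {C : Fus N Δ}

variable [C.Split]

def irr1 (C : Fus N Δ) : C.Irr := cls 1 C.unit_simple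

lemma hd_one_mul (a b : Δ) : C.hd 1 (a * b) = C.hd (C.cj a) b := by rw [<- hd_mul_left', mul_one]

lemma simple_cj {a : Δ} (h : C.Simple a) : C.Simple (C.cj a) := by
  apply simple_of_hd_self
  rw [<- hd_one_mul, <- hd_mul_right, one_mul, hd_self_of_simple h]

def star (i : C.Irr) : C.Irr := cls _ (simple_cj (rep_simple i))

lemma iso_star (i : C.Irr) : C.Iso (C.cj (rep i)) (rep (star i)) := iso_rep_cls _

lemma hd_cj_rep (i : C.Irr) (a : Δ) : C.hd (C.cj (rep i)) a = C.hd (rep (star i)) a :=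
  (add_hd_right a).iso (iso_star i)

lemma hd_one_rep_mul_rep (i j : C.Irr) : C.hd 1 (rep i * rep j) = if star i = j then 1 else 0 := by
  rw [hd_one_mul, hd_cj_rep, hd_rep_rep]

lemma hd_one_rep_mul_rep' (i j : C.Irr) : C.hd 1 (rep i * rep j) = if star j = i then 1 else 0 := by
  rw [<- hd_mul_right', one_mul, hd_cj_rep, hd_rep_rep]

lemma star_eq_comm {i j : C.Irr} : star i = j ↔ star j = i := by
  have h := (hd_one_rep_mul_rep i j).symm.trans (hd_one_rep_mul_rep' i j)
  split_ifs at h <;> simp_all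

@[simp] lemma star_star (i : C.Irr) : star (star i) = i := star_eq_comm.1 rfl

lemma hd_one_rep (i : C.Irr) : C.hd 1 (rep i) = if C.irr1 = i then 1 else 0 := by
  rw [(add_hd_right (rep i)).iso (iso_rep_cls C.unit_simple), hd_rep_rep]; rfl

lemma add_hd_cj (b : Δ) : C.Additive (fun a => C.hd (C.cj a) b) := by
  have : (fun a => C.hd (C.cj a) b) = fun a => C.hd 1 (a * b) := by ext a; rw [hd_one_mul]
  rw [this]; exact add_mul_right (add_hd_left 1) b

/-- Characters of the Grothendieck ring, as functions on objects. -/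
structure IsChar (C : Fus N Δ) (χ : Δ -> ℂ) : Prop where
  add : C.Additive χ
  mul : ∀ a b, χ (a * b) = χ a * χ b
  one : χ 1 = 1

lemma isChar_d : C.IsChar C.d := ⟨add_d, d_mul, d_one⟩

/-- The matrix of left multiplication by `a` on the Grothendieck ring. -/
def lmat (C : Fus N Δ) [C.Split] (a : Δ) (i j : C.Irr) : ℕ := C.hd (rep j) (a * rep i)

lemma lmat_mul {χ : Δ -> ℂ} (hχ : C.IsChar χ) (a : Δ) (i : C.Irr) :
    ∑ j, C.lmat a i j * χ (rep j) = χ a * χ (rep i) := by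
  rw [<- hχ.mul, hχ.add.eq_sum]; simp [lmat]

lemma lmat_cj (a : Δ) (i j : C.Irr) : C.lmat (C.cj a) i j = C.lmat a j i := by
  rw [lmat, lmat, <- hd_mul_left, hd_comm]

lemma IsChar.ne_zero {χ : Δ -> ℂ} (hχ : C.IsChar χ) : (fun i : C.Irr => χ (rep i)) ≠ 0 := by
  intro h; have := congrFun h C.irr1; simp at this
  rw [irr1, <- hχ.add.iso (iso_rep_cls C.unit_simple), hχ.one] at this; exact one_ne_zero this

lemma IsChar.cj {χ : Δ -> ℂ} (hχ : C.IsChar χ) (a : Δ) : χ (C.cj a) = (starRingEnd ℂ) (χ a) := by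
  set v : C.Irr -> ℂ := fun i => χ (rep i)
  have h1 : ∑ i, (∑ j, C.lmat (C.cj a) i j * v j) * (starRingEnd ℂ) (v i)
      = ∑ j, v j * (starRingEnd ℂ) (∑ i, C.lmat a j i * v i) := by
    simp only [sum_mul, map_sum, mul_sum]; rw [sum_comm]
    refine sum_congr rfl fun j _ => sum_congr rfl fun i _ => ?_
    rw [lmat_cj]; simp; ring
  simp [v, lmat_mul hχ, map_mul] at h1
  have h2 : (χ (C.cj a) - (starRingEnd ℂ) (χ a)) * ∑ i : C.Irr, v i * (starRingEnd ℂ) (v i) = 0 := by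
    rw [sub_mul, sub_eq_zero, mul_sum, mul_sum]; simp [v]
    rw [sum_congr rfl fun i _ => (mul_assoc _ _ _).symm, h1]; exact sum_congr rfl fun i _ => by ring
  rcases mul_eq_zero.1 h2 with h | h
  . exact sub_eq_zero.1 h
  exfalso
  simp_rw [Complex.mul_conj] at h
  rw [<- Complex.ofReal_sum, Complex.ofReal_eq_zero,
    Finset.sum_eq_zero_iff_of_nonneg (fun i _ => Complex.normSq_nonneg _)] at h
  exact hχ.ne_zero (funext fun i => Complex.normSq_eq_zero.1 (h i (mem_univ i)))

open Polynomial in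
lemma IsChar.exists_poly {χ : Δ -> ℂ} (hχ : C.IsChar χ) (a : Δ) : ∃ P : ℤ[X], P.Monic ∧
    aeval (χ a) P = 0 ∧ ∀ z : ℂ, aeval z P = 0 -> ∃ w : C.Irr -> ℂ, w ≠ 0 ∧
      ∀ i, ∑ j, C.lmat a i j * w j = z * w i := by
  classical
  let M : Matrix C.Irr C.Irr ℤ := fun i j => C.lmat a i j
  have key : ∀ z, aeval z M.charpoly = 0 ↔ ∃ w : C.Irr -> ℂ, w ≠ 0 ∧
      ∀ i, ∑ j, C.lmat a i j * w j = z * w i := by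
    intro z
    have h1 : aeval z M.charpoly = (Matrix.scalar C.Irr z - M.map (Int.castRingHom ℂ)).det := by
      rw [<- Matrix.eval_charpoly, Matrix.charpoly_map, eval_map, aeval_def]; rfl
    rw [h1, <- Matrix.exists_mulVec_eq_zero_iff]
    refine exists_congr fun w => and_congr_right fun _ => ?_
    rw [Matrix.sub_mulVec, sub_eq_zero, funext_iff]; refine forall_congr' fun i => ?_
    have h2 : (M.map (Int.castRingHom ℂ)).mulVec w i = ∑ j, C.lmat a i j * w j := by
      simp only [Matrix.mulVec, dotProduct]; refine sum_congr rfl fun j _ => ?_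
      rw [Matrix.map_apply]; simp [M]
    rw [h2, eq_comm]; simp [Matrix.mulVec, dotProduct, Matrix.diagonal_apply]
  refine ⟨M.charpoly, M.charpoly_monic, (key _).2 ⟨_, hχ.ne_zero, fun i => lmat_mul hχ a i⟩,
    fun z hz => (key z).1 hz⟩

lemma IsChar.isIntegral {χ : Δ -> ℂ} (hχ : C.IsChar χ) (a : Δ) : IsIntegral ℤ (χ a) := by
  obtain ⟨P, hP, h, -⟩ := hχ.exists_poly a; exact ⟨P, hP, by simpa [Polynomial.aeval_def] using h⟩

lemma exists_dim (a : Δ) : ∃ m : ℕ, C.d a = m := by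
  obtain ⟨r, hr, h⟩ := C.rat a; have h1 := (isChar_d (C := C)).isIntegral a
  rw [d, h] at h1; obtain ⟨m, hm⟩ := exists_int_of_isIntegral h1
  have : 0 ≤ m := by rw [<- hm] at hr; exact_mod_cast hr
  refine ⟨m.toNat, ?_⟩
  rw [d, h, <- hm]; have h2 : ((m.toNat : ℤ) : ℂ) = m := by rw [Int.toNat_of_nonneg this]
  push_cast at h2 ⊢; exact h2.symm

/-- The dimension of an object. -/
def dim (C : Fus N Δ) [C.Split] (a : Δ) : ℕ := (C.exists_dim a).choose

lemma d_eq (a : Δ) : C.d a = C.dim a := (C.exists_dim a).choose_spec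

lemma dim_mul (a b : Δ) : C.dim (a * b) = C.dim a * C.dim b := by
  have := C.d_mul a b
  simp [d_eq] at this; exact_mod_cast this

lemma dim_one : C.dim 1 = 1 := by
  have := C.d_one
  simp [d_eq] at this; exact_mod_cast this

lemma dim_cj (a : Δ) : C.dim (C.cj a) = C.dim a := by
  have := C.d_cj a
  simp [d_eq] at this; exact_mod_cast this

lemma add_dim : C.Additive C.dim := ⟨fun h => by
  have := add_d.sum h
  simp [d_eq] at this
  exact_mod_cast this⟩

lemma dim_pos {a : Δ} (h : C.Simple a) : 0 < C.dim a := by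
  have h1 := h.tr_one_ne_zero
  rw [<- d, d_eq] at h1; exact Nat.pos_of_ne_zero (by exact_mod_cast h1)

lemma dim_rep_pos (i : C.Irr) : 0 < C.dim (rep i) := dim_pos (rep_simple i)

lemma dim_star (i : C.Irr) : C.dim (rep (star i)) = C.dim (rep i) := by
  rw [<- add_dim.iso (iso_star i), dim_cj]

lemma lmat_mul_dim (a : Δ) (i : C.Irr) :
    ∑ j, C.lmat a i j * C.dim (rep j) = C.dim a * C.dim (rep i) := by
  have := lmat_mul (isChar_d) a i
  simp [d_eq] at this; exact_mod_cast this

lemma IsChar.norm_le_of_root {a : Δ} {z : ℂ} {w : C.Irr -> ℂ} (hw : w ≠ 0)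
    (h : ∀ i, ∑ j, C.lmat a i j * w j = z * w i) : ‖z‖ ≤ C.dim a :=
  norm_le_of_eigenvector (C.lmat a) (fun i => (C.dim (rep i) : ℝ))
    (fun i => by exact_mod_cast dim_rep_pos i)
    (fun i => by exact_mod_cast lmat_mul_dim a i) hw h

lemma IsChar.norm_le {χ : Δ -> ℂ} (hχ : C.IsChar χ) (a : Δ) : ‖χ a‖ ≤ C.dim a :=
  norm_le_of_root hχ.ne_zero (lmat_mul hχ a)

open Polynomial in
lemma IsChar.eq_zero_or_norm_eq {χ : Δ -> ℂ} (hχ : C.IsChar χ) {a : Δ} (ha : C.dim a ≠ 0)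
    (hin : IsIntegral ℤ (χ a / C.dim a)) : χ a = 0 ∨ ‖χ a‖ = C.dim a := by
  obtain ⟨P, hP, h0, hr⟩ := hχ.exists_poly a; have hne : (C.dim a : ℂ) ≠ 0 := by exact_mod_cast ha
  have hcomp : ∀ z : ℂ, aeval z ((P.map (algebraMap ℤ ℚ)).comp (Polynomial.C (C.dim a : ℚ) * X))
      = aeval (C.dim a * z) P := by
    intro z; rw [aeval_comp, aeval_map_algebraMap]; simp
  rcases norm_eq_one_of_isIntegral hin ((P.map (algebraMap ℤ ℚ)).comp
    (Polynomial.C (C.dim a : ℚ) * X)) (by rw [hcomp, mul_div_cancel₀ _ hne, h0]) (fun z hz => by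
      rw [hcomp] at hz; obtain ⟨w, hw, h⟩ := hr _ hz; have h1 := norm_le_of_root hw h
      rw [norm_mul, Complex.norm_natCast] at h1
      have h2 : (0 : ℝ) < C.dim a := by exact_mod_cast Nat.pos_of_ne_zero ha
      nlinarith) with h | h
  . left
    rcases div_eq_zero_iff.1 h with h | h
    . exact h
    . exact (hne h).elim
  . right
    rwa [norm_div, Complex.norm_natCast, div_eq_one_iff_eq (by exact_mod_cast ha)] at h

/-- A set of simple objects closed under duals and constituents of tensor products. -/
structure Sub (C : Fus N Δ) [C.Split] where
  S : Finset C.Irr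
  one_mem : C.irr1 ∈ S
  mul_mem : ∀ {i j k}, i ∈ S -> j ∈ S -> C.hd (rep k) (rep i * rep j) ≠ 0 -> k ∈ S
  star_mem : ∀ {i}, i ∈ S -> star i ∈ S

namespace Sub
variable (K : C.Sub)

def top (C : Fus N Δ) [C.Split] : C.Sub :=
  ⟨Finset.univ, mem_univ _, fun _ _ _ => mem_univ _, fun _ => mem_univ _⟩

/-- The objects all of whose constituents lie in `K`. -/
def Mem (a : Δ) : Prop := ∀ k, C.hd (rep k) a ≠ 0 -> k ∈ K.S

def gdim : ℕ := ∑ i ∈ K.S, C.dim (rep i) ^ 2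

variable {K}

lemma mem_rep {i : C.Irr} : K.Mem (rep i) ↔ i ∈ K.S := by
  refine ⟨fun h => h i (by rw [hd_rep_rep]; simp), fun h k hk => ?_⟩
  rw [hd_rep_rep] at hk; split_ifs at hk with h'
  . rwa [h']
  . exact (hk rfl).elim

lemma Mem.mul {a b : Δ} (ha : K.Mem a) (hb : K.Mem b) : K.Mem (a * b) := by
  intro k hk; rw [(add_mul_right (add_hd_left (rep k)) b).eq_sum a] at hk
  obtain ⟨i, -, hi⟩ := exists_ne_zero_of_sum_ne_zero hk
  rw [(add_mul_left (add_hd_left (rep k)) (rep i)).eq_sum b] at hi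
  have hi1 : C.hd (rep i) a ≠ 0 := fun h => hi (by rw [h, zero_smul])
  have hi2 := right_ne_zero_of_smul hi
  obtain ⟨j, -, hj⟩ := exists_ne_zero_of_sum_ne_zero hi2
  exact K.mul_mem (ha i hi1) (hb j (left_ne_zero_of_smul hj)) (right_ne_zero_of_smul hj)

lemma Mem.one : K.Mem 1 := by
  intro k hk; rw [hd_comm, hd_one_rep] at hk; split_ifs at hk with h
  . exact h ▸ K.one_mem
  . exact (hk rfl).elim

lemma Mem.cj {a : Δ} (ha : K.Mem a) : K.Mem (C.cj a) := by
  intro k hk; rw [hd_comm, (add_hd_cj (rep k)).eq_sum a] at hk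
  obtain ⟨i, -, hi⟩ := exists_ne_zero_of_sum_ne_zero hk; have h1 := ha i (left_ne_zero_of_smul hi)
  have h2 := right_ne_zero_of_smul hi
  rw [hd_cj_rep, hd_rep_rep] at h2; split_ifs at h2 with h
  . exact h ▸ K.star_mem h1
  . exact (h2 rfl).elim

lemma gdim_pos : 0 < K.gdim :=
  lt_of_lt_of_le (pow_pos (dim_rep_pos _) 2)
    (single_le_sum (f := fun i => C.dim (rep i) ^ 2) (fun _ _ => Nat.zero_le _) K.one_mem)

lemma sum_dim_lmat {a : Δ} (ha : K.Mem a) {j : C.Irr} (hj : j ∈ K.S) :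
    ∑ i ∈ K.S, C.dim (rep i) * C.lmat a i j = C.dim a * C.dim (rep j) := by
  rw [<- dim_cj a, <- lmat_mul_dim]; simp_rw [lmat_cj]; rw [<- sum_subset (subset_univ K.S)]
  . exact sum_congr rfl fun i _ => mul_comm _ _
  . intro i _ hi; rw [<- lmat_cj, lmat]; have : C.hd (rep i) (C.cj a * rep j) = 0 := by
      by_contra h
      exact hi ((ha.cj.mul (mem_rep.2 hj)) i h)
    rw [this, zero_mul]

lemma sum_lmat {χ : Δ -> ℂ} (hχ : C.IsChar χ) {a : Δ} (ha : K.Mem a) {i : C.Irr} (hi : i ∈ K.S) :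
    ∑ j ∈ K.S, C.lmat a i j * χ (rep j) = χ a * χ (rep i) := by
  rw [<- lmat_mul hχ]; refine sum_subset (subset_univ K.S) fun j _ hj => ?_
  have : C.lmat a i j = 0 := by
    by_contra h
    exact hj ((ha.mul (mem_rep.2 hi)) j h)
  rw [this, Nat.cast_zero, zero_mul]

lemma sum_dim_mul_char {χ : Δ -> ℂ} (hχ : C.IsChar χ) {a : Δ} (ha : K.Mem a) :
    χ a * ∑ i ∈ K.S, C.dim (rep i) * χ (rep i) = C.dim a * ∑ i ∈ K.S, C.dim (rep i) * χ (rep i) := by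
  have h1 : ∀ i ∈ K.S, χ a * (C.dim (rep i) * χ (rep i))
      = ∑ j ∈ K.S, (C.dim (rep i) * C.lmat a i j) * χ (rep j) := by
    intro i hi; rw [mul_left_comm, <- sum_lmat hχ ha hi, mul_sum]
    exact sum_congr rfl fun j _ => by ring
  rw [mul_sum, sum_congr rfl h1, sum_comm, mul_sum]; refine sum_congr rfl fun j hj => ?_
  rw [<- sum_mul, <- mul_assoc]; congr 1; exact_mod_cast sum_dim_lmat ha hj

lemma sum_dim_mul_char_eq_zero {χ : Δ -> ℂ} (hχ : C.IsChar χ) {a : Δ} (ha : K.Mem a)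
    (hne : χ a ≠ C.dim a) : ∑ i ∈ K.S, C.dim (rep i) * χ (rep i) = 0 := by
  have h := sum_dim_mul_char hχ ha
  rw [<- sub_eq_zero, <- sub_mul] at h; exact (mul_eq_zero.1 h).resolve_left (sub_ne_zero.2 hne)

end Sub

lemma eq_smul_of_simple {a : Δ} (ha : C.Simple a) {t : N} (ht : t ∈ C.Hom a a) :
    t = (C.tr a t / C.dim a) • C.one a := by
  obtain ⟨z, rfl⟩ := ha.2 t ht; have h : (C.dim a : ℂ) ≠ 0 := by exact_mod_cast (dim_pos ha).ne'
  rw [map_smul, <- d, d_eq, smul_eq_mul, mul_div_cancel_right₀ _ h]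

/-- Slide identity: a trace-like family evaluated on the regular object absorbs `c`. -/
lemma sum_dim_slide (K : C.Sub) {c : Δ} (hc : K.Mem c) {a b : Δ} (z : Δ -> N →ₗ[ℂ] ℂ)
    (zcomm : ∀ {u v f y}, f ∈ C.Hom u v -> y ∈ C.Hom (v * b) (u * a) -> z v (f * y) = z u (y * f))
    {s : N} (hs : s ∈ C.Hom (c * b) (c * a)) :
    ∑ i ∈ K.S, C.dim (rep i) * z (rep i * c) (C.ρ (rep i) s)
      = ∑ j ∈ K.S, C.dim (rep j) * z (rep j) (C.ρ (rep j) (C.ltr c s)) := by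
  classical
  choose n l τ' τ hτ using fun j : C.Irr => C.exists_dec (rep j * C.cj c)
  let T := Σ j : C.Irr, Fin (n j)
  let lab : T -> C.Irr := fun x => l x.1 x.2
  let t : T -> N := fun x => τ x.1 x.2 * C.ρ (rep x.1) (C.cv c)
  let t' : T -> N := fun x => C.ρ (rep x.1) (C.ev' c) * (τ' x.1 x.2 * C.ρ (rep (lab x)) (C.one c))
  have ht : ∀ x i, lab x = i -> t x ∈ C.Hom (rep x.1) (rep i * c) := by
    rintro ⟨j, k⟩ _ rfl
    exact comp_w ((hτ j).mem' k) (lw_eq (C.cv_mem c) (rep j) (mul_one _).symm rfl) c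
      (by simp [mul_assoc]) rfl
  have ht' : ∀ x i, lab x = i -> t' x ∈ C.Hom (rep i * c) (rep x.1) := by
    rintro ⟨j, k⟩ _ rfl; exact C.comp_mem (lw_eq (C.ev'_mem c) (rep j) rfl (mul_one _).symm)
      (rw_eq ((hτ j).mem k) c rfl (by simp [mul_assoc]))
  have hd0 : ∀ i : C.Irr, (C.dim (rep i) : ℂ) ≠ 0 := fun i => by exact_mod_cast (dim_rep_pos i).ne'
  have htr : ∀ {j k k'}, l j k = l j k' ->
      C.tr (rep j) (t' ⟨j, k⟩ * t ⟨j, k'⟩) = C.tr (rep (l j k)) (τ j k' * τ' j k) := by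
    intro j k k' hl; have hk' := (hτ j).mem' k'; rw [<- hl] at hk'
    rw [<- C.tr_comm ((hτ j).mem k) hk', C.tr_right' (C.comp_mem ((hτ j).mem k) hk')]; congr 1
    simp only [t', t, lab, mul_assoc]
    rw [<- mul_assoc (C.ρ _ (C.one c)), <- C.nat hk', mul_assoc, C.ρ_mul, <- map_mul, <- C.one_mul,
      C.one_comp (C.cv_mem c)]
  have hdiff : ∀ x y, lab x = lab y -> x ≠ y -> t' x * t y = 0 := by
    rintro ⟨j, k⟩ ⟨j', k'⟩ hl hne; have hm := C.comp_mem (ht' ⟨j, k⟩ _ hl) (ht ⟨j', k'⟩ _ rfl)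
    by_cases hj : j = j'
    . subst hj; have hkk : k' ≠ k := fun h => hne (by rw [h])
      rw [eq_smul_of_simple (rep_simple j) hm, htr hl, (hτ j).diff _ _ hkk, map_zero, zero_div,
        zero_smul]
    . exact hd_eq_zero.1 (hd_simple_ne (rep_simple _) (rep_simple _)
        (fun h => hj (iso_rep_iff.1 h).symm)) _ hm
  have hsame : ∀ x, t' x * t x = (C.dim (rep (lab x)) / C.dim (rep x.1) : ℂ) • C.one (rep x.1) := by
    rintro ⟨j, k⟩
    rw [eq_smul_of_simple (rep_simple j) (C.comp_mem (ht' ⟨j, k⟩ _ rfl) (ht ⟨j, k⟩ _ rfl)),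
      htr rfl, (hτ j).same, <- d_eq (rep (lab _)), d]
  have hsum : ∀ i, C.IsSum (ι := {x : T // lab x = i}) (rep i * c) (fun x => rep x.1.1)
      (fun x => t x.1) (fun x => (C.dim (rep x.1.1) / C.dim (rep i) : ℂ) • t' x.1) := by
    intro i
    refine isSum_of_card (fun x => ht _ _ x.2) (fun x => Submodule.smul_mem _ _ (ht' _ _ x.2))
      (fun x => ?_) (fun x y hxy => ?_) (fun j => ?_)
    . rw [smul_mul_assoc, hsame, smul_smul, x.2, div_mul_div_cancel₀ (hd0 _), div_self (hd0 _), one_smul]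
    . rw [smul_mul_assoc, hdiff _ _ (x.2.trans y.2.symm) (fun h => hxy (Subtype.ext h)), smul_zero]
    . rw [<- hd_mul_right', hd_comm, (hτ j).hd_rep, <- Fintype.card_subtype, <- Fintype.card_subtype]
      refine Fintype.card_le_of_injective
        (fun k => ⟨⟨⟨j, k.1⟩, k.2⟩, rfl⟩) fun k k' h => ?_
      simp only [Subtype.mk.injEq] at h; have h' : (⟨j, k.1⟩ : Σ j, Fin (n j)) = ⟨j, k'.1⟩ := h
      exact Subtype.ext (by simpa using h')
  have hz : ∀ i, C.dim (rep i) * z (rep i * c) (C.ρ (rep i) s) = ∑ x : {x : T // lab x = i},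
      C.dim (rep x.1.1) * z (rep x.1.1) (t' x.1 * C.ρ (rep (lab x.1)) s * t x.1) := by
    intro i; have h1 : C.ρ (rep i) s = ∑ x : {x : T // lab x = i}, t x.1 *
        ((C.dim (rep x.1.1) / C.dim (rep i) : ℂ) • t' x.1 * C.ρ (rep i) s) := by
      simp_rw [<- mul_assoc, <- sum_mul, (hsum i).sum, C.one_mul, <- map_mul, C.one_eq, ρ_one_comp hs]
    rw [h1, map_sum, mul_sum]; refine sum_congr rfl fun x _ => ?_
    have hm : (C.dim (rep x.1.1) / C.dim (rep i) : ℂ) • t' x.1 * C.ρ (rep i) s ∈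
        C.Hom (rep i * c * b) (rep x.1.1 * a) :=
      comp_w ((hsum i).mem' x) (lw_eq hs (rep i) (by simp [mul_assoc]) rfl) a
        (by simp [mul_assoc]) rfl
    rw [zcomm ((hsum i).mem x) hm, smul_mul_assoc, smul_mul_assoc, map_smul, smul_eq_mul, <- mul_assoc, x.2,
      mul_div_cancel₀ _ (hd0 i)]
  have hz' : ∀ j, z (rep j) (C.ρ (rep j) (C.ltr c s))
      = ∑ k, z (rep j) (t' ⟨j, k⟩ * C.ρ (rep (l j k)) s * t ⟨j, k⟩) := by
    intro j; rw [<- map_sum]; congr 1; have h1 : ∀ k, t' ⟨j, k⟩ * C.ρ (rep (l j k)) s * t ⟨j, k⟩ =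
        C.ρ (rep j) (C.ev' c) * C.ρ (rep j * C.cj c) s * (τ' j k * τ j k) * C.ρ (rep j) (C.cv c) := by
      intro k; simp only [t', t, lab, mul_assoc]
      rw [<- mul_assoc (C.ρ _ (C.one c)), <- map_mul, C.one_eq c, ρ_one_comp hs,
        <- mul_assoc (τ' j k), C.nat ((hτ j).mem k)]
      simp only [mul_assoc]
    simp_rw [h1]
    rw [<- sum_mul, <- mul_sum, (hτ j).sum, mul_assoc, C.one_mul, <- map_mul, C.one_eq,
      ρ_one_comp (C.cv_mem c), ltr, map_mul, map_mul, C.ρ_mul]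
  have hiff : ∀ x : T, lab x ∈ K.S ↔ x.1 ∈ K.S := by
    rintro ⟨j, k⟩; have h1 : C.hd (rep (l j k)) (rep j * C.cj c) ≠ 0 := by
      rw [(hτ j).hd_rep, Finset.card_ne_zero]; exact ⟨k, by simp⟩
    refine ⟨fun h => ?_, fun h => ((Sub.mem_rep.2 h).mul hc.cj) _ h1⟩
    rw [hd_comm, hd_mul_right'] at h1; exact ((Sub.mem_rep.2 h).mul hc) _ h1
  rw [sum_congr rfl fun i _ => hz i]; simp_rw [hz', mul_sum]
  have hL : ∑ i ∈ K.S, ∑ x : {x : T // lab x = i},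
      (C.dim (rep x.1.1) * z (rep x.1.1) (t' x.1 * C.ρ (rep (lab x.1)) s * t x.1) : ℂ)
      = ∑ x : T, if lab x ∈ K.S then
        (C.dim (rep x.1) * z (rep x.1) (t' x * C.ρ (rep (lab x)) s * t x) : ℂ) else 0 := by
    rw [<- sum_filter]; rw [<- Finset.sum_fiberwise_of_maps_to (g := lab) (t := K.S) (by simp)]
    refine sum_congr rfl fun i hi => ?_
    rw [Finset.sum_subtype (p := fun x => lab x = i)]; intro x
    simp only [mem_filter, mem_univ, true_and]; exact ⟨fun h => h.2, fun h => ⟨h ▸ hi, h⟩⟩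
  rw [hL, sum_sigma]; simp_rw [hiff]; rw [<- sum_subset (subset_univ K.S)]
  . refine sum_congr rfl fun j hj => sum_congr rfl fun k _ => ?_
    rw [if_pos hj]
  . intro j _ hj; simp [hj]
end Fus

section reassoc
variable {N : Type v} [Ring N] {A B C D : N}
lemma reassoc (h : A * B = C * D) (z : N) : A * (B * z) = C * (D * z) := by
  rw [<- mul_assoc, h, mul_assoc]
lemma reassoc' (h : A * B = C) (z : N) : A * (B * z) = C * z := by rw [<- mul_assoc, h]
end reassoc

namespace Fus
open LCat
variable {C : Fus N Δ}

section
variable {a b c e : Δ} {s t : N}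

lemma eq_of_tr (hs : s ∈ C.Hom a b) (ht : t ∈ C.Hom a b)
    (h : ∀ r ∈ C.Hom b a, C.tr a (r * s) = C.tr a (r * t)) : s = t := by
  rw [<- sub_eq_zero]; refine C.tr_nondeg (Submodule.sub_mem _ hs ht) fun r hr => ?_
  rw [mul_sub, map_sub, h r hr, sub_self]

lemma ltr_ltr {c e a b : Δ} {t : N} (ht : t ∈ C.Hom (c * e * a) (c * e * b)) :
    C.ltr (c * e) t = C.ltr e (C.ltr c t) := by
  have ht' : t ∈ C.Hom (c * (e * a)) (c * (e * b)) := by simpa only [mul_assoc] using ht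
  refine eq_of_tr (ltr_mem ht) (ltr_mem (ltr_mem ht')) fun r hr => ?_
  rw [<- ltr_mul_left, <- tr_ltr (C.comp_mem (C.lw hr _) ht), <- ltr_mul_left,
    <- tr_ltr (C.comp_mem (C.lw hr _) (ltr_mem ht')), <- ltr_mul_left, <- C.ρ_mul, <- tr_ltr, mul_assoc]
  rw [C.ρ_mul]; exact C.comp_mem (C.lw (C.lw hr _) _) ht'

lemma ltr_comm {u v a b : Δ} {f t : N} (hf : f ∈ C.Hom u v) (ht : t ∈ C.Hom (v * a) (u * b)) :
    C.ltr v (f * t) = C.ltr u (t * f) := by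
  have h1 := comp_w hf ht b rfl rfl
  have h2 := w_comp ht hf a rfl rfl
  refine eq_of_tr (ltr_mem h1) (ltr_mem h2) fun r hr => ?_
  rw [<- ltr_mul_left, <- tr_ltr (C.comp_mem (C.lw hr _) h1), <- ltr_mul_left,
    <- tr_ltr (C.comp_mem (C.lw hr _) h2), reassoc (C.nat hf r).symm, <- mul_assoc (C.ρ u r)]
  have h3 := C.comp_mem (C.lw hr u) ht
  have h4 := C.tr_comm (C.rw hf a) h3
  rwa [mul_assoc, <- C.one_mul, C.one_comp h3, C.one_mul, C.nat hf,
    <- mul_assoc (C.ρ u r * t), <- C.one_mul, C.comp_one h3] at h4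

lemma rtr_mul_ρ_one (hs : s ∈ C.Hom b c) (a : Δ) :
    C.rtr b c a (s * C.ρ b (C.one a)) = C.d a • s := by
  have h : C.one a * C.cv' a = C.cv' a := by rw [C.one_eq]; exact ρ_one_comp (C.cv'_mem a)
  rw [rtr, mul_assoc, mul_assoc, <- map_mul, h, <- mul_assoc, <- C.nat hs, mul_assoc, <- map_mul,
    ev_cv', map_smul, mul_smul_comm, <- C.one_eq, C.comp_one hs]

end

/-- An object with a half-braiding. -/
@[ext] structure HB (C : Fus N Δ) where
  a : Δ
  β : Δ -> N
  mem : ∀ c, β c ∈ C.Hom (a * c) (c * a)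
  nat : ∀ {c e f}, f ∈ C.Hom c e -> f * β c = β e * C.ρ a f
  mul : ∀ c e, β (c * e) = C.ρ c (β e) * β c
  one : β 1 = C.one a

namespace HB
variable (X Y : HB C)

/-- The inverse half-braiding. -/
def β' (c : Δ) : N := C.ev c * C.ρ c (X.β (C.cj c)) * C.ρ c (C.ρ X.a (C.cv c))

lemma β'_mem (c : Δ) : X.β' c ∈ C.Hom (c * X.a) (X.a * c) := by
  unfold β'; rw [mul_assoc, <- map_mul]
  exact comp_w (C.ev_mem c) (C.lw (comp_w (X.mem _) (lw_eq (C.cv_mem c) X.a (mul_one _).symm rfl) c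
    (by simp [mul_assoc]) rfl) c) (X.a * c) (by simp [mul_assoc]) (by simp)

lemma β'_mul_β (c : Δ) : X.β' c * X.β c = C.one (X.a * c) := by
  have h1 : C.ρ c (C.ρ X.a (C.cv c)) * X.β c = X.β c * C.ρ X.a (C.ρ c (C.cv c)) := by
    have := C.nat (X.mem c) (C.cv c)
    simpa only [C.ρ_mul] using this.symm
  rw [β', mul_assoc, mul_assoc, h1, <- mul_assoc (C.ρ c _), <- X.mul, <- mul_assoc, X.nat (C.ev_mem c),
    mul_assoc, <- map_mul, C.zig, X.one, C.one_mul, C.one_eq, <- map_mul, one_mul]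

lemma β_mul_β' (c : Δ) : X.β c * X.β' c = C.one (c * X.a) := by
  rw [β', mul_assoc, <- mul_assoc, <- nat_to_one (C.ev_mem c), mul_assoc, C.ρ_mul, <- map_mul, <- map_mul,
    <- mul_assoc, <- X.mul, <- X.nat (C.cv_mem c), map_mul, <- mul_assoc, C.zig, X.one, C.one_mul,
    C.one_eq c, <- map_mul, one_mul]

variable {X} in
lemma eq_β' {c : Δ} {t : N} {b : Δ} {s : N} (ht : t ∈ C.Hom b (X.a * c)) (h : X.β c * t = s) :
    t = X.β' c * s := by
  rw [<- h, <- mul_assoc, β'_mul_β, C.one_comp ht]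

lemma nat' {c e : Δ} {f : N} (hf : f ∈ C.Hom c e) : C.ρ X.a f * X.β' c = X.β' e * f := by
  have hm := C.comp_mem (C.lw hf _) (X.β'_mem c)
  have h1 : X.β e * (C.ρ X.a f * X.β' c) = f * C.one (c * X.a) := by
    rw [<- mul_assoc, <- X.nat hf, mul_assoc, β_mul_β']
  rw [eq_β' hm h1, C.one_mul, C.nat hf, <- mul_assoc, <- C.one_mul, C.comp_one (X.β'_mem e)]

lemma mul' (c e : Δ) : X.β' (c * e) = X.β' c * C.ρ c (X.β' e) := by
  have hm : X.β' c * C.ρ c (X.β' e) ∈ C.Hom (c * (e * X.a)) (X.a * (c * e)) :=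
    comp_w (X.β'_mem c) (C.lw (X.β'_mem e) c) e (by simp [mul_assoc]) (by simp [mul_assoc])
  have h1 : X.β (c * e) * (X.β' c * C.ρ c (X.β' e)) = C.one (c * e * X.a) := by
    rw [X.mul, mul_assoc, <- mul_assoc (X.β c), β_mul_β', C.one_mul, <- map_mul, C.one_eq X.a,
      ρ_one_comp (X.β'_mem e), <- map_mul, β_mul_β', <- C.one_mul, mul_assoc]
  rw [eq_β' hm h1, C.comp_one (X.β'_mem _)]

lemma one' : X.β' 1 = C.one X.a := by
  have h := X.β'_mul_β 1
  have hm := X.β'_mem 1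
  rw [one_mul] at hm; rwa [X.one, C.comp_one hm, mul_one] at h

lemma slide (c : Δ) (x : N) : X.β c * C.ρ X.a (C.ρ c x) = C.ρ c (C.ρ X.a x) * X.β c := by
  simpa only [C.ρ_mul] using C.nat (X.mem c) x

lemma slide' (c : Δ) (x : N) : X.β' c * C.ρ c (C.ρ X.a x) = C.ρ X.a (C.ρ c x) * X.β' c := by
  simpa only [C.ρ_mul] using C.nat (X.β'_mem c) x

instance : Mul (HB C) where
  mul X Y :=
    { a := X.a * Y.a
      β := fun c => X.β c * C.ρ X.a (Y.β c)
      mem := fun c => comp_w (X.mem c) (lw_eq (Y.mem c) X.a (mul_assoc _ _ _) rfl) Y.a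
        (by simp [mul_assoc]) (by simp [mul_assoc])
      nat := fun {c e f} hf => by
        rw [<- mul_assoc, X.nat hf, mul_assoc, <- map_mul, Y.nat hf, map_mul, mul_assoc, C.ρ_mul]
      mul := fun c e => by
        rw [X.mul, Y.mul, map_mul, map_mul, mul_assoc, <- mul_assoc (X.β c), slide]; simp [mul_assoc]
      one := by rw [X.one, Y.one, C.one_mul, C.one_eq, <- map_mul, one_mul] }

instance : One (HB C) where
  one :=
    { a := 1
      β := C.one
      mem := fun c => by simpa using C.one_mem c
      nat := fun hf => by rw [C.comp_one hf, C.ρ_one, C.one_comp hf]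
      mul := fun c e => by rw [C.one_mul, C.one_eq c, <- map_mul, mul_one]
      one := rfl }

@[simp] lemma mul_a : (X * Y).a = X.a * Y.a := rfl
@[simp] lemma mul_β (c : Δ) : (X * Y).β c = X.β c * C.ρ X.a (Y.β c) := rfl
@[simp] lemma one_a : (1 : HB C).a = 1 := rfl
@[simp] lemma one_β (c : Δ) : (1 : HB C).β c = C.one c := rfl

instance : Monoid (HB C) where
  mul_assoc X Y Z := by
    ext
    . simp [mul_assoc]
    . simp [mul_assoc, C.ρ_mul]
  one_mul X := by
    ext c
    . simp
    . simp [mul_β, one_β, one_a, C.ρ_one]; rw [C.one_eq, ρ_one_comp (X.mem c)]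
  mul_one X := by
    ext c
    . simp
    . simp [mul_β, one_β]; rw [<- C.one_mul, C.comp_one (X.mem c)]

/-- The half-braiding on the dual object. -/
def βd (c : Δ) : N := C.ev' X.a * C.ρ (C.cj X.a) (X.β' c) * C.ρ (C.cj X.a) (C.ρ c (C.cv' X.a))

lemma βd_mem (c : Δ) : X.βd c ∈ C.Hom (C.cj X.a * c) (c * C.cj X.a) := by
  unfold βd; rw [mul_assoc, <- map_mul]
  exact comp_w (C.ev'_mem _) (C.lw (comp_w (X.β'_mem c) (lw_eq (C.cv'_mem _) c (mul_one _).symm rfl)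
    (C.cj X.a) (by simp [mul_assoc]) rfl) _) (c * C.cj X.a) (by simp [mul_assoc]) (by simp)

lemma slided (c : Δ) (x : N) :
    X.βd c * C.ρ (C.cj X.a) (C.ρ c x) = C.ρ c (C.ρ (C.cj X.a) x) * X.βd c := by
  simpa only [C.ρ_mul] using C.nat (X.βd_mem c) x

lemma ev'_βd (c : Δ) : C.ρ c (C.ev' X.a) * X.βd c = C.ev' X.a * C.ρ (C.cj X.a) (X.β' c) := by
  have h1 := nat_to_one (C.ev'_mem X.a) (C.ρ c (C.ev' X.a))
  rw [βd, <- mul_assoc, <- mul_assoc, <- h1, C.ρ_mul, mul_assoc (C.ev' _), <- map_mul, <- slide', mul_assoc,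
    <- map_mul, mul_assoc, <- map_mul, C.zag', <- C.one_mul, C.comp_one (X.β'_mem c)]

/-- The dual object in the centre. -/
def cj : HB C where
  a := C.cj X.a
  β := X.βd
  mem := X.βd_mem
  nat := fun {c e f} hf => by
    have h1 := nat_to_one (C.ev'_mem X.a) f
    rw [βd, <- mul_assoc, <- mul_assoc, <- h1, C.ρ_mul, mul_assoc (C.ev' _), <- map_mul, X.nat' hf, βd,
      map_mul]
    simp [mul_assoc]; rw [<- map_mul, <- map_mul, C.nat hf]; simp [map_mul]
  mul := fun c e => by
    have h1 : X.βd e = C.ev' X.a * C.ρ (C.cj X.a) (X.β' e * C.ρ e (C.cv' X.a)) := by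
      rw [βd, map_mul, mul_assoc]
    rw [h1, map_mul, mul_assoc, <- slided, <- mul_assoc, ev'_βd, βd, mul', map_mul, map_mul, map_mul,
      C.ρ_mul]
    simp [mul_assoc]
  one := by
    rw [βd, one', C.ρ_one, mul_assoc, <- map_mul, C.one_eq X.a, ρ_one_comp (C.cv'_mem _), C.zig']

@[simp] lemma cj_a : X.cj.a = C.cj X.a := rfl
@[simp] lemma cj_β (c : Δ) : X.cj.β c = X.βd c := rfl

/-- Morphisms compatible with the half-braidings. -/
def Hom (X Y : HB C) : Submodule ℂ N where
  carrier := {t | t ∈ C.Hom X.a Y.a ∧ ∀ c, Y.β c * t = C.ρ c t * X.β c}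
  add_mem' := fun {s t} hs ht => ⟨Submodule.add_mem _ hs.1 ht.1, fun c => by
    rw [mul_add, hs.2, ht.2, map_add, add_mul]⟩
  zero_mem' := ⟨Submodule.zero_mem _, fun c => by simp⟩
  smul_mem' := fun r t ht => ⟨Submodule.smul_mem _ _ ht.1, fun c => by
    rw [mul_smul_comm, ht.2, map_smul, smul_mul_assoc]⟩

lemma ev'_mem : C.ev' X.a ∈ Hom (X.cj * X) 1 := by
  refine ⟨C.ev'_mem _, fun c => ?_⟩
  simp [mul_β, one_β, cj_β, cj_a]
  rw [<- mul_assoc, ev'_βd, mul_assoc, <- map_mul, β'_mul_β, C.one_mul, <- C.ρ_mul,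
    nat_to_one (C.ev'_mem _)]

lemma cv'_mem : C.cv' X.a ∈ Hom 1 (X * X.cj) := by
  refine ⟨C.cv'_mem _, fun c => ?_⟩
  simp [mul_β, one_β, cj_β]
  have h1 : X.βd c = C.ev' X.a * C.ρ (C.cj X.a) (X.β' c * C.ρ c (C.cv' X.a)) := by
    rw [βd, map_mul, mul_assoc]
  rw [h1, map_mul, mul_assoc, mul_assoc, <- C.ρ_mul, <- nat_one (C.cv'_mem _), reassoc' (C.zag' _),
    C.one_eq X.a, <- mul_assoc (C.ρ X.a 1), ρ_one_comp (X.β'_mem c), <- mul_assoc, β_mul_β', C.one_mul,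
    <- map_mul, C.one_eq X.a, ρ_one_comp (C.cv'_mem _), C.one_eq, <- map_mul, mul_one]

lemma tr_ev {a b : Δ} {W : N} (hW : W ∈ C.Hom b (b * (a * C.cj a))) : C.tr b (C.ρ b (C.ev a) * W)
      = C.tr (b * a) (C.ρ b (C.ρ a (C.ev' a)) * (W * C.ρ b (C.one a))) := by
  have hm :=
    C.comp_mem (lw_eq (lw_eq (C.ev'_mem a) a rfl (mul_one a).symm) b rfl rfl)
      (rw_eq hW a rfl (by simp [mul_assoc]))
  rw [tr_rtr hm, rtr]
  have h1 : C.one a * C.cv' a = C.cv' a := by rw [C.one_eq]; exact ρ_one_comp (C.cv'_mem a)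
  have h2 : W * C.ρ b (C.cv' a) = C.ρ b (C.ρ a (C.ρ (C.cj a) (C.cv' a))) * W := by
    simpa only [C.ρ_mul] using C.nat hW (C.cv' a)
  simp [mul_assoc]
  rw [<- map_mul, h1, h2, <- mul_assoc (C.ρ b (C.ρ a _)), <- map_mul, <- map_mul, C.zig', <- mul_assoc,
    <- map_mul, <- C.one_mul, C.comp_one (C.ev_mem a)]

lemma β_cv' (c : Δ) : X.β c * C.ρ X.a (C.cv' c) = C.ρ c (X.β' (C.cj c)) * C.cv' c * C.one X.a := by
  have h1 := X.nat (C.cv'_mem c)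
  rw [X.one, X.mul] at h1; have hm : X.β c * C.ρ X.a (C.cv' c) ∈ C.Hom X.a (c * (X.a * C.cj c)) :=
    comp_w (X.mem c) (lw_eq (C.cv'_mem c) X.a (mul_one _).symm rfl) (C.cj c) (by simp [mul_assoc])
      (by simp [mul_assoc])
  rw [mul_assoc, h1, mul_assoc, <- mul_assoc, <- map_mul, β'_mul_β, <- C.one_mul, C.one_comp hm]

lemma ev_mem : C.ev X.a ∈ Hom (X * X.cj) 1 := by
  refine ⟨C.ev_mem _, fun c => ?_⟩
  simp only [mul_β, one_β, cj_β]; set a := X.a with ha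
  have hev : C.one c * C.ev a ∈ C.Hom (a * C.cj a * c) c :=
    w_comp (C.one_mem c) (C.ev_mem a) c (one_mul c).symm rfl
  have hβ : X.β c * C.ρ a (X.βd c) ∈ C.Hom (a * C.cj a * c) (c * (a * C.cj a)) := (X * X.cj).mem c
  have hD := C.comp_mem (lw_eq (C.ev_mem a) c rfl (mul_one c).symm) hβ
  refine eq_of_tr hev hD fun s hs => ?_
  rw [C.tr_comm hs hev, C.tr_comm hs hD]
  -- the right hand side, with the loop `a` opened up
  have hW := C.comp_mem hβ hs
  have hsβ' : C.ρ (C.cj a) (X.β' c) ∈ C.Hom (C.cj a * (c * a)) (C.cj a * (a * c)) :=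
    C.lw (X.β'_mem c) _
  have hsa := C.rw hs a
  have hU : C.ρ a (C.ev' a * C.ρ (C.cj a) (X.β' c)) ∈ C.Hom (a * C.cj a * c * a) (a * c) :=
    lw_eq (comp_w (C.ev'_mem a) hsβ' c (by simp [mul_assoc]) rfl) a (by simp [mul_assoc]) (by simp)
  have e1 : C.tr c (C.ρ c (C.ev a) * (X.β c * C.ρ a (X.βd c)) * s)
      = C.tr (a * c) (C.ρ a (C.ev' a * C.ρ (C.cj a) (X.β' c)) * s * X.β c) := by
    rw [mul_assoc, tr_ev hW]
    have h1 : C.ρ c (C.ρ a (C.ev' a)) * (X.β c * C.ρ a (X.βd c) * s * C.ρ c (C.one a))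
        = X.β c * (C.ρ a (C.ev' a * C.ρ (C.cj a) (X.β' c)) * (s * C.ρ c (C.one a))) := by
      simp only [mul_assoc]
      rw [<- mul_assoc, <- X.slide, mul_assoc, <- mul_assoc (C.ρ _ _), <- map_mul, ev'_βd]
    rw [h1, C.tr_comm (X.mem c) (C.comp_mem hU hsa)]; congr 1; simp only [mul_assoc]
    rw [<- C.one_mul, C.one_comp (X.mem c)]
  have hk : C.ρ a (C.ρ (C.cj a) (C.ev c)) * (s * C.cv' c) ∈ C.Hom 1 (1 * (a * C.cj a)) := by
    exact C.comp_mem (lw_eq (lw_eq (C.ev_mem c) (C.cj a) rfl (mul_one _).symm) a rfl (by simp))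
      (comp_w hs (C.cv'_mem c) (C.cj c) rfl (by simp [mul_assoc]))
  have e2 : C.tr (a * c) (C.ρ a (C.ev' a * C.ρ (C.cj a) (X.β' c)) * s * X.β c)
      = C.tr 1 (C.ev a * (C.ρ a (C.ρ (C.cj a) (C.ev c)) * (s * C.cv' c))) := by
    have h1 := tr_ev hk
    rw [C.ρ_one, C.ρ_one, C.ρ_one] at h1; have hm := C.comp_mem hU (comp_w hs (X.mem c) a rfl rfl)
    rw [<- mul_assoc] at hm; rw [h1, one_mul, tr_rtr hm, rtr]; congr 1
    have h2 : s * C.ρ c (X.β' (C.cj c)) = C.ρ a (C.ρ (C.cj a) (C.ρ c (X.β' (C.cj c)))) * s := by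
      simpa only [C.ρ_mul] using C.nat hs (X.β' (C.cj c))
    have h3 : C.ev c * (C.ev' a * C.ρ (C.cj a) (X.β' c) * C.ρ (C.cj a) (C.ρ c (X.β' (C.cj c))))
        = C.ev' a * C.ρ (C.cj a) (C.ev c) := by
      rw [mul_assoc, <- map_mul, <- X.mul', <- mul_assoc, <- nat_to_one (C.ev'_mem a), C.ρ_mul, mul_assoc,
        <- map_mul, X.nat' (C.ev_mem c), X.one', map_mul, <- mul_assoc, <- C.one_mul,
        C.comp_one (C.ev'_mem a)]
    simp only [mul_assoc]; rw [X.β_cv' c, mul_assoc, reassoc h2]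
    have h4 := congrArg (fun y => C.ρ a y * (s * (C.cv' c * C.one a))) h3
    simpa only [map_mul, mul_assoc] using h4
  have hes : C.ev a * s ∈ C.Hom c c := comp_w (C.ev_mem a) hs c rfl (one_mul c).symm
  have h3 := C.tr_right (a := c) (b := 1) (t := C.ev a * s) (by simpa using hes)
  rw [C.ρ_one, C.ρ_one, one_mul] at h3
  rw [e1, e2, mul_assoc, C.one_comp hes, h3, <- mul_assoc (C.ev a), <- C.ρ_mul,
    nat_to_one (C.ev_mem a)]
  simp only [mul_assoc]

lemma cv_mem : C.cv X.a ∈ Hom 1 (X.cj * X) := by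
  refine ⟨C.cv_mem _, fun c => ?_⟩
  simp [mul_β, one_β, cj_β, cj_a]; have hev := (X.ev_mem).2 c; simp [mul_β, one_β, cj_β] at hev
  have hβcv : C.ρ (C.cj X.a) (X.β c) * C.cv X.a ∈ C.Hom c (C.cj X.a * (c * X.a)) :=
    w_comp (C.lw (X.mem c) _) (C.cv_mem X.a) c (by simp [mul_assoc]) (by simp)
  set Q := X.βd c * (C.ρ (C.cj X.a) (X.β c) * C.cv X.a) with hQ
  have hQm : Q ∈ C.Hom c (c * (C.cj X.a * X.a)) :=
    comp_w (X.βd_mem c) hβcv X.a (by simp [mul_assoc]) (by simp [mul_assoc])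
  set B := C.ρ (C.cj X.a) (C.ρ c (C.ev X.a)) * (C.ρ (C.cj X.a) (X.β c) * C.cv X.a) with hB
  have hBβ : B * X.βd c = C.one (C.cj X.a * c) := by
    rw [hB, mul_assoc, mul_assoc, nat_one (C.cv_mem X.a), C.ρ_mul, <- mul_assoc (C.ρ _ (X.β c)),
      <- map_mul, <- mul_assoc, <- map_mul, <- hev, map_mul, mul_assoc, C.zag,
      C.one_eq (C.cj X.a), <- map_mul, mul_one, C.one_mul]
  have hBm : B ∈ C.Hom (c * C.cj X.a) (C.cj X.a * c) := by
    exact w_comp (lw_eq (lw_eq (C.ev_mem X.a) c rfl (mul_one c).symm) (C.cj X.a) rfl rfl) hβcv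
      (C.cj X.a) (by simp [mul_assoc]) rfl
  have hβB : X.βd c * B = C.one (c * C.cj X.a) := by
    have h1 : B = X.cj.β' c := by
      rw [<- C.comp_one hBm, <- cj_a, <- X.cj.β_mul_β' c, <- mul_assoc, cj_β, hBβ, <- cj_a,
        C.one_comp (X.cj.β'_mem c)]
    rw [h1]; exact X.cj.β_mul_β' c
  have h2 : C.ρ c (C.ρ (C.cj X.a) (C.ev X.a)) * Q = C.one (c * C.cj X.a) := by
    rw [<- hβB, hB, hQ, <- mul_assoc, <- slided, mul_assoc]
  have h3 : Q * C.ρ c (C.cv X.a) = C.ρ c (C.ρ (C.cj X.a) (C.ρ X.a (C.cv X.a))) * Q := by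
    simpa only [C.ρ_mul] using C.nat hQm (C.cv X.a)
  have h4 := congrArg (· * C.ρ c (C.cv X.a)) h2
  simp [mul_assoc] at h4
  rw [h3, <- mul_assoc, <- map_mul, <- map_mul, C.zig, <- C.one_mul, <- C.one_mul,
    C.one_comp hQm, C.one_mul, <- map_mul, C.one_eq (C.cj X.a), ρ_one_comp (C.cv_mem _)] at h4
  rw [mul_assoc, <- hQ, h4, C.one_eq, <- map_mul, mul_one]

end HB
end Fus

namespace Fus
open LCat
variable {C : Fus N Δ}

namespace HB
variable (X Y : HB C) {x : N}

/-- `x : X ⟶ Y` conjugated past `u` by the half-braidings. -/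
def enc (x : N) (u : Δ) : N := Y.β u * x * X.β' u

variable {X Y}

lemma enc_mem (hx : x ∈ C.Hom X.a Y.a) (u : Δ) : enc X Y x u ∈ C.Hom (u * X.a) (u * Y.a) := by
  unfold enc; rw [mul_assoc]; exact C.comp_mem (Y.mem u) (comp_w hx (X.β'_mem u) u rfl rfl)

lemma enc_nat (hx : x ∈ C.Hom X.a Y.a) {u v : Δ} {f : N} (hf : f ∈ C.Hom u v) :
    f * enc X Y x u = enc X Y x v * f := by
  unfold enc
  rw [<- mul_assoc, <- mul_assoc, Y.nat hf, mul_assoc (Y.β v), <- C.nat hx, <- mul_assoc, mul_assoc,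
    X.nat' hf, mul_assoc]
  simp [mul_assoc]

lemma enc_mul (x : N) (c e : Δ) :
    enc X Y x (c * e) = C.ρ c (Y.β e) * enc X Y x c * C.ρ c (X.β' e) := by
  simp [enc, Y.mul, X.mul', mul_assoc]

variable (X Y)

/-- Encircling by `c`. -/
def P (c : Δ) (x : N) : N := C.ltr c (enc X Y x c)

variable {X Y}

lemma P_mem (hx : x ∈ C.Hom X.a Y.a) (c : Δ) : P X Y c x ∈ C.Hom X.a Y.a := ltr_mem (enc_mem hx c)

lemma P_mul (hx : x ∈ C.Hom X.a Y.a) (c e : Δ) : P X Y (c * e) x = P X Y e (P X Y c x) := by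
  rw [P, ltr_ltr (enc_mem hx _), enc_mul, mul_assoc, ltr_mul_left, ltr_mul_right]
  simp [P, enc, mul_assoc]

lemma P_one (hx : x ∈ C.Hom X.a Y.a) : P X Y 1 x = x := by
  rw [P, enc, X.one', Y.one, C.one_comp hx, C.comp_one hx]; have := ltr_one_mul (C := C) 1 x
  rwa [C.ρ_one, d_one, one_smul] at this

lemma P_sum (hx : x ∈ C.Hom X.a Y.a) : C.Additive (fun c => P X Y c x) := by
  refine ⟨fun {ι _ c Z s s'} h => ?_⟩
  have hm := enc_mem hx c
  have h1 : enc X Y x c = ∑ k, s k * (s' k * enc X Y x c) := by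
    simp_rw [<- mul_assoc, <- sum_mul, h.sum, C.one_eq, ρ_one_comp hm]
  change C.ltr c (enc X Y x c) = _
  rw [h1, ltr_sum]; refine sum_congr rfl fun k _ => ?_
  rw [ltr_comm (h.mem k) (comp_w (h.mem' k) hm Y.a rfl rfl), mul_assoc, <- enc_nat hx (h.mem k),
    <- mul_assoc, h.same, C.one_eq, ρ_one_comp (enc_mem hx _), P]

lemma P_smul (r : ℂ) (c : Δ) : P X Y c (r • x) = r • P X Y c x := by simp [P, enc, ltr_smul]

lemma tr_P_mul {s t : N} (hs : s ∈ C.Hom Y.a X.a) (ht : t ∈ Hom X Y) (c : Δ) :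
    C.tr X.a (P Y X c s * t) = C.d c * C.tr X.a (s * t) := by
  have h0 : Y.β' c * C.ρ c t = t * X.β' c := by
    have h2 := ht.2 c
    have hm := comp_w ht.1 (X.β'_mem c) c rfl rfl
    have h3 : Y.β c * (t * X.β' c) = C.ρ c t * C.one (c * X.a) := by
      rw [<- mul_assoc, h2, mul_assoc, β_mul_β']
    rw [eq_β' hm h3, C.comp_one (C.lw ht.1 c)]
  have hst := C.comp_mem hs ht.1
  have hm1 := comp_w hst (X.β'_mem c) c rfl rfl
  have h1 : enc Y X s c * C.ρ c t = X.β c * (s * t * X.β' c) := by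
    rw [enc, mul_assoc, h0]; simp [mul_assoc]
  have hm2 : s * t * C.one (X.a * c) ∈ C.Hom (X.a * c) (X.a * c) := by
    rw [C.one_mul]; exact C.rw hst c
  rw [P, <- ltr_mul_right, <- tr_ltr (C.comp_mem (enc_mem hs c) (C.lw ht.1 c)), h1,
    C.tr_comm (X.mem c) hm1, mul_assoc, β'_mul_β, tr_rtr hm2, C.one_mul, rtr_mul_ρ_one hst, map_smul,
    smul_eq_mul]

variable [C.Split]

lemma avg_comm (hx : x ∈ C.Hom X.a Y.a) (K : C.Sub) {c : Δ} (hc : K.Mem c) :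
    Y.β c * (∑ i ∈ K.S, (C.dim (rep i) : ℂ) • P X Y (rep i) x)
      = C.ρ c (∑ i ∈ K.S, (C.dim (rep i) : ℂ) • P X Y (rep i) x) * X.β c := by
  set Q := ∑ i ∈ K.S, (C.dim (rep i) : ℂ) • P X Y (rep i) x with hQ
  have hQm : Q ∈ C.Hom X.a Y.a := Submodule.sum_mem _ fun i _ => Submodule.smul_mem _ _ (P_mem hx _)
  have hL := enc_mem hQm c
  suffices h : enc X Y Q c = C.ρ c Q by
    have hm := w_comp (Y.mem c) hQm c rfl rfl
    rw [<- h, enc, mul_assoc, β'_mul_β, C.comp_one hm]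
  refine eq_of_tr hL (C.lw hQm c) fun s hs => ?_
  let z : Δ -> N →ₗ[ℂ] ℂ := fun u => (C.tr (u * X.a)).comp (mulRight ℂ (enc X Y x u))
  have hz : ∀ u y, z u y = C.tr (u * X.a) (y * enc X Y x u) := fun u y => rfl
  have key := sum_dim_slide K hc z (by
    intro u v f y hf hy; rw [hz, hz]; have h1 := C.comp_mem hy (enc_mem hx v)
    have h2 := C.tr_comm (C.rw hf X.a) h1
    rw [mul_assoc, <- C.one_mul, C.one_comp h1, C.one_mul, C.nat hf, mul_assoc y,
      <- mul_assoc (enc X Y x v), <- C.one_mul, C.comp_one (enc_mem hx v), <- enc_nat hx hf] at h2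
    rw [mul_assoc, h2, mul_assoc]) hs
  simp [hz] at key
  have e1 : ∀ i : C.Irr, C.tr (rep i * c * X.a) (C.ρ (rep i) s * enc X Y x (rep i * c))
      = C.tr (c * X.a) (s * enc X Y (P X Y (rep i) x) c) := by
    intro i; have hm :=
      C.comp_mem (C.lw hs _) (by simpa only [mul_assoc] using enc_mem hx (rep i * c))
    rw [mul_assoc, tr_ltr hm, ltr_mul_left, enc_mul, mul_assoc, ltr_mul_left, ltr_mul_right]
    simp [enc, P, mul_assoc]
  have e2 : ∀ i : C.Irr, C.tr (rep i * X.a) (C.ρ (rep i) (C.ltr c s) * enc X Y x (rep i))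
      = C.tr (c * X.a) (s * C.ρ c (P X Y (rep i) x)) := by
    intro i
    rw [tr_ltr (C.comp_mem (C.lw (ltr_mem hs) _) (enc_mem hx _)), ltr_mul_left,
      tr_ltr (C.comp_mem hs (C.lw (P_mem hx _) c)), ltr_mul_right, P]
  simp [e1, e2] at key; rw [hQ, enc, map_sum, mul_sum, sum_mul, mul_sum, mul_sum, map_sum, map_sum]
  simp only [mul_smul_comm, smul_mul_assoc, map_smul, smul_eq_mul]; exact key

end HB

section induction
variable [C.Split]

def decN (C : Fus N Δ) [C.Split] (a : Δ) : ℕ := (C.exists_dec a).choose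
def decl (a : Δ) : Fin (C.decN a) -> C.Irr := (C.exists_dec a).choose_spec.choose
def decs (a : Δ) : Fin (C.decN a) -> N := (C.exists_dec a).choose_spec.choose_spec.choose
def decs' (a : Δ) : Fin (C.decN a) -> N :=
  (C.exists_dec a).choose_spec.choose_spec.choose_spec.choose
lemma dec_isSum (a : Δ) : C.IsSum a (fun k => rep (decl (C := C) a k)) (decs a) (decs' a) :=
  (C.exists_dec a).choose_spec.choose_spec.choose_spec.choose_spec

lemma exists_sum {ι : Type*} [Fintype ι] (Y : ι -> Δ) : ∃ X s s', C.IsSum X Y s s' := by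
  obtain ⟨X, s, s', h⟩ := C.sum (Y ∘ (equivFin ι).symm)
  refine ⟨X, s ∘ equivFin ι, s' ∘ equivFin ι, ?_⟩
  have := h.reindex (equivFin ι)
  have hY : (Y ∘ (equivFin ι).symm) ∘ equivFin ι = Y := by ext; simp
  rwa [hY] at this

lemma exists_ind (C : Fus N Δ) [C.Split] (X : Δ) :
    ∃ (J : Δ) (u u' : C.Irr -> N), C.IsSum J (fun j => C.cj (rep j) * X * rep j) u u' := exists_sum _

variable (C) (X : Δ)
/-- The underlying object of the induced object. -/
def indJ : Δ := (C.exists_ind X).choose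
def indu : C.Irr -> N := (C.exists_ind X).choose_spec.choose
def indu' : C.Irr -> N := (C.exists_ind X).choose_spec.choose_spec.choose
lemma ind_isSum : C.IsSum (C.indJ X) (fun j => C.cj (rep j) * X * rep j) (C.indu X) (C.indu' X) :=
  (C.exists_ind X).choose_spec.choose_spec.choose_spec

/-- The map `y X a ⟶ J` attached to a pairing `π : y a ⟶ 1`. -/
def ie (y a : Δ) (π : N) : N :=
  ∑ k, C.indu X (decl a k) * (π * C.ρ y (decs a k * C.cv' (rep (decl a k))))
    * C.ρ y (C.ρ X (decs' a k))

variable {C X}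
variable {y a b c e z : Δ} {π f g : N}

lemma pair_mem (hπ : π ∈ C.Hom (y * a) 1) {i : C.Irr} {s : N} (hs : s ∈ C.Hom (rep i) a) :
    π * C.ρ y (s * C.cv' (rep i)) ∈ C.Hom y (C.cj (rep i)) :=
  comp_w hπ (lw_eq (comp_w hs (C.cv'_mem _) (C.cj (rep i)) rfl rfl) y (mul_one y).symm rfl)
    (C.cj (rep i)) (by simp [mul_assoc]) (by simp)

lemma ie_term_mem (hπ : π ∈ C.Hom (y * a) 1) (k : Fin (C.decN a)) :
    (π * C.ρ y (decs a k * C.cv' (rep (decl (C := C) a k)))) * C.ρ y (C.ρ X (decs' a k))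
      ∈ C.Hom (y * X * a) (C.cj (rep (decl a k)) * X * rep (decl a k)) :=
  comp_w (pair_mem hπ ((dec_isSum a).mem k)) (lw_eq (C.lw ((dec_isSum a).mem' k) X) y
    (by simp [mul_assoc]) rfl) (X * rep (decl a k)) rfl (by simp [mul_assoc])

lemma ie_mem (hπ : π ∈ C.Hom (y * a) 1) : C.ie X y a π ∈ C.Hom (y * X * a) (C.indJ X) := by
  refine Submodule.sum_mem _ fun k _ => ?_
  rw [mul_assoc (C.indu X _)]; exact C.comp_mem ((C.ind_isSum X).mem _) (ie_term_mem hπ k)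

lemma ie_swap {i j : C.Irr} {w s r' : N} (hw : w ∈ C.Hom (rep j) (rep i))
    (hs : s ∈ C.Hom (rep i) a) (hr : r' ∈ C.Hom b (rep j)) :
    C.indu X i * (π * C.ρ y (s * C.cv' (rep i))) * C.ρ y (C.ρ X (w * r'))
      = C.indu X j * (π * C.ρ y (s * w * C.cv' (rep j))) * C.ρ y (C.ρ X r') := by
  by_cases h : j = i
  . subst h; obtain ⟨r, rfl⟩ := (rep_simple j).2 w hw
    simp [map_smul, C.one_comp hr, C.comp_one hs]
  . rw [hd_eq_zero.1 (hd_simple_ne (rep_simple j) (rep_simple i) (fun h' => h (iso_rep_iff.1 h'))) w hw]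
    simp

lemma ie_right (hf : f ∈ C.Hom b a) :
    C.ie X y a π * C.ρ y (C.ρ X f) = C.ie X y b (π * C.ρ y f) := by
  have h1 : ∀ k, C.indu X (decl a k) * (π * C.ρ y (decs a k * C.cv' (rep (decl a k))))
      * C.ρ y (C.ρ X (decs' a k)) * C.ρ y (C.ρ X f) = ∑ m, C.indu X (decl a k) *
      (π * C.ρ y (decs a k * C.cv' (rep (decl (C := C) a k))))
      * C.ρ y (C.ρ X ((decs' a k * f * decs b m) * decs' (C := C) b m)) := by
    intro k
    rw [<- mul_sum, <- map_sum, <- map_sum,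
      (dec_isSum b).expand_right (C.comp_mem ((dec_isSum a).mem' k) hf), mul_assoc, <- map_mul,
      <- map_mul]
  have h2 : ∀ m, C.indu X (decl b m) * (π * C.ρ y f * C.ρ y (decs b m * C.cv' (rep (decl b m))))
      * C.ρ y (C.ρ X (decs' (C := C) b m)) = ∑ k, C.indu X (decl b m) *
      (π * C.ρ y (decs a k * (decs' (C := C) a k * f * decs b m) * C.cv' (rep (decl b m))))
      * C.ρ y (C.ρ X (decs' (C := C) b m)) := by
    intro m; rw [<- sum_mul, <- mul_sum, <- mul_sum, <- map_sum, <- sum_mul]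
    have h3 := (dec_isSum a).expand_left (C.comp_mem hf ((dec_isSum b).mem m))
    simp_rw [<- mul_assoc] at h3 ⊢; rw [h3]; simp [map_mul, mul_assoc]
  rw [ie, sum_mul, sum_congr rfl fun k _ => h1 k, ie, sum_congr rfl fun m _ => h2 m, sum_comm]
  refine sum_congr rfl fun m _ => sum_congr rfl fun k _ => ?_
  exact ie_swap (C.comp_mem (C.comp_mem ((dec_isSum a).mem' k) hf) ((dec_isSum b).mem m))
    ((dec_isSum a).mem k) ((dec_isSum b).mem' m)

lemma ie_right_w (hπ : π ∈ C.Hom (y * (a * c)) 1) (hf : f ∈ C.Hom b a) :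
    C.ie X y (a * c) π * C.ρ y (C.ρ X f) = C.ie X y (b * c) (π * C.ρ y f) := by
  have h1 := ie_right (X := X) (y := y) (π := π) (C.rw hf c)
  rwa [C.nat hf, map_mul, map_mul, map_mul, <- C.one_mul a c, <- C.one_mul X, <- C.one_mul y,
    <- C.one_mul y, <- mul_assoc, <- mul_assoc π, C.comp_one hπ, <- mul_assoc,
    C.comp_one (ie_mem hπ)] at h1

lemma ie_left (hg : g ∈ C.Hom z y) : C.ie X y a π * g = C.ie X z a (π * g) := by
  rw [ie, ie, sum_mul]; refine sum_congr rfl fun k _ => ?_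
  simp only [mul_assoc]; rw [<- C.nat hg, <- mul_assoc (C.ρ y _) g, <- C.nat hg]; simp [mul_assoc]

lemma ie_sum {ι : Type*} (S : Finset ι) (p : ι -> N) :
    ∑ m ∈ S, C.ie X y a (p m) = C.ie X y a (∑ m ∈ S, p m) := by
  simp [ie]; rw [sum_comm]; simp [sum_mul, mul_sum]

lemma ie_rep (i : C.Irr) : C.ie X (C.cj (rep i)) (rep i) (C.ev' (rep i)) = C.indu X i := by
  have h1 := fun k => ie_swap (X := X) (y := C.cj (rep i)) (π := C.ev' (rep i))
    ((dec_isSum (rep i)).mem k) (C.one_mem (rep i)) ((dec_isSum (rep i)).mem' k)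
  simp only [C.one_comp ((dec_isSum (rep i)).mem _)] at h1
  rw [ie, <- sum_congr rfl fun k _ => h1 k, <- mul_sum, <- map_sum, <- map_sum,
    (dec_isSum (rep i)).sum, C.one_eq (rep i), ρ_one_comp (C.cv'_mem _), C.zig', <- C.one_eq,
    mul_assoc, C.one_eq (C.cj _), <- map_mul, one_mul, <- C.one_mul, <- C.one_mul, <- mul_assoc]
  exact C.comp_one ((C.ind_isSum X).mem i)

/-- The half-braiding of the induced object precomposed with `ie`. -/
def gb (C : Fus N Δ) [C.Split] (X c y a : Δ) (π : N) : N :=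
  C.ρ c (C.ie X (C.cj c * y) (a * c) (C.ev' c * C.ρ (C.cj c) π)) * C.cv' c

def indβ (C : Fus N Δ) [C.Split] (X c : Δ) : N :=
  ∑ j, C.gb X c (C.cj (rep j)) (rep j) (C.ev' (rep j)) * C.indu' X j

lemma nest_mem (hπ : π ∈ C.Hom (y * a) 1) (c : Δ) :
    C.ev' c * C.ρ (C.cj c) π ∈ C.Hom (C.cj c * y * (a * c)) 1 :=
  w_comp (C.ev'_mem c) (C.lw hπ _) c (by simp) (by simp [mul_assoc])

end induction
end Fus

namespace Fus
open LCat
variable {C : Fus N Δ} [C.Split]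
variable {X y a b c e z : Δ} {π f g : N}

lemma gb_mem (hπ : π ∈ C.Hom (y * a) 1) (c : Δ) :
    C.gb X c y a π ∈ C.Hom (y * X * a * c) (c * C.indJ X) :=
  w_comp (C.lw (ie_mem (nest_mem hπ c)) c) (C.cv'_mem c) (y * X * a * c) (by simp [mul_assoc])
    (by simp)

lemma indβ_mem (c : Δ) : C.indβ X c ∈ C.Hom (C.indJ X * c) (c * C.indJ X) :=
  Submodule.sum_mem _ fun j _ => w_comp (gb_mem (C.ev'_mem _) c) ((C.ind_isSum X).mem' j) c rfl rfl

lemma ev'_pair (hπ : π ∈ C.Hom (y * a) 1) {s : N} (hs : s ∈ C.Hom b a) :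
    C.ev' b * (π * C.ρ y (s * C.cv' b)) = π * C.ρ y s := by
  have h1 : C.ev' b * π = π * C.ρ y (C.ρ a (C.ev' b)) := by rw [<- C.ρ_mul, nat_to_one hπ]
  rw [<- mul_assoc, h1, mul_assoc, <- map_mul, <- mul_assoc, <- C.nat hs, mul_assoc, C.zag',
    C.comp_one hs]

lemma indβ_ie (hπ : π ∈ C.Hom (y * a) 1) (c : Δ) : C.indβ X c * C.ie X y a π = C.gb X c y a π := by
  have h1 : ∀ i, C.indβ X c * C.indu X i =
      C.gb X c (C.cj (rep i)) (rep i) (C.ev' (rep i)) * C.one (C.cj (rep i) * X * rep i) := by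
    intro i; rw [indβ, sum_mul, sum_eq_single i, mul_assoc, (C.ind_isSum X).same]
    . intro j _ hj; rw [mul_assoc, (C.ind_isSum X).diff j i hj, mul_zero]
    . simp
  set q : Fin (C.decN a) -> N := fun k => π * C.ρ y (decs a k * C.cv' (rep (decl a k))) with hq
  have hqm := fun k => pair_mem hπ ((dec_isSum a).mem k)
  have h2 : ∀ k, C.indβ X c * (C.indu X (decl a k) * q k * C.ρ y (C.ρ X (decs' a k)))
      = C.ρ c (C.ie X (C.cj c * y) (a * c)
        (C.ev' c * C.ρ (C.cj c) (π * C.ρ y (decs a k * decs' a k)))) * C.cv' c := by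
    intro k
    rw [mul_assoc, <- mul_assoc, h1, mul_assoc, C.one_comp (ie_term_mem hπ k), gb,
      mul_assoc, nat_one (C.cv'_mem c), <- mul_assoc, C.ρ_mul, <- map_mul, map_mul (C.ρ (C.cj c)),
      <- mul_assoc, ie_left (C.lw (hqm k) _), <- C.ρ_mul (C.cj c) y, ie_right_w _ ((dec_isSum a).mem' k)]
    . have h4 : C.ev' c * C.ρ (C.cj c) (C.ev' (rep (decl a k))) * C.ρ (C.cj c) (q k)
          * C.ρ (C.cj c * y) (decs' a k)
          = C.ev' c * C.ρ (C.cj c) (π * C.ρ y (decs a k * decs' (C := C) a k)) := by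
        rw [mul_assoc, mul_assoc, C.ρ_mul, <- map_mul, <- map_mul, <- mul_assoc, hq,
          ev'_pair hπ ((dec_isSum a).mem k), mul_assoc, <- map_mul]
      rw [h4]
    . exact w_comp (nest_mem (C.ev'_mem _) c) (C.lw (hqm k) _) (rep (decl a k) * c) rfl rfl
  rw [ie, mul_sum, sum_congr rfl fun k _ => h2 k, <- sum_mul, <- map_sum, ie_sum,
    <- mul_sum, <- map_sum, <- mul_sum, <- map_sum, (dec_isSum a).sum, <- C.one_mul,
    C.comp_one hπ]
  rfl

lemma ie_left_w {w : Δ} (hπ : π ∈ C.Hom (y * w * a) 1) (hg : g ∈ C.Hom z y) :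
    C.ie X (y * w) a π * g = C.ie X (z * w) a (π * g) := by
  have h1 := ie_left (X := X) (a := a) (π := π) (C.rw hg w)
  have h2 : C.ie X (y * w) a π ∈ C.Hom (y * w * (X * a)) (C.indJ X) := by
    simpa only [mul_assoc] using ie_mem hπ
  rwa [C.nat hg, <- C.one_mul, C.one_eq, <- mul_assoc, <- mul_assoc, comp_ρ_one h2,
    comp_ρ_one hπ] at h1

lemma mate_mem {b w : Δ} (hg : g ∈ C.Hom 1 (b * w)) : C.ev' b * C.ρ (C.cj b) g ∈ C.Hom (C.cj b) w :=
  comp_w (C.ev'_mem b) (lw_eq hg (C.cj b) (mul_one _).symm rfl) w (by simp [mul_assoc]) (by simp)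

lemma mate_cv' {b w : Δ} (hg : g ∈ C.Hom z (b * w)) :
    C.ρ b (C.ev' b * C.ρ (C.cj b) g) * C.cv' b = g := by
  rw [map_mul, mul_assoc, <- C.ρ_mul, <- nat_one (C.cv'_mem b), reassoc' (C.zag' b), C.one_eq,
    ρ_one_comp hg]

lemma comp_mate {b : Δ} (A : N) :
    A * (C.ev' b * C.ρ (C.cj b) g) = C.ev' b * C.ρ (C.cj b) (C.ρ b A * g) := by
  rw [<- mul_assoc, <- nat_to_one (C.ev'_mem b), C.ρ_mul, mul_assoc, <- map_mul]

lemma gb_nat (hπ : π ∈ C.Hom (y * a) 1) (hf : f ∈ C.Hom c e) :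
    f * C.gb X c y a π = C.gb X e y a π * C.ρ y (C.ρ X (C.ρ a f)) := by
  have hg := comp_w hf (C.cv'_mem c) (C.cj c) rfl rfl
  have h2 : C.ev' c * (C.ev' e * C.ρ (C.cj e) (f * C.cv' c)) = C.ev' e * C.ρ (C.cj e) f := by
    rw [comp_mate, <- mul_assoc, <- C.nat hf, mul_assoc, C.zag', C.comp_one hf]
  rw [gb, <- mul_assoc, C.nat hf, mul_assoc, <- mate_cv' hg, <- mul_assoc, <- map_mul,
    ie_left_w (by simpa only [mul_assoc] using nest_mem hπ c) (mate_mem hg), mul_assoc,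
    <- C.nat (mate_mem hg), <- mul_assoc, h2, gb, mul_assoc, mul_assoc, nat_one (C.cv'_mem e),
    C.ρ_mul, <- mul_assoc (C.ρ e _),
    <- map_mul (C.ρ e), <- C.ρ_mul (C.cj e) y, ie_right (C.lw hf a), C.ρ_mul (C.cj e) y,
    mul_assoc, <- map_mul, <- map_mul, <- C.ρ_mul y a, nat_to_one hπ]

lemma gb_mul (hπ : π ∈ C.Hom (y * a) 1) (c e : Δ) :
    C.ρ c (C.gb X e (C.cj c * y) (a * c) (C.ev' c * C.ρ (C.cj c) π)) * C.cv' c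
      = C.gb X (c * e) y a π := by
  set Cv := C.ρ c (C.cv' e) * C.cv' c with hCv
  have hCm : Cv ∈ C.Hom 1 (c * e * (C.cj e * C.cj c)) :=
    comp_w (lw_eq (C.cv'_mem e) c (mul_one c).symm rfl) (C.cv'_mem c) (C.cj c) rfl
      (by simp [mul_assoc])
  have h1 : C.ρ (c * e) (C.ev' e * C.ρ (C.cj e) (C.ev' c)) * Cv = C.one (c * e) := by
    rw [C.ρ_mul, hCv, <- mul_assoc, <- map_mul, map_mul (C.ρ e), mul_assoc,
      <- C.ρ_mul e, <- nat_one (C.cv'_mem e), reassoc' (C.zag' e), <- nat_to_one (C.ev'_mem c),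
      map_mul, mul_assoc, C.ρ_mul, <- C.ρ_mul c (C.cj c), <- nat_one (C.cv'_mem c), reassoc' (C.zag' c),
      C.one_eq c, <- map_mul, one_mul, C.one_mul]
  have h2 : C.ev' e * C.ρ (C.cj e) (C.ev' c) * (C.ev' (c * e) * C.ρ (C.cj (c * e)) Cv)
      = C.ev' (c * e) := by
    rw [comp_mate, h1, <- C.one_mul, C.comp_one (C.ev'_mem _)]
  have hn : C.ev' e * C.ρ (C.cj e) (C.ev' c * C.ρ (C.cj c) π) ∈
      C.Hom (C.cj e * C.cj c * y * (a * (c * e))) 1 := by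
    simpa only [mul_assoc] using nest_mem (nest_mem hπ c) e
  rw [gb, map_mul, mul_assoc, <- hCv, <- C.ρ_mul c e, <- mate_cv' hCm, <- mul_assoc, <- map_mul,
    <- mul_assoc (C.cj e), mul_assoc a, ie_left_w hn (mate_mem hCm), map_mul, <- C.ρ_mul (C.cj e),
    mul_assoc, mul_assoc, <- C.nat (mate_mem hCm), <- mul_assoc (C.ev' e),
    <- mul_assoc (C.ev' e * _), h2, gb]

lemma gb_one (hπ : π ∈ C.Hom (y * a) 1) : C.gb X 1 y a π = C.ie X y a π := by
  have hcv : C.cv' 1 ∈ C.Hom 1 (C.cj 1) := by simpa using C.cv'_mem 1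
  have h1 : C.ev' 1 * C.cv' 1 = 1 := by
    have := C.zag' 1
    rwa [C.ρ_one, C.one_one] at this
  have hn := nest_mem hπ 1
  rw [mul_one] at hn
  rw [gb, C.ρ_one, mul_one, ie_left_w hn hcv, mul_assoc, <- nat_one hcv, <- mul_assoc, h1,
    one_mul, one_mul]

/-- The induced object of the centre. -/
def ind (C : Fus N Δ) [C.Split] (X : Δ) : HB C where
  a := C.indJ X
  β := C.indβ X
  mem := indβ_mem
  nat := fun {c e f} hf => by
    rw [indβ, indβ, mul_sum, sum_mul]; refine sum_congr rfl fun j _ => ?_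
    rw [<- mul_assoc, gb_nat (C.ev'_mem _) hf, mul_assoc, mul_assoc, C.nat ((C.ind_isSum X).mem' j),
      C.ρ_mul, C.ρ_mul]
  mul := fun c e => by
    rw [indβ, indβ.eq_1 C X c, mul_sum]; refine sum_congr rfl fun j _ => ?_
    rw [<- gb_mul (C.ev'_mem _), <- indβ_ie (nest_mem (C.ev'_mem _) c), map_mul, gb]
    simp [mul_assoc]
  one := by rw [indβ]; simp_rw [gb_one (C.ev'_mem _), ie_rep]; exact (C.ind_isSum X).sum

lemma dim_ind (X : Δ) : C.dim (C.ind X).a = (Sub.top C).gdim * C.dim X := by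
  change C.dim (C.indJ X) = _
  rw [add_dim.sum_eq (C.ind_isSum X), Sub.gdim, sum_mul]; refine sum_congr rfl fun j _ => ?_
  rw [dim_mul, dim_mul, dim_cj]; ring

/-- The unit of the induction adjunction. -/
def indη (C : Fus N Δ) [C.Split] (X : Δ) : N := C.ie X 1 1 1

lemma one_pair : (1 : N) ∈ C.Hom (1 * 1) 1 := by simpa using C.one_mem_one

lemma indη_mem (X : Δ) : C.indη X ∈ C.Hom X (C.ind X).a := by
  have := ie_mem (X := X) (one_pair (C := C))
  rwa [one_mul, mul_one] at this

def indh (Z : HB C) (X : Δ) (w : N) : N :=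
  ∑ j : C.Irr, C.ev' (rep j) * C.ρ (C.cj (rep j)) (Z.β (rep j) * w) * C.indu' X j

lemma indh_ie {Z : HB C} {w : N} (hw : w ∈ C.Hom X Z.a) (hπ : π ∈ C.Hom (y * a) 1) :
    indh Z X w * C.ie X y a π = π * C.ρ y (Z.β a * w) := by
  have hZ := fun c => w_comp (Z.mem c) hw c rfl rfl
  have hm : ∀ i : C.Irr, C.ev' (rep i) * C.ρ (C.cj (rep i)) (Z.β (rep i) * w) ∈
      C.Hom (C.cj (rep i) * X * rep i) Z.a := fun i => by
    rw [mul_assoc]; exact comp_w (C.ev'_mem _) (C.lw (hZ _) _) Z.a (by simp [mul_assoc]) (by simp)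
  have h1 : ∀ i, indh Z X w * C.indu X i = C.ev' (rep i) * C.ρ (C.cj (rep i)) (Z.β (rep i) * w) :=
    fun i => (C.ind_isSum X).sum_incl _ hm i
  have h2 : ∀ k, indh Z X w * (C.indu X (decl a k) *
      (π * C.ρ y (decs a k * C.cv' (rep (decl a k)))) * C.ρ y (C.ρ X (decs' a k)))
      = π * C.ρ y (decs a k * decs' a k) * C.ρ y (Z.β a * w) := by
    intro k
    rw [<- mul_assoc, <- mul_assoc, h1, mul_assoc (C.ev' _), <- C.nat (pair_mem hπ ((dec_isSum a).mem k)),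
      <- mul_assoc, ev'_pair hπ ((dec_isSum a).mem k), mul_assoc, <- map_mul, mul_assoc (Z.β _),
      C.nat hw, <- mul_assoc, <- Z.nat ((dec_isSum a).mem' k)]
    simp [map_mul, mul_assoc]
  rw [ie, mul_sum, sum_congr rfl fun k _ => h2 k, <- sum_mul, <- mul_sum,
    <- map_sum, (dec_isSum a).sum, <- C.one_mul, C.comp_one hπ]

lemma indh_indη {Z : HB C} {w : N} (hw : w ∈ C.Hom X Z.a) : indh Z X w * C.indη X = w := by
  rw [indη, indh_ie hw one_pair, Z.one, C.ρ_one, C.one_comp hw, one_mul]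

lemma indh_mem {Z : HB C} {w : N} (hw : w ∈ C.Hom X Z.a) : indh Z X w ∈ HB.Hom (C.ind X) Z := by
  have hZ := fun c => w_comp (Z.mem c) hw c rfl rfl
  have hm : ∀ i c, C.ev' i * C.ρ (C.cj i) (Z.β (i * c) * w) ∈ C.Hom (C.cj i * (X * (i * c))) (c * Z.a) :=
    fun i c => comp_w (C.ev'_mem _) (C.lw (hZ _) _) (c * Z.a) (by simp [mul_assoc]) (by simp)
  refine ⟨Submodule.sum_mem _ fun j _ => ?_, fun c => ?_⟩
  . have := hm (rep j) 1
    rw [mul_one, one_mul] at this; have h2 := (C.ind_isSum X).mem' j; rw [mul_assoc] at h2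
    exact C.comp_mem this h2
  . change Z.β c * indh Z X w = C.ρ c (indh Z X w) * C.indβ X c
    rw [indh, mul_sum, indβ, mul_sum]; refine sum_congr rfl fun j _ => ?_
    rw [<- indh, <- mul_assoc (C.ρ c _), gb, <- mul_assoc (C.ρ c _), <- map_mul,
      indh_ie hw (nest_mem (C.ev'_mem _) c), C.ρ_mul, mul_assoc (C.ev' c), <- map_mul,
      mate_cv' (hm _ c), Z.mul, mul_assoc (C.ρ _ _),
      map_mul _ (C.ρ (rep j) (Z.β c)), <- mul_assoc (C.ev' _), <- C.ρ_mul,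
      nat_to_one (C.ev'_mem _)]
    simp [mul_assoc]

lemma eq_indh {Z : HB C} {h : N} (hh : h ∈ HB.Hom (C.ind X) Z) : h = indh Z X (h * C.indη X) := by
  have hw := C.comp_mem hh.1 (indη_mem X)
  have h1 : ∀ i, h * C.indu X i
      = C.ev' (rep i) * C.ρ (C.cj (rep i)) (Z.β (rep i) * (h * C.indη X)) := by
    intro i; have hm := C.comp_mem hh.1 ((C.ind_isSum X).mem i); have h2 := hh.2 (rep i)
    change Z.β (rep i) * h = C.ρ (rep i) h * C.indβ X (rep i) at h2
    rw [<- mul_assoc, h2, mul_assoc, indη, indβ_ie one_pair, gb]; simp only [one_mul, mul_one]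
    rw [comp_ρ_one (C.ev'_mem _), ie_rep, <- mul_assoc, <- map_mul,
      map_mul, <- C.ρ_mul, <- mul_assoc, nat_to_one (C.ev'_mem _), mul_assoc, C.zig', C.one_eq]
    rw [mul_assoc] at hm; rw [comp_ρ_one hm]
  have h2 := (C.ind_isSum X).expand_right hh.1
  rw [<- h2, indh]; refine sum_congr rfl fun j _ => ?_
  rw [h2, h1]

end Fus

namespace Fus
open LCat
variable {C : Fus N Δ} [C.Split]

namespace HB
variable {X Y Z W : HB C} {s t : N}

lemma one_memHom (X : HB C) : C.one X.a ∈ Hom X X :=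
  ⟨C.one_mem _, fun c => by rw [<- C.one_mul, C.one_comp (X.mem c), C.one_eq, comp_ρ_one (X.mem c)]⟩

lemma comp_memHom (hs : s ∈ Hom Y Z) (ht : t ∈ Hom X Y) : s * t ∈ Hom X Z :=
  ⟨C.comp_mem hs.1 ht.1, fun c => by
    rw [<- mul_assoc, hs.2, mul_assoc, ht.2, <- mul_assoc, map_mul]⟩

lemma tr_nondeg (ht : t ∈ Hom X Y) (h : ∀ s ∈ Hom Y X, C.tr X.a (s * t) = 0) : t = 0 := by
  refine C.tr_nondeg ht.1 fun s hs => ?_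
  have hK : ∀ c, (Sub.top C).Mem c := fun c k _ => mem_univ k
  set Q := ∑ i ∈ (Sub.top C).S, (C.dim (rep i) : ℂ) • P Y X (rep i) s with hQ
  have hQm : Q ∈ Hom Y X :=
    ⟨Submodule.sum_mem _ fun i _ => Submodule.smul_mem _ _ (P_mem hs _), fun c =>
      avg_comm hs (Sub.top C) (hK c)⟩
  have h1 := h Q hQm
  rw [hQ, sum_mul, map_sum] at h1
  simp [map_smul, tr_P_mul hs ht, d_eq, smul_eq_mul, <- mul_assoc] at h1
  rw [<- sum_mul] at h1; refine (mul_eq_zero.1 h1).resolve_left ?_; have := (Sub.top C).gdim_pos.ne'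
  rw [Sub.gdim] at this; simp [<- sq]; exact_mod_cast this

lemma lw_memHom (ht : t ∈ Hom X Y) (W : HB C) : C.ρ W.a t ∈ Hom (W * X) (W * Y) :=
  ⟨C.lw ht.1 _, fun c => by
    simp [mul_β]
    rw [mul_assoc, <- map_mul, ht.2, map_mul, <- mul_assoc, slide, mul_assoc]⟩

lemma rw_memHom (ht : t ∈ Hom X Y) (W : HB C) : t * C.ρ X.a (C.one W.a) ∈ Hom (X * W) (Y * W) :=
  ⟨C.rw ht.1 _, fun c => by
    simp only [mul_β]; have h1 : W.β c * C.one W.a = W.β c := by rw [C.one_eq, comp_ρ_one (W.mem c)]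
    have h2 : C.ρ c (C.one W.a) * W.β c = W.β c := by rw [<- C.one_mul, C.one_comp (W.mem c)]
    rw [mul_assoc, <- mul_assoc (C.ρ _ _) t, <- C.nat ht.1, mul_assoc, <- map_mul, h1, <- mul_assoc,
      ht.2, map_mul, mul_assoc, mul_assoc, reassoc (X.slide c _).symm, <- map_mul, h2]⟩

/-- A direct sum of objects of the centre. -/
lemma exists_isSum {ι : Type*} [Fintype ι] (Y : ι -> HB C) {J : Δ} {s s' : ι -> N}
    (h : C.IsSum J (fun k => (Y k).a) s s') :
    ∃ X : HB C, X.a = J ∧ (∀ k, s k ∈ Hom (Y k) X) ∧ (∀ k, s' k ∈ Hom X (Y k)) := by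
  classical
  have hY : ∀ c k, (Y k).β c * C.one (Y k).a = (Y k).β c := fun c k => by
    rw [C.one_eq, comp_ρ_one ((Y k).mem c)]
  have hβ : ∀ c k, (∑ l, C.ρ c (s l) * (Y l).β c * s' l) * s k = C.ρ c (s k) * (Y k).β c := by
    intro c k; rw [sum_mul, sum_eq_single k]
    . rw [mul_assoc, h.same, mul_assoc, hY]
    . intro l _ hl; rw [mul_assoc, h.diff _ _ hl, mul_zero]
    . simp
  refine ⟨⟨J, fun c => ∑ k, C.ρ c (s k) * (Y k).β c * s' k, fun c => ?_, fun {c e f} hf => ?_,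
    fun c e => ?_, ?_⟩, rfl, fun k => ⟨h.mem k, fun c => hβ c k⟩, fun k => ⟨h.mem' k, fun c => ?_⟩⟩
  . exact Submodule.sum_mem _ fun k _ =>
      w_comp (C.comp_mem (C.lw (h.mem k) c) ((Y k).mem c)) (h.mem' k) c rfl rfl
  . rw [mul_sum, sum_mul]; refine sum_congr rfl fun k _ => ?_
    rw [mul_assoc _ (s' k), C.nat (h.mem' k)]; simp [mul_assoc]
    rw [reassoc (C.nat hf _), reassoc ((Y k).nat hf)]
  . rw [mul_sum]; refine sum_congr rfl fun k _ => ?_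
    rw [<- mul_assoc, <- mul_assoc, <- map_mul, hβ, map_mul, (Y k).mul, C.ρ_mul]; simp [mul_assoc]
  . rw [<- h.sum]; exact sum_congr rfl fun k _ => by rw [C.ρ_one, (Y k).one, C.comp_one (h.mem k)]
  . rw [mul_sum, sum_eq_single k]
    . rw [<- mul_assoc, <- mul_assoc, <- map_mul, h.same, <- C.one_mul, C.one_comp ((Y k).mem c)]
    . intro l _ hl
      rw [<- mul_assoc, <- mul_assoc, <- map_mul, h.diff _ _ hl.symm, map_zero, zero_mul, zero_mul]
    . simp

end HB

/-- The Drinfeld centre. -/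
def Z (C : Fus N Δ) [C.Split] : Fus N (HB C) where
  one X := C.one X.a
  Hom := HB.Hom
  one_mem := HB.one_memHom
  comp_mem := HB.comp_memHom
  comp_one ht := C.comp_one ht.1
  one_comp ht := C.one_comp ht.1
  fin X Y := Submodule.finiteDimensional_of_le fun _ ht => ht.1
  tr X := C.tr X.a
  tr_comm hs ht := C.tr_comm hs.1 ht.1
  tr_nondeg ht h := HB.tr_nondeg ht h
  tr_nilp ht h := C.tr_nilp ht.1 h
  gen := by
    classical
    obtain ⟨S, hS⟩ := C.gen; refine ⟨S.image C.ind, fun X Y s hs h0 => ?_⟩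
    obtain ⟨G, hG, t, ht, hne⟩ := hS X.a Y.a s hs.1 h0
    refine ⟨C.ind G, mem_image_of_mem _ hG, _, indh_mem ht, fun h => hne ?_⟩
    rw [<- indh_indη ht, <- mul_assoc, h, zero_mul]
  ρ X := C.ρ X.a
  ρ_one := C.ρ_one
  ρ_mul X Y := C.ρ_mul X.a Y.a
  one_eq X := C.one_eq X.a
  nat ht := C.nat ht.1
  lw ht W := HB.lw_memHom ht W
  rw ht W := HB.rw_memHom ht W
  unit t ht := C.unit t ht.1
  one_ne := C.one_ne
  tr_unit := C.tr_unit
  sum Y := by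
    obtain ⟨J, s, s', h⟩ := C.sum (fun k => (Y k).a); obtain ⟨X, rfl, h1, h2⟩ := HB.exists_isSum Y h
    exact ⟨X, s, s', h1, h2, h.same, h.diff, h.sum⟩
  rat X := C.rat X.a
  cj := HB.cj
  cv X := C.cv X.a
  ev X := C.ev X.a
  cv' X := C.cv' X.a
  ev' X := C.ev' X.a
  cv_mem := HB.cv_mem
  ev_mem := HB.ev_mem
  cv'_mem := HB.cv'_mem
  ev'_mem := HB.ev'_mem
  zig X := C.zig X.a
  zag X := C.zag X.a
  zig' X := C.zig' X.a
  zag' X := C.zag' X.a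
  tr_left ht := C.tr_left ht.1
  tr_left' ht := C.tr_left' ht.1
  tr_right ht := C.tr_right ht.1
  tr_right' ht := C.tr_right' ht.1

instance : C.Z.Split where
  split := by
    intro X e he hee; obtain ⟨Y, s, s', hs, hs', h1, h2⟩ := LCat.Split.split he.1 hee
    have hes : e * s = s := by rw [<- h2, mul_assoc, h1, C.comp_one hs]
    have hse : s' * e = s' := by rw [<- h2, <- mul_assoc, h1, C.one_comp hs']
    have he2 := fun c => (he.2 c).symm
    have hβs := fun c => w_comp (X.mem c) hs c rfl rfl
    refine ⟨⟨Y, fun c => C.ρ c s' * (X.β c * s), fun c => C.comp_mem (C.lw hs' c) (hβs c),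
      fun {c f g} hg => ?_, fun c f => ?_, ?_⟩, s, s', ⟨hs, fun c => ?_⟩, ⟨hs', fun c => ?_⟩, h1, h2⟩
    . rw [<- mul_assoc, C.nat hg, mul_assoc, <- mul_assoc g, X.nat hg, mul_assoc, <- C.nat hs]
      simp [mul_assoc]
    . rw [X.mul, C.ρ_mul, map_mul, map_mul]; simp [mul_assoc]
      rw [<- mul_assoc (C.ρ c s), <- map_mul, h2, <- mul_assoc (C.ρ c e), he2, mul_assoc, hes]
    . rw [X.one, C.ρ_one, C.one_comp hs, h1]
    . rw [<- mul_assoc, <- map_mul, h2, <- mul_assoc, he2, mul_assoc, hes]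
    . rw [mul_assoc, mul_assoc, h2, <- he2, <- mul_assoc, <- map_mul, hse]

lemma isSum_forget {ι : Type*} [Fintype ι] {X : HB C} {Y : ι -> HB C} {s s' : ι -> N}
    (h : C.Z.IsSum X Y s s') : C.IsSum X.a (fun k => (Y k).a) s s' :=
  ⟨fun k => (h.mem k).1, fun k => (h.mem' k).1, h.same, h.diff, h.sum⟩

lemma add_forget {A : Type*} [AddCommMonoid A] {f : Δ -> A} (hf : C.Additive f) :
    C.Z.Additive (fun X => f X.a) := ⟨fun h => hf.sum (isSum_forget h)⟩

@[simp] lemma dim_Z (X : HB C) : C.Z.dim X = C.dim X.a := by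
  have h : C.Z.d X = C.d X.a := rfl
  rw [d_eq, d_eq] at h; exact_mod_cast h

lemma hd_ind (X : Δ) (Z : HB C) : C.Z.hd (C.ind X) Z = C.hd X Z.a := by
  refine LinearEquiv.finrank_eq ?_
  exact
    { toFun := fun h => ⟨h * C.indη X, C.comp_mem h.2.1 (indη_mem X)⟩
      map_add' := fun s t => by ext; simp [add_mul]
      map_smul' := fun z t => by ext; simp
      invFun := fun w => ⟨indh Z X w, indh_mem w.2⟩
      left_inv := fun h => by ext; exact (eq_indh h.2).symm
      right_inv := fun w => by ext; exact indh_indη w.2 }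

def gd (C : Fus N Δ) [C.Split] : ℕ := (Sub.top C).gdim

lemma sum_dim_hd (X : Δ) : ∑ Z : C.Z.Irr, C.hd X (rep Z).a * C.dim (rep Z).a = C.gd * C.dim X := by
  rw [gd, <- dim_ind, <- dim_Z, (add_dim).eq_sum]; refine sum_congr rfl fun Z _ => ?_
  rw [<- hd_ind, hd_comm, dim_Z]; rfl

lemma gd_Z : C.Z.gd = C.gd ^ 2 := by
  have h1 : ∀ Z : C.Z.Irr, C.Z.dim (rep Z) ^ 2
      = ∑ i : C.Irr, C.dim (rep i) * (C.hd (rep i) (rep Z).a * C.dim (rep Z).a) := by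
    intro Z; rw [dim_Z, sq]; nth_rw 1 [(add_dim).eq_sum (rep Z).a]; rw [sum_mul]
    exact sum_congr rfl fun i _ => by rw [smul_eq_mul]; ring
  have h2 : C.Z.gd = ∑ Z : C.Z.Irr, C.Z.dim (rep Z) ^ 2 := rfl
  have h3 : C.gd = ∑ i : C.Irr, C.dim (rep i) ^ 2 := rfl
  rw [h2, sum_congr rfl fun Z _ => h1 Z, sum_comm]; simp_rw [<- mul_sum, sum_dim_hd, sq]
  nth_rw 3 [h3]; rw [mul_sum]; exact sum_congr rfl fun i _ => by ring

namespace HB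
variable {X Y Z W : HB C} {s t : N}

lemma inv_memHom (ht : t ∈ Hom X Y) (hs : s ∈ C.Hom Y.a X.a) (h1 : s * t = C.one X.a)
    (h2 : t * s = C.one Y.a) : s ∈ Hom Y X := by
  refine ⟨hs, fun c => ?_⟩
  have hX : C.ρ c (C.one X.a) * X.β c = X.β c := by rw [<- C.one_mul, C.one_comp (X.mem c)]
  have hY : Y.β c * C.one Y.a = Y.β c := by rw [C.one_eq, comp_ρ_one (Y.mem c)]
  rw [<- hX, <- h1, map_mul, mul_assoc (C.ρ c s), <- ht.2, mul_assoc, mul_assoc, h2, hY]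

/-- The object `Z` of the centre with its braiding. -/
def up (Z : HB C) : HB C.Z where
  a := Z
  β Y := Z.β Y.a
  mem Y := ⟨Z.mem _, fun c => by
    simp [mul_β]
    rw [mul_assoc, <- Z.mul, Z.nat (Y.mem c), Z.mul, mul_assoc]⟩
  nat hf := Z.nat hf.1
  mul Y Y' := Z.mul _ _
  one := Z.one

lemma β'_memHom (Y Z : HB C) : Y.β' Z.a ∈ Hom (Z * Y) (Y * Z) :=
  inv_memHom (Y.up.mem Z) (Y.β'_mem _) (Y.β'_mul_β _) (Y.β_mul_β' Z.a)

/-- The object `Z` of the centre with its reversed braiding. -/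
def rev (Z : HB C) : HB C.Z where
  a := Z
  β Y := Y.β' Z.a
  mem Y := β'_memHom Y Z
  nat {Y Y' f} hf := by
    have hm : f * Y.β' Z.a ∈ C.Hom (Z.a * Y.a) (Y'.a * Z.a) := comp_w hf.1 (Y.β'_mem _) _ rfl rfl
    refine eq_β' hm ?_
    rw [<- mul_assoc, hf.2, mul_assoc, β_mul_β', C.one_mul, <- map_mul, C.comp_one hf.1]; rfl
  mul Y Y' := by
    have hm :=
      w_comp (lw_eq (Y'.β'_mem Z.a) Y.a rfl (mul_assoc _ _ _)) (Y.β'_mem Z.a) Y'.a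
        (mul_assoc _ _ _).symm (mul_assoc _ _ _).symm
    have h : (Y * Y').β Z.a * (C.ρ Y.a (Y'.β' Z.a) * Y.β' Z.a) = C.one (Z.a * (Y * Y').a) := by
      rw [mul_β, mul_assoc, <- mul_assoc (C.ρ _ _), <- map_mul, β_mul_β', <- mul_assoc, C.one_mul,
        slide, mul_assoc, β_mul_β', mul_a, C.one_mul, C.one_mul, C.one_mul, C.one_eq Y.a, <- map_mul,
        <- map_mul, mul_one]
    change _ = C.ρ Y.a (Y'.β' Z.a) * Y.β' Z.a
    rw [eq_β' hm h]; exact (C.comp_one ((Y * Y').β'_mem Z.a)).symm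
  one := by
    have h := (1 : HB C).β'_mul_β Z.a
    have hm := (1 : HB C).β'_mem Z.a
    simp [one_a, mul_one, one_mul, one_β] at h hm; rwa [C.comp_one hm] at h

@[simp] lemma up_β : Z.up.β Y = Z.β Y.a := rfl
@[simp] lemma rev_β : Z.rev.β Y = Y.β' Z.a := rfl

lemma rev_β' : Z.rev.β' Y = Y.β Z.a := by
  have h := eq_β' (X := Z.rev) (t := Y.β Z.a)
    (Y.up.mem Z) (Y.β'_mul_β _)
  rw [h]; exact (C.Z.comp_one (Z.rev.β'_mem Y)).symm

/-- The monodromy trace of `Y` around `Z`. -/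
def mon (Z Y : HB C) : N := P Z.rev Z.up Y (C.one Z.a)

lemma mon_eq : mon Z Y = C.ltr Y.a (Z.β Y.a * Y.β Z.a) := by
  have h : Z.β Y.a * C.one Z.a = Z.β Y.a := by rw [C.one_eq, comp_ρ_one (Z.mem _)]
  rw [mon, P, enc, rev_β', up_β, h]; rfl

lemma mon_mem : mon Z Y ∈ C.Z.Hom Z Z := 
  P_mem (X := Z.rev) (Y := Z.up) (C.Z.one_mem Z) Y

def smat (Z Y : HB C) : ℂ := C.tr Z.a (mon Z Y)

lemma smat_eq : smat Z Y = C.tr (Y.a * Z.a) (Z.β Y.a * Y.β Z.a) := by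
  rw [smat, mon_eq, tr_ltr (C.comp_mem (Z.mem _) (Y.mem _))]

lemma smat_comm (Z Y : HB C) : smat Z Y = smat Y Z := by
  rw [smat_eq, smat_eq, C.tr_comm (Z.mem _) (Y.mem _)]

/-- The central character of a simple object of the centre. -/
def lam (Z Y : HB C) : ℂ := smat Z Y / C.dim Z.a

lemma mon_eq_lam (hZ : C.Z.Simple Z) : mon Z Y = lam Z Y • C.one Z.a := by
  have h := eq_smul_of_simple hZ mon_mem (t := mon Z Y)
  rwa [dim_Z] at h

lemma smat_eq_lam (hZ : C.Z.Simple Z) : smat Z Y = C.dim Z.a * lam Z Y := by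
  have := dim_pos hZ
  rw [dim_Z] at this; rw [lam, mul_div_cancel₀]; exact_mod_cast this.ne'

lemma lam_comm (hZ : C.Z.Simple Z) (hY : C.Z.Simple Y) :
    C.dim Z.a * lam Z Y = C.dim Y.a * lam Y Z := by
  rw [<- smat_eq_lam hZ, <- smat_eq_lam hY, smat_comm]

lemma add_smat (Z : HB C) : C.Z.Additive (smat Z) := by
  refine ⟨fun {ι} _ X Y s s' h => ?_⟩
  have := (P_sum (X := Z.rev) (Y := Z.up) (C.Z.one_mem Z)).sum h
  unfold smat mon; rw [<- map_sum]; exact congrArg _ this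

lemma isChar_lam (hZ : C.Z.Simple Z) : C.Z.IsChar (lam Z) where
  add := ⟨fun {ι} _ X Y s s' h => by
    unfold lam
    rw [(add_smat Z).sum h, sum_div]⟩
  mul Y Y' := by
    have h1 : mon Z (Y * Y') = lam Z Y • mon Z Y' := by
      rw [mon, P_mul (C.Z.one_mem Z)]; change P _ _ _ (mon Z Y) = _; rw [mon_eq_lam hZ, P_smul]; rfl
    rw [mon_eq_lam hZ, mon_eq_lam hZ, smul_smul] at h1; exact smul_left_injective ℂ hZ.1 h1
  one := by
    have h1 : mon Z 1 = C.one Z.a := P_one (C.Z.one_mem Z)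
    rw [mon_eq_lam hZ] at h1; exact smul_left_injective ℂ hZ.1 (h1.trans (one_smul _ _).symm)

/-- If the character of `Z` is the dimension on `K`, then `Z` centralises `K`. -/
lemma β_eq_β'_of_lam (hZ : C.Z.Simple Z) (K : C.Z.Sub)
    (h : ∀ i ∈ K.S, lam Z (rep i) = C.dim (rep i).a) (hY : K.Mem Y) : Z.β Y.a = Y.β' Z.a := by
  have h1 := avg_comm (X := Z.rev) (Y := Z.up) (C.Z.one_mem Z) K hY
  have h2 : ∑ i ∈ K.S, (C.Z.dim (rep i) : ℂ) • P Z.rev Z.up (rep i) (C.Z.one Z)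
      = (K.gdim : ℂ) • C.one Z.a := by
    rw [Sub.gdim, Nat.cast_sum, Finset.sum_smul]; refine sum_congr rfl fun i hi => ?_
    change _ • mon Z (rep i) = _
    rw [mon_eq_lam hZ, h i hi, smul_smul, dim_Z, sq, Nat.cast_mul]
  rw [h2, up_β, rev_β, mul_smul_comm] at h1
  have h3 : Z.β Y.a * C.one Z.a = Z.β Y.a := by rw [C.one_eq, comp_ρ_one (Z.mem _)]
  have h4 : C.Z.ρ Y ((K.gdim : ℂ) • C.one Z.a) * Y.β' Z.a = (K.gdim : ℂ) • Y.β' Z.a := by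
    change C.ρ Y.a _ * _ = _
    rw [map_smul, smul_mul_assoc, <- C.one_mul, C.one_comp (Y.β'_mem _)]
  rw [h3, h4] at h1; exact smul_right_injective N (by exact_mod_cast K.gdim_pos.ne') h1

end HB

lemma exists_unit_iso (C : Fus N Δ) [C.Split] : ∃ f f', f ∈ C.Hom (rep C.irr1) 1 ∧
    f' ∈ C.Hom 1 (rep C.irr1) ∧ f' * f = C.one (rep C.irr1) ∧ f * f' = 1 := by
  obtain ⟨s, t, hs, ht, h1, h2⟩ := iso_rep_cls C.unit_simple
  exact ⟨t, s, ht, hs, h2, h1.trans C.one_one⟩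

/-- The unit of the induction is a split inclusion of the summand indexed by the unit object. -/
lemma exists_indη_eq (X : Δ) : ∃ G G', G ∈ C.Hom (C.cj (rep C.irr1) * X * rep C.irr1) X ∧
    G * G' = C.one X ∧ C.indη X = C.indu X C.irr1 * G' := by
  obtain ⟨f, f', hf, hf', h1, h2⟩ := C.exists_unit_iso; set i := C.irr1
  have hg := C.comp_mem (C.ev'_mem _) (lw_eq hf' _ (mul_one _).symm rfl)
  have hg' := C.comp_mem (lw_eq hf _ rfl (mul_one _).symm) (C.cv_mem _)
  set g := C.ev' (rep i) * C.ρ (C.cj (rep i)) f' with hgd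
  set g' := C.ρ (C.cj (rep i)) f * C.cv (rep i) with hgd'
  have hev : C.ev' (rep i) * C.ρ (C.cj (rep i)) (C.one (rep i)) = C.ev' (rep i) := by
    rw [<- C.one_mul, C.comp_one (C.ev'_mem _)]
  have hdi : C.d (rep i) = 1 := by
    have := (add_d).iso (iso_rep_cls C.unit_simple)
    exact this.symm.trans d_one
  have hgg : g * g' = 1 := by
    rw [hgd, hgd', mul_assoc, <- mul_assoc (C.ρ _ f'), <- map_mul, h1, <- mul_assoc, hev, ev'_cv, hdi,
      one_smul]
  have hη : C.indη X * (g * C.ρ (C.cj (rep i)) (C.ρ X f)) = C.indu X i := by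
    rw [indη, <- mul_assoc, ie_left (by simpa using hg), one_mul, ie_right hf, hgd, mul_assoc,
      <- map_mul, h1, hev, ie_rep]
  clear_value g g'
  have hGG : g * C.ρ (C.cj (rep i)) (C.ρ X f) * (g' * C.ρ X f') = C.one X := by
    rw [mul_assoc, <- mul_assoc _ g', <- nat_one hg', mul_assoc, <- map_mul, h2, <- mul_assoc, hgg,
      one_mul, C.one_eq]
  refine ⟨g * C.ρ (C.cj (rep i)) (C.ρ X f), g' * C.ρ X f', ?_, hGG, ?_⟩
  . exact comp_w hg (lw_eq (lw_eq hf X rfl (mul_one X).symm) _ (mul_assoc _ _ _) rfl) X rfl (by simp)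
  . rw [<- hη, mul_assoc, hGG, C.comp_one (indη_mem X)]

lemma exists_indη_retraction (X : Δ) : ∃ r, r * C.indη X = C.one X := by
  obtain ⟨G, G', hG, h1, h2⟩ := exists_indη_eq (C := C) X
  exact ⟨G * C.indu' X C.irr1, by
    rw [h2, mul_assoc, <- mul_assoc (C.indu' _ _), (C.ind_isSum X).same, <- mul_assoc, C.comp_one hG,
      h1]⟩

namespace HB
variable {W : HB C}

lemma hd_eq_zero_of_transparent (h : ∀ Y : HB C, W.β Y.a = Y.β' W.a) {i : C.Irr}
    (hi : i ≠ C.irr1) : C.hd (rep i) W.a = 0 := by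
  by_contra hne
  set a := W.a with ha
  obtain ⟨G, G', -, -, hη⟩ := exists_indη_eq (C := C) 1
  have h1 : C.indβ 1 a * (C.indη 1 * C.one a) = C.ρ a (C.indη 1) := by
    have e1 : C.indη 1 * C.one a = (C.ind 1).β' a * C.ρ a (C.indη 1) := by
      rw [<- h, ha, <- W.nat (indη_mem 1), W.one]
    have e2 := (C.ind 1).β_mul_β' a
    rw [e1, <- mul_assoc]; change (C.ind 1).β a * (C.ind 1).β' a * _ = _
    rw [e2, C.one_mul, <- map_mul, C.one_comp (indη_mem 1)]
  have hA : C.ie 1 (C.cj a) a (C.ev' a) ∈ C.Hom (C.cj a * 1 * a) (C.indJ 1) := ie_mem (C.ev'_mem a)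
  rw [mul_one] at hA; have h2 : C.ie 1 (C.cj a) a (C.ev' a) = C.indη 1 * C.ev' a := by
    have e1 := indβ_ie (X := 1) (one_pair (C := C)) a
    rw [gb, comp_ρ_one (C.ev'_mem a), one_mul, mul_one] at e1
    have e2 : C.ie 1 (C.cj a) a (C.ev' a) * C.ρ (C.cj a) (C.one a) = C.ie 1 (C.cj a) a (C.ev' a) := by
      rw [<- C.one_mul, C.comp_one hA]
    rw [<- mul_assoc, indη, e1, mul_assoc, nat_one (C.cv'_mem a), C.ρ_mul, <- mul_assoc, <- map_mul,
      e2] at h1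
    have h3 := comp_mate (C := C) (b := a) (g := C.cv' a) (C.ie 1 (C.cj a) a (C.ev' a))
    rwa [h1, C.zig', C.one_eq, comp_ρ_one hA, <- C.ρ_mul, nat_to_one (C.ev'_mem a)] at h3
  rw [hd_eq_zero] at hne
  push Not at hne
  obtain ⟨s, hs, hs0⟩ := hne; set g := C.ev' a * C.ρ (C.cj a) (s * C.cv' (rep i)) with hg
  have hgm : g ∈ C.Hom (C.cj a) (C.cj (rep i)) := pair_mem (C.ev'_mem a) hs
  have hsm := comp_w hs (C.cv'_mem _) _ rfl rfl
  have h3 : C.indη 1 * (C.ev' a * C.ρ (C.cj a) s) = C.indu 1 i * g := by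
    rw [<- mul_assoc, <- h2, <- ie_rep, ie_left hgm, hg, ev'_pair (C.ev'_mem a) hs]
    have := ie_right (X := 1) (y := C.cj a) (π := C.ev' a) hs
    rwa [C.ρ_one] at this
  have h4 : g * C.ρ (C.cj a) (C.one (rep i)) = 0 := by
    have e := congrArg (fun z => C.indu' 1 i * z) h3
    simp only [hη, <- mul_assoc] at e
    rw [(C.ind_isSum 1).diff _ _ hi, zero_mul, zero_mul, zero_mul, (C.ind_isSum 1).same, mul_one,
      C.one_mul, <- C.nat hgm] at e
    exact e.symm
  have h5 : s * C.cv' (rep i) * C.one (rep i) = 0 := by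
    rw [<- mate_cv' hsm, <- hg, mul_assoc, nat_one (C.cv'_mem a), C.ρ_mul, <- mul_assoc, <- map_mul, h4,
      map_zero, zero_mul]
  apply hs0
  have h6 := congrArg (fun z => C.ρ a (C.ev' (rep i)) * z) h5
  simp only [<- mul_assoc, mul_zero] at h6
  rwa [<- C.nat hs, mul_assoc s, C.zag', C.comp_one hs, C.comp_one hs] at h6

/-- A transparent simple object of the centre is trivial. -/
lemma iso_one_of_transparent (hW : C.Z.Simple W) (h : ∀ Y : HB C, W.β Y.a = Y.β' W.a) :
    C.Z.Iso 1 W := by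
  obtain ⟨i, hi⟩ := exists_hd_ne_zero (X := W.a) hW.1; have hi' : i = C.irr1 := by
    by_contra hne
    exact hi (hd_eq_zero_of_transparent h hne)
  have h1 : C.hd 1 W.a ≠ 0 := by
    rw [(add_hd_right W.a).iso (iso_rep_cls C.unit_simple)]; rwa [hi'] at hi
  rw [Ne, hd_eq_zero] at h1
  push Not at h1
  obtain ⟨t, ht, h0⟩ := h1; refine C.Z.unit_simple.iso_of_ne_zero hW ⟨ht, fun c => ?_⟩ h0
  obtain ⟨r, hr⟩ := exists_indη_retraction (C := C) c
  have hJ : W.β (C.ind c).a * t = C.ρ (C.ind c).a t := by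
    have e := (C.ind c).nat' ht
    rw [h, <- e, one', C.one_eq, <- map_mul, mul_one]
  have h2 : C.indη c * (W.β c * t) = C.indη c * C.ρ c t := by
    rw [<- mul_assoc, W.nat (indη_mem c), mul_assoc, <- nat_one ht, <- mul_assoc, hJ, C.nat (indη_mem c)]
  have h3 : C.one c * (W.β c * t) = C.one c * C.ρ c t := by rw [<- hr, mul_assoc, h2, mul_assoc]
  have hm : W.β c * t ∈ C.Hom c (c * W.a) := w_comp (W.mem c) ht c rfl (by simp)
  have h4 : C.one c * (W.β c * t) = W.β c * t := by rw [C.one_eq, ρ_one_comp hm]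
  rw [one_β, <- h4, h3, C.one_eq, <- map_mul, <- map_mul, mul_one, one_mul]

lemma iso_one_of_lam (hW : C.Z.Simple W) (h : ∀ i : C.Z.Irr, lam W (rep i) = C.dim (rep i).a) :
    C.Z.Iso 1 W :=
  iso_one_of_transparent hW fun _ =>
    β_eq_β'_of_lam hW (Sub.top C.Z) (fun i _ => h i)
      (fun k _ => mem_univ k)

end HB

end Fus

lemma eq_of_sum_eq {ι : Type*} [Fintype ι] (m : ι -> ℕ) (f : ι -> ℂ) (d : ι -> ℕ) {κ : ℂ}
    (h : ∀ k, ‖f k‖ ≤ ‖κ‖ * d k) (hs : ∑ k, m k * f k = κ * ∑ k, (m k * d k : ℂ)) {k : ι}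
    (hk : m k ≠ 0) : f k = κ * d k := by
  by_cases hκ : κ = 0
  . have := h k
    simp [hκ, norm_zero, zero_mul, norm_le_zero_iff] at this; rw [this, hκ, zero_mul]
  have hg : ∀ l, ‖f l / κ‖ ≤ d l := fun l => by
    rw [norm_div, div_le_iff₀ (norm_pos_iff.2 hκ), mul_comm]; exact h l
  have hre := fun l => (Complex.re_le_norm _).trans (hg l)
  have h0 : ∑ l, (m l : ℝ) * (d l - (f l / κ).re) = 0 := by
    have h1 : ∑ l, (m l : ℂ) * (f l / κ) = ∑ l, (m l * d l : ℂ) := by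
      refine mul_left_cancel₀ hκ (Eq.trans ?_ hs)
      rw [mul_sum]; exact sum_congr rfl fun l _ => by field_simp
    have h2 := congrArg Complex.re h1
    simp [Complex.re_sum, <- Complex.ofReal_natCast, Complex.ofReal_re] at h2
    simp [mul_sub, Finset.sum_sub_distrib, h2, sub_self]
  have h1 := (Finset.sum_eq_zero_iff_of_nonneg (fun l _ =>
    mul_nonneg (Nat.cast_nonneg (m l)) (sub_nonneg.2 (hre l)))).1 h0 k (mem_univ k)
  have h2 : (f k / κ).re = d k := by
    rcases mul_eq_zero.1 h1 with h | h
    . exact (hk (by exact_mod_cast h)).elim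
    . linarith
  have h3 : f k / κ = (d k : ℂ) := by
    have h4 := Complex.sq_norm (f k / κ)
    rw [Complex.normSq_apply, h2] at h4; have h5 := hg k
    have h6 : ‖f k / κ‖ ^ 2 ≤ (d k : ℝ) ^ 2 := by gcongr
    apply Complex.ext
    . simpa using h2
    . simp [Complex.natCast_im]; nlinarith
  rw [<- h3]; field_simp

namespace Fus
open LCat
variable {C : Fus N Δ} [C.Split]

lemma Additive.eq_of_eq_mul_dim {f : Δ -> ℂ} (hf : C.Additive f) {κ : ℂ}
    (hb : ∀ i : C.Irr, ‖f (rep i)‖ ≤ ‖κ‖ * C.dim (rep i)) {a : Δ} (ha : f a = κ * C.dim a) {k : C.Irr}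
    (hk : C.hd (rep k) a ≠ 0) : f (rep k) = κ * C.dim (rep k) := by
  refine eq_of_sum_eq (fun i => C.hd (rep i) a) (fun i => f (rep i)) (fun i => C.dim (rep i)) hb ?_ hk
  have h1 := hf.eq_sum a
  have h2 := (add_dim (C := C)).eq_sum a
  simp [nsmul_eq_mul, smul_eq_mul] at h1 h2; rw [<- h1, ha, h2]; push_cast; rfl

/-- The simple objects on which all the characters `χ x` equal the dimension. -/
def ker {ι : Type*} (χ : ι -> Δ -> ℂ) (h : ∀ x, C.IsChar (χ x)) : C.Sub := by
  classical
  have key : ∀ x {a} {k : C.Irr}, χ x a = C.dim a -> C.hd (rep k) a ≠ 0 -> χ x (rep k) = C.dim (rep k) := by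
    intro x a k ha hk
    have := Additive.eq_of_eq_mul_dim (h x).add (κ := 1) (fun i => by simpa using (h x).norm_le (rep i))
      (by simpa using ha) hk
    simpa using this
  exact
  { S := Finset.univ.filter fun i => ∀ x, χ x (rep i) = C.dim (rep i)
    one_mem := by
      simp [mem_filter, mem_univ, true_and]; intro x
      refine key x (by rw [(h x).one, dim_one, Nat.cast_one]) ?_
      rw [hd_comm, hd_one_rep, if_pos rfl]; exact one_ne_zero
    mul_mem := by
      simp [mem_filter, mem_univ, true_and]; intro i j k hi hj hk x
      exact key x (by rw [(h x).mul, hi, hj, dim_mul, Nat.cast_mul]) hk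
    star_mem := by
      simp [mem_filter, mem_univ, true_and]; intro i hi x
      rw [dim_star, <- (h x).add.iso (iso_star i), (h x).cj, hi]
      simp }

lemma mem_ker {ι : Type*} {χ : ι -> Δ -> ℂ} {h : ∀ x, C.IsChar (χ x)} {i : C.Irr} :
    i ∈ (ker χ h).S ↔ ∀ x, χ x (rep i) = C.dim (rep i) := by
  simp [ker]

namespace HB
variable {Z : HB C}

lemma isChar_lam_rep (i : C.Z.Irr) : C.Z.IsChar (lam (rep i)) := isChar_lam (rep_simple i)

lemma lam_rep_comm (i j : C.Z.Irr) :
    C.dim (rep i).a * lam (rep i) (rep j) = C.dim (rep j).a * lam (rep j) (rep i) :=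
  lam_comm (rep_simple i) (rep_simple j)

lemma dim_rep_a_ne_zero (i : C.Z.Irr) : (C.dim (rep i).a : ℂ) ≠ 0 := by
  have := dim_rep_pos i
  rw [dim_Z] at this; exact_mod_cast this.ne'

lemma lam_rep_eq_dim_comm {i j : C.Z.Irr} :
    lam (rep i) (rep j) = C.dim (rep j).a ↔ lam (rep j) (rep i) = C.dim (rep i).a := by
  have h := lam_rep_comm i j
  constructor
  . intro e; rw [e, mul_comm] at h; exact (mul_left_cancel₀ (dim_rep_a_ne_zero j) h).symm
  . intro e; rw [e, mul_comm (C.dim (rep j).a : ℂ)] at h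
    exact mul_left_cancel₀ (dim_rep_a_ne_zero i) h

lemma eq_irr1_of_lam {i : C.Z.Irr}
    (h : ∀ j : C.Z.Irr, lam (rep i) (rep j) = C.dim (rep j).a) : i = C.Z.irr1 :=
  (cls_eq_iff.2 (iso_one_of_lam (rep_simple i) h)).symm

lemma sum_dim_lam {i : C.Z.Irr} (hi : i ≠ C.Z.irr1) :
    ∑ j : C.Z.Irr, C.dim (rep j).a * lam (rep i) (rep j) = 0 := by
  obtain ⟨j, hj⟩ : ∃ j, lam (rep i) (rep j) ≠ C.dim (rep j).a := by
    by_contra hcon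
    push Not at hcon
    exact hi (eq_irr1_of_lam hcon)
  have := Sub.sum_dim_mul_char_eq_zero (K := Sub.top C.Z) (isChar_lam_rep i)
    (fun k _ => mem_univ k) (by rwa [dim_Z])
  simpa [Sub.top] using this

lemma dim_irr1 : C.dim (rep C.irr1) = 1 := by
  rw [<- dim_one (C := C)]; exact ((add_dim).iso (iso_rep_cls C.unit_simple)).symm

lemma lam_unit_left (Y : HB C) : lam (rep C.Z.irr1) Y = C.dim Y.a := by
  have h1 : smat Y 1 = C.dim Y.a := by rw [smat, mon, P_one (C.Z.one_mem Y)]; exact d_eq _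
  have h2 := (add_smat Y).iso (iso_rep_cls C.Z.unit_simple)
  have h3 := dim_irr1 (C := C.Z)
  rw [dim_Z] at h3; rw [lam, h3, Nat.cast_one, div_one, smat_comm, <- h1]; exact h2.symm

lemma sum_dim_lam_ite (i : C.Z.Irr) : ∑ j : C.Z.Irr, C.dim (rep j).a * lam (rep i) (rep j)
      = if i = C.Z.irr1 then (C.gd : ℂ) ^ 2 else 0 := by
  split_ifs with h
  . rw [h]; have h2 : C.Z.gd = ∑ Z : C.Z.Irr, C.Z.dim (rep Z) ^ 2 := rfl; rw [gd_Z] at h2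
    simp [dim_Z] at h2; simp [lam_unit_left, <- sq]; exact_mod_cast h2.symm
  . exact sum_dim_lam h

lemma sum_norm_lam (i : C.Z.Irr) :
    (C.dim (rep i).a : ℂ) ^ 2 * ∑ j : C.Z.Irr, lam (rep i) (rep j) * lam (rep i) (C.Z.cj (rep j))
      = (C.gd : ℂ) ^ 2 := by
  set A : HB C := rep i * C.Z.cj (rep i) with hA
  have h1 : ∀ j : C.Z.Irr, (C.dim (rep i).a : ℂ) ^ 2 *
      (lam (rep i) (rep j) * lam (rep i) (C.Z.cj (rep j)))
      = ∑ u : C.Z.Irr, C.Z.hd (rep u) A * (C.dim (rep u).a *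
        (C.dim (rep j).a * lam (rep u) (rep j))) := by
    intro j; have e1 := lam_rep_comm i j; have e2 : C.dim (rep i).a * lam (rep i) (C.Z.cj (rep j))
        = C.dim (rep j).a * lam (rep j) (C.Z.cj (rep i)) := by
      rw [(isChar_lam_rep i).cj, (isChar_lam_rep j).cj]; simpa using congrArg (starRingEnd ℂ) e1
    calc _ = (C.dim (rep i).a * lam (rep i) (rep j)) *
          (C.dim (rep i).a * lam (rep i) (C.Z.cj (rep j))) := by ring
      _ = C.dim (rep j).a * (C.dim (rep j).a * lam (rep j) A) := by
          rw [e1, e2, hA, (isChar_lam_rep j).mul]; ring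
      _ = _ := by
          rw [(isChar_lam_rep j).add.eq_sum A, mul_sum, mul_sum]; refine sum_congr rfl fun u _ => ?_
          have := lam_rep_comm u j
          rw [nsmul_eq_mul]
          linear_combination (-(C.Z.hd (rep u) A : ℂ) * C.dim (rep j).a) * this
  rw [mul_sum, sum_congr rfl fun j _ => h1 j, sum_comm]; simp only [<- mul_sum, sum_dim_lam_ite]
  rw [sum_eq_single C.Z.irr1]
  . have h2 := dim_irr1 (C := C.Z)
    rw [dim_Z] at h2; have h3 : C.Z.hd (rep C.Z.irr1) A = 1 := by
      have := (add_hd_right A).iso (iso_rep_cls C.Z.unit_simple)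
      rw [hA, hd_one_mul, hd_self_of_simple (simple_cj (rep_simple i))] at this; exact this.symm
    rw [if_pos rfl, h2, h3]; simp
  . intro u _ hu; rw [if_neg hu]; simp
  . simp

lemma dim_rep_dvd_gd (i : C.Z.Irr) : C.dim (rep i).a ∣ C.gd := by
  have h := sum_norm_lam i
  have hd := dim_rep_a_ne_zero i
  have h1 : IsIntegral ℤ (((C.gd ^ 2 / C.dim (rep i).a ^ 2 : ℚ)) : ℂ) := by
    push_cast; rw [<- h, mul_div_cancel_left₀ _ (pow_ne_zero 2 hd)]
    exact IsIntegral.sum _ fun j _ => ((isChar_lam_rep i).isIntegral _).mul ((isChar_lam_rep i).isIntegral _)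
  obtain ⟨m, hm⟩ := exists_int_of_isIntegral h1
  have hd' : (C.dim (rep i).a : ℚ) ≠ 0 := by exact_mod_cast hd
  rw [eq_div_iff (pow_ne_zero 2 hd')] at hm
  have h2 : (C.dim (rep i).a : ℤ) ^ 2 ∣ (C.gd : ℤ) ^ 2 := ⟨m, by rw [mul_comm]; exact_mod_cast hm.symm⟩
  rw [<- Nat.pow_dvd_pow_iff (n := 2) (by norm_num)]; exact_mod_cast h2

end HB

/-- The centralizer of `K`. -/
def centralizer (K : C.Z.Sub) : C.Z.Sub :=
  ker (fun j : K.S => HB.lam (rep j.1)) fun j => HB.isChar_lam_rep j.1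

lemma mem_centralizer {K : C.Z.Sub} {i : C.Z.Irr} :
    i ∈ (centralizer K).S ↔ ∀ j ∈ K.S, HB.lam (rep i) (rep j) = C.dim (rep j).a := by
  rw [centralizer, mem_ker]; simp [Subtype.forall, dim_Z]
  exact forall₂_congr fun j _ => HB.lam_rep_eq_dim_comm

lemma gdim_mul_gdim_centralizer (K : C.Z.Sub) : K.gdim * (centralizer K).gdim = C.gd ^ 2 := by
  have h1 : ∀ i, ∑ j ∈ K.S, C.dim (rep j).a * HB.lam (rep i) (rep j)
      = if i ∈ (centralizer K).S then (K.gdim : ℂ) else 0 := by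
    intro i; split_ifs with hi
    . rw [mem_centralizer] at hi; rw [Sub.gdim, Nat.cast_sum]; refine sum_congr rfl fun j hj => ?_
      rw [hi j hj, dim_Z, sq, Nat.cast_mul]
    . rw [mem_centralizer] at hi
      push Not at hi
      obtain ⟨j, hj, hne⟩ := hi
      have := Sub.sum_dim_mul_char_eq_zero (HB.isChar_lam_rep i) (Sub.mem_rep.2 hj)
        (by rwa [dim_Z])
      simpa using this
  have h2 : ∑ i : C.Z.Irr, (C.dim (rep i).a : ℂ) ^ 2 *
      ∑ j ∈ K.S, C.dim (rep j).a * HB.lam (rep i) (rep j) = K.gdim * (centralizer K).gdim := by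
    simp only [h1, mul_ite, mul_zero]
    rw [<- sum_filter, Finset.filter_mem_eq_inter, Finset.univ_inter]; nth_rw 3 [Sub.gdim]
    simp [Nat.cast_sum, Nat.cast_pow, mul_sum, dim_Z]; exact sum_congr rfl fun i _ => mul_comm _ _
  have h3 : ∑ i : C.Z.Irr, (C.dim (rep i).a : ℂ) ^ 2 *
      ∑ j ∈ K.S, C.dim (rep j).a * HB.lam (rep i) (rep j) = C.gd ^ 2 := by
    have e : ∀ i j : C.Z.Irr, (C.dim (rep i).a : ℂ) ^ 2 * (C.dim (rep j).a * HB.lam (rep i) (rep j))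
        = C.dim (rep j).a ^ 2 * (C.dim (rep i).a * HB.lam (rep j) (rep i)) := fun i j => by
      linear_combination (C.dim (rep i).a * C.dim (rep j).a : ℂ) * HB.lam_rep_comm i j
    simp [mul_sum]; rw [sum_congr rfl fun i _ => sum_congr rfl fun j _ => e i j, sum_comm]
    simp only [<- mul_sum, HB.sum_dim_lam_ite]; rw [Finset.sum_eq_single_of_mem C.Z.irr1 K.one_mem]
    . have h2 := HB.dim_irr1 (C := C.Z)
      rw [dim_Z] at h2; rw [if_pos rfl, h2]; simp
    . intro u _ hu; rw [if_neg hu, mul_zero]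
  exact_mod_cast h2.symm.trans h3

lemma hd_cj_mul_cj (w b : Δ) : C.hd (C.cj w) (b * C.cj b) = C.hd w (b * C.cj b) := by
  rw [<- hd_one_mul, <- mul_assoc, <- hd_mul_right, one_mul, hd_comm, hd_mul_right]

lemma eq_irr1_of_iso {k : C.Irr} (h : C.Iso 1 (rep k)) : k = C.irr1 := (cls_eq_iff.2 h).symm

lemma hd_irr1 (a : Δ) : C.hd (rep C.irr1) a = C.hd 1 a :=
  ((add_hd_right a).iso (iso_rep_cls C.unit_simple)).symm

/-- Constituents of products of constituents. -/
lemma hd_mul_ne_zero {a b : Δ} {i j k : C.Irr} (hi : C.hd (rep i) a ≠ 0) (hj : C.hd (rep j) b ≠ 0)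
    (hk : C.hd (rep k) (rep i * rep j) ≠ 0) : C.hd (rep k) (a * b) ≠ 0 := by
  rw [(add_mul_right (add_hd_left (rep k)) b).eq_sum a]; intro h
  have h1 := (sum_eq_zero_iff.1 h) i (mem_univ i)
  rw [smul_eq_mul, mul_eq_zero, or_iff_right hi,
    (add_mul_left (add_hd_left (rep k)) (rep i)).eq_sum b] at h1
  have h2 := (sum_eq_zero_iff.1 h1) j (mem_univ j)
  rw [smul_eq_mul, mul_eq_zero] at h2; exact h2.elim hj hk

lemma exists_hd_mul_ne_zero {a b : Δ} {k : C.Irr} (hk : C.hd (rep k) (a * b) ≠ 0) :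
    ∃ i j : C.Irr, C.hd (rep i) a ≠ 0 ∧ C.hd (rep j) b ≠ 0 ∧ C.hd (rep k) (rep i * rep j) ≠ 0 := by
  rw [(add_mul_right (add_hd_left (rep k)) b).eq_sum a] at hk
  obtain ⟨i, -, hi⟩ := exists_ne_zero_of_sum_ne_zero hk
  rw [smul_eq_mul, Ne, mul_eq_zero, not_or] at hi; have h2 := hi.2
  rw [(add_mul_left (add_hd_left (rep k)) (rep i)).eq_sum b] at h2
  obtain ⟨j, -, hj⟩ := exists_ne_zero_of_sum_ne_zero h2
  rw [smul_eq_mul, Ne, mul_eq_zero, not_or] at hj; exact ⟨i, j, hi.1, hj.1, hj.2⟩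

lemma unit_iso : C.Iso (rep C.irr1) 1 := (iso_rep_cls C.unit_simple).symm

lemma star_irr1 : star C.irr1 = C.irr1 := by
  have h1 := unit_iso (C := C)
  have h : C.hd 1 (rep C.irr1 * rep C.irr1) = 1 := by
    rw [(add_mul_left (add_hd_left 1) _).iso h1, mul_one,
      (add_hd_left 1).iso h1, hd_self_of_simple C.unit_simple]
  rw [hd_one_rep_mul_rep] at h; by_contra hne; rw [if_neg hne] at h; exact zero_ne_one h

lemma hd_star_mul_star (i j k : C.Irr) :
    C.hd (rep (star k)) (rep (star j) * rep (star i)) = C.hd (rep k) (rep i * rep j) := by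
  rw [<- hd_cj_rep, (add_mul_right (add_hd_left _) _).iso (iso_star j).symm,
    (add_mul_left (add_hd_left _) _).iso (iso_star i).symm, <- hd_one_mul,
    <- mul_assoc, <- hd_mul_right, one_mul, <- hd_mul_right, hd_comm]

namespace HB
variable {Y Z : HB C} {v : N}

lemma one_β' (c : Δ) : (1 : HB C).β' c = C.one c := by
  have h := (1 : HB C).β'_mul_β c
  have hm := (1 : HB C).β'_mem c
  simp [one_a, mul_one, one_mul, one_β] at h hm; rwa [C.comp_one hm] at h

lemma P_one_left (hv : v ∈ C.Hom 1 Z.a) (c : Δ) : P 1 Z c v = C.ltr c (Z.β c * v) := by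
  have hm := w_comp (Z.mem c) hv c rfl rfl
  rw [one_mul] at hm; rw [P, enc, one_β', C.comp_one hm]

lemma P_forget (hZ : C.Z.Simple Z) (hv : v ∈ C.Hom 1 Z.a) (Y : HB C) :
    P 1 Z Y.a v = lam Z Y • v := by
  have h1 : mon Z Y * v = lam Z Y • v := by rw [mon_eq_lam hZ, smul_mul_assoc, C.one_comp hv]
  have hm := w_comp (Z.mem Y.a) hv Y.a rfl rfl
  rw [one_mul] at hm
  rw [<- h1, mon_eq, <- ltr_mul_right, P_one_left hv, mul_assoc, <- Y.nat hv, Y.one, <- mul_assoc,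
    C.comp_one hm]

lemma exists_functional (h : v ≠ 0) : ∃ ξ : N →ₗ[ℂ] ℂ, ξ v ≠ 0 := by
  by_contra hcon
  push Not at hcon
  exact h ((Module.forall_dual_apply_eq_zero_iff ℂ v).1 hcon)

/-- If the action of `b * b̄` on a nonzero vector of `Hom(1, Z)` is extremal, then `b * b̄` is
a multiple of the unit object, provided that `C` has no proper fusion subcategories. -/
lemma eq_irr1_of_P_eq (hC : ∀ K : C.Sub, (∀ k ∈ K.S, k = C.irr1) ∨ ∀ k, k ∈ K.S)
    (hZ : C.Z.Simple Z) (hZ1 : ¬ C.Z.Iso 1 Z) (hv : v ∈ C.Hom 1 Z.a) (h0 : v ≠ 0)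
    {b : Δ} (hb : P 1 Z (b * C.cj b) v = ((C.dim b : ℂ) ^ 2) • v) {k : C.Irr}
    (hk : C.hd (rep k) (b * C.cj b) ≠ 0) : k = C.irr1 := by
  classical
  obtain ⟨ξ, hξ⟩ := exists_functional h0; set f : Δ -> ℂ := fun c => ξ (P 1 Z c v) with hf
  have hfa : C.Additive f := ⟨fun h => by
    simp only [hf]
    rw [(P_sum (X := 1) (Y := Z) hv).sum h, map_sum]⟩
  have hf1 : f 1 = ξ v := by simp only [hf]; rw [P_one (X := 1) (Y := Z) hv]
  have hd0 : ∀ k : C.Irr, (0 : ℝ) < C.dim (rep k) := fun k => by exact_mod_cast dim_rep_pos k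
  obtain ⟨m, -, hm⟩ := Finset.exists_max_image (Finset.univ : Finset C.Irr)
    (fun k => ‖f (rep k)‖ / C.dim (rep k)) ⟨C.irr1, mem_univ _⟩
  set κ := f (rep m) / C.dim (rep m) with hκ
  have hbd : ∀ k : C.Irr, ‖f (rep k)‖ ≤ ‖κ‖ * C.dim (rep k) := fun k => by
    have := hm k (mem_univ k)
    rw [div_le_iff₀ (hd0 k)] at this; rwa [hκ, norm_div, Complex.norm_natCast]
  have hmS : f (rep m) = κ * C.dim (rep m) := by
    rw [hκ, div_mul_cancel₀]; exact_mod_cast (dim_rep_pos m).ne'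
  have hu1 : f (rep C.irr1) = f 1 := (hfa.iso (iso_rep_cls C.unit_simple)).symm
  have hκ0 : κ ≠ 0 := by
    intro h; have := hbd C.irr1; rw [h, norm_zero, zero_mul, norm_le_zero_iff, hu1, hf1] at this
    exact hξ this
  -- the objects on which `f` is extremal
  have ext : ∀ {a : Δ}, f a = κ * C.dim a ↔ ∀ k : C.Irr, C.hd (rep k) a ≠ 0 -> f (rep k) = κ * C.dim (rep k) := by
    intro a; refine ⟨fun h k hk => Additive.eq_of_eq_mul_dim hfa hbd h hk, fun h => ?_⟩
    rw [hfa.eq_sum a, (add_dim (C := C)).eq_sum a]; push_cast; rw [mul_sum]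
    refine sum_congr rfl fun k _ => ?_
    by_cases hk : C.hd (rep k) a = 0
    . simp [hk]
    . rw [h k hk, nsmul_eq_mul, smul_eq_mul]; push_cast; ring
  let good : C.Irr -> Prop := fun w => ∀ u : C.Irr, f (rep u) = κ * C.dim (rep u) ->
    f (rep w * rep u) = κ * C.dim (rep w * rep u)
  have good_mul : ∀ {i j k}, good i -> good j -> C.hd (rep k) (rep i * rep j) ≠ 0 -> good k := by
    intro i j k hi hj hk u hu; rw [ext]; intro l hl
    have h1 : C.hd (rep l) (rep i * (rep j * rep u)) ≠ 0 := by
      rw [<- mul_assoc]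
      exact hd_mul_ne_zero hk (j := u) (by rw [hd_self_of_simple (rep_simple u)]; exact one_ne_zero) hl
    obtain ⟨i', w, hi', hw, hl'⟩ := exists_hd_mul_ne_zero h1; have hw' := ext.1 (hj u hu) w hw
    have hii : i' = i := by
      by_contra hne
      rw [hd_rep_rep, if_neg hne] at hi'; exact hi' rfl
    subst hii; exact ext.1 (hi w hw') l hl'
  have good_one : good C.irr1 := fun u hu => by
    have h1 := unit_iso (C := C)
    rw [(add_mul_right hfa (rep u)).iso h1, (add_mul_right (add_dim (C := C)) (rep u)).iso h1,
      one_mul, hu]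
  let K : C.Sub :=
    { S := Finset.univ.filter fun w => good w ∧ good (star w)
      one_mem := by
        simp only [mem_filter, mem_univ, true_and, star_irr1]; exact ⟨good_one, good_one⟩
      mul_mem := by
        simp only [mem_filter, mem_univ, true_and]; intro i j k hi hj hk
        exact ⟨good_mul hi.1 hj.1 hk, good_mul hj.2 hi.2 (by rwa [hd_star_mul_star])⟩
      star_mem := by
        simp only [mem_filter, mem_univ, true_and, star_star]
        exact fun h => ⟨h.2, h.1⟩ }
  have hgood : ∀ {w}, C.hd (rep w) (b * C.cj b) ≠ 0 -> good w := by
    intro w hw u hu; rw [ext]; intro l hl; have h1 :=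
      hd_mul_ne_zero hw (j := u) (by rw [hd_self_of_simple (rep_simple u)]; exact one_ne_zero) hl
    refine ext.1 ?_ l h1
    simp only [hf]; rw [P_mul (X := 1) (Y := Z) hv, hb, P_smul, map_smul]; change _ • f (rep u) = _
    rw [hu, dim_mul, dim_mul, dim_cj, smul_eq_mul]; push_cast; ring
  rcases hC K with hK | hK
  . refine hK k (mem_filter.2 ⟨mem_univ _, hgood hk, hgood ?_⟩)
    rwa [<- hd_cj_rep, hd_cj_mul_cj]
  . exfalso
    have hall : ∀ w, good w := fun w => (mem_filter.1 (hK w)).2.1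
    have hfu : f (rep C.irr1) = κ * C.dim (rep C.irr1) := by
      refine ext.1 (hall (star m) m hmS) _ ?_
      rw [hd_irr1, hd_one_rep_mul_rep, if_pos (star_star m)]; exact one_ne_zero
    have hfall := fun w => by
      refine ext.1 (hall w _ hfu) w ?_
      rw [(add_mul_left (add_hd_left (rep w)) (rep w)).iso unit_iso, mul_one, hd_self_of_simple (rep_simple w)]
      exact one_ne_zero
    have hff : ∀ a, f a = κ * C.dim a := fun a => ext.2 fun k _ => hfall k
    refine hZ1 (iso_one_of_lam hZ fun i => ?_)
    have h1 := hff (rep i).a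
    have h2 := hff 1
    simp only [hf] at h1 h2; rw [P_forget hZ hv, map_smul, smul_eq_mul] at h1
    rw [P_one (X := 1) (Y := Z) hv, dim_one, Nat.cast_one, mul_one] at h2; rw [h2, mul_comm] at h1
    exact mul_left_cancel₀ hκ0 h1

lemma dim_of_constituents_unit {b : Δ} (h : ∀ k : C.Irr, C.hd (rep k) b ≠ 0 -> k = C.irr1) :
    C.dim b = C.hd 1 b := by
  rw [(add_dim).eq_sum b, sum_eq_single C.irr1]
  . rw [dim_irr1, smul_eq_mul, mul_one, hd_irr1]
  . intro k _ hk; have : C.hd (rep k) b = 0 := by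
      by_contra h0
      exact hk (h k h0)
    rw [this, zero_smul]
  . simp

lemma hd_rep_self (k : C.Irr) : C.hd (rep k) (rep k) ≠ 0 := by
  rw [hd_self_of_simple (rep_simple k)]; exact one_ne_zero

/-- If `b * b̄` is a multiple of the unit, then `b` is a multiple of an invertible object. -/
lemma dim_eq_one_of_constituents {b : Δ}
    (h : ∀ k : C.Irr, C.hd (rep k) (b * C.cj b) ≠ 0 -> k = C.irr1) {i j : C.Irr}
    (hi : C.hd (rep i) b ≠ 0) (hj : C.hd (rep j) b ≠ 0) : C.dim (rep i) = 1 ∧ i = j := by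
  have key : ∀ {i j : C.Irr}, C.hd (rep i) b ≠ 0 -> C.hd (rep j) b ≠ 0 ->
      C.dim (rep i) * C.dim (rep j) = C.hd (rep i) (rep j) := by
    intro i j hi hj; have hj' : C.hd (rep (star j)) (C.cj b) ≠ 0 := by
      rwa [<- hd_cj_rep, <- hd_one_mul, hd_mul_right b 1 (rep j) |>.symm, one_mul, hd_comm]
    have h1 := dim_of_constituents_unit fun k hk => h k (hd_mul_ne_zero hi hj' hk)
    rw [dim_mul, dim_star] at h1
    rw [h1, (add_mul_left (add_hd_left _) _).iso (iso_star j).symm,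
      <- hd_mul_right, one_mul, hd_comm]
  have h1 := key hi hi
  rw [hd_self_of_simple (rep_simple i)] at h1; refine ⟨Nat.eq_one_of_mul_eq_one_right h1, ?_⟩
  by_contra hne
  have h2 := key hi hj
  rw [hd_rep_rep, if_neg hne] at h2; have := Nat.mul_pos (dim_rep_pos i) (dim_rep_pos j); omega

lemma lam_unit_right (i : C.Z.Irr) : lam (rep i) (rep C.Z.irr1) = 1 := by
  rw [(isChar_lam_rep i).add.iso unit_iso, (isChar_lam_rep i).one]

lemma exists_not_dvd_dim {q : ℕ} (hq : q.Prime) {i : C.Z.Irr} {S : Finset C.Z.Irr}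
    (h : ∑ j ∈ S, C.dim (rep j).a * lam (rep i) (rep j) = -1) :
    ∃ j ∈ S, ¬ q ∣ C.dim (rep j).a ∧ lam (rep i) (rep j) ≠ 0 := by
  by_contra hcon
  push Not at hcon
  have h2 : ∀ x ∈ S, IsIntegral ℤ ((C.dim (rep x).a * lam (rep i) (rep x)) / q) := by
    intro x hx; by_cases hqx : q ∣ C.dim (rep x).a
    . obtain ⟨m, hm⟩ := hqx; have hq0 : q ≠ 0 := by exact_mod_cast hq.ne_zero
      have : (C.dim (rep x).a * lam (rep i) (rep x)) / q = m * lam (rep i) (rep x) := by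
        rw [hm]; push_cast; field_simp
      rw [this]; exact (isIntegral_algebraMap).mul ((isChar_lam_rep i).isIntegral _)
    . rw [hcon x hx hqx]; simp [isIntegral_zero]
  have h3 : IsIntegral ℤ (((-1 / q : ℚ)) : ℂ) := by
    have : (((-1 / q : ℚ)) : ℂ) = ∑ x ∈ S, (C.dim (rep x).a * lam (rep i) (rep x)) / q := by
      rw [<- sum_div, h]; push_cast; rfl
    rw [this]; exact IsIntegral.sum _ fun x hx => h2 x hx
  obtain ⟨m, hm⟩ := exists_int_of_isIntegral h3; rw [eq_div_iff (by exact_mod_cast hq.ne_zero)] at hm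
  have h4 : m * (q : ℤ) = -1 := by exact_mod_cast hm
  have h5 : (q : ℤ) ∣ 1 := ⟨-m, by linarith⟩
  exact hq.one_lt.ne' (by exact_mod_cast Int.eq_one_of_dvd_one (by positivity) h5)

lemma norm_lam_eq {q k : ℕ} (hq : q.Prime) {i j : C.Z.Irr} (hk : C.dim (rep i).a = q ^ k)
    (hqj : ¬ q ∣ C.dim (rep j).a) (hl : lam (rep i) (rep j) ≠ 0) :
    ‖lam (rep i) (rep j)‖ = C.dim (rep j).a := by
  have hc2 : IsCoprime (C.dim (rep i).a : ℤ) (C.dim (rep j).a : ℤ) := by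
    rw [Nat.isCoprime_iff_coprime, hk]; exact Nat.Coprime.pow_left _ ((hq.coprime_iff_not_dvd).2 hqj)
  obtain ⟨u, w, huw⟩ := hc2; have hdj := dim_rep_a_ne_zero j
  have hin : IsIntegral ℤ (lam (rep i) (rep j) / C.Z.dim (rep j)) := by
    have : lam (rep i) (rep j) / C.Z.dim (rep j)
        = u * lam (rep j) (rep i) + w * lam (rep i) (rep j) := by
      rw [dim_Z, div_eq_iff hdj]; have h1 := lam_rep_comm i j
      have h2 : (u : ℂ) * C.dim (rep i).a + w * C.dim (rep j).a = 1 := by exact_mod_cast huw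
      linear_combination (-lam (rep i) (rep j)) * h2 + u * h1
    rw [this]; exact ((isIntegral_algebraMap).mul ((isChar_lam_rep j).isIntegral _)).add
      ((isIntegral_algebraMap).mul ((isChar_lam_rep i).isIntegral _))
  have := (isChar_lam_rep i).eq_zero_or_norm_eq
    (by rw [dim_Z]; exact_mod_cast hdj) hin
  rw [dim_Z] at this; exact this.resolve_left hl

lemma dim_rep_eq_pow {p q a b : ℕ} (hp : p.Prime) (hq : q.Prime) (hn : C.gd = p ^ a * q ^ b)
    {i : C.Z.Irr} (hpi : ¬ p ∣ C.dim (rep i).a) : ∃ k, C.dim (rep i).a = q ^ k := by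
  have hcop := (hp.coprime_iff_not_dvd).2 hpi
  obtain ⟨k, -, hk⟩ : ∃ k ≤ b, C.dim (rep i).a = q ^ k := by
    rw [<- Nat.dvd_prime_pow hq]
    refine Nat.Coprime.dvd_of_dvd_mul_left (Nat.Coprime.pow_right a hcop.symm) ?_
    rw [<- hn]; exact dim_rep_dvd_gd i
  exact ⟨k, hk⟩

lemma exists_simple_lam_isIntegral {p q a b : ℕ} (hp : p.Prime) (hq : q.Prime)
    (hn : C.gd = p ^ a * q ^ b) (hpn : p ∣ C.gd) :
    ∃ i j : C.Z.Irr, i ≠ C.Z.irr1 ∧ j ≠ C.Z.irr1 ∧ C.hd 1 (rep i).a ≠ 0 ∧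
      ‖lam (rep i) (rep j)‖ = C.dim (rep j).a := by
  have hdu : C.dim (rep C.Z.irr1).a = 1 := by
    have := dim_irr1 (C := C.Z)
    rwa [dim_Z] at this
  obtain ⟨i, hi, hpi⟩ : ∃ i, i ≠ C.Z.irr1 ∧ ¬ p ∣ C.hd 1 (rep i).a * C.dim (rep i).a := by
    by_contra hcon
    push Not at hcon
    have h1 := sum_dim_hd (C := C) 1
    rw [dim_one, mul_one, <- add_sum_erase _ _ (mem_univ C.Z.irr1), hdu] at h1
    have h2 : p ∣ ∑ x ∈ Finset.univ.erase C.Z.irr1, C.hd 1 (rep x).a * C.dim (rep x).a :=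
      dvd_sum fun x hx => hcon x (Finset.ne_of_mem_erase hx)
    have h3 : C.hd 1 (rep C.Z.irr1).a = 1 := by
      have := (add_forget (add_hd_left 1)).iso (unit_iso (C := C.Z))
      rw [this]; exact hd_self_of_simple C.unit_simple
    rw [h3] at h1; rw [<- h1] at hpn
    exact hp.one_lt.ne' (Nat.dvd_one.1 ((Nat.dvd_add_left h2).1 hpn))
  obtain ⟨k, hk⟩ := dim_rep_eq_pow hp hq hn fun h => hpi (h.mul_left _)
  obtain ⟨j, hj, hqj, hl⟩ := exists_not_dvd_dim hq (by
    have h1 := sum_dim_lam hi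
    rw [<- add_sum_erase _ _ (mem_univ C.Z.irr1), lam_unit_right, hdu] at h1
    linear_combination h1)
  exact ⟨i, j, hi, Finset.ne_of_mem_erase hj, fun h => hpi (by rw [h, zero_mul]; exact dvd_zero _),
    norm_lam_eq hq hk hqj hl⟩

lemma P_mul_cj_of_unit {v : N} (hv : v ∈ C.Hom 1 Y.a)
    (h : ∀ k : C.Irr, C.hd (rep k) Y.a ≠ 0 -> k = C.irr1) {c : Δ} (hc : C.Simple c) :
    P 1 Y (c * C.cj c) v = ((C.dim c : ℂ) ^ 2) • v := by
  have hd0 : ∀ {c : Δ}, C.Simple c -> C.d c ≠ 0 := fun hc => by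
    rw [d_eq]; exact_mod_cast (dim_pos hc).ne'
  have key : ∀ {c : Δ}, C.Simple c -> ∀ v ∈ C.Hom 1 Y.a, ∃ w ∈ C.Hom 1 Y.a, Y.β c * v = C.ρ c w := by
    intro c hc v hv; let L : C.Hom 1 Y.a →ₗ[ℂ] C.Hom c (c * Y.a) :=
      { toFun := fun w => ⟨C.ρ c w, lw_eq w.2 c (mul_one c).symm rfl⟩
        map_add' := fun s t => by ext; simp
        map_smul' := fun z t => by ext; simp }
    have hinj : Function.Injective L := by
      rw [injective_iff_map_eq_zero]; intro w hw; have h1 : C.ρ c w = 0 := congrArg Subtype.val hw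
      have h2 := ltr_one_mul (C := C) c w
      rw [h1, ltr, map_zero, mul_zero, zero_mul] at h2; ext
      exact (smul_eq_zero.1 h2.symm).resolve_left (hd0 hc)
    have hrk : C.hd 1 Y.a = C.hd c (c * Y.a) := by
      rw [(add_mul_left (add_hd_left c) c).eq_sum Y.a, sum_eq_single C.irr1]
      . rw [(add_mul_left (add_hd_left (C := C.toLCat) c) c).iso unit_iso, mul_one,
          hd_self_of_simple hc, hd_irr1, smul_eq_mul, mul_one]
      . intro k _ hk; have : C.hd (rep k) Y.a = 0 := by
          by_contra h0
          exact hk (h k h0)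
        rw [this, zero_smul]
      . simp
    have hsurj := (LinearMap.injective_iff_surjective_of_finrank_eq_finrank hrk).1 hinj
    obtain ⟨w, hw⟩ := hsurj ⟨Y.β c * v, w_comp (Y.mem c) hv c rfl (by simp)⟩
    exact ⟨w, w.2, (congrArg Subtype.val hw).symm⟩
  obtain ⟨w, hw, e1⟩ := key hc v hv; obtain ⟨w', hw', e2⟩ := key (simple_cj hc) w hw
  have e3 : w' = v := by
    have h1 : C.cv' c * v = C.cv' c * w' := by
      calc C.cv' c * v = C.cv' c * Y.β 1 * v := by rw [Y.one, mul_assoc, C.one_comp hv]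
        _ = Y.β (c * C.cj c) * v * C.cv' c := by
          rw [Y.nat (C.cv'_mem c), mul_assoc, <- nat_one hv, mul_assoc]
        _ = C.cv' c * w' := by
          rw [Y.mul, mul_assoc _ _ v, e1, <- map_mul, e2, <- C.ρ_mul, <- nat_one (C.cv'_mem c)]
    have h2 := congrArg (fun z => C.ev c * z) h1
    simp [<- mul_assoc, ev_cv', one_mul] at h2
    exact (smul_right_injective N (hd0 hc) h2).symm
  have e4 : P 1 Y c v = C.d c • w := by rw [P_one_left hv, e1, ltr_one_mul]
  have e5 : P 1 Y (C.cj c) w = C.d c • v := by rw [P_one_left hw, e2, ltr_one_mul, d_cj, e3]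
  rw [P_mul hv, e4, P_smul, e5, smul_smul, d_eq, sq]

/-- A fusion category without proper fusion subcategories whose dimension has at most two prime
factors has a nontrivial invertible object. -/
lemma exists_dim_eq_one (hC : ∀ K : C.Sub, (∀ k ∈ K.S, k = C.irr1) ∨ ∀ k, k ∈ K.S)
    {p q a b : ℕ} (hp : p.Prime) (hq : q.Prime) (hn : C.gd = p ^ a * q ^ b) (h1 : C.gd ≠ 1) :
    ∃ k : C.Irr, k ≠ C.irr1 ∧ C.dim (rep k) = 1 := by
  obtain ⟨i, j, hi, hj, hv, hl⟩ : ∃ i j, i ≠ C.Z.irr1 ∧ j ≠ C.Z.irr1 ∧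
      C.hd 1 (rep i).a ≠ 0 ∧ ‖lam (rep i) (rep j)‖ = C.dim (rep j).a := by
    by_cases hpn : p ∣ C.gd
    . exact exists_simple_lam_isIntegral hp hq hn hpn
    . refine exists_simple_lam_isIntegral hq hp (hn.trans (mul_comm _ _)) ?_
      have ha : a = 0 := by
        by_contra ha
        exact hpn (hn ▸ (dvd_pow_self p ha).mul_right _)
      have hb : b ≠ 0 := by rintro rfl; exact h1 (by rw [hn, ha]; simp)
      exact hn ▸ (dvd_pow_self q hb).mul_left _
  have hZ1 : ∀ {i : C.Z.Irr}, i ≠ C.Z.irr1 -> ¬ C.Z.Iso 1 (rep i) :=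
    fun hi h => hi (eq_irr1_of_iso h)
  have hne : ∀ {a : Δ}, C.hd 1 a ≠ 0 -> ∃ v ∈ C.Hom 1 a, v ≠ 0 := fun h => by
    rw [Ne, hd_eq_zero] at h
    push Not at h
    exact h
  obtain ⟨v, hv, hv0⟩ := hne hv
  have hb1 : P 1 (rep i) ((rep j).a * C.cj (rep j).a) v = ((C.dim (rep j).a : ℂ) ^ 2) • v := by
    have h2 := P_forget (rep_simple i) hv (rep j * C.Z.cj (rep j))
    rw [(isChar_lam_rep i).mul, (isChar_lam_rep i).cj, Complex.mul_conj, Complex.normSq_eq_norm_sq,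
      hl] at h2
    push_cast at h2; exact h2
  have hb2 := fun k => eq_irr1_of_P_eq (k := k) hC (rep_simple i) (hZ1 hi) hv hv0 hb1
  obtain ⟨x, hx⟩ := exists_hd_ne_zero (C := C.toLCat) (rep_simple j).1; by_cases hxu : x = C.irr1
  . have hall : ∀ k, C.hd (rep k) (rep j).a ≠ 0 -> k = C.irr1 := fun k hk =>
      (dim_eq_one_of_constituents hb2 hk hx).2.trans hxu
    rw [hxu, hd_irr1] at hx; obtain ⟨w, hw, hw0⟩ := hne hx; have hdim := fun c =>
      (dim_eq_one_of_constituents (fun k => eq_irr1_of_P_eq hC (rep_simple j) (hZ1 hj) hw hw0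
        (P_mul_cj_of_unit hw hall (rep_simple c))) (hd_rep_self c) (hd_rep_self c)).1
    obtain ⟨c, hc⟩ : ∃ c : C.Irr, c ≠ C.irr1 := by
      by_contra hcon
      push Not at hcon
      apply h1
      have h3 : C.gd = ∑ i : C.Irr, C.dim (rep i) ^ 2 := rfl
      rw [h3, sum_eq_single C.irr1 (fun k _ hk => (hk (hcon k)).elim) (by simp), dim_irr1,
        one_pow]
    exact ⟨c, hc, hdim c⟩
  . exact ⟨x, hxu, (dim_eq_one_of_constituents hb2 hx hx).1⟩

end HB

namespace Sub
variable (K : C.Sub)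

/-- The objects with all constituents in `K`. -/
def obj : Submonoid Δ where
  carrier := {a | K.Mem a}
  mul_mem' ha hb := ha.mul hb
  one_mem' := Mem.one

variable {K}

lemma Mem.of_isSum {ι : Type*} [Fintype ι] {X : Δ} {Y : ι -> Δ} {s s' : ι -> N}
    (h : C.IsSum X Y s s') (hY : ∀ k, K.Mem (Y k)) : K.Mem X := by
  intro k hk; rw [h.hd_left] at hk; obtain ⟨j, -, hj⟩ := exists_ne_zero_of_sum_ne_zero hk
  exact hY j k hj

lemma Mem.of_mono {X Y : Δ} (hX : K.Mem X) {s s' : N} (hs : s ∈ C.Hom Y X) (h : s' * s = C.one Y) :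
    K.Mem Y := by
  intro k hk; refine hX k fun h0 => hk ?_
  rw [hd_eq_zero] at h0 ⊢; intro t ht; have := h0 _ (C.comp_mem hs ht)
  rw [<- C.one_comp ht, <- h, mul_assoc, this, mul_zero]

variable (K)

/-- The fusion subcategory with simple objects `K`. -/
def restrict : Fus N K.obj where
  one X := C.one X.1
  Hom X Y := C.Hom X.1 Y.1
  one_mem X := C.one_mem X.1
  comp_mem := C.comp_mem
  comp_one := C.comp_one
  one_comp := C.one_comp
  fin X Y := C.fin X.1 Y.1
  tr X := C.tr X.1
  tr_comm := C.tr_comm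
  tr_nondeg := C.tr_nondeg
  tr_nilp := C.tr_nilp
  gen := by
    classical
    refine ⟨Finset.univ.image fun k : K.S => ⟨rep k.1, mem_rep.2 k.2⟩, fun X Y s hs h0 => ?_⟩
    obtain ⟨n, l, t, t', h⟩ := C.exists_dec X.1; obtain ⟨k, hk⟩ : ∃ k, s * t k ≠ 0 := by
      by_contra hcon
      push Not at hcon
      apply h0
      rw [<- h.expand_right hs]; exact sum_eq_zero fun k _ => by rw [hcon, zero_mul]
    have hl := X.2 _ fun h1 => hk (by rw [hd_eq_zero.1 h1 _ (h.mem k), mul_zero])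
    exact ⟨_, mem_image_of_mem _ (mem_univ ⟨l k, hl⟩), t k, h.mem k, hk⟩
  ρ X := C.ρ X.1
  ρ_one := C.ρ_one
  ρ_mul X Y := C.ρ_mul X.1 Y.1
  one_eq X := C.one_eq X.1
  nat ht := C.nat ht
  lw ht W := C.lw ht W.1
  rw ht W := C.rw ht W.1
  unit := C.unit
  one_ne := C.one_ne
  tr_unit := C.tr_unit
  sum Y := by
    obtain ⟨J, s, s', h⟩ := C.sum (fun k => (Y k).1)
    exact ⟨⟨J, Mem.of_isSum h fun k => (Y k).2⟩, s, s', h.mem, h.mem', h.same, h.diff, h.sum⟩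
  rat X := C.rat X.1
  cj X := ⟨C.cj X.1, Mem.cj X.2⟩
  cv X := C.cv X.1
  ev X := C.ev X.1
  cv' X := C.cv' X.1
  ev' X := C.ev' X.1
  cv_mem X := C.cv_mem X.1
  ev_mem X := C.ev_mem X.1
  cv'_mem X := C.cv'_mem X.1
  ev'_mem X := C.ev'_mem X.1
  zig X := C.zig X.1
  zag X := C.zag X.1
  zig' X := C.zig' X.1
  zag' X := C.zag' X.1
  tr_left ht := C.tr_left ht
  tr_left' ht := C.tr_left' ht
  tr_right ht := C.tr_right ht
  tr_right' ht := C.tr_right' ht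

instance : K.restrict.Split where
  split := by
    intro X e he hee; obtain ⟨Y, s, s', hs, hs', h1, h2⟩ := LCat.Split.split (C := C.toLCat) he hee
    exact ⟨⟨Y, Mem.of_mono X.2 hs h1⟩, s, s', hs, hs', h1, h2⟩

@[simp] lemma dim_restrict (X : K.obj) : K.restrict.dim X = C.dim X.1 := by
  have h : K.restrict.d X = C.d X.1 := rfl
  rw [d_eq, d_eq] at h; exact_mod_cast h

/-- The simple object of `C` underlying a simple object of the subcategory. -/
def incl (i : K.restrict.Irr) : C.Irr := cls (rep i).1 (rep_simple i)

variable {K}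

lemma iso_incl (i : K.restrict.Irr) : C.Iso (rep i).1 (rep (K.incl i)) := iso_rep_cls _

lemma incl_mem (i : K.restrict.Irr) : K.incl i ∈ K.S := by
  refine (rep i).2 _ ?_
  rw [(add_hd_left _).iso (iso_incl i)]; exact HB.hd_rep_self _

lemma incl_injective : Function.Injective K.incl := by
  intro i j h; have h1 := (iso_incl i).trans (h ▸ (iso_incl j).symm); exact (iso_rep_iff).1 h1

lemma exists_incl {k : C.Irr} (hk : k ∈ K.S) : ∃ i, K.incl i = k := by
  have hs : K.restrict.Simple ⟨rep k, mem_rep.2 hk⟩ := rep_simple k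
  refine ⟨cls _ hs, cls_eq_iff.2 ?_⟩
  have h := (iso_rep_cls hs).symm
  exact h

lemma gd_restrict : K.restrict.gd = K.gdim := by
  have h1 : K.restrict.gd = ∑ i : K.restrict.Irr, K.restrict.dim (rep i) ^ 2 := rfl
  rw [h1, gdim]
  refine sum_bij (fun i _ => K.incl i) (fun i _ => incl_mem i) (fun i _ j _ h => incl_injective h)
    (fun k hk => ?_) (fun i _ => ?_)
  . obtain ⟨i, hi⟩ := exists_incl hk; exact ⟨i, mem_univ _, hi⟩
  . rw [dim_restrict, (add_dim).iso (iso_incl i)]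

lemma hd_incl (i : K.restrict.Irr) (X : K.obj) : C.hd (rep (K.incl i)) X.1 = K.restrict.hd (rep i) X :=
  ((add_hd_right X.1).iso (iso_incl i)).symm

lemma incl_irr1 : K.incl K.restrict.irr1 = C.irr1 := by
  refine eq_irr1_of_iso (Iso.trans ?_ (iso_incl _))
  exact (unit_iso (C := K.restrict)).symm

lemma incl_star (i : K.restrict.Irr) : K.incl (star i) = star (K.incl i) := by
  have h1 : C.hd 1 (rep (K.incl i) * rep (K.incl (star i))) = 1 := by
    rw [<- (add_mul_right (add_hd_left _) _).iso (iso_incl i),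
      <- (add_mul_left (add_hd_left _) _).iso (iso_incl (star i))]
    refine (hd_one_rep_mul_rep i (star i)).trans (if_pos rfl)
  rw [hd_one_rep_mul_rep] at h1; by_contra hne; rw [if_neg (Ne.symm hne)] at h1; exact zero_ne_one h1

/-- A fusion subset of the subcategory, as a fusion subset of `C`. -/
def lift (L : K.restrict.Sub) : C.Sub where
  S := L.S.image K.incl
  one_mem := Finset.mem_image.2 ⟨_, L.one_mem, incl_irr1⟩
  mul_mem := by
    intro i j k hi hj hk; obtain ⟨i, hi', rfl⟩ := Finset.mem_image.1 hi
    obtain ⟨j, hj', rfl⟩ := Finset.mem_image.1 hj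
    obtain ⟨k, rfl⟩ := exists_incl (K.mul_mem (incl_mem i) (incl_mem j) hk)
    refine mem_image_of_mem _ (L.mul_mem hi' hj' ?_)
    rw [<- hd_incl]
    rwa [<- (add_mul_right (add_hd_left _) _).iso (iso_incl i),
      <- (add_mul_left (add_hd_left _) _).iso (iso_incl j)] at hk
  star_mem := by
    intro i hi; obtain ⟨i, hi', rfl⟩ := Finset.mem_image.1 hi
    exact Finset.mem_image.2 ⟨_, L.star_mem hi', incl_star i⟩

end Sub

lemma exists_minimal_sub (K : C.Sub) (hK : ∃ k ∈ K.S, k ≠ C.irr1) :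
    ∃ L : C.Sub, L.S ⊆ K.S ∧ (∃ k ∈ L.S, k ≠ C.irr1) ∧
      ∀ M : C.Sub, M.S ⊆ L.S -> (∀ k ∈ M.S, k = C.irr1) ∨ M.S = L.S := by
  induction hm : K.S.card using Nat.strong_induction_on generalizing K with
  | _ m ih =>
    by_cases h : ∀ M : C.Sub, M.S ⊆ K.S -> (∀ k ∈ M.S, k = C.irr1) ∨ M.S = K.S
    . exact ⟨K, subset_rfl, hK, h⟩
    push Not at h
    obtain ⟨M, hM, hk, hne⟩ := h
    obtain ⟨L, hL, h1, h2⟩ := ih _ (hm ▸ Finset.card_lt_card (hM.ssubset_of_ne hne)) M hk rfl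
    exact ⟨L, hL.trans hM, h1, h2⟩

/-- Every nontrivial fusion subset of the centre contains a nontrivial invertible object, if the
dimension of `C` has at most two prime factors. -/
lemma exists_invertible (K : C.Z.Sub) (hK : ∃ k ∈ K.S, k ≠ C.Z.irr1)
    {p q a b : ℕ} (hp : p.Prime) (hq : q.Prime) (hn : C.gd = p ^ a * q ^ b) :
    ∃ k ∈ K.S, k ≠ C.Z.irr1 ∧ C.dim (rep k).a = 1 := by
  obtain ⟨L, hL, ⟨k, hk, hk1⟩, hmin⟩ := exists_minimal_sub K hK
  have hs : ∀ M : L.restrict.Sub, (∀ k ∈ M.S, k = L.restrict.irr1) ∨ ∀ k, k ∈ M.S := by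
    intro M; have hsub : (Sub.lift M).S ⊆ L.S := fun k hk => by
      obtain ⟨i, -, rfl⟩ := Finset.mem_image.1 hk; exact Sub.incl_mem i
    rcases hmin (Sub.lift M) hsub with h | h
    . refine Or.inl fun i hi => Sub.incl_injective ?_
      rw [Sub.incl_irr1]; exact h _ (mem_image_of_mem _ hi)
    . refine Or.inr fun i => ?_
      have h1 := Sub.incl_mem i
      rw [<- h] at h1; obtain ⟨j, hj, e⟩ := Finset.mem_image.1 h1; rwa [Sub.incl_injective e] at hj
  have hdvd : L.restrict.gd ∣ p ^ (a * 2) * q ^ (b * 2) := by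
    rw [Sub.gd_restrict, pow_mul, pow_mul, <- mul_pow, <- hn]
    exact ⟨_, (gdim_mul_gdim_centralizer L).symm⟩
  obtain ⟨x, y, hx, hy, hxy⟩ := (Nat.dvd_mul).1 hdvd
  obtain ⟨c, -, rfl⟩ := (Nat.dvd_prime_pow hp).1 hx
  obtain ⟨e, -, rfl⟩ := (Nat.dvd_prime_pow hq).1 hy; obtain ⟨i, rfl⟩ := Sub.exists_incl hk
  have h1 : L.restrict.gd ≠ 1 := by
    intro h; have h2 : L.restrict.gd = ∑ i : L.restrict.Irr, L.restrict.dim (rep i) ^ 2 := rfl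
    have hi : i ≠ L.restrict.irr1 := fun h => hk1 (by rw [h, Sub.incl_irr1])
    have h3 : ∑ i ∈ {L.restrict.irr1, i}, L.restrict.dim (rep i) ^ 2 ≤ L.restrict.gd := by
      rw [h2]; exact sum_le_sum_of_subset (subset_univ _)
    rw [sum_pair hi.symm, HB.dim_irr1] at h3; have := pow_pos (dim_rep_pos i) 2; omega
  obtain ⟨j, hj, hd⟩ := HB.exists_dim_eq_one hs hp hq hxy.symm h1
  refine ⟨L.incl j, hL (Sub.incl_mem j), fun h => hj (Sub.incl_injective ?_), ?_⟩
  . rw [h, Sub.incl_irr1]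
  . rw [<- dim_Z, <- (add_dim).iso (Sub.iso_incl j), <- Sub.dim_restrict, hd]

namespace HB
variable {X Y Z : HB C} {t v : N}

/-- The twist. -/
def twist (Z : HB C) : N := C.ltr Z.a (Z.β Z.a)

lemma twist_mem (Z : HB C) : twist Z ∈ C.Z.Hom Z Z := ltr_mem (Z.up.mem Z)

lemma twist_nat (ht : t ∈ Hom X Y) : twist Y * t = t * twist X := by
  rw [twist, <- ltr_mul_right, <- Y.nat ht.1, ltr_comm ht.1 (Y.mem _), ht.2, ltr_mul_left, twist]

def tw (i : C.Z.Irr) : ℂ := C.tr (rep i).a (twist (rep i)) / C.dim (rep i).a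

lemma twist_rep (i : C.Z.Irr) : twist (rep i) = tw i • C.one (rep i).a := by
  have h := eq_smul_of_simple (rep_simple i) (twist_mem (rep i))
  rwa [dim_Z] at h

lemma twist_mul_vec (hv : v ∈ C.Hom 1 Z.a) : twist Z * v = v := by
  have h := ltr_comm (a := 1) hv
    (by simpa using C.one_mem Z.a)
  have h1 := fun x => by
    have := ltr_one_mul (C := C) 1 x
    rwa [C.ρ_one, d_one, one_smul] at this
  rw [twist, <- ltr_mul_right, <- Z.nat hv, Z.one, h, h1, C.one_comp hv]

lemma tw_eq_one_of_hd {i : C.Z.Irr} (h : C.hd 1 (rep i).a ≠ 0) : tw i = 1 := by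
  rw [Ne, hd_eq_zero] at h
  push Not at h
  obtain ⟨v, hv, h0⟩ := h; have h1 := twist_mul_vec hv
  rw [twist_rep, smul_mul_assoc, C.one_comp hv] at h1
  exact smul_left_injective ℂ h0 (h1.trans (one_smul _ _).symm)

lemma twist_mul (h : X.β Y.a = Y.β' X.a) {x y : ℂ} (hx : twist X = x • C.one X.a)
    (hy : twist Y = y • C.one Y.a) : twist (X * Y) = (x * y) • C.one (X.a * Y.a) := by
  have hm := Y.mem X.a
  have yb : Y.β' X.a * C.ρ X.a (Y.β Y.a) * Y.β X.a
      = C.ρ Y.a (Y.β X.a) * Y.β Y.a * C.ρ Y.a (Y.β' X.a) := by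
    have h1 := Y.nat hm
    rw [Y.mul, Y.mul] at h1; have hm3 :=
      w_comp (C.lw (Y.mem _) _) hm Y.a (mul_assoc _ _ _).symm (mul_assoc _ _ _).symm
    have h2 : C.ρ X.a (Y.β Y.a) * Y.β X.a * C.ρ Y.a (C.one (X.a * Y.a))
        = C.ρ X.a (Y.β Y.a) * Y.β X.a := by
      rw [<- C.one_mul, C.comp_one hm3]
    have h3 : C.one (Y.a * X.a) * C.ρ Y.a (Y.β X.a) = C.ρ Y.a (Y.β X.a) := by
      rw [C.one_mul, <- map_mul, C.one_eq, ρ_one_comp hm]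
    rw [<- h3, mul_assoc, mul_assoc, <- h2, <- β_mul_β', map_mul, <- mul_assoc _ _ (C.ρ Y.a (Y.β' X.a)),
      <- h1, <- β'_mul_β]
    simp [mul_assoc]
  have e1 : (X * Y).β (X * Y).a = C.ρ X.a (X.β Y.a) * (C.ρ X.a (C.ρ X.a (Y.β Y.a)) * X.β X.a) *
      C.ρ X.a (Y.β X.a) := by
    rw [mul_β, mul_a, X.mul, Y.mul, map_mul]; simp [mul_assoc]; rw [reassoc (X.slide X.a _)]
  have hm2 : (X * Y).β (X * Y).a ∈ C.Hom (X.a * Y.a * (X.a * Y.a)) (X.a * Y.a * (X.a * Y.a)) :=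
    (X * Y).mem _
  have e2 : C.ltr X.a ((X * Y).β (X * Y).a) = x • (X.β Y.a * C.ρ X.a (Y.β Y.a) * Y.β X.a) := by
    rw [e1, ltr_mul_right, ltr_mul_left, ltr_mul_left]; change _ * (_ * twist X) * _ = _
    have : C.one X.a * Y.β X.a = Y.β X.a := by rw [C.one_eq, ρ_one_comp hm]
    rw [hx]; simp [mul_assoc, this]
  rw [twist]; change C.ltr (X.a * Y.a) _ = _
  rw [ltr_ltr hm2, e2, h, ltr_smul, yb, ltr_mul_right, ltr_mul_left]
  change _ • (_ * twist Y * _) = _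
  have : C.one Y.a * Y.β' X.a = Y.β' X.a := by rw [C.one_eq, ρ_one_comp (Y.β'_mem _)]
  rw [hy, mul_smul_comm, smul_mul_assoc, mul_assoc, this, β_mul_β', smul_smul]

lemma β_eq_β'_of_lam_rep {i j : C.Z.Irr} (h : lam (rep i) (rep j) = C.dim (rep j).a) :
    (rep i).β (rep j).a = (rep j).β' (rep i).a := by
  let K := ker (fun _ : Unit => lam (rep i)) fun _ => isChar_lam_rep i
  refine β_eq_β'_of_lam (rep_simple i) K (fun k hk => ?_) (Sub.mem_rep.2 (mem_ker.2 fun _ => ?_))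
  . have := mem_ker.1 hk ()
    rwa [dim_Z] at this
  . rwa [dim_Z]

lemma tw_mul {i j k : C.Z.Irr} (h : lam (rep i) (rep j) = C.dim (rep j).a)
    (hk : C.Z.hd (rep k) (rep i * rep j) ≠ 0) : tw k = tw i * tw j := by
  rw [Ne, hd_eq_zero] at hk
  push Not at hk
  obtain ⟨t, ht, h0⟩ := hk; have h1 := twist_nat ht
  rw [twist_mul (β_eq_β'_of_lam_rep h) (twist_rep i) (twist_rep j), twist_rep, mul_smul_comm,
    smul_mul_assoc] at h1
  have h2 : C.one ((rep i).a * (rep j).a) * t = t := C.one_comp ht.1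
  rw [h2, C.comp_one ht.1] at h1; exact (smul_left_injective ℂ h0 h1).symm

lemma tw_ne_zero (i : C.Z.Irr) : tw i ≠ 0 := by
  intro h; have h1 := twist_rep i; rw [h, zero_smul] at h1; apply (rep_simple i).1
  change C.one (rep i).a = 0
  generalize rep i = X at h1; set a := X.a
  have e1 : C.ev' a * C.ρ (C.cj a) (X.β a) = C.ρ a (C.ev' a) * X.β' (C.cj a) := by
    have h2 := X.nat (C.ev'_mem a)
    rw [X.mul, X.one] at h2
    have h3 : C.ρ (C.cj a) (X.β a) * C.one (C.cj a * a) = C.ρ (C.cj a) (X.β a) := by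
      rw [C.one_mul, <- map_mul, C.one_eq, comp_ρ_one (X.mem a)]
    have h4 : C.ρ a (C.ev' a) = C.one X.a * C.ρ a (C.ev' a) := by rw [C.one_eq, <- map_mul, one_mul]
    rw [h4, <- h2, mul_assoc, mul_assoc, β_mul_β', h3]
  set g := X.β' (C.cj a) * C.cv a with hg
  have hgm := C.comp_mem (X.β'_mem _) (C.cv_mem a)
  have e2 : C.ρ a (C.ev' a) * g = 0 := by rwa [hg, <- mul_assoc, <- e1]
  have e3 : g = 0 := by
    have : C.ρ a (C.ev' a) * g * C.cv' a = g := by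
      rw [mul_assoc, nat_one hgm, C.ρ_mul, <- mul_assoc, <- map_mul, C.zig', <- C.one_mul, C.one_comp hgm]
    rw [<- this, e2, zero_mul]
  have e4 : C.cv a = 0 := by
    rw [<- C.one_comp (C.cv_mem a), <- β_mul_β', mul_assoc, <- hg, e3, mul_zero]
  rw [<- C.zig, e4, map_zero, mul_zero]

end HB

lemma hd_mul_dim_le (k : C.Irr) (a : Δ) : C.hd (rep k) a * C.dim (rep k) ≤ C.dim a := by
  rw [(add_dim).eq_sum a]; exact single_le_sum (f := fun k => C.hd (rep k) a • C.dim (rep k))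
    (fun _ _ => Nat.zero_le _) (mem_univ k)

lemma dim_le_of_hd {k : C.Irr} {a : Δ} (h : C.hd (rep k) a ≠ 0) : C.dim (rep k) ≤ C.dim a :=
  (Nat.le_mul_of_pos_left _ (Nat.pos_of_ne_zero h)).trans (hd_mul_dim_le k a)

lemma exists_hd_ne_zero_of_dim {a : Δ} (h : C.dim a ≠ 0) : ∃ k : C.Irr, C.hd (rep k) a ≠ 0 := by
  by_contra hcon
  push Not at hcon
  exact h (by rw [(add_dim).eq_sum a]; simp [hcon])

lemma simple_of_dim_eq_one {a : Δ} (h : C.dim a = 1) : C.Simple a := by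
  obtain ⟨k, hk⟩ := exists_hd_ne_zero_of_dim (C := C) (a := a) (by omega)
  have h1 := hd_mul_dim_le k a
  have h2 := dim_rep_pos k
  have h3 : C.hd (rep k) a = 1 ∧ C.dim (rep k) = 1 := by
    rw [h] at h1; have := Nat.pos_of_ne_zero hk; constructor <;> nlinarith
  have h4 : ∀ l, l ≠ k -> C.hd (rep l) a = 0 := by
    intro l hl; have h5 := (add_dim (C := C)).eq_sum a
    rw [h, <- add_sum_erase _ _ (mem_univ k), h3.1, h3.2] at h5
    have h6 : ∑ x ∈ Finset.univ.erase k, C.hd (rep x) a • C.dim (rep x) = 0 := by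
      simp [smul_eq_mul, mul_one] at h5 ⊢; omega
    have h7 := (sum_eq_zero_iff.1 h6) l (Finset.mem_erase.2 ⟨hl, mem_univ l⟩)
    exact (mul_eq_zero.1 h7).resolve_right (dim_rep_pos l).ne'
  refine simple_of_hd_self ?_
  rw [hd_eq_sum, sum_eq_single k (fun l _ hl => by rw [h4 l hl, zero_mul]) (by simp), h3.1]

/-- The invertible objects. -/
def invSub (C : Fus N Δ) [C.Split] : C.Sub where
  S := Finset.univ.filter fun k => C.dim (rep k) = 1
  one_mem := by simp [HB.dim_irr1]
  mul_mem := by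
    simp [mem_filter, mem_univ, true_and]; intro i j k hi hj hk; have h1 := dim_le_of_hd hk
    have h2 := dim_rep_pos k
    rw [dim_mul, hi, hj] at h1; omega
  star_mem := by simp [mem_filter, mem_univ, true_and]; intro i hi; rw [dim_star, hi]

lemma mem_invSub {k : C.Irr} : k ∈ (invSub C).S ↔ C.dim (rep k) = 1 := by simp [invSub]

def Sub.inf (K L : C.Sub) : C.Sub where
  S := K.S ∩ L.S
  one_mem := mem_inter.2 ⟨K.one_mem, L.one_mem⟩
  mul_mem hi hj hk := by rw [mem_inter] at *; exact ⟨K.mul_mem hi.1 hj.1 hk, L.mul_mem hi.2 hj.2 hk⟩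
  star_mem hi := by rw [mem_inter] at *; exact ⟨K.star_mem hi.1, L.star_mem hi.2⟩

lemma Sub.mem_inf {K L : C.Sub} {k : C.Irr} : k ∈ (K.inf L).S ↔ k ∈ K.S ∧ k ∈ L.S := mem_inter

lemma hd_irr1_mul_star {i : C.Irr} : C.hd (rep C.irr1) (rep i * rep (star i)) ≠ 0 := by
  rw [hd_irr1, hd_one_rep_mul_rep, if_pos rfl]; exact one_ne_zero

lemma eq_of_hd_irr1 {i j : C.Irr} (h : C.hd (rep C.irr1) (rep i * rep (star j)) ≠ 0) : i = j := by
  rw [hd_irr1, hd_one_rep_mul_rep] at h; by_contra hne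
  exact h (if_neg fun h => hne (by rw [<- star_star i, h, star_star]))

namespace HB

lemma β_self_eq {i : C.Z.Irr} (h : C.dim (rep i).a = 1) :
    (rep i).β (rep i).a = tw i • C.one ((rep i).a * (rep i).a) := by
  have hs : C.Simple ((rep i).a * (rep i).a) := simple_of_dim_eq_one (by rw [dim_mul, h])
  have h1 := eq_smul_of_simple hs ((rep i).mem (rep i).a)
  have h2 := twist_rep i
  rw [twist, h1, ltr_smul, C.one_mul, ltr_one_mul, d_eq, h, Nat.cast_one, one_smul] at h2
  rwa [<- smul_left_injective ℂ (rep_simple i).1 h2]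

lemma tw_sq {i : C.Z.Irr} (h : C.dim (rep i).a = 1)
    (hl : lam (rep i) (rep i) = C.dim (rep i).a) : tw i = 1 ∨ tw i = -1 := by
  have h1 := (rep i).β_mul_β' (rep i).a
  rw [<- β_eq_β'_of_lam_rep hl, β_self_eq h, smul_mul_smul_comm, one_mul_one] at h1
  have h0 : C.one ((rep i).a * (rep i).a) ≠ 0 := (simple_of_dim_eq_one (by rw [dim_mul, h])).1
  have h2 := smul_left_injective ℂ h0 (h1.trans (one_smul _ _).symm)
  exact mul_self_eq_one_iff.1 h2

lemma tw_irr1 : tw C.Z.irr1 = 1 := by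
  refine tw_eq_one_of_hd ?_
  rw [(add_forget (add_hd_left 1)).iso (unit_iso)]
  exact (hd_self_of_simple C.unit_simple).trans_ne one_ne_zero

section noBoson
variable (hB : ∀ k : C.Z.Irr, C.dim (rep k).a = 1 -> tw k = 1 -> k = C.Z.irr1)
  {p q a b : ℕ} (hp : p.Prime) (hq : q.Prime) (hn : C.gd = p ^ a * q ^ b)
include hB hp hq hn

/-- A symmetric fusion subset without bosons has at most one nontrivial simple object. -/
lemma symmetric_sub (E : C.Z.Sub)
    (hE : ∀ i ∈ E.S, ∀ j ∈ E.S, lam (rep i) (rep j) = C.dim (rep j).a) :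
    (∀ i ∈ E.S, i ≠ C.Z.irr1 -> C.dim (rep i).a = 1 ∧ tw i = -1) ∧
    ∀ i ∈ E.S, ∀ j ∈ E.S, i ≠ C.Z.irr1 -> j ≠ C.Z.irr1 -> i = j := by
  have hstar : ∀ i ∈ E.S, tw i * tw (star i) = 1 := fun i hi => by
    rw [<- tw_mul (hE i hi _ (E.star_mem hi)) hd_irr1_mul_star, tw_irr1]
  let E' : C.Z.Sub :=
    { S := E.S.filter fun k => tw k = 1
      one_mem := mem_filter.2 ⟨E.one_mem, tw_irr1⟩
      mul_mem := fun {i j k} hi hj hk => by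
        rw [mem_filter] at *
        exact ⟨E.mul_mem hi.1 hj.1 hk, by rw [tw_mul (hE i hi.1 j hj.1) hk, hi.2, hj.2, mul_one]⟩
      star_mem := fun {i} hi => by
        rw [mem_filter] at *; refine ⟨E.star_mem hi.1, ?_⟩; have := hstar i hi.1
        rwa [hi.2, one_mul] at this }
  have hE' : ∀ k ∈ E.S, tw k = 1 -> k = C.Z.irr1 := by
    intro k hk hk1; by_contra hne
    obtain ⟨l, hl, hl1, hld⟩ := exists_invertible E' ⟨k, mem_filter.2 ⟨hk, hk1⟩, hne⟩ hp hq hn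
    exact hl1 (hB l hld (mem_filter.1 hl).2)
  have hdim : ∀ i ∈ E.S, C.dim (rep i).a = 1 := by
    intro i hi; rw [<- dim_Z]
    refine (dim_eq_one_of_constituents (fun k hk => ?_) (hd_rep_self i)
      (hd_rep_self i)).1
    rw [(add_mul_left (add_hd_left _) _).iso (iso_star i)] at hk; have hi' := E.star_mem hi
    exact hE' k (E.mul_mem hi hi' hk) (by rw [tw_mul (hE i hi _ hi') hk, hstar i hi])
  have htw : ∀ i ∈ E.S, i ≠ C.Z.irr1 -> tw i = -1 := fun i hi hi1 =>
    (tw_sq (hdim i hi) (hE i hi i hi)).resolve_left fun h => hi1 (hE' i hi h)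
  refine ⟨fun i hi hi1 => ⟨hdim i hi, htw i hi hi1⟩, fun i hi j hj hi1 hj1 => ?_⟩
  have hj' := E.star_mem hj
  have hts : tw (star j) = -1 := by
    have := hstar j hj
    rw [htw j hj hj1] at this
    linear_combination -this
  obtain ⟨k, hk⟩ := exists_hd_ne_zero_of_dim (C := C.Z) (a := rep i * rep (star j))
    (by rw [dim_mul]; exact (Nat.mul_pos (dim_rep_pos i) (dim_rep_pos _)).ne')
  have hk1 := hE' k (E.mul_mem hi hj' hk) (by
    rw [tw_mul (hE i hi _ hj') hk, htw i hi hi1, hts]; norm_num)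
  rw [hk1] at hk; exact eq_of_hd_irr1 hk

omit hp hq hn in
lemma gdim_invSub_le : (invSub C.Z).gdim ≤ C.gd := by
  have h1 : (invSub C.Z).gdim = (invSub C.Z).S.card := by
    rw [Sub.gdim, Finset.card_eq_sum_ones]
    exact sum_congr rfl fun i hi => by rw [mem_invSub.1 hi, one_pow]
  have hs : ∀ i : C.Z.Irr, i ∈ (invSub C.Z).S -> C.Simple (rep i).a := fun i hi =>
    simple_of_dim_eq_one (by rw [<- dim_Z]; exact mem_invSub.1 hi)
  have h2 : (invSub C.Z).S.card ≤ (invSub C).S.card := by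
    refine Finset.card_le_card_of_injOn
      (fun i => if h : i ∈ (invSub C.Z).S then cls _ (hs i h) else C.irr1) ?_ ?_
    . intro i hi; have hi' : i ∈ (invSub C.Z).S := hi; simp only [dif_pos hi']
      rw [Finset.mem_coe, mem_invSub, <- (add_dim (C := C)).iso (iso_rep_cls (hs i hi')), <- dim_Z]
      exact mem_invSub.1 hi'
    . intro i hi j hj hij; have hi' : i ∈ (invSub C.Z).S := hi; have hj' : j ∈ (invSub C.Z).S := hj
      simp only [dif_pos hi', dif_pos hj'] at hij; have hiso :=
        (iso_rep_cls (hs i hi')).trans (hij ▸ (iso_rep_cls (hs j hj')).symm)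
      set W : HB C := rep i * C.Z.cj (rep j) with hW
      have hWd : C.Z.dim W = 1 := by rw [hW, dim_mul, dim_cj, mem_invSub.1 hi', mem_invSub.1 hj']
      have hW1 : C.hd 1 W.a ≠ 0 := by
        change C.hd 1 ((rep i).a * C.cj (rep j).a) ≠ 0
        rw [<- hd_mul_right, one_mul, (add_hd_left _).iso hiso, hd_self_of_simple (hs j hj')]
        exact one_ne_zero
      have hWs := simple_of_dim_eq_one hWd
      have hk := iso_rep_cls hWs
      have hk1 := hB (cls W hWs) (by rw [<- dim_Z, <- (add_dim).iso hk, hWd])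
        (tw_eq_one_of_hd (by rwa [<- (add_forget (add_hd_left 1)).iso hk]))
      apply eq_of_hd_irr1 (C := C.Z)
      rw [<- (add_mul_left (add_hd_left _) _).iso (iso_star j), <- hW, (add_hd_left _).iso hk, hk1]
      exact hd_rep_self _
  have h3 : (invSub C).S.card ≤ C.gd := by
    rw [Finset.card_eq_sum_ones, gd, Sub.gdim]
    refine (Finset.sum_le_sum fun i _ => Nat.one_le_pow 2 _ (dim_rep_pos i)).trans
      (sum_le_sum_of_subset (subset_univ _))
  omega

end noBoson
end HB
end Fus

lemma exists_half_of_involution {ι : Type*} [Fintype ι] [DecidableEq ι] {M : Finset ι} {σ : ι -> ι}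
    (h1 : ∀ k ∈ M, σ k ∈ M) (h2 : ∀ k ∈ M, σ (σ k) = k) (h3 : ∀ k ∈ M, σ k ≠ k) :
    ∃ T ⊆ M, ∀ F : ι -> ℂ, (∀ k ∈ M, F (σ k) = F k) -> ∑ k ∈ M, F k = 2 * ∑ k ∈ T, F k := by
  let e := equivFin ι
  refine ⟨M.filter fun k => e k < e (σ k), Finset.filter_subset _ _, fun F hF => ?_⟩
  rw [<- Finset.sum_filter_add_sum_filter_not M (fun k => e k < e (σ k)), two_mul]; congr 1
  refine sum_bij (fun k _ => σ k) (fun k hk => ?_) (fun k hk l hl h => ?_) (fun k hk => ?_)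
    (fun k hk => ?_)
  . rw [mem_filter] at hk ⊢; refine ⟨h1 k hk.1, ?_⟩; rw [h2 k hk.1]
    exact lt_of_le_of_ne (not_lt.1 hk.2) fun h => h3 k hk.1 (e.injective h)
  . rw [mem_filter] at hk hl; rw [<- h2 k hk.1, h, h2 l hl.1]
  . rw [mem_filter] at hk; refine ⟨σ k, ?_, h2 k hk.1⟩; rw [mem_filter, h2 k hk.1]
    exact ⟨h1 k hk.1, not_lt.2 hk.2.le⟩
  . exact (hF k (mem_filter.1 hk).1).symm

namespace Fus
open LCat
variable {C : Fus N Δ} [C.Split]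

namespace HB

lemma iso_one_of_dim {f : Δ} (h : C.dim f = 1) (h1 : C.hd 1 f ≠ 0) : C.Iso f 1 := by
  rw [Ne, hd_eq_zero] at h1
  push Not at h1
  obtain ⟨t, ht, h0⟩ := h1; exact (C.unit_simple.iso_of_ne_zero (simple_of_dim_eq_one h) ht h0).symm

lemma simple_mul_of_dim {f k : Δ} (h : C.dim f = 1) (hk : C.Simple k) : C.Simple (f * k) := by
  have hf : C.Iso (C.cj f * f) 1 := iso_one_of_dim (by rw [dim_mul, dim_cj, h]) (by
    rw [<- hd_mul_left, mul_one, hd_self_of_simple (simple_of_dim_eq_one h)]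
    exact one_ne_zero)
  refine simple_of_hd_self ?_
  rw [hd_mul_left, <- mul_assoc, (add_mul_right (add_hd_left _) _).iso hf,
    one_mul, hd_self_of_simple hk]

section noBoson
variable (hB : ∀ k : C.Z.Irr, C.dim (rep k).a = 1 -> tw k = 1 -> k = C.Z.irr1)
  {p q a b : ℕ} (hp : p.Prime) (hq : q.Prime) (hn : C.gd = p ^ a * q ^ b)
include hB hp hq hn

/-- Descent in the fusion subsets centralising the invertible objects, in the presence of a fermion. -/
lemma exists_smaller_sub {f : C.Z.Irr} (hf1 : f ≠ C.Z.irr1)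
    (hf : C.dim (rep f).a = 1) (hft : tw f = -1) (M : C.Z.Sub)
    (hinv : ∀ k ∈ M.S, C.dim (rep k).a = 1 -> k = C.Z.irr1 ∨ k = f)
    (hfc : ∀ k ∈ M.S, lam (rep f) (rep k) = C.dim (rep k).a)
    (hfM : f ∈ M.S) (hM : ∃ k ∈ M.S, k ≠ C.Z.irr1 ∧ k ≠ f) :
    ∃ L : C.Z.Sub, L.S ⊂ M.S ∧ f ∈ L.S ∧ ∃ k ∈ L.S, k ≠ C.Z.irr1 ∧ k ≠ f := by
  have hff : star f = f := by
    have h1 : C.dim (rep (star f)).a = 1 := by rw [<- dim_Z, dim_star, dim_Z, hf]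
    refine (hinv _ (M.star_mem hfM) h1).resolve_left fun h => hf1 ?_
    rw [<- star_star f, h, star_irr1]
  have hfr : ∀ k ∈ M.S, C.Z.hd (rep k) (rep f * rep k) = 0 := by
    intro k hk; by_contra h0; have h1 := tw_mul (hfc k hk) h0; rw [hft] at h1
    exact tw_ne_zero k (by linear_combination h1 / 2)
  have hfX : ∀ k ∈ M.S, lam (rep k) (rep f) = 1 := fun k hk => by
    rw [lam_rep_eq_dim_comm.1 (hfc k hk), hf, Nat.cast_one]
  let σ : C.Z.Irr -> C.Z.Irr := fun k =>
    cls (rep f * rep k) (simple_mul_of_dim (by rw [dim_Z, hf]) (rep_simple k))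
  have hσ : ∀ k, C.Z.Iso (rep f * rep k) (rep (σ k)) := fun k => iso_rep_cls _
  have hffi : C.Z.Iso (rep f * rep f) 1 := iso_one_of_dim (by rw [dim_mul, dim_Z, hf]) (by
    rw [hd_one_rep_mul_rep, if_pos hff]; exact one_ne_zero)
  have hσσ : ∀ k, σ (σ k) = k := fun k => by
    refine cls_of_hd_ne_zero _ ?_
    rw [<- (add_mul_left (add_hd_left _) _).iso (hσ k), <- mul_assoc,
      (add_mul_right (add_hd_left _) _).iso hffi, one_mul]
    exact hd_rep_self k
  have hσu : σ C.Z.irr1 = f := by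
    refine cls_of_hd_ne_zero _ ?_
    rw [(add_mul_left (add_hd_left (C := C.Z.toLCat) _) _).iso unit_iso, mul_one]
    exact hd_rep_self f
  have hσf : σ f = C.Z.irr1 := by rw [<- hσu, hσσ]
  have hσM : ∀ k ∈ M.S, σ k ∈ M.S := fun k hk => M.mul_mem hfM hk (by
    rw [(add_hd_left _).iso (hσ k)]; exact hd_rep_self _)
  have hσne : ∀ k ∈ M.S, σ k ≠ k := fun k hk h => by
    have h1 := hfr k hk
    rw [(add_hd_left (C := C.Z.toLCat) _).iso (hσ k), h] at h1; exact hd_rep_self k h1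
  have hσd : ∀ k, C.dim (rep (σ k)).a = C.dim (rep k).a := fun k => by
    rw [<- dim_Z, <- (add_dim (C := C.Z)).iso (hσ k), dim_mul, dim_Z, dim_Z, hf, one_mul]
  have hσl : ∀ x ∈ M.S, ∀ k, lam (rep x) (rep (σ k)) = lam (rep x) (rep k) := fun x hx k => by
    rw [<- (isChar_lam_rep x).add.iso (hσ k), (isChar_lam_rep x).mul, hfX x hx, one_mul]
  set R := (M.S.erase C.Z.irr1).erase f with hR
  have memR : ∀ k, k ∈ R ↔ k ≠ f ∧ k ≠ C.Z.irr1 ∧ k ∈ M.S := fun k => by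
    rw [hR, Finset.mem_erase, Finset.mem_erase]
  obtain ⟨T, hT, hsum⟩ := exists_half_of_involution (M := R) (σ := σ)
    (fun k hk => by
      rw [memR] at *; refine ⟨fun h => hk.2.1 ?_, fun h => hk.1 ?_, hσM k hk.2.2⟩
      . rw [<- hσσ k, h, hσf]
      . rw [<- hσσ k, h, hσu])
    (fun k _ => hσσ k) (fun k hk => hσne k ((memR k).1 hk).2.2)
  have hTM : ∀ k ∈ T, k ∈ M.S := fun k hk => ((memR k).1 (hT hk)).2.2
  have hdu : C.dim (rep C.Z.irr1).a = 1 := by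
    have := dim_irr1 (C := C.Z)
    rwa [dim_Z] at this
  have hsumM : ∀ F : C.Z.Irr -> ℂ, F C.Z.irr1 = 1 -> (∀ k ∈ M.S, F (σ k) = F k) ->
      ∑ k ∈ M.S, F k = 2 * (1 + ∑ k ∈ T, F k) := by
    intro F hF1 hF; have hFf : F f = 1 := by rw [<- hσu, hF _ M.one_mem, hF1]
    rw [<- add_sum_erase _ _ M.one_mem, <- add_sum_erase _ _ (Finset.mem_erase.2 ⟨hf1, hfM⟩), <- hR,
      hsum F fun k hk => hF k ((memR k).1 hk).2.2, hF1, hFf]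
    ring
  have hgd : M.gdim = 2 * (1 + ∑ k ∈ T, C.dim (rep k).a ^ 2) := by
    have := hsumM (fun k => (C.dim (rep k).a : ℂ) ^ 2) (by simp [hdu]) (fun k _ => by simp only [hσd])
    rw [Sub.gdim]; simp only [dim_Z]; exact_mod_cast this
  have hTne : T.Nonempty := by
    by_contra hemp
    rw [Finset.not_nonempty_iff_eq_empty] at hemp; rw [hemp, Finset.sum_empty, Sub.gdim] at hgd
    obtain ⟨k, hk, hk1, hkf⟩ := hM
    rw [<- add_sum_erase _ _ M.one_mem,
      <- add_sum_erase _ _ (Finset.mem_erase.2 ⟨hf1, hfM⟩), <- hR, dim_Z, dim_Z, hdu, hf,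
      <- add_sum_erase _ _ ((memR k).2 ⟨hkf, hk1, hk⟩)] at hgd
    have := pow_pos (dim_rep_pos k) 2
    omega
  have hMM : ∀ x ∈ T, ∃ j ∈ M.S, lam (rep x) (rep j) ≠ C.dim (rep j).a := by
    intro x hx; by_contra hcon
    push Not at hcon
    have hxR := (memR x).1 (hT hx)
    have hs := (symmetric_sub hB hp hq hn (M.inf (centralizer M)) (fun i hi j hj => by
      rw [Sub.mem_inf, mem_centralizer] at *
      exact hi.2 j hj.1)).2 x (Sub.mem_inf.2 ⟨hTM x hx, mem_centralizer.2 hcon⟩) f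
      (Sub.mem_inf.2 ⟨hfM, mem_centralizer.2 hfc⟩) hxR.2.1 hf1
    exact hxR.1 hs
  -- a pair of simple objects with extremal monodromy
  obtain ⟨x, hx, y, hy, hl⟩ : ∃ x ∈ T, ∃ y ∈ T, ‖lam (rep x) (rep y)‖ = C.dim (rep y).a := by
    have key : ∀ {p q a b : ℕ}, p.Prime -> q.Prime -> C.gd = p ^ a * q ^ b ->
        p ∣ 1 + ∑ k ∈ T, C.dim (rep k).a ^ 2 ->
        ∃ x ∈ T, ∃ y ∈ T, ‖lam (rep x) (rep y)‖ = C.dim (rep y).a := by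
      intro p q a b hp hq hn hpm; obtain ⟨x, hx, hpx⟩ : ∃ x ∈ T, ¬ p ∣ C.dim (rep x).a := by
        by_contra hcon
        push Not at hcon
        have h2 := dvd_sum fun k hk => dvd_pow (hcon k hk) two_ne_zero
        exact hp.one_lt.ne' (Nat.dvd_one.1 ((Nat.dvd_add_left h2).1 hpm))
      obtain ⟨k, hk⟩ := dim_rep_eq_pow hp hq hn hpx; obtain ⟨j, hj, hne⟩ := hMM x hx
      have h0 := Sub.sum_dim_mul_char_eq_zero (K := M) (isChar_lam_rep x) (Sub.mem_rep.2 hj)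
        (by rwa [dim_Z])
      simp only [dim_Z] at h0
      rw [hsumM (fun k => C.dim (rep k).a * lam (rep x) (rep k)) (by simp [hdu, lam_unit_right])
        (fun k _ => by simp only [hσd, hσl x (hTM x hx)])] at h0
      obtain ⟨y, hy, hqy, hly⟩ := exists_not_dvd_dim (i := x) hq (S := T)
        (by linear_combination h0 / 2)
      exact ⟨x, hx, y, hy, norm_lam_eq hq hk hqy hly⟩
    have hdvd : 1 + ∑ k ∈ T, C.dim (rep k).a ^ 2 ∣ (p ^ a * q ^ b) ^ 2 := by
      rw [<- hn, <- gdim_mul_gdim_centralizer M, hgd]; exact (Dvd.intro_left _ rfl).mul_right _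
    have hne1 : 1 + ∑ k ∈ T, C.dim (rep k).a ^ 2 ≠ 1 := by
      obtain ⟨k, hk⟩ := hTne; have h1 := single_le_sum (f := fun k : C.Z.Irr => C.dim (rep k).a ^ 2)
        (fun _ _ => Nat.zero_le _) hk
      have h2 := pow_pos (dim_rep_pos k) 2
      rw [dim_Z] at h2; omega
    obtain ⟨ℓ, hℓ, hℓm⟩ := Nat.exists_prime_and_dvd hne1
    rcases (Nat.Prime.dvd_mul hℓ).1 (hℓ.dvd_of_dvd_pow (hℓm.trans hdvd)) with h | h
    . rw [(Nat.prime_dvd_prime_iff_eq hℓ hp).1 (hℓ.dvd_of_dvd_pow h)] at hℓm; exact key hp hq hn hℓm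
    . rw [(Nat.prime_dvd_prime_iff_eq hℓ hq).1 (hℓ.dvd_of_dvd_pow h)] at hℓm
      exact key hq hp (hn.trans (mul_comm _ _)) hℓm
  refine ⟨M.inf (ker (fun _ : Unit => lam (rep x)) fun _ => isChar_lam_rep x), ?_, ?_, ?_⟩
  . obtain ⟨j, hj, hne⟩ := hMM x hx
    refine Finset.ssubset_iff_subset_ne.2 ⟨Finset.inter_subset_left, fun h => hne ?_⟩
    rw [<- h] at hj; have := mem_ker.1 (Sub.mem_inf.1 hj).2 (); rwa [dim_Z] at this
  . exact Sub.mem_inf.2 ⟨hfM, mem_ker.2 fun _ => by rw [hfX x (hTM x hx), dim_Z, hf, Nat.cast_one]⟩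
  . by_contra hcon
    push Not at hcon
    have hyR := (memR y).1 (hT hy)
    have hY : ∀ k, C.Z.hd (rep k) (rep y * C.Z.cj (rep y)) ≠ 0 -> k ≠ C.Z.irr1 -> k = f := by
      intro k hk hk1; refine hcon k (Sub.mem_inf.2 ⟨?_, mem_ker.2 fun _ => ?_⟩) hk1
      . exact (Sub.Mem.mul (Sub.mem_rep.2 hyR.2.2) (Sub.Mem.cj (Sub.mem_rep.2 hyR.2.2))) k hk
      . have h1 := Additive.eq_of_eq_mul_dim (C := C.Z) (isChar_lam_rep x).add (κ := 1)
          (fun i => by simpa using (isChar_lam_rep x).norm_le (rep i))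
          (by
            rw [(isChar_lam_rep x).mul, (isChar_lam_rep x).cj, Complex.mul_conj,
              Complex.normSq_eq_norm_sq, hl, dim_mul, dim_cj, dim_Z]
            push_cast; ring) hk
        simpa using h1
    have hfy : C.Z.hd (rep f) (rep y * C.Z.cj (rep y)) = 0 := by
      rw [<- hd_mul_right, hd_comm, hfr y hyR.2.2]
    have hd1 := dim_of_constituents_unit (C := C.Z) fun k hk => by
      by_contra hk1
      rw [hY k hk hk1] at hk; exact hk hfy
    rw [dim_mul, dim_cj, <- hd_mul_right, one_mul, hd_self_of_simple (rep_simple y)] at hd1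
    have hy1 : C.dim (rep y).a = 1 := by rw [<- dim_Z]; exact Nat.eq_one_of_mul_eq_one_right hd1
    rcases hinv y hyR.2.2 hy1 with h | h
    . exact hyR.2.1 h
    . exact hyR.1 h

end noBoson

/-- The centre of a nontrivial fusion category whose dimension has at most two prime factors has a
nontrivial invertible object with trivial twist. -/
lemma exists_boson {p q a b : ℕ} (hp : p.Prime) (hq : q.Prime) (hn : C.gd = p ^ a * q ^ b)
    (h1 : C.gd ≠ 1) : ∃ k : C.Z.Irr, k ≠ C.Z.irr1 ∧ C.dim (rep k).a = 1 ∧ tw k = 1 := by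
  by_contra hcon
  have hB : ∀ k, C.dim (rep k).a = 1 -> tw k = 1 -> k = C.Z.irr1 := by
    intro k hk hk1; by_contra h; exact hcon ⟨k, h, hk, hk1⟩
  set Γ := invSub C.Z with hΓ
  set E := Γ.inf (centralizer Γ) with hE
  have hΓd : ∀ k, k ∈ Γ.S ↔ C.dim (rep k).a = 1 := fun k => by rw [hΓ, mem_invSub, dim_Z]
  have hS := symmetric_sub hB hp hq hn E fun i hi j hj => by
    rw [hE, Sub.mem_inf, mem_centralizer] at *; exact hi.2 j hj.1
  have hle := gdim_invSub_le hB
  have hmul := gdim_mul_gdim_centralizer Γ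
  have hpos : 0 < C.gd := (Sub.top C).gdim_pos
  have hdu : C.dim (rep C.Z.irr1).a = 1 := by
    have := dim_irr1 (C := C.Z)
    rwa [dim_Z] at this
  rw [<- hΓ] at hle; by_cases hf : ∃ f ∈ E.S, f ≠ C.Z.irr1
  . obtain ⟨f, hf, hf1⟩ := hf; obtain ⟨hfd, hft⟩ := hS.1 f hf hf1
    rw [hE, Sub.mem_inf] at hf
    have hc : ∀ k ∈ (centralizer Γ).S, lam (rep f) (rep k) = C.dim (rep k).a := fun k hk =>
      lam_rep_eq_dim_comm.1 (mem_centralizer.1 hk f hf.1)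
    have hinv : ∀ k ∈ (centralizer Γ).S, C.dim (rep k).a = 1 -> k = C.Z.irr1 ∨ k = f := by
      intro k hk hk1; by_cases hku : k = C.Z.irr1
      . exact Or.inl hku
      . exact Or.inr (hS.2 k (Sub.mem_inf.2 ⟨(hΓd k).2 hk1, hk⟩) f (Sub.mem_inf.2 hf) hku hf1)
    have hdesc : ∀ (n : ℕ) (M : C.Z.Sub), M.S.card = n -> M.S ⊆ (centralizer Γ).S -> f ∈ M.S ->
        ¬ ∃ k ∈ M.S, k ≠ C.Z.irr1 ∧ k ≠ f := by
      intro n; induction n using Nat.strong_induction_on with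
      | _ n ih =>
        intro M hMn hM hfM hex
        obtain ⟨L, hL, hfL, hLex⟩ := exists_smaller_sub hB hp hq hn hf1 hfd hft M
          (fun k hk => hinv k (hM hk)) (fun k hk => hc k (hM hk)) hfM hex
        exact ih _ (hMn ▸ Finset.card_lt_card hL) L rfl (hL.1.trans hM) hfL hLex
    have h2 := hdesc _ (centralizer Γ) rfl subset_rfl hf.2
    push Not at h2
    have h3 : (centralizer Γ).gdim ≤ 2 := by
      have hsub : (centralizer Γ).S ⊆ {C.Z.irr1, f} := fun k hk => by
        rw [Finset.mem_insert, Finset.mem_singleton]; by_cases hku : k = C.Z.irr1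
        . exact Or.inl hku
        . exact Or.inr (h2 k hk hku)
      refine (sum_le_sum_of_subset hsub).trans ?_
      rw [sum_pair hf1.symm, dim_Z, dim_Z, hdu, hfd]; norm_num
    have h4 : C.gd = 2 := by
      have h5 : C.gd ^ 2 ≤ C.gd * 2 := by rw [<- hmul]; exact Nat.mul_le_mul hle h3
      have : C.gd ≤ 2 := by nlinarith
      omega
    have h5 := sum_dim_hd (C := C) 1
    have h6 : C.hd 1 (rep C.Z.irr1).a = 1 := by
      rw [(add_forget (add_hd_left 1)).iso (unit_iso)]; exact hd_self_of_simple C.unit_simple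
    rw [dim_one, h4, <- add_sum_erase _ _ (mem_univ C.Z.irr1), hdu, h6] at h5
    have h7 : ∑ x ∈ Finset.univ.erase C.Z.irr1, C.hd 1 (rep x).a * C.dim (rep x).a = 1 := by omega
    obtain ⟨z, hz, hz0⟩ := exists_ne_zero_of_sum_ne_zero (h7.trans_ne one_ne_zero)
    have h8 := single_le_sum (f := fun x => C.hd 1 (rep x).a * C.dim (rep x).a)
      (fun _ _ => Nat.zero_le _) hz
    rw [h7] at h8; have h9 := mul_eq_one.1 (le_antisymm h8 (Nat.pos_of_ne_zero hz0))
    exact (Finset.ne_of_mem_erase hz) (hB z h9.2 (tw_eq_one_of_hd (by rw [h9.1]; exact one_ne_zero)))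
  . push Not at hf
    have h2 : ∀ k ∈ (centralizer Γ).S, k = C.Z.irr1 := by
      by_contra hc
      push Not at hc
      obtain ⟨k, hk, hk1, hkd⟩ := exists_invertible (centralizer Γ) hc hp hq hn
      exact hk1 (hf k (Sub.mem_inf.2 ⟨(hΓd k).2 hkd, hk⟩))
    have h3 : (centralizer Γ).gdim = 1 := by
      rw [Sub.gdim, Finset.sum_eq_single_of_mem _ (centralizer Γ).one_mem
        (fun k hk hk1 => (hk1 (h2 k hk)).elim), dim_irr1, one_pow]
    rw [h3, mul_one] at hmul; rw [hmul] at hle; have : C.gd ≤ 1 := by nlinarith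
    omega

end HB
end Fus

/-- A Perron–Frobenius rigidity statement for a symmetric nonnegative matrix with `G² = nG`. -/
lemma Matrix.mul_eq_mul_of_sq_eq {ι : Type*} [Fintype ι] {G : ι -> ι -> ℕ} {n : ℕ}
    (symm : ∀ i j, G i j = G j i) (sq : ∀ i j, ∑ k, G i k * G k j = n * G i j)
    (diag : ∀ i, G i i ≠ 0) {f : ι -> ℕ} (hf : ∀ j, ∑ i, G j i * f i = n * f j) {i j : ι}
    (h : G j i ≠ 0) : f i * G j j = f j * G j i := by
  classical
  have trans : ∀ {a b c}, G a b ≠ 0 -> G b c ≠ 0 -> G a c ≠ 0 := by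
    intro a b c hab hbc h0; have h1 := sq a c; rw [h0, mul_zero, sum_eq_zero_iff] at h1
    exact mul_ne_zero hab hbc (h1 b (mem_univ b))
  obtain ⟨k, hk, hmin⟩ := Finset.exists_min_image (Finset.univ.filter fun k => G j k ≠ 0)
    (fun k => (f k : ℚ) / G j k) ⟨i, by simp [h]⟩
  have hk' : G j k ≠ 0 := by simpa using hk
  have hle : ∀ l, G k l * (f k * G j l) ≤ G k l * (f l * G j k) := by
    intro l; by_cases hl : G j l = 0
    . simp [hl]
    refine Nat.mul_le_mul_left _ ?_
    have h1 := hmin l (by simp [hl])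
    rw [div_le_div_iff₀ (by positivity) (by positivity)] at h1; exact_mod_cast h1
  have hsum : ∑ l, G k l * (f k * G j l) = ∑ l, G k l * (f l * G j k) := by
    have e1 : ∑ l, G k l * (f k * G j l) = f k * (n * G k j) := by
      rw [<- sq, mul_sum]; exact sum_congr rfl fun l _ => by rw [symm j l]; ring
    have e2 : ∑ l, G k l * (f l * G j k) = n * f k * G j k := by
      rw [<- hf, sum_mul]; exact sum_congr rfl fun l _ => by ring
    rw [e1, e2, symm k j]; ring
  have heq := (Finset.sum_eq_sum_iff_of_le fun l _ => hle l).1 hsum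
  have key : ∀ l, G j l ≠ 0 -> f k * G j l = f l * G j k := by
    intro l hl; have h0 : G k l ≠ 0 := trans (by rwa [symm]) hl
    exact Nat.eq_of_mul_eq_mul_left (Nat.pos_of_ne_zero h0) (heq l (mem_univ l))
  refine Nat.eq_of_mul_eq_mul_right (Nat.pos_of_ne_zero hk') ?_
  calc f i * G j j * G j k = f i * G j k * G j j := by ring
    _ = f j * G j k * G j i := by rw [<- key i h, <- key j (diag j)]; ring
    _ = f j * G j i * G j k := by ring

/-- A module category over `C`, realised inside the same algebra. -/
structure Mdl {N : Type v} [Ring N] [Algebra ℂ N] {Δ : Type u} [Monoid Δ] (C : Fus N Δ)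
    (O : Type w) [MulAction Δ O] extends LCat N O where
  one_smul : ∀ (a : Δ) (X : O), one (a • X) = C.ρ a (one X)
  lw : ∀ {X Y t}, t ∈ Hom X Y -> ∀ a : Δ, C.ρ a t ∈ Hom (a • X) (a • Y)
  rw : ∀ {a b t}, t ∈ C.Hom a b -> ∀ X, t * C.ρ a (one X) ∈ Hom (a • X) (b • X)
  tr_left : ∀ {a : Δ} {X : O} {t}, t ∈ Hom (a • X) (a • X) -> tr (a • X) t = tr X (C.ltr a t)

namespace Mdl
open LCat
variable {C : Fus N Δ} {O : Type w} [MulAction Δ O] {M : Mdl C O}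

/-- The regular module category. -/
def regular (C : Fus N Δ) : Mdl C Δ where
  toLCat := C.toLCat
  one_smul := C.one_mul
  lw := C.lw
  rw := C.rw
  tr_left := C.tr_left

section
variable {a b : Δ} {X Y Z W : O} {s t : N}

lemma comp_w (hs : s ∈ C.Hom a b) (ht : t ∈ M.Hom X Y) {Z W : O} (h1 : Y = a • Z)
    (h2 : W = b • Z) : s * t ∈ M.Hom X W := by
  subst h1 h2; have := M.comp_mem (M.rw hs Z) ht
  rwa [mul_assoc, <- M.one_smul, M.one_comp ht] at this

lemma w_comp (hs : s ∈ M.Hom X Y) (ht : t ∈ C.Hom a b) {Z W : O} (h1 : X = b • Z)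
    (h2 : W = a • Z) : s * t ∈ M.Hom W Y := by
  subst h1 h2; have := M.comp_mem hs (M.rw ht Z)
  rwa [C.nat ht, <- M.one_smul, <- mul_assoc, M.comp_one hs] at this

lemma comp_ρ_one (ht : t ∈ M.Hom (a • X) Y) : t * C.ρ a 1 = t := by
  have h2 : M.one (a • X) * C.ρ a 1 = M.one (a • X) := by rw [M.one_smul, <- map_mul, mul_one]
  rw [<- M.comp_one ht, mul_assoc, h2]

lemma ρ_one_comp (ht : t ∈ M.Hom Y (a • X)) : C.ρ a 1 * t = t := by
  have h2 : C.ρ a 1 * M.one (a • X) = M.one (a • X) := by rw [M.one_smul, <- map_mul, one_mul]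
  rw [<- M.one_comp ht, <- mul_assoc, h2]

lemma isSum_lw {ι : Type*} [Fintype ι] {X : O} {Y : ι -> O} {s s' : ι -> N}
    (h : M.IsSum X Y s s') (c : Δ) :
    M.IsSum (c • X) (fun k => c • Y k) (fun k => C.ρ c (s k)) (fun k => C.ρ c (s' k)) where
  mem k := M.lw (h.mem k) c
  mem' k := M.lw (h.mem' k) c
  same k := by rw [<- map_mul, h.same, M.one_smul]
  diff k l hkl := by rw [<- map_mul, h.diff k l hkl, map_zero]
  sum := by simp_rw [<- map_mul, <- map_sum, h.sum, M.one_smul]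

lemma isSum_rw {ι : Type*} [Fintype ι] {a : Δ} {b : ι -> Δ} {s s' : ι -> N}
    (h : C.IsSum a b s s') (X : O) :
    M.IsSum (a • X) (fun k => b k • X) (fun k => s k * C.ρ (b k) (M.one X))
      (fun k => s' k * C.ρ a (M.one X)) where
  mem k := M.rw (h.mem k) X
  mem' k := M.rw (h.mem' k) X
  same k := by
    rw [mul_assoc, <- mul_assoc _ (s k), <- C.nat (h.mem k), mul_assoc, <- map_mul, one_mul_one,
      <- mul_assoc, h.same, M.one_smul, C.one_eq, <- map_mul, one_mul]
  diff k l hkl := by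
    rw [mul_assoc, <- mul_assoc _ (s l), <- C.nat (h.mem l), mul_assoc, <- map_mul, one_mul_one,
      <- mul_assoc, h.diff k l hkl, zero_mul]
  sum := by
    have : ∀ k, s k * C.ρ (b k) (M.one X) * (s' k * C.ρ a (M.one X))
        = s k * s' k * C.ρ a (M.one X) := fun k => by
      rw [mul_assoc, <- mul_assoc _ (s' k), <- C.nat (h.mem' k), mul_assoc, <- map_mul, one_mul_one,
        <- mul_assoc]
    simp_rw [this, <- sum_mul, h.sum, M.one_smul, C.one_eq, <- map_mul, one_mul]

lemma add_smul_left {A : Type*} [AddCommMonoid A] {f : O -> A} (hf : M.Additive f) (c : Δ) :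
    M.Additive (fun X => f (c • X)) := ⟨fun h => hf.sum (isSum_lw h c)⟩
lemma add_smul_right {A : Type*} [AddCommMonoid A] {f : O -> A} (hf : M.Additive f) (X : O) :
    C.Additive (fun a => f (a • X)) := ⟨fun h => hf.sum (isSum_rw h X)⟩

lemma hd_smul (a : Δ) (X Y : O) : M.hd (a • X) Y = M.hd X (C.cj a • Y) := by
  refine LinearEquiv.finrank_eq ?_
  exact
    { toFun := fun t => ⟨C.ρ (C.cj a) t * C.cv a,
        w_comp (M.lw t.2 _) (C.cv_mem a) (smul_smul _ _ _) (MulAction.one_smul X).symm⟩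
      map_add' := fun s t => by ext; simp [add_mul]
      map_smul' := fun z t => by ext; simp
      invFun := fun t => ⟨C.ev a * C.ρ a t,
        comp_w (C.ev_mem a) (M.lw t.2 a) (smul_smul _ _ _) (MulAction.one_smul Y).symm⟩
      left_inv := fun t => by
        ext; simp [map_mul, <- mul_assoc]
        rw [<- C.ρ_mul, Fus.nat_to_one (C.ev_mem a), mul_assoc, C.zig, C.one_eq, comp_ρ_one t.2]
      right_inv := fun t => by
        ext; simp [map_mul, mul_assoc]
        rw [<- C.ρ_mul, <- Fus.nat_one (C.cv_mem a), <- mul_assoc, C.zag, C.one_eq, ρ_one_comp t.2] }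
end

variable [C.Split] [M.Split]

lemma iso_cj_mul {e : Δ} (he : C.dim e = 1) : C.Iso (C.cj e * e) 1 := by
  refine Fus.HB.iso_one_of_dim (by rw [Fus.dim_mul, Fus.dim_cj, he]) ?_
  rw [<- Fus.hd_mul_left, mul_one, Ne, hd_eq_zero]; intro h
  have h3 : C.d e = 0 := by rw [Fus.d, h _ (C.one_mem _), map_zero]
  rw [Fus.d_eq, he] at h3; simp at h3

lemma simple_smul {e : Δ} (he : C.dim e = 1) {X : O} (hX : M.Simple X) : M.Simple (e • X) := by
  refine simple_of_hd_self ?_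
  rw [hd_smul, smul_smul]; have h := (add_smul_right (M := M) (add_hd_left X) X).iso (iso_cj_mul he)
  rw [h, MulAction.one_smul, hd_self_of_simple hX]

/-- The weighted multiplicity of `Y` in `⊕ c • X`. -/
def pair (M : Mdl C O) (w : C.Irr -> ℕ) (X Y : O) : ℕ := ∑ c : C.Irr, w c * M.hd (rep c • X) Y

lemma add_pair_left (w : C.Irr -> ℕ) (Y : O) : M.Additive fun X => M.pair w X Y :=
  ⟨fun h => by
    simp [pair, (add_smul_left (add_hd_right Y) _).sum h, mul_sum]
    exact sum_comm⟩

lemma add_pair_right (w : C.Irr -> ℕ) (X : O) : M.Additive fun Y => M.pair w X Y :=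
  ⟨fun h => by
    simp [pair, (add_hd_left _).sum h, mul_sum]
    exact sum_comm⟩

lemma pair_star (w : C.Irr -> ℕ) (X Y : O) :
    M.pair w X Y = M.pair (fun c => w (Fus.star c)) Y X := by
  refine Finset.sum_bij' (fun c _ => Fus.star c) (fun c _ => Fus.star c) (by simp) (by simp)
    (by simp [Fus.star_star]) (by simp [Fus.star_star]) fun c _ => ?_
  beta_reduce
  rw [Fus.star_star, hd_smul, hd_comm, (add_smul_right (add_hd_right X) Y).iso (Fus.iso_star c)]

lemma pair_smul {w w' : C.Irr -> ℕ} {c : Δ} {m : ℕ}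
    (h : ∀ k, ∑ e, w e * C.hd (rep e) (rep k * C.cj c) = m * w' k) (X Y : O) :
    M.pair w (c • X) Y = m * M.pair w' X Y := by
  unfold pair; have h1 : ∀ e : C.Irr, M.hd (rep e • c • X) Y
      = ∑ k : C.Irr, C.hd (rep e) (rep k * C.cj c) * M.hd (rep k • X) Y := by
    intro e; rw [smul_smul, (add_smul_right (add_hd_right Y) X).eq_sum]
    refine sum_congr rfl fun k _ => ?_
    rw [smul_eq_mul, hd_comm, Fus.hd_mul_right]
  simp_rw [h1, mul_sum, <- mul_assoc]; rw [sum_comm]; refine sum_congr rfl fun k _ => ?_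
  rw [<- h k, sum_mul]

lemma sum_pair_mul_pair (w w' : C.Irr -> ℕ) (X Y : O) :
    ∑ Z : M.Irr, M.pair w X (rep Z) * M.pair w' (rep Z) Y
      = ∑ c, w c * M.pair w' (rep c • X) Y := by
  have h1 : ∀ c : C.Irr, M.pair w' (rep c • X) Y
      = ∑ Z : M.Irr, M.hd (rep c • X) (rep Z) * M.pair w' (rep Z) Y := by
    intro c; rw [(add_pair_left w' Y).eq_sum]
    exact sum_congr rfl fun Z _ => by rw [smul_eq_mul, hd_comm]
  simp_rw [h1, pair, sum_mul, mul_sum]; rw [sum_comm]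
  refine sum_congr rfl fun c _ => sum_congr rfl fun Z _ => sum_congr rfl fun e _ => by ring

/-- Dimension-weighted multiplicity of `Y` in the `C`-span of `X`. -/
def wt (M : Mdl C O) (X Y : O) : ℕ := M.pair (fun c => C.dim (rep c)) X Y

lemma wt_comm (X Y : O) : M.wt X Y = M.wt Y X := by rw [wt, pair_star]; simp [wt, Fus.dim_star]

lemma wt_smul (c : Δ) (X Y : O) : M.wt (c • X) Y = C.dim c * M.wt X Y := by
  refine pair_smul (fun k => ?_) X Y
  have h := (Fus.add_dim (C := C)).eq_sum (rep k * C.cj c)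
  rw [Fus.dim_mul, Fus.dim_cj] at h; rw [mul_comm (C.dim c), h]
  exact sum_congr rfl fun e _ => by rw [smul_eq_mul, mul_comm]

lemma wt_smul_right (c : Δ) (X Y : O) : M.wt X (c • Y) = C.dim c * M.wt X Y := by
  rw [wt_comm, wt_smul, wt_comm]

lemma gd_eq : C.gd = ∑ i : C.Irr, C.dim (rep i) ^ 2 := rfl

lemma sum_wt_mul_wt (X Y : O) : ∑ Z : M.Irr, M.wt X (rep Z) * M.wt (rep Z) Y = C.gd * M.wt X Y := by
  rw [gd_eq, sum_mul]; refine (sum_pair_mul_pair _ _ X Y).trans (sum_congr rfl fun c _ => ?_)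
  have := wt_smul (M := M) (rep c) X Y
  rw [wt] at this; rw [this]; ring

lemma add_wt_left (Y : O) : M.Additive fun X => M.wt X Y := add_pair_left _ Y
lemma add_wt_right (X : O) : M.Additive fun Y => M.wt X Y := add_pair_right _ X

lemma pair_ne_zero {w : C.Irr -> ℕ} {X Y : O} (h : M.hd X Y ≠ 0) (hw : w C.irr1 ≠ 0) :
    M.pair w X Y ≠ 0 := by
  intro h0; rw [pair, sum_eq_zero_iff] at h0
  have h1 := (Nat.mul_eq_zero.1 (h0 C.irr1 (mem_univ _))).resolve_left hw
  rw [(add_smul_right (add_hd_right Y) X).iso Fus.unit_iso, MulAction.one_smul] at h1; exact h h1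

lemma wt_ne_zero {X Y : O} (h : M.hd X Y ≠ 0) : M.wt X Y ≠ 0 :=
  pair_ne_zero h (Fus.dim_rep_pos _).ne'

end Mdl

/-- A commutative separable algebra in the centre of `C`, with one-dimensional space of units. -/
structure CAlg {N : Type v} [Ring N] [Algebra ℂ N] {Δ : Type u} [Monoid Δ] (C : Fus N Δ) where
  L : Fus.HB C
  m : N
  η : N
  ε : N
  κ : N
  p : ℕ
  p_ne : p ≠ 0
  m_mem : m ∈ Fus.HB.Hom (L * L) L
  η_mem : η ∈ Fus.HB.Hom 1 L
  ε_mem : ε ∈ Fus.HB.Hom L 1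
  κ_mem : κ ∈ C.Hom 1 (L.a * L.a)
  assoc : m * m = m * C.ρ L.a m
  m_η : m * η = C.one L.a
  m_ρη : m * C.ρ L.a η = C.one L.a
  comm : m * L.β L.a = m
  pairing : ε * m * C.ρ L.a κ = C.one L.a
  ltr_m : C.ltr L.a m = (p : ℂ) • ε
  ε_η : ε * η = 1
  unit : ∀ t ∈ C.Hom 1 L.a, ∃ c : ℂ, t = c • η

namespace CAlg
open LCat Fus
variable {C : Fus N Δ} (A : CAlg C)

lemma m_nat (x : N) : A.m * C.ρ A.L.a (C.ρ A.L.a x) = C.ρ A.L.a x * A.m := by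
  rw [<- C.ρ_mul]; exact C.nat A.m_mem.1 x
lemma η_nat (x : N) : A.η * x = C.ρ A.L.a x * A.η := nat_one A.η_mem.1 x
lemma ε_nat (x : N) : A.ε * C.ρ A.L.a x = x * A.ε := nat_to_one A.ε_mem.1 x

lemma m_mul_m (x : N) : A.m * (A.m * x) = A.m * (C.ρ A.L.a A.m * x) := by
  rw [<- mul_assoc, A.assoc, mul_assoc]

lemma ε_β' (c : Δ) : A.ε * A.L.β' c = C.ρ c A.ε := by
  have h := A.ε_mem.2 c
  rw [HB.one_β] at h; have h1 := congrArg (· * A.L.β' c) h; simp [mul_assoc, HB.β_mul_β'] at h1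
  have h2 := C.comp_one (C.lw A.ε_mem.1 c)
  rw [h2] at h1
  rw [<- h1, <- mul_assoc, <- A.ε_nat, mul_assoc, <- C.one_mul, C.one_comp (A.L.β'_mem c)]

lemma β'_η (c : Δ) : A.L.β' c * C.ρ c A.η = A.η * C.one c := by
  have h := A.η_mem.2 c
  rw [HB.one_β] at h; have h1 : C.ρ c A.η * C.one c = C.ρ c A.η := by
    rw [C.one_eq, <- map_mul, mul_one]
  rw [h1] at h; rw [<- h, <- mul_assoc, HB.β'_mul_β, C.one_mul, A.η_nat]

lemma m_β' : A.m * A.L.β' A.L.a = A.m := by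
  have h := congrArg (· * A.L.β' A.L.a) A.comm
  simp [mul_assoc, HB.β_mul_β'] at h
  have h2 : A.m * C.one (A.L.a * A.L.a) = A.m := C.comp_one A.m_mem.1
  rw [h2] at h; exact h.symm

lemma β'_m (c : Δ) : A.L.β' c * C.ρ c A.m = A.m * (C.ρ A.L.a (A.L.β' c) * A.L.β' c) := by
  have h := A.m_mem.2 c
  rw [HB.mul_β] at h
  have e1 : C.ρ A.L.a (C.one (c * A.L.a)) * A.L.β' c = A.L.β' c * C.ρ (c * A.L.a) (C.one A.L.a) := by
    rw [C.nat (A.L.β'_mem c), C.ρ_mul, C.one_mul]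
  have e2 : C.ρ c A.m * (A.L.β c * (A.L.β' c * C.ρ (c * A.L.a) (C.one A.L.a))) = C.ρ c A.m := by
    rw [<- mul_assoc (A.L.β c), HB.β_mul_β', C.one_mul, C.ρ_mul, <- map_mul, <- map_mul,
      C.one_eq A.L.a, <- map_mul, one_mul, <- C.one_eq, <- C.one_mul]
    exact congrArg (C.ρ c) (C.comp_one A.m_mem.1)
  have e3 := congrArg (fun x => A.L.β' c * (x * (C.ρ A.L.a (A.L.β' c) * A.L.β' c))) h
  simp [mul_assoc] at e3
  rw [<- mul_assoc (C.ρ A.L.a (A.L.β c)), <- map_mul, HB.β_mul_β', e1, e2,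
    <- mul_assoc, HB.β'_mul_β, C.one_mul, <- mul_assoc, <- m_nat, mul_assoc,
    <- mul_assoc (C.ρ A.L.a _), <- map_mul, <- C.one_mul, C.one_comp (A.L.β'_mem c)] at e3
  exact e3.symm

/-- Morphisms of the Kleisli category, i.e. of the category of free `A`-modules. -/
def Kl : Submodule ℂ N where
  carrier := {x | C.one A.L.a * x = x}
  add_mem' hx hy := by rw [Set.mem_ofPred_eq, mul_add, hx, hy]
  zero_mem' := by simp
  smul_mem' c x hx := by rw [Set.mem_ofPred_eq, mul_smul_comm, hx]

lemma one_mul_m : C.one A.L.a * A.m = A.m := C.one_comp A.m_mem.1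
lemma one_mul_η : C.one A.L.a * A.η = A.η := C.one_comp A.η_mem.1

variable {A} in

instance : Ring A.Kl :=
  { (inferInstance : AddCommGroup A.Kl) with
    mul := fun x y => ⟨A.m * (C.ρ A.L.a x * y), show _ = _ by rw [<- mul_assoc, one_mul_m]⟩
    one := ⟨A.η, A.one_mul_η⟩
    left_distrib := fun x y z => Subtype.ext (by
      change A.m * (C.ρ A.L.a x * (y + z)) = A.m * _ + A.m * _
      rw [mul_add, mul_add])
    right_distrib := fun x y z => Subtype.ext (by
      change A.m * (C.ρ A.L.a (x + y) * z) = A.m * _ + A.m * _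
      rw [map_add, add_mul, mul_add])
    zero_mul := fun x => Subtype.ext (by
      change A.m * (C.ρ A.L.a 0 * x) = 0
      simp)
    mul_zero := fun x => Subtype.ext (by
      change A.m * (C.ρ A.L.a x * 0) = 0
      simp)
    mul_assoc := fun x y z => Subtype.ext (by
      change A.m * (C.ρ A.L.a (A.m * (C.ρ A.L.a x * y)) * z)
        = A.m * (C.ρ A.L.a x * (A.m * (C.ρ A.L.a y * z)))
      rw [map_mul, map_mul, mul_assoc, <- m_mul_m, <- mul_assoc (C.ρ A.L.a x) A.m, <- m_nat]
      simp [mul_assoc])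
    one_mul := fun x => Subtype.ext (by
      change A.m * (C.ρ A.L.a A.η * x) = x
      rw [<- mul_assoc, A.m_ρη, x.2])
    mul_one := fun x => Subtype.ext (by
      change A.m * (C.ρ A.L.a x * A.η) = x
      rw [<- η_nat, <- mul_assoc, A.m_η, x.2]) }

lemma coe_mul (x y : A.Kl) : ((x * y : A.Kl) : N) = A.m * (C.ρ A.L.a x * y) := rfl

instance : Algebra ℂ A.Kl :=
  Algebra.ofModule
    (fun r x y => Subtype.ext (by
      change A.m * (C.ρ A.L.a (r • x) * y) = r • (A.m * (C.ρ A.L.a x * y))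
      simp))
    (fun r x y => Subtype.ext (by
      change A.m * (C.ρ A.L.a x * (r • y)) = r • (A.m * (C.ρ A.L.a x * y))
      simp))

/-- The free module functor on morphisms. -/
def J (t : N) : A.Kl := ⟨A.η * t, show _ = _ by rw [<- mul_assoc, one_mul_η]⟩

lemma coe_J (t : N) : (A.J t : N) = A.η * t := rfl
lemma J_one : A.J 1 = 1 := Subtype.ext (mul_one _)

lemma J_mul (s : N) (y : A.Kl) : ((A.J s * y : A.Kl) : N) = C.ρ A.L.a s * y := by
  rw [coe_mul, coe_J, map_mul, <- mul_assoc, <- mul_assoc, A.m_ρη, mul_assoc, C.one_eq, <- mul_assoc,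
    <- map_mul, one_mul]

lemma mul_J (x : A.Kl) (t : N) : ((x * A.J t : A.Kl) : N) = x * t := by
  rw [coe_mul, coe_J, <- mul_assoc (C.ρ _ _), <- η_nat, mul_assoc, <- mul_assoc, A.m_η, <- mul_assoc,
    x.2]

lemma J_mul_J (s t : N) : A.J s * A.J t = A.J (s * t) := Subtype.ext (by
  rw [mul_J, coe_J, coe_J, mul_assoc])

lemma J_sum {ι : Type*} (S : Finset ι) (f : ι -> N) : A.J (∑ i ∈ S, f i) = ∑ i ∈ S, A.J (f i) :=
  Subtype.ext (by simp [coe_J, mul_sum])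

lemma J_zero : A.J 0 = 0 := Subtype.ext (by simp [coe_J])

lemma ε_J (t : N) : A.ε * A.J t = t := by rw [coe_J, <- mul_assoc, A.ε_η, one_mul]

/-- The endomorphism of the free module on the right, as a morphism in the original category. -/
def Φ : A.Kl →ₙₐ[ℂ] N where
  toFun x := A.m * C.ρ A.L.a x
  map_smul' r x := by simp
  map_zero' := by simp
  map_add' x y := by simp [mul_add]
  map_mul' x y := by
    rw [coe_mul, map_mul, map_mul, <- m_mul_m, <- mul_assoc A.m (C.ρ _ _), m_nat]; simp [mul_assoc]

lemma Φ_apply (x : A.Kl) : A.Φ x = A.m * C.ρ A.L.a x := rfl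
lemma mul_eq_Φ (x y : A.Kl) : ((x * y : A.Kl) : N) = A.Φ x * y := by
  rw [coe_mul, Φ_apply, mul_assoc]

/-- The action of an object on Kleisli morphisms. -/
def ρ (a : Δ) : A.Kl →ₙₐ[ℂ] A.Kl where
  toFun x := ⟨A.L.β' a * C.ρ a x, show _ = _ by
    rw [<- mul_assoc, C.one_eq, Fus.ρ_one_comp (A.L.β'_mem a)]⟩
  map_smul' r x := Subtype.ext (by simp)
  map_zero' := Subtype.ext (by simp)
  map_add' x y := Subtype.ext (by simp [mul_add])
  map_mul' x y := Subtype.ext (by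
    rw [coe_mul, coe_mul, map_mul, map_mul, map_mul]; change _ * (_ * (_ * _)) = _
    rw [<- mul_assoc, β'_m]
    have h : A.L.β' a * C.ρ a (C.ρ A.L.a x) = C.ρ A.L.a (C.ρ a x) * A.L.β' a := by
      rw [<- C.ρ_mul, C.nat (A.L.β'_mem a), C.ρ_mul]
    simp [mul_assoc, reassoc h])

lemma coe_ρ (a : Δ) (x : A.Kl) : (A.ρ a x : N) = A.L.β' a * C.ρ a x := rfl

lemma ρ_J (a : Δ) (s : N) : A.ρ a (A.J s) = A.J (C.ρ a s) := Subtype.ext (by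
  rw [coe_ρ, coe_J, map_mul, <- mul_assoc, β'_η, coe_J, mul_assoc, C.one_eq, <- map_mul, one_mul])

lemma ρ_one (x : A.Kl) : A.ρ 1 x = x := Subtype.ext (by rw [coe_ρ, C.ρ_one, A.L.one', x.2])

lemma ρ_mul (a b : Δ) (x : A.Kl) : A.ρ (a * b) x = A.ρ a (A.ρ b x) := Subtype.ext (by
  rw [coe_ρ, coe_ρ, coe_ρ, C.ρ_mul, A.L.mul', map_mul, mul_assoc])

lemma ε_ρ (s : N) (c : Δ) (t : A.Kl) (r : N) :
    A.ε * (A.J s * A.ρ c t * A.J r : A.Kl) = s * C.ρ c (A.ε * t) * r := by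
  rw [mul_J, J_mul, coe_ρ, <- mul_assoc, <- mul_assoc, ε_nat, map_mul, <- ε_β']; simp [mul_assoc]

section Mdl
variable {O : Type w} [MulAction Δ O] (M : Mdl C O)

variable {M} in
lemma coe_mem {X Y : O} {t : N} (ht : t ∈ M.Hom X (A.L.a • Y)) : t ∈ A.Kl := by
  change _ = _
  rw [C.one_eq, Mdl.ρ_one_comp ht]

/-- Morphisms of free modules are adjoint to morphisms into the underlying object. -/
def homEquiv (X Y : O) : (M.Hom X (A.L.a • Y)).comap A.Kl.subtype ≃ₗ[ℂ] M.Hom X (A.L.a • Y) where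
  toFun t := ⟨t.1.1, t.2⟩
  map_add' _ _ := rfl
  map_smul' _ _ := rfl
  invFun t := ⟨⟨t.1, A.coe_mem t.2⟩, t.2⟩
  left_inv _ := rfl
  right_inv _ := rfl

variable {M} in
lemma Φ_mem {X Y : O} {t : A.Kl} (ht : (t : N) ∈ M.Hom X (A.L.a • Y)) :
    A.Φ t ∈ M.Hom (A.L.a • X) (A.L.a • Y) :=
  Mdl.comp_w A.m_mem.1 (M.lw ht _) (smul_smul _ _ _) rfl

variable {M} in
lemma tr_Φ {X : O} {t : A.Kl} (ht : (t : N) ∈ M.Hom X (A.L.a • X)) :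
    M.tr (A.L.a • X) (A.Φ t) = A.p * M.tr X (A.ε * t) := by
  rw [M.tr_left (A.Φ_mem ht), Φ_apply, ltr_mul_right, A.ltr_m, smul_mul_assoc, map_smul, smul_eq_mul]

lemma Φ_pow (t : A.Kl) (k : ℕ) : A.Φ t ^ (k + 1) = A.Φ (t ^ (k + 1)) := by
  induction k with
  | zero => simp
  | succ k ih => rw [pow_succ, ih, <- map_mul, <- pow_succ]

/-- The category of free `A`-modules in `M`. -/
def kl : LCat A.Kl O where
  one X := A.J (M.one X)
  Hom X Y := (M.Hom X (A.L.a • Y)).comap A.Kl.subtype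
  one_mem X := Mdl.comp_w A.η_mem.1 (M.one_mem X) (MulAction.one_smul X).symm rfl
  comp_mem {X Y Z s t} hs ht := by
    change _ ∈ M.Hom _ _
    rw [Submodule.subtype_apply, coe_mul]
    exact Mdl.comp_w A.m_mem.1 (M.comp_mem (M.lw hs _) ht) (smul_smul _ _ _) rfl
  comp_one {X Y t} ht := Subtype.ext ((A.mul_J t _).trans (M.comp_one ht))
  one_comp {X Y t} ht := Subtype.ext ((A.J_mul _ t).trans (by
    rw [<- M.one_smul]; exact M.one_comp ht))
  fin X Y := by
    have := M.fin X (A.L.a • Y)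
    exact Module.Finite.equiv (A.homEquiv M X Y).symm
  tr X := (M.tr X).comp ((mulLeft ℂ A.ε).comp A.Kl.subtype)
  tr_comm {X Y s t} hs ht := by
    have h1 : M.tr (A.L.a • X) (A.Φ (s * t)) = M.tr (A.L.a • Y) (A.Φ (t * s)) := by
      rw [map_mul A.Φ, map_mul A.Φ]; exact M.tr_comm (A.Φ_mem hs) (A.Φ_mem ht)
    have h2 : ∀ {X Y : O} {s t : A.Kl}, (s : N) ∈ M.Hom Y (A.L.a • X) -> (t : N) ∈ M.Hom X (A.L.a • Y) ->
        ((s * t : A.Kl) : N) ∈ M.Hom X (A.L.a • X) := fun hs ht =>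
      Mdl.comp_w A.m_mem.1 (M.comp_mem (M.lw hs _) ht) (smul_smul _ _ _) rfl
    rw [tr_Φ A (h2 hs ht), tr_Φ A (h2 ht hs)] at h1
    exact mul_left_cancel₀ (Nat.cast_ne_zero.2 A.p_ne) h1
  tr_nondeg {X Y t} ht h := by
    refine Subtype.ext (M.tr_nondeg ht fun r hr => ?_)
    have hs :=
      M.comp_mem (M.lw hr _) (Mdl.comp_w A.κ_mem (M.one_mem Y) (MulAction.one_smul Y).symm
        (smul_smul _ _ _))
    have h1 := h ⟨_, A.coe_mem hs⟩ hs
    change M.tr X (A.ε * (A.m * (C.ρ A.L.a (C.ρ A.L.a r * (A.κ * M.one Y)) * t))) = 0 at h1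
    have h2 : C.ρ A.L.a (M.one Y) * t = t := by rw [<- M.one_smul]; exact M.one_comp ht
    have h3 := t.2
    rwa [map_mul (C.ρ A.L.a), map_mul (C.ρ A.L.a), mul_assoc, mul_assoc, h2, <- mul_assoc A.m, m_nat, mul_assoc,
      <- mul_assoc, ε_nat, mul_assoc, <- mul_assoc A.m, <- mul_assoc A.ε, <- mul_assoc A.ε,
      A.pairing, h3] at h1
  tr_nilp {X t} ht hn := by
    obtain ⟨k, hk⟩ := hn
    have h0 : IsNilpotent (A.Φ t) := ⟨k + 1, by rw [Φ_pow, pow_succ, hk, zero_mul, map_zero]⟩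
    have h1 := M.tr_nilp (A.Φ_mem ht) h0
    rw [tr_Φ A ht] at h1; exact (mul_eq_zero.1 h1).resolve_left (Nat.cast_ne_zero.2 A.p_ne)
  gen := by
    obtain ⟨S, hS⟩ := M.gen; refine ⟨S, fun X Y s hs h0 => ?_⟩
    obtain ⟨G, hG, t, ht, h1⟩ := hS X (A.L.a • Y) s hs (fun h => h0 (Subtype.ext h))
    refine ⟨G, hG, A.J t, Mdl.comp_w A.η_mem.1 ht (MulAction.one_smul X).symm rfl, fun h => h1 ?_⟩
    rw [<- mul_J, h]; rfl

variable {M}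

lemma mem_kl {X Y : O} {t : A.Kl} : t ∈ (A.kl M).Hom X Y ↔ (t : N) ∈ M.Hom X (A.L.a • Y) := Iff.rfl

lemma J_mem {X Y : O} {t : N} (ht : t ∈ M.Hom X Y) : A.J t ∈ (A.kl M).Hom X Y :=
  Mdl.comp_w A.η_mem.1 ht (MulAction.one_smul Y).symm rfl

lemma tr_kl (X : O) (t : A.Kl) : (A.kl M).tr X t = M.tr X (A.ε * t) := rfl
lemma tr_J (X : O) (t : N) : (A.kl M).tr X (A.J t) = M.tr X t := by rw [tr_kl, ε_J]

lemma isSum_J {ι : Type*} [Fintype ι] {X : O} {Y : ι -> O} {s s' : ι -> N} (h : M.IsSum X Y s s') :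
    (A.kl M).IsSum X Y (fun k => A.J (s k)) (fun k => A.J (s' k)) where
  mem k := A.J_mem (h.mem k)
  mem' k := A.J_mem (h.mem' k)
  same k := by rw [J_mul_J, h.same]; rfl
  diff k l hkl := by rw [J_mul_J, h.diff k l hkl, J_zero]
  sum := by simp_rw [J_mul_J, <- J_sum, h.sum]; rfl

lemma ρ_mem {X Y : O} {t : A.Kl} (ht : t ∈ (A.kl M).Hom X Y) (c : Δ) :
    A.ρ c t ∈ (A.kl M).Hom (c • X) (c • Y) :=
  Mdl.comp_w (A.L.β'_mem c) (M.lw ht c) (smul_smul _ _ _) (smul_smul _ _ _)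

lemma mul_ρ_mem {a b : Δ} {t : A.Kl} (ht : (t : N) ∈ C.Hom a (A.L.a * b)) (X : O) :
    t * A.ρ a (A.J (M.one X)) ∈ (A.kl M).Hom (a • X) (b • X) := by
  rw [mem_kl, ρ_J, mul_J, smul_smul]; exact M.rw ht X

lemma tr_kl_left {a : Δ} {X Y : O} {t : A.Kl} (ht : t ∈ (A.kl M).Hom X (a • Y)) :
    A.ε * (t : N) ∈ M.Hom X (a • Y) :=
  Mdl.comp_w A.ε_mem.1 ht rfl (MulAction.one_smul _).symm

end Mdl

/-- The fusion category of free `A`-modules. -/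
def fus : Fus A.Kl Δ where
  toLCat := A.kl (Mdl.regular C)
  ρ := A.ρ
  ρ_one := A.ρ_one
  ρ_mul := A.ρ_mul
  one_eq a := by rw [<- J_one, ρ_J, <- C.one_eq]; rfl
  nat {a b t} ht x := Subtype.ext (by
    have ht' : (t : N) ∈ C.Hom a (A.L.a * b) := ht
    rw [coe_mul, coe_mul, coe_ρ, coe_ρ, map_mul, <- mul_assoc (C.ρ A.L.a t), A.L.nat' ht', A.L.mul']
    have h := C.nat ht' (x : N)
    rw [C.ρ_mul] at h; rw [mul_assoc (C.ρ _ _), <- h]; simp only [<- mul_assoc]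
    rw [m_β'])
  lw ht c := A.ρ_mem ht c
  rw ht c := A.mul_ρ_mem ht c
  unit t ht := by
    have ht' : (t : N) ∈ C.Hom 1 (A.L.a * 1) := ht
    rw [mul_one] at ht'; obtain ⟨c, hc⟩ := A.unit t ht'; exact ⟨c, Subtype.ext hc⟩
  one_ne h := by
    have h1 : A.η = 0 := congrArg Subtype.val h
    have h2 := A.ε_η
    rw [h1, mul_zero] at h2; exact C.one_ne h2.symm
  tr_unit := (congrArg (C.tr 1) A.ε_η).trans C.tr_unit
  sum Y := by obtain ⟨X, s, s', h⟩ := C.sum Y; exact ⟨X, _, _, A.isSum_J h⟩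
  rat a := by obtain ⟨r, hr, h⟩ := C.rat a; exact ⟨r, hr, (A.tr_J a (C.one a)).trans h⟩
  cj := C.cj
  cv a := A.J (C.cv a)
  ev a := A.J (C.ev a)
  cv' a := A.J (C.cv' a)
  ev' a := A.J (C.ev' a)
  cv_mem a := A.J_mem (C.cv_mem a)
  ev_mem a := A.J_mem (C.ev_mem a)
  cv'_mem a := A.J_mem (C.cv'_mem a)
  ev'_mem a := A.J_mem (C.ev'_mem a)
  zig a := by rw [ρ_J, J_mul_J, C.zig]; rfl
  zag a := by rw [ρ_J, J_mul_J, C.zag]; rfl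
  zig' a := by rw [ρ_J, J_mul_J, C.zig']; rfl
  zag' a := by rw [ρ_J, J_mul_J, C.zag']; rfl
  tr_left ht := by rw [tr_kl, tr_kl, ε_ρ]; exact C.tr_left (A.tr_kl_left ht)
  tr_left' ht := by rw [tr_kl, tr_kl, ε_ρ]; exact C.tr_left' (A.tr_kl_left ht)
  tr_right ht := by
    rw [tr_kl, tr_kl, ρ_J, ρ_J, mul_J, J_mul, <- mul_assoc, <- mul_assoc, ε_nat, mul_assoc (C.ρ _ _)]
    exact C.tr_right (A.tr_kl_left ht)
  tr_right' ht := by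
    rw [tr_kl, tr_kl, ρ_J, ρ_J, mul_J, J_mul, <- mul_assoc, <- mul_assoc, ε_nat, mul_assoc (C.ρ _ _)]
    exact C.tr_right' (A.tr_kl_left (M := Mdl.regular C) ht)

/-- Free `A`-modules in `M`, as a module category over free `A`-modules in `C`. -/
def mdl {O : Type w} [MulAction Δ O] (M : Mdl C O) : Mdl A.fus O where
  toLCat := A.kl M
  one_smul a X := by
    change A.J (M.one (a • X)) = A.ρ a (A.J (M.one X))
    rw [ρ_J, M.one_smul]
  lw ht a := A.ρ_mem ht a
  rw ht X := A.mul_ρ_mem ht X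
  tr_left ht := by
    rw [tr_kl, tr_kl]; refine (M.tr_left (A.tr_kl_left ht)).trans (congrArg _ ?_)
    exact (A.ε_ρ _ _ _ _).symm

end CAlg

namespace LCat
variable {O : Type u} (C : LCat N O)

/-- Objects of the idempotent completion. -/
@[ext] structure Kar where
  X : O
  f : N
  mem : f ∈ C.Hom X X
  idem : f * f = f

variable {C}

/-- Morphisms of the idempotent completion. -/
def Kar.Hom (P Q : C.Kar) : Submodule ℂ N where
  carrier := {t | t ∈ C.Hom P.X Q.X ∧ Q.f * t = t ∧ t * P.f = t}
  add_mem' hs ht := ⟨Submodule.add_mem _ hs.1 ht.1, by rw [mul_add, hs.2.1, ht.2.1],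
    by rw [add_mul, hs.2.2, ht.2.2]⟩
  zero_mem' := ⟨Submodule.zero_mem _, mul_zero _, zero_mul _⟩
  smul_mem' r t ht := ⟨Submodule.smul_mem _ _ ht.1, by rw [mul_smul_comm, ht.2.1],
    by rw [smul_mul_assoc, ht.2.2]⟩

lemma Kar.mul_mul_mem (P Q : C.Kar) {t : N} (ht : t ∈ C.Hom P.X Q.X) :
    Q.f * t * P.f ∈ Kar.Hom P Q :=
  ⟨C.comp_mem (C.comp_mem Q.mem ht) P.mem, by rw [<- mul_assoc, <- mul_assoc, Q.idem],
    by rw [mul_assoc, P.idem]⟩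

variable (C)

/-- The inclusion of objects into the idempotent completion. -/
def toKar (X : O) : C.Kar := ⟨X, C.one X, C.one_mem X, one_mul_one X⟩

variable {C} in
lemma mem_toKar {X Y : O} {t : N} : t ∈ Kar.Hom (C.toKar X) (C.toKar Y) ↔ t ∈ C.Hom X Y :=
  ⟨fun h => h.1, fun h => ⟨h, C.one_comp h, C.comp_one h⟩⟩

/-- The idempotent completion. -/
def kar : LCat N C.Kar where
  one P := P.f
  Hom := Kar.Hom
  one_mem P := ⟨P.mem, P.idem, P.idem⟩
  comp_mem hs ht := ⟨C.comp_mem hs.1 ht.1, by rw [<- mul_assoc, hs.2.1], by rw [mul_assoc, ht.2.2]⟩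
  comp_one ht := ht.2.2
  one_comp ht := ht.2.1
  fin P Q := by
    have := C.fin P.X Q.X
    exact Submodule.finiteDimensional_of_le (fun t (ht : t ∈ Kar.Hom P Q) => ht.1)
  tr P := C.tr P.X
  tr_comm hs ht := C.tr_comm hs.1 ht.1
  tr_nondeg {P Q t} ht h := by
    refine C.tr_nondeg ht.1 fun s hs => ?_
    have h1 := h _ (Q.mul_mul_mem P hs)
    have h2 := C.tr_comm P.mem (C.comp_mem hs ht.1)
    rwa [mul_assoc, ht.2.1, mul_assoc, h2, mul_assoc, ht.2.2] at h1
  tr_nilp ht hn := C.tr_nilp ht.1 hn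
  gen := by
    classical
    obtain ⟨S, hS⟩ := C.gen; refine ⟨S.image C.toKar, fun P Q s hs h0 => ?_⟩
    obtain ⟨G, hG, t, ht, h1⟩ := hS _ _ s hs.1 h0
    refine ⟨_, mem_image_of_mem _ hG, P.f * t, ⟨C.comp_mem P.mem ht, ?_, ?_⟩, ?_⟩
    . rw [<- mul_assoc, P.idem]
    . rw [mul_assoc]; exact congrArg _ (C.comp_one ht)
    . rwa [<- mul_assoc, hs.2.2]

instance : C.kar.Split where
  split {P e} he hee := ⟨⟨P.X, e, he.1, hee⟩, e, e, ⟨he.1, he.2.1, hee⟩, ⟨he.1, hee, he.2.2⟩, hee, hee⟩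

variable {C}

lemma isSum_kar {ι : Type*} [Fintype ι] {X : O} {P : ι -> C.Kar} {s s' : ι -> N}
    (h : C.IsSum X (fun k => (P k).X) s s') :
    ∃ Q : C.Kar, C.kar.IsSum Q P (fun k => s k * (P k).f) (fun k => (P k).f * s' k) := by
  classical
  have hm := fun k => C.comp_mem (h.mem k) (P k).mem
  have hm' := fun k => C.comp_mem (P k).mem (h.mem' k)
  have hsame : ∀ k, (P k).f * s' k * (s k * (P k).f) = (P k).f := fun k => by
    rw [mul_assoc, <- mul_assoc (s' k), h.same, C.one_comp (P k).mem, (P k).idem]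
  have hdiff : ∀ k l, k ≠ l -> (P k).f * s' k * (s l * (P l).f) = 0 := fun k l hkl => by
    rw [mul_assoc, <- mul_assoc (s' k), h.diff k l hkl, zero_mul, mul_zero]
  have hl : ∀ k, (∑ j, s j * (P j).f * ((P j).f * s' j)) * (s k * (P k).f) = s k * (P k).f := by
    intro k; rw [sum_mul, sum_eq_single k]
    . rw [mul_assoc, hsame, mul_assoc, (P k).idem]
    . intro j _ hj; rw [mul_assoc, hdiff j k hj, mul_zero]
    . simp
  have hr : ∀ k, (P k).f * s' k * (∑ j, s j * (P j).f * ((P j).f * s' j)) = (P k).f * s' k := by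
    intro k; rw [mul_sum, sum_eq_single k]
    . rw [<- mul_assoc, hsame, <- mul_assoc, (P k).idem]
    . intro j _ hj; rw [<- mul_assoc, hdiff k j hj.symm, zero_mul]
    . simp
  refine ⟨⟨X, ∑ j, s j * (P j).f * ((P j).f * s' j),
    Submodule.sum_mem _ fun j _ => C.comp_mem (hm j) (hm' j), ?_⟩, fun k => ⟨hm k, hl k, ?_⟩,
    fun k => ⟨hm' k, ?_, hr k⟩, hsame, hdiff, rfl⟩
  . rw [mul_sum]; exact sum_congr rfl fun k _ => by rw [<- mul_assoc, hl]
  . rw [mul_assoc, (P k).idem]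
  . rw [<- mul_assoc, (P k).idem]

end LCat

namespace Fus
open LCat
variable (C : Fus N Δ)

variable {C} in
lemma mul_ρ_mem {a b c e : Δ} {s t : N} (hs : s ∈ C.Hom a b) (ht : t ∈ C.Hom c e) :
    s * C.ρ a t ∈ C.Hom (a * c) (b * e) := comp_w hs (C.lw ht a) e rfl rfl

instance : Monoid C.Kar where
  mul P Q := ⟨P.X * Q.X, P.f * C.ρ P.X Q.f, mul_ρ_mem P.mem Q.mem, by
    rw [mul_assoc, <- mul_assoc _ P.f, <- C.nat P.mem, mul_assoc, <- map_mul, Q.idem, <- mul_assoc, P.idem]⟩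
  one := ⟨1, 1, C.one_mem_one, mul_one 1⟩
  mul_assoc P Q R := Kar.ext (mul_assoc _ _ _) (by
    change P.f * C.ρ P.X Q.f * C.ρ (P.X * Q.X) R.f = P.f * C.ρ P.X (Q.f * C.ρ Q.X R.f)
    rw [C.ρ_mul, map_mul, mul_assoc])
  one_mul P := Kar.ext (one_mul _) (by
    change 1 * C.ρ 1 P.f = P.f
    rw [C.ρ_one, one_mul])
  mul_one P := Kar.ext (mul_one _) (by
    change P.f * C.ρ P.X 1 = P.f
    rw [<- C.one_eq, C.comp_one P.mem])

@[simp] lemma kar_mul_X (P Q : C.Kar) : (P * Q).X = P.X * Q.X := rfl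
@[simp] lemma kar_mul_f (P Q : C.Kar) : (P * Q).f = P.f * C.ρ P.X Q.f := rfl
@[simp] lemma kar_one_X : (1 : C.Kar).X = 1 := rfl
@[simp] lemma kar_one_f : (1 : C.Kar).f = 1 := rfl

/-- The action of an object of the idempotent completion. -/
def karρ (P : C.Kar) : N →ₙₐ[ℂ] N where
  toFun x := P.f * C.ρ P.X x
  map_smul' r x := by simp
  map_zero' := by simp
  map_add' x y := by rw [map_add, mul_add]
  map_mul' x y := by
    rw [mul_assoc, <- mul_assoc _ P.f, <- C.nat P.mem, mul_assoc, <- map_mul, <- mul_assoc, P.idem]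

lemma karρ_apply (P : C.Kar) (x : N) : C.karρ P x = P.f * C.ρ P.X x := rfl

/-- The transpose of an endomorphism. -/
def tp (a : Δ) (f : N) : N := C.ρ (C.cj a) (C.ev a * f) * C.cv a

variable {C}
section tp
variable {a b : Δ} {f g : N}

lemma tp_mem (hf : f ∈ C.Hom a a) : C.tp a f ∈ C.Hom (C.cj a) (C.cj a) := by
  have h1 := w_comp (C.ev_mem a) hf (C.cj a) rfl rfl
  exact w_comp (lw_eq h1 (C.cj a) rfl (mul_one _).symm) (C.cv_mem a) (C.cj a)
    (by simp [mul_assoc]) (by simp)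

lemma tp_cv (hf : f ∈ C.Hom a a) : C.tp a f * C.cv a = C.ρ (C.cj a) f * C.cv a := by
  rw [tp, mul_assoc, nat_one (C.cv_mem a) (C.cv a), C.ρ_mul, <- mul_assoc, <- map_mul, mul_assoc, C.nat hf,
    <- mul_assoc, C.zig, C.one_comp hf]

lemma ev_tp (hf : f ∈ C.Hom a a) : C.ev a * C.ρ a (C.tp a f) = C.ev a * f := by
  have h1 := w_comp (C.ev_mem a) hf (C.cj a) rfl rfl
  rw [tp, map_mul, <- mul_assoc, <- C.ρ_mul, nat_to_one (C.ev_mem a), mul_assoc, C.zig, C.one_eq,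
    comp_ρ_one h1]

lemma tp_eq (hf : f ∈ C.Hom a a) : C.tp a f = C.ev' a * C.ρ (C.cj a) (f * C.cv' a) := by
  have h1 := comp_w hf (C.cv'_mem a) (C.cj a) rfl rfl
  have hm : C.ev' a * C.ρ (C.cj a) (f * C.cv' a) ∈ C.Hom (C.cj a) (C.cj a) :=
    comp_w (C.ev'_mem a) (lw_eq h1 (C.cj a) (mul_one _).symm rfl) (C.cj a) (by simp [mul_assoc]) (by simp)
  refine eq_of_tr (tp_mem hf) hm fun s hs => ?_
  have key : ∀ t ∈ C.Hom (C.cj a) (C.cj a), C.tr (C.cj a) t = C.tr 1 (C.ev a * C.ρ a t * C.cv' a) := by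
    intro t ht; have := C.tr_left' (b := 1) (by simpa using ht); rwa [mul_one] at this
  rw [C.tr_comm hs (tp_mem hf), key _ (C.comp_mem (tp_mem hf) hs), key _ (C.comp_mem hs hm),
    map_mul (C.ρ a), <- mul_assoc, ev_tp hf, map_mul (C.ρ a), map_mul (C.ρ a)]
  congr 1; have e : C.ρ a (C.ρ (C.cj a) (f * C.cv' a)) * C.cv' a = C.cv' a * (f * C.cv' a) := by
    rw [nat_one (C.cv'_mem a) (f * C.cv' a), C.ρ_mul]
  simp only [mul_assoc]; rw [e, reassoc' (C.zag' a), reassoc' (C.one_comp hf), reassoc (C.nat hf s)]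

lemma tp_cv' (hf : f ∈ C.Hom a a) : C.ρ a (C.tp a f) * C.cv' a = f * C.cv' a := by
  have h1 := comp_w hf (C.cv'_mem a) (C.cj a) rfl rfl
  rw [tp_eq hf, map_mul, mul_assoc, <- C.ρ_mul, <- nat_one (C.cv'_mem a), <- mul_assoc, C.zag', C.one_eq,
    ρ_one_comp h1]

lemma ev'_tp (hf : f ∈ C.Hom a a) : C.ev' a * C.tp a f = C.ev' a * C.ρ (C.cj a) f := by
  rw [tp_eq hf, <- mul_assoc, <- nat_to_one (C.ev'_mem a) (C.ev' a), mul_assoc, C.ρ_mul, <- map_mul,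
    <- mul_assoc, <- C.nat hf, mul_assoc, C.zag', C.comp_one hf]

lemma tp_mul (hf : f ∈ C.Hom a a) : C.tp a f * C.tp a f = C.tp a (f * f) := by
  have h : C.tp a f * C.tp a f = C.ρ (C.cj a) (C.ev a * f) * C.cv a * C.tp a f := rfl
  rw [h, mul_assoc, nat_one (C.cv_mem a), C.ρ_mul, <- mul_assoc, <- map_mul, mul_assoc, C.nat hf, <- mul_assoc,
    ev_tp hf, mul_assoc]
  rfl

end tp

lemma tp_idem (P : C.Kar) : C.tp P.X P.f * C.tp P.X P.f = C.tp P.X P.f := by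
  rw [tp_mul P.mem, P.idem]

lemma ltr_kar (P : C.Kar) {t : N} (e1 : P.f * t = t) (e2 : t * P.f = t) :
    C.ev' P.X * C.ρ (C.cj P.X) t * C.cv P.X
      = C.ev' P.X * C.ρ (C.cj P.X) P.f * (C.tp P.X P.f * C.ρ (C.cj P.X) t)
      * (C.ρ (C.cj P.X) P.f * C.cv P.X) := by
  rw [<- ev'_tp P.mem, mul_assoc (C.ev' _) (C.tp _ _), <- mul_assoc (C.tp _ _), tp_idem, <- mul_assoc (C.ev' _),
    ev'_tp P.mem, mul_assoc (C.ev' _) (C.ρ _ P.f), <- map_mul, e1, mul_assoc, mul_assoc,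
    <- mul_assoc (C.ρ _ t) (C.ρ _ P.f), <- map_mul, e2]

/-- The dual of an object of the idempotent completion. -/
def karCj (P : C.Kar) : C.Kar := ⟨C.cj P.X, C.tp P.X P.f, tp_mem P.mem, tp_idem P⟩

@[simp] lemma karCj_X (P : C.Kar) : (karCj P).X = C.cj P.X := rfl
@[simp] lemma karCj_f (P : C.Kar) : (karCj P).f = C.tp P.X P.f := rfl

lemma kar_comp {P Q : C.Kar} {t : N} (h1 : P.f * C.ρ P.X Q.f * t = t) (h2 : t * (P.f * C.ρ P.X Q.f) = t) :
    P.f * t = t ∧ t * P.f = t ∧ C.ρ P.X Q.f * t = t ∧ t * C.ρ P.X Q.f = t := by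
  refine ⟨?_, ?_, ?_, ?_⟩
  . rw [<- h1, <- mul_assoc, <- mul_assoc, P.idem]
  . rw [<- h2, mul_assoc, mul_assoc, <- C.nat P.mem, <- mul_assoc P.f, P.idem]
  . rw [<- h1, <- mul_assoc, <- mul_assoc, <- C.nat P.mem, mul_assoc P.f, <- map_mul, Q.idem]
  . rw [<- h2, mul_assoc, mul_assoc, <- map_mul, Q.idem]

variable (C)

/-- The idempotent completion of a fusion category. -/
def kar (rat : ∀ P : C.Kar, ∃ r : ℚ, 0 ≤ r ∧ C.tr P.X P.f = r) : Fus N C.Kar where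
  toLCat := C.toLCat.kar
  ρ := C.karρ
  ρ_one x := by rw [karρ_apply, kar_one_f, kar_one_X, C.ρ_one, one_mul]
  ρ_mul P Q x := by
    rw [karρ_apply, karρ_apply, karρ_apply, kar_mul_f, kar_mul_X, C.ρ_mul, map_mul, mul_assoc]
  one_eq P := by rw [karρ_apply, <- C.one_eq, C.comp_one P.mem]; rfl
  nat {P Q t} ht x := by
    rw [karρ_apply, karρ_apply, <- mul_assoc, ht.2.2, mul_assoc, <- C.nat ht.1, <- mul_assoc, ht.2.1]
  lw {P Q t} ht R := by
    refine ⟨mul_ρ_mem R.mem ht.1, ?_, ?_⟩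
    . rw [karρ_apply, kar_mul_f, mul_assoc, <- mul_assoc _ R.f, <- C.nat R.mem, mul_assoc, <- map_mul,
        ht.2.1, <- mul_assoc, R.idem]
    . rw [karρ_apply, kar_mul_f, mul_assoc, <- mul_assoc _ R.f, <- C.nat R.mem, mul_assoc, <- map_mul,
        ht.2.2, <- mul_assoc, R.idem]
  rw {P Q t} ht R := by
    have e : t * C.karρ P R.f = t * C.ρ P.X R.f := by rw [karρ_apply, <- mul_assoc, ht.2.2]
    change t * C.karρ P R.f ∈ Kar.Hom _ _
    rw [e]; refine ⟨mul_ρ_mem ht.1 R.mem, ?_, ?_⟩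
    . rw [kar_mul_f, mul_assoc, <- mul_assoc _ t, <- C.nat ht.1, mul_assoc, <- map_mul, R.idem, <- mul_assoc,
        ht.2.1]
    . rw [kar_mul_f, mul_assoc, <- mul_assoc _ P.f, <- C.nat P.mem, mul_assoc, <- map_mul, R.idem,
        <- mul_assoc, ht.2.2]
  unit t ht := C.unit t ht.1
  one_ne := C.one_ne
  tr_unit := C.tr_unit
  sum Y := by
    obtain ⟨X, s, s', h⟩ := C.sum fun k => (Y k).X
    obtain ⟨Q, hQ⟩ := isSum_kar h; exact ⟨Q, _, _, hQ⟩
  rat := rat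
  cj := karCj
  cv P := C.ρ (C.cj P.X) P.f * C.cv P.X
  ev P := C.ev P.X * P.f
  cv' P := P.f * C.cv' P.X
  ev' P := C.ev' P.X * C.ρ (C.cj P.X) P.f
  cv_mem P := by
    refine ⟨C.comp_mem (C.lw P.mem _) (C.cv_mem _), ?_, mul_one _⟩
    rw [kar_mul_f, karCj_f, karCj_X, mul_assoc, <- mul_assoc (C.ρ _ _), <- map_mul, P.idem, <- tp_cv P.mem,
      <- mul_assoc, tp_idem]
  ev_mem P := by
    refine ⟨w_comp (C.ev_mem _) P.mem _ rfl rfl, one_mul _, ?_⟩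
    rw [kar_mul_f, karCj_f, mul_assoc, <- mul_assoc P.f, P.idem, C.nat P.mem, <- mul_assoc, ev_tp P.mem, mul_assoc,
      P.idem]
  cv'_mem P := by
    refine ⟨comp_w P.mem (C.cv'_mem _) _ rfl rfl, ?_, mul_one _⟩
    rw [kar_mul_f, karCj_f, mul_assoc, <- mul_assoc (C.ρ _ _), <- C.nat P.mem, mul_assoc, tp_cv' P.mem,
      <- mul_assoc, <- mul_assoc, P.idem, P.idem]
  ev'_mem P := by
    refine ⟨C.comp_mem (C.ev'_mem _) (C.lw P.mem _), one_mul _, ?_⟩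
    rw [kar_mul_f, karCj_f, karCj_X, <- mul_assoc, mul_assoc _ (C.ρ _ _), <- C.nat (tp_mem P.mem), <- mul_assoc, ev'_tp P.mem,
      mul_assoc, mul_assoc, <- map_mul, <- map_mul, P.idem, P.idem]
  zig P := by
    change C.ev P.X * P.f * C.karρ P (C.ρ (C.cj P.X) P.f * C.cv P.X) = P.f
    rw [karρ_apply, mul_assoc, <- mul_assoc P.f, P.idem, C.nat P.mem, map_mul, <- mul_assoc, <- mul_assoc,
      <- C.ρ_mul, nat_to_one (C.ev_mem _), mul_assoc, mul_assoc, <- mul_assoc (C.ev _), C.zig,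
      C.one_comp P.mem, P.idem]
  zag P := by
    rw [karρ_apply, karCj_f, karCj_X, mul_assoc, <- mul_assoc (C.ρ _ _), <- map_mul, mul_assoc, P.idem]
    exact tp_idem P
  zig' P := by
    change C.ev' P.X * C.ρ (C.cj P.X) P.f * C.karρ (karCj P) (P.f * C.cv' P.X) = C.tp P.X P.f
    rw [karρ_apply, karCj_f, karCj_X, C.nat (tp_mem P.mem), mul_assoc, <- mul_assoc (C.ρ _ _), <- map_mul,
      <- mul_assoc P.f, P.idem, <- mul_assoc, <- tp_eq P.mem, tp_idem]
  zag' P := by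
    change C.karρ P (C.ev' P.X * C.ρ (C.cj P.X) P.f) * (P.f * C.cv' P.X) = P.f
    have e : C.ρ P.X (C.ρ (C.cj P.X) P.f) * C.cv' P.X = C.cv' P.X * P.f := by
      rw [nat_one (C.cv'_mem _), C.ρ_mul]
    rw [karρ_apply, mul_assoc, <- mul_assoc _ P.f, <- C.nat P.mem, mul_assoc, map_mul, mul_assoc, e,
      <- mul_assoc (C.ρ _ _), C.zag', C.one_comp P.mem, P.idem, P.idem]
  tr_left {P Q t} ht := by
    obtain ⟨e1, e2, -, -⟩ := kar_comp ht.2.1 ht.2.2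
    exact (C.tr_left ht.1).trans (congrArg _ (ltr_kar P e1 e2))
  tr_left' {P Q t} ht := by
    obtain ⟨e1, e2, -, -⟩ := kar_comp ht.2.1 ht.2.2; rw [karCj_f] at e1 e2
    refine (C.tr_left' ht.1).trans (congrArg _ ?_)
    change C.ev P.X * C.ρ P.X t * C.cv' P.X = C.ev P.X * P.f * (P.f * C.ρ P.X t) * (P.f * C.cv' P.X)
    rw [mul_assoc (C.ev P.X) P.f, <- mul_assoc P.f P.f, P.idem, <- tp_cv' P.mem, <- mul_assoc (C.ev _) P.f,
      <- ev_tp P.mem, mul_assoc (C.ev _) _ (C.ρ _ t), <- map_mul, e1, <- mul_assoc (_ * _) _ (C.cv' _),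
      mul_assoc (C.ev _) _ (C.ρ _ _), <- map_mul, e2]
  tr_right {P Q t} ht := by
    obtain ⟨e1, e2, e3, e4⟩ := kar_comp ht.2.1 ht.2.2; refine (C.tr_right ht.1).trans (congrArg _ ?_)
    change _ = Q.f * C.ρ Q.X (C.ev P.X * P.f) * t * (Q.f * C.ρ Q.X (P.f * C.cv' P.X))
    rw [C.nat Q.mem, map_mul, map_mul, mul_assoc (_ * _) Q.f, e1, mul_assoc _ _ t, e3,
      mul_assoc, mul_assoc, reassoc' e2, reassoc' e4]
  tr_right' {P Q t} ht := by
    obtain ⟨e1, e2, e3, e4⟩ := kar_comp ht.2.1 ht.2.2; rw [karCj_f] at e3 e4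
    refine (C.tr_right' ht.1).trans (congrArg _ ?_)
    change _ = Q.f * C.ρ Q.X (C.ev' P.X * C.ρ (C.cj P.X) P.f) * t
      * (Q.f * C.ρ Q.X (C.ρ (C.cj P.X) P.f * C.cv P.X))
    rw [<- ev'_tp P.mem, <- tp_cv P.mem, C.nat Q.mem, map_mul, map_mul, mul_assoc (_ * _) Q.f, e1,
      mul_assoc _ _ t, e3, mul_assoc, mul_assoc, reassoc' e2, reassoc' e4]

instance (rat) : (C.kar rat).Split := inferInstanceAs C.toLCat.kar.Split

end Fus

namespace Mdl
open LCat
variable {C : Fus N Δ} {O : Type w} [MulAction Δ O] (M : Mdl C O)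

variable {M} in
lemma mul_ρ_mem {a b : Δ} {X Y : O} {s t : N} (hs : s ∈ C.Hom a b) (ht : t ∈ M.Hom X Y) :
    s * C.ρ a t ∈ M.Hom (a • X) (b • Y) := comp_w hs (M.lw ht a) rfl rfl

instance : MulAction C.Kar M.Kar where
  smul P Q := ⟨P.X • Q.X, P.f * C.ρ P.X Q.f, mul_ρ_mem P.mem Q.mem, by
    rw [mul_assoc, <- mul_assoc _ P.f, <- C.nat P.mem, mul_assoc, <- map_mul, Q.idem, <- mul_assoc, P.idem]⟩
  mul_smul P Q R := Kar.ext (mul_smul _ _ _) (by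
    change P.f * C.ρ P.X Q.f * C.ρ (P.X * Q.X) R.f = P.f * C.ρ P.X (Q.f * C.ρ Q.X R.f)
    rw [C.ρ_mul, map_mul, mul_assoc])
  one_smul P := Kar.ext (MulAction.one_smul _) (by
    change 1 * C.ρ 1 P.f = P.f
    rw [C.ρ_one, one_mul])

@[simp] lemma kar_smul_f (P : C.Kar) (Q : M.Kar) : (P • Q).f = P.f * C.ρ P.X Q.f := rfl

/-- The idempotent completion of a module category. -/
def kar (rat) : Mdl (C.kar rat) M.Kar where
  toLCat := M.toLCat.kar
  one_smul P X := rfl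
  lw {P Q t} ht R := by
    change R.f * C.ρ R.X t ∈ Kar.Hom _ _
    refine ⟨mul_ρ_mem R.mem ht.1, ?_, ?_⟩
    . rw [kar_smul_f, mul_assoc, <- mul_assoc _ R.f, <- C.nat R.mem, mul_assoc, <- map_mul,
        ht.2.1, <- mul_assoc, R.idem]
    . rw [kar_smul_f, mul_assoc, <- mul_assoc _ R.f, <- C.nat R.mem, mul_assoc, <- map_mul,
        ht.2.2, <- mul_assoc, R.idem]
  rw {P Q t} ht R := by
    have e : t * C.karρ P R.f = t * C.ρ P.X R.f := by rw [Fus.karρ_apply, <- mul_assoc, ht.2.2]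
    change t * C.karρ P R.f ∈ Kar.Hom _ _
    rw [e]; refine ⟨mul_ρ_mem ht.1 R.mem, ?_, ?_⟩
    . rw [kar_smul_f, mul_assoc, <- mul_assoc _ t, <- C.nat ht.1, mul_assoc, <- map_mul, R.idem, <- mul_assoc,
        ht.2.1]
    . rw [kar_smul_f, mul_assoc, <- mul_assoc _ P.f, <- C.nat P.mem, mul_assoc, <- map_mul, R.idem,
        <- mul_assoc, ht.2.2]
  tr_left {P Q t} ht := by
    have ht2 := ht.2
    have e1 : P.f * t = t := by rw [<- ht2.1, kar_smul_f, <- mul_assoc, <- mul_assoc, P.idem]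
    have e2 : t * P.f = t := by
      rw [<- ht2.2, kar_smul_f, mul_assoc, mul_assoc, <- C.nat P.mem, <- mul_assoc P.f, P.idem]
    refine (M.tr_left ht.1).trans (congrArg _ ?_)
    exact Fus.ltr_kar P e1 e2

instance (rat) : (M.kar rat).Split := inferInstanceAs M.toLCat.kar.Split

end Mdl

namespace Fus
open LCat
variable {D : Fus N Δ}

section cyclic
variable {x l : Δ} {p : ℕ} [NeZero p] {σ σ' : N} {f f' : Fin p -> N}

/-- The inclusion of `x ^ n` in the cyclic algebra `⊕ x ^ i`, `i < p`. -/
def cyc (f : Fin p -> N) (σ' : N) (n : ℕ) : N := f (Fin.ofNat p n) * σ' ^ (n / p)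

/-- Multiplication of the cyclic algebra. -/
def cycMul (D : Fus N Δ) (l : Δ) (f f' : Fin p -> N) (σ' : N) : N :=
  ∑ i : Fin p, ∑ j : Fin p, cyc f σ' (i + j) * (f' i * D.ρ l (f' j))

lemma cyc_val (i : Fin p) : cyc f σ' i = f i := by simp [cyc, Nat.div_eq_of_lt i.2]

lemma cyc_add (n : ℕ) : cyc f σ' (n + p) = cyc f σ' n * σ' := by
  have h : Fin.ofNat p (n + p) = Fin.ofNat p n := by ext; simp
  rw [cyc, cyc, h, Nat.add_div_right n (NeZero.pos p), pow_succ, mul_assoc]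

section
variable (hσ' : σ' ∈ D.Hom (x ^ p) 1)
include hσ'

lemma pow_σ'_mem (k : ℕ) : σ' ^ k ∈ D.Hom (x ^ (p * k)) 1 := by
  induction k with
  | zero => simpa using D.one_mem_one
  | succ k ih => rw [pow_succ']; exact w_comp hσ' ih (x ^ p) (by simp) (by rw [<- pow_add]; rfl)

variable (h2 : D.ρ x σ' = σ' * D.one (x ^ (p + 1)))
include h2

lemma ρ_pow_σ' (i : ℕ) : D.ρ (x ^ i) σ' = σ' * D.one (x ^ (p + i)) := by
  induction i with
  | zero => rw [pow_zero, D.ρ_one, add_zero, D.comp_one hσ']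
  | succ i ih =>
    have h3 : D.one (x ^ (p + 1)) * D.one (x ^ (p + (i + 1))) = D.one (x ^ (p + (i + 1))) := by
      rw [D.one_eq (x ^ (p + 1))]
      exact ρ_one_comp (by rw [<- pow_add, add_assoc, add_comm 1]; exact D.one_mem _)
    rw [pow_succ', D.ρ_mul, ih, map_mul, h2, <- D.one_mul, <- pow_succ', mul_assoc, add_assoc p i 1, h3]

end

variable (hs : D.IsSum l (fun i : Fin p => x ^ (i : ℕ)) f f')
include hs

lemma cyc_ext {c e y : Δ} {s t : N} (hs' : s ∈ D.Hom (c * l * e) y) (ht : t ∈ D.Hom (c * l * e) y)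
    (h : ∀ j, s * D.ρ c (f j) = t * D.ρ c (f j)) : s = t := by
  have h1 : ∀ r ∈ D.Hom (c * l * e) y, r = ∑ j, r * D.ρ c (f j) * D.ρ c (f' j) := by
    intro r hr
    simp_rw [mul_assoc, <- map_mul, <- mul_sum, <- map_sum, hs.sum, <- D.one_mul, D.one_eq, comp_ρ_one hr]
  rw [h1 s hs', h1 t ht]; exact sum_congr rfl fun j _ => by rw [h]

variable (hσ' : σ' ∈ D.Hom (x ^ p) 1)
include hσ'

lemma cyc_mem (n : ℕ) : cyc f σ' n ∈ D.Hom (x ^ n) l := by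
  refine w_comp (hs.mem _) (pow_σ'_mem hσ' _) (x ^ (n % p)) (by simp) ?_
  rw [<- pow_add, Nat.div_add_mod]

lemma cycMul_mem : cycMul D l f f' σ' ∈ D.Hom (l * l) l :=
  Submodule.sum_mem _ fun i _ => Submodule.sum_mem _ fun j _ =>
    D.comp_mem (by rw [<- pow_add]; exact cyc_mem hs hσ' _) (mul_ρ_mem (hs.mem' i) (hs.mem' j))

variable (h2 : D.ρ x σ' = σ' * D.one (x ^ (p + 1)))
include h2

lemma cycMul_cyc (i j : ℕ) :
    cycMul D l f f' σ' * (cyc f σ' i * D.ρ (x ^ i) (cyc f σ' j)) = cyc f σ' (i + j) := by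
  have base : ∀ i j : Fin p, cycMul D l f f' σ' * (cyc f σ' i * D.ρ (x ^ (i : ℕ)) (cyc f σ' j))
      = cyc f σ' (i + j) := by
    intro i j; rw [cyc_val, cyc_val, cycMul, sum_mul, sum_eq_single i, sum_mul, sum_eq_single j]
    . rw [mul_assoc, mul_assoc, reassoc (D.nat (hs.mem i) _).symm, <- map_mul, hs.same,
        reassoc' (hs.same i), <- D.one_mul, <- pow_add]
      have h3 : D.one (x ^ (i : ℕ)) * D.one (x ^ ((i : ℕ) + j)) = D.one (x ^ ((i : ℕ) + j)) := by
        rw [D.one_eq (x ^ (i : ℕ))]; exact ρ_one_comp (by rw [<- pow_add]; exact D.one_mem _)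
      rw [h3, D.comp_one (cyc_mem hs hσ' _)]
    . intro k _ hk
      rw [mul_assoc, mul_assoc, reassoc (D.nat (hs.mem i) _).symm, <- map_mul, hs.diff k j hk,
        map_zero, mul_zero, mul_zero, mul_zero]
    . simp
    . intro k _ hk; rw [sum_mul]; refine sum_eq_zero fun a _ => ?_
      rw [mul_assoc, mul_assoc, reassoc (D.nat (hs.mem i) _).symm, reassoc' (hs.diff k i hk), zero_mul,
        mul_zero]
    . simp
  have step : ∀ i j, cycMul D l f f' σ' * (cyc f σ' i * D.ρ (x ^ i) (cyc f σ' j)) = cyc f σ' (i + j) ->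
      cycMul D l f f' σ' * (cyc f σ' (i + p) * D.ρ (x ^ (i + p)) (cyc f σ' j)) = cyc f σ' (i + p + j) := by
    intro i j h; have h3 : σ' * D.ρ (x ^ (i + p)) (cyc f σ' j) = D.ρ (x ^ i) (cyc f σ' j) * σ' := by
      rw [add_comm i p, pow_add, D.ρ_mul, nat_to_one hσ']
    rw [cyc_add, mul_assoc, h3, <- mul_assoc, <- mul_assoc, mul_assoc _ (cyc f σ' i), h, <- cyc_add,
      add_right_comm]
  have step' : ∀ i j, cycMul D l f f' σ' * (cyc f σ' i * D.ρ (x ^ i) (cyc f σ' j)) = cyc f σ' (i + j) ->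
      cycMul D l f f' σ' * (cyc f σ' i * D.ρ (x ^ i) (cyc f σ' (j + p))) = cyc f σ' (i + (j + p)) := by
    intro i j h; have h3 : cyc f σ' (i + j + p) * D.one (x ^ (p + i)) = cyc f σ' (i + j + p) := by
      rw [D.one_eq]; refine comp_ρ_one (b := x ^ j) (c := l) ?_
      rw [<- pow_add, show p + i + j = i + j + p by ring]; exact cyc_mem hs hσ' _
    rw [cyc_add, map_mul, ρ_pow_σ' hσ' h2, <- mul_assoc, <- mul_assoc, <- mul_assoc,
      mul_assoc _ (cyc f σ' i), h, <- cyc_add, h3, add_assoc]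
  have g : ∀ i j a b, cycMul D l f f' σ' * (cyc f σ' i * D.ρ (x ^ i) (cyc f σ' j)) = cyc f σ' (i + j) ->
      cycMul D l f f' σ' * (cyc f σ' (i + p * a) * D.ρ (x ^ (i + p * a)) (cyc f σ' (j + p * b)))
        = cyc f σ' (i + p * a + (j + p * b)) := by
    intro i j a b h; induction a with
    | zero =>
      induction b with
      | zero => simpa using h
      | succ b ih => rw [Nat.mul_succ, <- add_assoc]; exact step' _ _ ih
    | succ a ih => rw [Nat.mul_succ, <- add_assoc]; exact step _ _ ih
  have := g _ _ (i / p) (j / p) (base (Fin.ofNat p i) (Fin.ofNat p j))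
  simpa only [Fin.val_ofNat, Nat.mod_add_div] using this

lemma cycMul_assoc : cycMul D l f f' σ' * cycMul D l f f' σ'
    = cycMul D l f f' σ' * D.ρ l (cycMul D l f f' σ') := by
  set m := cycMul D l f f' σ' with hm
  have hmm := cycMul_mem hs hσ'
  have mul := cycMul_cyc hs hσ' h2
  rw [<- hm] at hmm mul; have a1 := w_comp hmm hmm l rfl rfl
  have a2 : m * D.ρ l m ∈ D.Hom (l * l * l) l := by
    rw [mul_assoc]; exact D.comp_mem hmm (D.lw hmm l)
  refine cyc_ext hs (c := 1) (by simpa [mul_assoc] using a1)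
    (by simpa [mul_assoc] using a2) fun i => ?_
  rw [D.ρ_one]; refine cyc_ext hs
    (w_comp a1 (hs.mem i) (l * l) (mul_assoc _ _ _) (mul_assoc _ _ _))
    (w_comp a2 (hs.mem i) (l * l) (mul_assoc _ _ _) (mul_assoc _ _ _)) fun j => ?_
  have b : ∀ r ∈ D.Hom (l * l * l) l, r * f i * D.ρ (x ^ (i : ℕ)) (f j) ∈
      D.Hom (x ^ (i : ℕ) * x ^ (j : ℕ) * l * 1) l := fun r hr => by
    rw [mul_one, mul_assoc r]; exact w_comp hr (mul_ρ_mem (hs.mem i) (hs.mem j)) l rfl rfl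
  refine cyc_ext hs (b _ a1) (b _ a2) fun k => ?_
  have e1 := mul i j
  have e2 := mul (i + j) k
  have e3 := mul j k
  have e4 := mul i (j + k)
  rw [cyc_val, cyc_val] at e1 e3; rw [cyc_val] at e2 e4
  rw [mul_assoc m m, mul_assoc m, mul_assoc m (f i), e1, mul_assoc m, <- pow_add, e2, mul_assoc m,
    <- D.nat (hs.mem i), pow_add, D.ρ_mul, mul_assoc, mul_assoc, mul_assoc, <- map_mul, <- map_mul, e3, e4,
    add_assoc]

lemma cycMul_unit : cycMul D l f f' σ' * f 0 = D.one l := by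
  have hm := cycMul_mem hs hσ'
  have h0 : f 0 ∈ D.Hom 1 l := by simpa using hs.mem 0
  refine cyc_ext hs (c := 1) (e := 1) (w_comp hm h0 l rfl (by simp))
    (by simpa using D.one_mem l) fun j => ?_
  have h := cycMul_cyc hs hσ' h2 0 j
  have h3 := cyc_val (f := f) (σ' := σ') 0
  rw [Fin.val_zero] at h3; rw [h3, cyc_val, zero_add, cyc_val, pow_zero] at h; rw [D.ρ_one] at h ⊢
  rw [mul_assoc, h, D.one_comp (hs.mem j)]

lemma cycMul_unit' : cycMul D l f f' σ' * D.ρ l (f 0) = D.one l := by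
  have hm := cycMul_mem hs hσ'
  have h0 : f 0 ∈ D.Hom 1 l := by simpa using hs.mem 0
  refine cyc_ext hs (c := 1) (e := 1) (D.comp_mem hm (lw_eq h0 l (by simp) rfl))
    (by simpa using D.one_mem l) fun j => ?_
  have h := cycMul_cyc hs hσ' h2 j 0
  have h3 := cyc_val (f := f) (σ' := σ') 0
  rw [Fin.val_zero] at h3; rw [h3, cyc_val, add_zero, cyc_val, D.nat (hs.mem j)] at h
  rw [D.ρ_one, mul_assoc, h, D.one_comp (hs.mem j)]

variable (hσ : σ ∈ D.Hom 1 (x ^ p)) (h1 : σ' * σ = 1)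
include hσ h1

lemma exists_cyc_pairing : ∃ κ ∈ D.Hom 1 (l * l),
    f' 0 * cycMul D l f f' σ' * D.ρ l κ = D.one l := by
  set m := cycMul D l f f' σ' with hm
  have hmm := cycMul_mem hs hσ'
  have mul := cycMul_cyc hs hσ' h2
  rw [<- hm] at hmm mul; have hw := cyc_mem hs hσ'
  have h0 : f' 0 ∈ D.Hom l 1 := by simpa using hs.mem' 0
  have hk : ∀ i : Fin p, cyc f σ' i * D.ρ (x ^ (i : ℕ)) (cyc f σ' (p - i)) * σ ∈ D.Hom 1 (l * l) :=
    fun i => D.comp_mem (mul_ρ_mem (hw _) (hw _)) (by rwa [<- pow_add, Nat.add_sub_cancel' i.2.le])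
  have hκ : ∑ i : Fin p, cyc f σ' i * D.ρ (x ^ (i : ℕ)) (cyc f σ' (p - i)) * σ ∈ D.Hom 1 (l * l) :=
    Submodule.sum_mem _ fun i _ => hk i
  refine ⟨_, hκ, ?_⟩
  have hem := D.comp_mem h0 hmm
  refine cyc_ext hs (c := 1) (e := 1) (y := l)
    (comp_w hem (lw_eq hκ l (by simp) rfl) l (by simp [mul_assoc]) (by simp))
    (by simpa using D.one_mem l) fun j => ?_
  rw [D.ρ_one, D.one_comp (hs.mem j), mul_assoc, <- D.nat (hs.mem j), map_sum, mul_sum, mul_sum]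
  have term : ∀ i : Fin p, f' 0 * m * (f j * D.ρ (x ^ (j : ℕ)) (cyc f σ' i * D.ρ (x ^ (i : ℕ)) (cyc f σ' (p - i)) * σ))
      = f' 0 * cyc f σ' (j + i) * (D.ρ (x ^ ((j : ℕ) + i)) (cyc f σ' (p - i)) * D.ρ (x ^ (j : ℕ)) σ) := by
    intro i; have h := mul j i; rw [cyc_val] at h; rw [<- h, map_mul, map_mul, pow_add, D.ρ_mul]
    simp only [mul_assoc]
  simp_rw [term]; have hcyc0 : f' 0 * cyc f σ' 0 = 1 := by
    have h3 := cyc_val (f := f) (σ' := σ') 0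
    rw [Fin.val_zero] at h3; rw [h3, hs.same]; simp [D.one_one]
  have hzero : ∀ n, n % p ≠ 0 -> f' 0 * cyc f σ' n = 0 := by
    intro n hn; rw [cyc, <- mul_assoc, hs.diff, zero_mul]; intro h
    exact hn (by simpa using (congrArg Fin.val h).symm)
  have hσρ : ∀ i : ℕ, σ' * D.ρ (x ^ i) σ = D.one (x ^ i) := by
    intro i; have h4 : D.ρ (x ^ i) σ ∈ D.Hom (x ^ i) (x ^ (p + i)) :=
      lw_eq hσ _ (mul_one _).symm (by rw [<- pow_add, add_comm])
    rw [<- D.one_comp h4, <- mul_assoc, <- ρ_pow_σ' hσ' h2, <- map_mul, h1, <- D.one_eq]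
  by_cases hj : j = 0
  . subst hj; rw [sum_eq_single 0]
    . simp only [Fin.val_zero, add_zero, pow_zero, tsub_zero]; rw [hcyc0, one_mul, D.ρ_one, D.ρ_one]
      have h5 := cyc_add (f := f) (σ' := σ') 0
      rw [zero_add] at h5; rw [h5, mul_assoc, h1, mul_one]; exact cyc_val 0
    . intro i _ hi; rw [hzero, zero_mul]; rw [Fin.val_zero, zero_add, Nat.mod_eq_of_lt i.2]
      exact fun h => hi (Fin.ext h)
    . simp
  . have hj' : (j : ℕ) ≠ 0 := fun h => hj (Fin.ext h)
    have hlt : p - j < p := by have := NeZero.pos p; omega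
    have hjp := j.2
    rw [sum_eq_single ⟨p - j, hlt⟩]
    . have e1 : (j : ℕ) + (p - j) = 0 + p := by omega
      have e2 : p - (p - (j : ℕ)) = j := by omega
      simp only [e1, e2]
      rw [cyc_add, <- mul_assoc (f' 0), hcyc0, one_mul, zero_add, <- mul_assoc, nat_to_one hσ', mul_assoc,
        hσρ, D.comp_one (hw _), cyc_val]
    . intro i _ hi; rw [hzero, zero_mul]; intro h; have hip := i.2; apply hi; ext
      by_cases hlt : (j : ℕ) + i < p
      . rw [Nat.mod_eq_of_lt hlt] at h; omega
      . rw [Nat.mod_eq_sub_mod (by omega), Nat.mod_eq_of_lt (by omega)] at h; simp only; omega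
    . simp

end cyclic

namespace HB
variable {C : Fus N Δ} [C.Split] {Z : HB C}

@[simp] lemma pow_a (i : ℕ) : (Z ^ i).a = Z.a ^ i := by
  induction i with
  | zero => rw [pow_zero, pow_zero, one_a]
  | succ i ih => rw [pow_succ, mul_a, ih, pow_succ]

lemma pow_β_of_self (hb : Z.β Z.a = C.one (Z.a * Z.a)) (i j : ℕ) :
    (Z ^ i).β (Z ^ j).a = C.one ((Z ^ i).a * (Z ^ j).a) := by
  have h1 : ∀ i, (Z ^ i).β Z.a = C.one ((Z ^ i).a * Z.a) := by
    intro i; induction i with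
    | zero => rw [pow_zero, one_β, one_a, one_mul]
    | succ i ih =>
      rw [pow_succ, mul_β, ih, hb, mul_a, C.one_mul Z.a, C.one_mul _ Z.a, <- map_mul, C.one_mul (_ * _),
        C.ρ_mul, C.one_eq, <- map_mul, one_mul]
  induction j with
  | zero => rw [pow_zero, one_a, (Z ^ i).one, mul_one]
  | succ j ih =>
    rw [pow_succ, mul_a, (Z ^ i).mul, ih, h1]; simp [pow_a]
    rw [<- C.one_mul, <- pow_succ, <- pow_succ, <- pow_add, <- pow_add, <- pow_add, C.one_eq (_ ^ (i + j)),
      show j + (i + 1) = i + j + 1 by ring, show i + (j + 1) = i + j + 1 by ring, pow_succ]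
    exact comp_ρ_one (C.one_mem _)

lemma exists_calg (hb : Z.β Z.a = C.one (Z.a * Z.a)) (hdim : C.dim Z.a = 1) {p : ℕ} (hp : p ≠ 0)
    (hiso : C.Z.Iso (Z ^ p) 1) (hd : ∀ i, i ≠ 0 -> i < p -> C.hd 1 (Z ^ i).a = 0) :
    ∃ A : CAlg C, A.p = p ∧ ∃ f f' : Fin p -> N, C.IsSum A.L.a (fun i : Fin p => Z.a ^ (i : ℕ)) f f' := by
  have : NeZero p := ⟨hp⟩
  obtain ⟨σ', σ, hσ', hσ, h21, h1⟩ := hiso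
  obtain ⟨L, f, f', hs⟩ := C.Z.sum (fun i : Fin p => Z ^ (i : ℕ))
  have hsC : C.IsSum L.a (fun i : Fin p => Z.a ^ (i : ℕ)) f f' := by
    simpa only [pow_a] using isSum_forget hs
  have h2 : C.Z.ρ Z σ' = σ' * C.Z.one (Z ^ (p + 1)) := by
    have h3 := hσ'.2 Z.a
    have h4 := pow_β_of_self hb p 1
    rw [pow_one] at h4; have h5 : C.ρ Z.a σ' * C.one ((Z ^ p).a * Z.a) = C.ρ Z.a σ' := by
      have h6 := C.comp_one (C.lw hσ'.1 Z.a)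
      rwa [pow_a, <- pow_succ', pow_succ, <- pow_a] at h6
    rw [h4, one_β, h5, <- nat_to_one hσ'.1, <- C.one_mul] at h3; rw [pow_succ]; exact h3.symm
  have h1' := h1.trans C.one_one
  obtain ⟨κ, hκ, hpair⟩ := exists_cyc_pairing hs hσ' h2 hσ h1'; have hη : f 0 ∈ HB.Hom 1 L := by
    have := hs.mem 0
    rwa [Fin.val_zero, pow_zero] at this
  have hε : f' 0 ∈ HB.Hom L 1 := by
    have := hs.mem' 0
    rwa [Fin.val_zero, pow_zero] at this
  have hεη : f' 0 * f 0 = 1 := by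
    have := hs.same 0
    rw [Fin.val_zero, pow_zero] at this; exact this.trans C.one_one
  have hd1 : C.hd 1 L.a = 1 := by
    rw [hsC.hd_left, sum_eq_single 0]
    . simpa using hd_self_of_simple C.unit_simple
    . intro i _ hi; rw [<- pow_a]; exact hd _ (fun h => hi (Fin.ext h)) i.2
    . simp
  have hne : ∀ {X Y : Δ} {v : N} (hv : v ∈ C.Hom X Y), v ≠ 0 -> C.hd X Y = 1 -> ∀ t ∈ C.Hom X Y,
      ∃ c : ℂ, t = c • v := by
    intro X Y v hv h0 h t ht
    obtain ⟨c, hc⟩ := (finrank_eq_one_iff_of_nonzero' (⟨v, hv⟩ : C.Hom X Y)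
      (fun h => h0 (congrArg Subtype.val h))).1 h ⟨t, ht⟩
    exact ⟨c, (congrArg Subtype.val hc).symm⟩
  have hunit := hne hη.1 (fun h => C.one_ne (by rw [<- hεη, h, mul_zero])) hd1
  have hcounit : ∀ t ∈ C.Hom L.a 1, ∃ c : ℂ, t = c • f' 0 :=
    hne hε.1 (fun h => C.one_ne (by rw [<- hεη, h, zero_mul])) (by rw [hd_comm, hd1])
  have hm := cycMul_mem hs hσ'
  have hunit' := cycMul_unit' hs hσ' h2
  have mul := cycMul_cyc hs hσ' h2
  set m := cycMul C.Z L f f' σ' with hmdef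
  refine ⟨⟨L, m, f 0, f' 0, κ, p, hp, hm, hη, hε, hκ.1, cycMul_assoc hs hσ' h2,
    cycMul_unit hs hσ' h2, hunit', ?_, hpair, ?_, hεη, hunit⟩, rfl, f, f', hsC⟩
  . have hmC := hm.1
    have hmβ := C.comp_mem hmC (L.mem _)
    refine cyc_ext hsC (c := 1) (e := L.a) (y := L.a) (by simpa using hmβ) (by simpa using hmC)
      fun i => ?_
    have b : ∀ r ∈ C.Hom (L.a * L.a) L.a, r * f i ∈ C.Hom (Z.a ^ (i : ℕ) * L.a * 1) L.a := fun r hr =>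
      w_comp hr (hsC.mem i) L.a rfl (mul_one _)
    rw [C.ρ_one]; refine cyc_ext hsC (e := 1) (b _ hmβ) (b _ hmC) fun j => ?_
    have e1 := (hs.mem i).2 L.a
    have e2 := (Z ^ (i : ℕ)).nat (hs.mem j).1
    rw [pow_β_of_self hb] at e2; have e3 := mul i j; have e4 := mul j i
    rw [cyc_val, cyc_val] at e3 e4
    have e5 : f j * C.ρ (Z ^ (j : ℕ)).a (f i) = C.ρ L.a (f i) * f j := C.nat (hs.mem j).1 _
    have e6 : C.Z.ρ (Z ^ (j : ℕ)) (f i) = C.ρ (Z ^ (j : ℕ)).a (f i) := rfl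
    have e7 : C.Z.ρ (Z ^ (i : ℕ)) (f j) = C.ρ (Z ^ (i : ℕ)).a (f j) := rfl
    rw [e6, e5] at e4; rw [e7] at e3
    rw [<- pow_a, mul_assoc m (f i), e3, mul_assoc m, e1, mul_assoc m, mul_assoc (C.ρ _ _), <- e2,
      <- mul_assoc (C.ρ _ _), <- mul_assoc m, e4, add_comm]
    have h8 := C.Z.comp_one (cyc_mem hs hσ' ((i : ℕ) + j))
    rw [pow_add] at h8; exact h8
  . have hmC : m ∈ C.Hom (L.a * L.a) (L.a * 1) := by rw [mul_one]; exact hm.1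
    obtain ⟨c, hc⟩ := hcounit _ (ltr_mem hmC); have e1 : C.ltr L.a m * f 0 = (p : ℂ) • 1 := by
      have e2 : m * C.ρ L.a (f 0) = C.one L.a := hunit'
      rw [<- ltr_mul_right, e2, C.one_eq, ltr_one_mul, d_eq, add_dim.sum_eq hsC]; congr 2
      have : ∀ i : ℕ, C.dim (Z.a ^ i) = 1 := fun i => by
        induction i with
        | zero => rw [pow_zero, dim_one]
        | succ i ih => rw [pow_succ, dim_mul, ih, hdim]
      simp [this]
    rw [hc, smul_mul_assoc, hεη] at e1; rw [hc, smul_left_injective ℂ C.one_ne e1]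

end HB
end Fus

lemma Matrix.dvd_sq_of_sq_eq {ι : Type*} [Fintype ι] {G : ι -> ι -> ℕ} {n : ℕ}
    (symm : ∀ i j, G i j = G j i) (sq : ∀ i j, ∑ k, G i k * G k j = n * G i j)
    (diag : ∀ i, G i i ≠ 0) (hG : ∀ i, G i i ∣ n ^ 2) {m : ι -> ℕ} {κ p : ℕ} (hκ : κ ≠ 0)
    (hm : ∀ j, m j ≠ 0 -> κ ∣ p * ∑ i, m i * G i j)
    (htot : ∑ j, m j * ∑ i, m i * G i j = κ) : κ ∣ (p * n) ^ 2 := by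
  classical
  set f : ι -> ℕ := fun j => ∑ i, m i * G i j with hf
  have hfG : ∀ j, ∑ i, G j i * f i = n * f j := by
    intro j; simp [hf, mul_sum]; rw [sum_comm]; refine sum_congr rfl fun k _ => ?_
    rw [mul_left_comm, <- sq k j, mul_sum]; refine sum_congr rfl fun i _ => ?_
    rw [symm j i]; ring
  have trans : ∀ {a b c}, G a b ≠ 0 -> G b c ≠ 0 -> G a c ≠ 0 := by
    intro a b c hab hbc h0; have h1 := sq a c; rw [h0, mul_zero, sum_eq_zero_iff] at h1
    exact mul_ne_zero hab hbc (h1 b (mem_univ b))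
  let s : Setoid ι := ⟨fun i j => G i j ≠ 0, diag, fun h => by rwa [symm], trans⟩
  have key : ∀ c, ∃ t, (p * n) ^ 2 * ∑ j with Quotient.mk s j = c, m j * f j = κ ^ 2 * t := by
    intro c; by_cases h : ∃ j, Quotient.mk s j = c ∧ m j ≠ 0
    . obtain ⟨j, rfl, hj⟩ := h; obtain ⟨a, ha⟩ := hG j
      obtain ⟨b, hb⟩ := hm j hj; refine ⟨a * b ^ 2, ?_⟩
      have hiff : ∀ i, Quotient.mk s i = Quotient.mk s j ↔ G j i ≠ 0 := fun i => by
        rw [Quotient.eq]; change G i j ≠ 0 ↔ _; rw [symm]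
      have h1 : (∑ i with Quotient.mk s i = Quotient.mk s j, m i * f i) * G j j = f j ^ 2 := by
        rw [sum_mul, pow_two]
        conv_rhs => rw [hf, sum_mul]
        rw [sum_filter]; refine sum_congr rfl fun i _ => ?_
        split_ifs with hi
        . rw [mul_assoc, Matrix.mul_eq_mul_of_sq_eq symm sq diag hfG ((hiff i).1 hi), symm i j]; ring
        . have : G i j = 0 := by
            by_contra h0
            exact hi ((hiff i).2 (by rwa [symm]))
          rw [this, mul_zero, zero_mul]
      calc _ = p ^ 2 * a * ((∑ i with Quotient.mk s i = Quotient.mk s j, m i * f i) * G j j) := by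
            rw [mul_pow, ha]; ring
        _ = a * (p * f j) ^ 2 := by rw [h1]; ring
        _ = _ := by rw [hb]; ring
    . push Not at h
      refine ⟨0, ?_⟩
      rw [sum_eq_zero, mul_zero, mul_zero]; intro j hj; rw [h j (mem_filter.1 hj).2, zero_mul]
  choose t ht using key
  refine ⟨∑ c, t c, ?_⟩
  refine Nat.eq_of_mul_eq_mul_left (Nat.pos_of_ne_zero hκ) ?_
  have h1 : ∑ c, ∑ j with Quotient.mk s j = c, m j * f j = κ := by rwa [Finset.sum_fiberwise]
  calc κ * (p * n) ^ 2 = (p * n) ^ 2 * ∑ c, ∑ j with Quotient.mk s j = c, m j * f j := by rw [h1]; ring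
    _ = κ * (κ * ∑ c, t c) := by rw [mul_sum, sum_congr rfl fun c _ => ht c, <- mul_sum]; ring

namespace CAlg
open LCat Fus
variable {C : Fus N Δ} (A : CAlg C)

section
variable {O : Type w} [MulAction Δ O] {M : Mdl C O} [M.Split]

lemma exists_image (P : (A.kl M).Kar) : ∃ U s s', s ∈ M.Hom U (A.L.a • P.X) ∧
    s' ∈ M.Hom (A.L.a • P.X) U ∧ s' * s = M.one U ∧ s * s' = A.Φ P.f :=
  LCat.Split.split (A.Φ_mem P.mem) (by rw [<- map_mul, P.idem])

/-- The object underlying a direct summand of a free module. -/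
def U (P : (A.kl M).Kar) : O := (A.exists_image P).choose

lemma hd_U (Z : O) (P : (A.kl M).Kar) : M.hd Z (A.U P) = (A.kl M).kar.hd ((A.kl M).toKar Z) P := by
  obtain ⟨s, s', hs, hs', h1, h2⟩ := (A.exists_image P).choose_spec
  have hΦs : A.Φ P.f * s = s := by rw [<- h2, mul_assoc, h1, M.comp_one hs]
  have hmem : ∀ t : M.Hom Z (A.U P), s * t ∈ M.Hom Z (A.L.a • P.X) := fun t => M.comp_mem hs t.2
  refine LinearEquiv.finrank_eq ?_
  exact
    { toFun := fun t => ⟨⟨s * t, A.coe_mem (hmem t)⟩, hmem t,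
        Subtype.ext (by rw [mul_eq_Φ]; change A.Φ P.f * (s * t) = s * t; rw [<- mul_assoc, hΦs]),
        Subtype.ext ((A.mul_J _ _).trans (M.comp_one (hmem t)))⟩
      map_add' := fun a b => Subtype.ext (Subtype.ext (mul_add s _ _))
      map_smul' := fun r a => Subtype.ext (Subtype.ext (mul_smul_comm r s _))
      invFun := fun x => ⟨s' * x.1, M.comp_mem hs' x.2.1⟩
      left_inv := fun t => Subtype.ext (by
        change s' * (s * t) = t
        rw [<- mul_assoc, h1]; exact M.one_comp t.2)
      right_inv := fun x => Subtype.ext (Subtype.ext (by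
        change s * (s' * x.1) = x.1
        rw [<- mul_assoc, h2, <- mul_eq_Φ, x.2.2.1])) }

lemma hd_toKar (X Y : O) :
    (A.kl M).kar.hd ((A.kl M).toKar X) ((A.kl M).toKar Y) = M.hd X (A.L.a • Y) := by
  rw [hd, show (A.kl M).kar.Hom ((A.kl M).toKar X) ((A.kl M).toKar Y) = (A.kl M).Hom X Y from
    Submodule.ext fun t => mem_toKar]
  exact LinearEquiv.finrank_eq (A.homEquiv M X Y)

lemma eq_of_additive {B : Type*} [AddCommMonoid B] {f : O -> B} (hf : M.Additive f) (X : O) :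
    f (A.U ((A.kl M).toKar X)) = f (A.L.a • X) := by
  rw [hf.eq_sum, hf.eq_sum (A.L.a • X)]; exact sum_congr rfl fun Z _ => by rw [hd_U, hd_toKar]

end

variable [C.Split]

instance : (Mdl.regular C).Split := ‹C.Split›

lemma d_U (P : A.fus.Kar) : C.d (A.U (M := Mdl.regular C) P) = A.p * A.fus.tr P.X P.f := by
  obtain ⟨s, s', hs, hs', h1, h2⟩ := (A.exists_image P).choose_spec
  refine Eq.trans ?_ (A.tr_Φ P.mem)
  rw [d, <- h2]; exact (congrArg _ h1.symm).trans (C.tr_comm hs' hs)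

lemma rat (P : A.fus.Kar) : ∃ r : ℚ, 0 ≤ r ∧ A.fus.tr P.X P.f = r := by
  refine ⟨C.dim (A.U P) / A.p, by positivity, ?_⟩
  have h := A.d_U P
  have hp : (A.p : ℂ) ≠ 0 := Nat.cast_ne_zero.2 A.p_ne
  rw [d_eq] at h; push_cast; rw [h, mul_div_cancel_left₀ _ hp]

/-- The fusion category of `A`-modules. -/
abbrev quot : Fus A.Kl A.fus.Kar := A.fus.kar A.rat

lemma dim_U (P : A.fus.Kar) : C.dim (A.U (M := Mdl.regular C) P) = A.p * A.quot.dim P := by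
  have h := A.d_U P
  have h2 : A.fus.tr P.X P.f = A.quot.d P := rfl
  rw [d_eq, h2, d_eq] at h; exact_mod_cast h

lemma dim_toKar (a : Δ) : A.quot.dim (A.fus.toKar a) = C.dim a := by
  have h : A.quot.d (A.fus.toKar a) = C.d a := A.tr_J a (C.one a)
  rw [d_eq, d_eq] at h; exact_mod_cast h

lemma dim_L : C.dim A.L.a = A.p := by
  have h1 : C.ltr A.L.a A.m * A.η = (A.p : ℂ) • 1 := by rw [A.ltr_m, smul_mul_assoc, A.ε_η]
  rw [<- ltr_mul_right, A.m_ρη, C.one_eq, ltr_one_mul, d_eq] at h1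
  exact_mod_cast smul_left_injective ℂ C.one_ne h1

lemma sum_dim_hd_toKar (P : A.fus.Kar) :
    ∑ c : C.Irr, C.dim (rep c) * A.quot.hd P (A.fus.toKar (rep c)) = A.p * A.quot.dim P := by
  rw [<- dim_U, add_dim.eq_sum]; refine sum_congr rfl fun c _ => ?_
  rw [hd_comm, smul_eq_mul, mul_comm]; exact congrArg (· * _) (A.hd_U (rep c) P).symm

lemma p_mul_gd : A.p * A.quot.gd = C.gd := by
  have h1 : A.p * A.quot.gd
      = ∑ e : A.quot.Irr, A.quot.dim (rep e) * (A.p * A.quot.dim (rep e)) := by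
    rw [Mdl.gd_eq, mul_sum]; exact sum_congr rfl fun e _ => by ring
  rw [h1, Mdl.gd_eq]; simp_rw [<- sum_dim_hd_toKar, mul_sum]; rw [sum_comm]
  refine sum_congr rfl fun c _ => ?_
  rw [pow_two, <- A.dim_toKar (rep c), add_dim.eq_sum, mul_sum]; refine sum_congr rfl fun e _ => ?_
  rw [smul_eq_mul]; ring

variable {O : Type w} [MulAction Δ O] (M : Mdl C O) [M.Split]

/-- The module category of `A`-modules in `M`. -/
abbrev quotMdl : Mdl A.quot (A.mdl M).Kar := (A.mdl M).kar A.rat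

variable {M}

lemma toKar_smul (c : Δ) (X : O) : (A.mdl M).toKar (c • X) = A.fus.toKar c • (A.mdl M).toKar X := by
  refine Kar.ext rfl ?_
  change A.J (M.one (c • X)) = A.J (C.one c) * A.ρ c (A.J (M.one X))
  rw [ρ_J, J_mul_J, M.one_smul, C.one_eq, <- map_mul, one_mul]

lemma wt_U (X : O) (Y : (A.mdl M).Kar) :
    M.wt X (A.U Y) = A.p * (A.quotMdl M).wt ((A.mdl M).toKar X) Y := by
  have h1 : ∀ c : C.Irr, M.hd (rep c • X) (A.U Y) = ∑ e : A.quot.Irr,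
      A.quot.hd (rep e) (A.fus.toKar (rep c)) * (A.quotMdl M).hd (rep e • (A.mdl M).toKar X) Y := by
    intro c; refine (A.hd_U _ Y).trans ?_
    change (A.quotMdl M).hd ((A.mdl M).toKar (rep c • X)) Y = _
    rw [toKar_smul]; exact (Mdl.add_smul_right (add_hd_right Y) _).eq_sum _
  simp [Mdl.wt, Mdl.pair, h1, mul_sum]; rw [sum_comm]; refine sum_congr rfl fun e _ => ?_
  rw [<- mul_assoc, <- sum_dim_hd_toKar, sum_mul]; exact sum_congr rfl fun c _ => by ring

lemma wt_dvd {ι : Type*} [Fintype ι] {y : ι -> Δ} {f f' : ι -> N} (hL : C.IsSum A.L.a y f f')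
    (hy : ∀ i, C.dim (y i) = 1) {X : O} (hX : M.Simple X)
    (ih : ∀ Y, (A.quotMdl M).Simple Y -> (A.quotMdl M).wt Y Y ∣ A.quot.gd ^ 2) :
    M.wt X X ∣ C.gd ^ 2 := by
  rw [<- p_mul_gd A]; set X' := (A.mdl M).toKar X with hX'
  have hf : ∀ Y, ∑ i : (A.quotMdl M).Irr, (A.quotMdl M).hd (rep i) X' * (A.quotMdl M).wt (rep i) Y
      = (A.quotMdl M).wt X' Y := fun Y =>
    ((Mdl.add_wt_left Y).eq_sum X').symm
  have hrep : ∀ i : (A.quotMdl M).Irr, (A.quotMdl M).hd (rep i) (rep i) ≠ 0 := fun i => by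
    rw [hd_rep_rep]; simp
  refine Matrix.dvd_sq_of_sq_eq
    (m := fun i => (A.quotMdl M).hd (rep i) X') (fun i j => Mdl.wt_comm _ _)
    (fun i j => Mdl.sum_wt_mul_wt _ _) (fun i => Mdl.wt_ne_zero (hrep i)) (fun i => ih _ (rep_simple i))
    (Mdl.wt_ne_zero (by rw [hd_self_of_simple hX]; exact one_ne_zero)) (fun j hj => ?_) ?_
  . rw [hf, <- wt_U]; refine (dvd_sum fun Z _ => ?_).trans
      (dvd_of_eq ((Mdl.add_wt_right X).eq_sum (A.U (rep j))).symm)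
    by_cases hZ : M.hd (rep Z) (A.U (rep j)) = 0
    . rw [hZ, zero_smul]; exact dvd_zero _
    have h1 : (A.quotMdl M).hd ((A.mdl M).toKar (rep Z)) (rep j) ≠ 0 := by rwa [hd_U] at hZ
    have h2 : (A.quotMdl M).hd X' ((A.mdl M).toKar (rep Z)) ≠ 0 := by
      rw [hd_eq_sum]; intro h0; rw [sum_eq_zero_iff] at h0; rw [hd_comm] at h1
      exact mul_ne_zero hj h1 (h0 j (mem_univ j))
    have h3 : M.hd X (A.L.a • rep Z) ≠ 0 := by rwa [<- A.hd_toKar]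
    rw [(Mdl.isSum_rw hL (rep Z)).hd_left] at h3
    obtain ⟨i, -, hi⟩ := exists_ne_zero_of_sum_ne_zero h3
    have hs := Mdl.simple_smul (hy i) (rep_simple Z)
    have hiso : M.Iso X (y i • rep Z) := by
      by_contra hn
      exact hi (hd_simple_ne hX hs hn)
    have h4 := (Mdl.add_wt_right X).iso hiso
    rw [Mdl.wt_smul_right, hy, one_mul] at h4; rw [<- h4, smul_eq_mul]; exact dvd_mul_left _ _
  . simp_rw [hf]; have h1 := (Mdl.add_wt_right (M := A.quotMdl M) X').eq_sum X'
    simp [smul_eq_mul] at h1; rw [<- h1]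
    refine Nat.eq_of_mul_eq_mul_left (Nat.pos_of_ne_zero A.p_ne) ?_
    rw [hX', <- wt_U, <- A.dim_L, <- Mdl.wt_smul_right]
    exact A.eq_of_additive (Mdl.add_wt_right X) X

end CAlg

namespace Fus
open LCat
variable {C : Fus N Δ} [C.Split]

/-- A grading of the simple objects by a group. -/
def IsGrading {G : Type*} [Group G] (χ : C.Irr -> G) : Prop :=
  ∀ i j k, C.hd (rep k) (rep i * rep j) ≠ 0 -> χ k = χ i * χ j

open Classical in
/-- Dimensions restricted to one component. -/
def gwt {G : Type*} (χ : C.Irr -> G) (z : G) (i : C.Irr) : ℕ := if χ i = z then C.dim (rep i) else 0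

/-- The dimension of a component. -/
def ggd {G : Type*} (χ : C.Irr -> G) (z : G) : ℕ := ∑ i, gwt χ z i * C.dim (rep i)

open Classical in
lemma sum_gwt_mul {G : Type*} (χ : C.Irr -> G) (z : G) (F : C.Irr -> ℕ) :
    ∑ i, gwt χ z i * F i = ∑ i with χ i = z, C.dim (rep i) * F i := by
  rw [sum_filter]; exact sum_congr rfl fun i _ => by unfold gwt; split_ifs <;> simp

namespace IsGrading
variable {G : Type*} [Group G] {χ : C.Irr -> G} (h : IsGrading χ)
include h

lemma unit : χ C.irr1 = 1 := by
  have h1 := h C.irr1 C.irr1 C.irr1 (by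
    rw [(add_mul_right (add_hd_left _) _).iso unit_iso, one_mul]
    exact HB.hd_rep_self _)
  exact left_eq_mul.1 h1

lemma star (i : C.Irr) : χ (star i) = (χ i)⁻¹ := by
  have h1 := h i (Fus.star i) C.irr1 (by
    rw [(add_hd_right _).iso unit_iso, hd_one_rep_mul_rep]
    simp)
  rw [h.unit] at h1; exact eq_inv_of_mul_eq_one_right h1.symm

open Classical in
/-- The trivial component. -/
def ker : C.Sub where
  S := Finset.univ.filter fun i => χ i = 1
  one_mem := by simp [h.unit]
  mul_mem := by
    intro i j k hi hj hk; simp [mem_filter, mem_univ, true_and] at *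
    rw [h i j k hk, hi, hj, mul_one]
  star_mem := by intro i hi; simp [mem_filter, mem_univ, true_and] at *; rw [h.star, hi, inv_one]

lemma sum_gwt (z : G) (c k : C.Irr) :
    ∑ e, gwt χ z e * C.hd (rep e) (rep k * C.cj (rep c)) = C.dim (rep c) * gwt χ (z * χ c) k := by
  have h1 : ∀ e, C.hd (rep e) (rep k * C.cj (rep c)) ≠ 0 -> χ e = χ k * (χ c)⁻¹ := by
    intro e he; rw [(add_mul_left (add_hd_left _) (rep k)).iso (iso_star c)] at he
    rw [h _ _ _ he, h.star]
  by_cases hk : χ k = z * χ c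
  . rw [gwt, if_pos hk, <- dim_cj, mul_comm, <- dim_mul, add_dim.eq_sum]
    refine sum_congr rfl fun e _ => ?_
    by_cases he : C.hd (rep e) (rep k * C.cj (rep c)) = 0
    . simp [he]
    . rw [gwt, if_pos (by rw [h1 e he, hk, mul_inv_cancel_right]), smul_eq_mul, mul_comm]
  . rw [gwt, if_neg hk, mul_zero]; refine sum_eq_zero fun e _ => ?_
    by_cases he : C.hd (rep e) (rep k * C.cj (rep c)) = 0
    . simp [he]
    . rw [gwt, if_neg, zero_mul]; intro h2; exact hk (by rw [<- h2, h1 e he, inv_mul_cancel_right])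

lemma ggd_mul (z : G) (c : C.Irr) : ggd χ (z * χ c) = ggd χ z := by
  refine Nat.eq_of_mul_eq_mul_left (dim_rep_pos c) ?_
  have h1 : ∀ e : C.Irr, C.dim (rep c) * C.dim (rep e)
      = ∑ k : C.Irr, C.hd (rep e) (rep k * C.cj (rep c)) * C.dim (rep k) := by
    intro e; rw [mul_comm, <- dim_mul, add_dim.eq_sum]; refine sum_congr rfl fun k _ => ?_
    rw [smul_eq_mul, hd_comm, hd_mul_right]
  have h2 : C.dim (rep c) * ggd χ z
      = ∑ e, ∑ k : C.Irr, gwt χ z e * C.hd (rep e) (rep k * C.cj (rep c)) * C.dim (rep k) := by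
    rw [ggd, mul_sum]; refine sum_congr rfl fun e _ => ?_
    rw [mul_left_comm, h1, mul_sum]; exact sum_congr rfl fun k _ => (mul_assoc _ _ _).symm
  rw [h2, sum_comm, ggd, mul_sum]; refine sum_congr rfl fun k _ => ?_
  rw [<- sum_mul, h.sum_gwt]; ring

lemma ggd_eq (c : C.Irr) : ggd χ (χ c) = ggd χ 1 := by rw [<- h.ggd_mul 1 c, one_mul]

lemma gdim_ker : h.ker.gdim = ggd χ 1 := by
  rw [Sub.gdim, ggd, sum_gwt_mul]; exact sum_congr rfl fun i _ => pow_two _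

/-- The group of degrees. -/
def range : Subgroup G where
  carrier := Set.range χ
  one_mem' := ⟨_, h.unit⟩
  mul_mem' := by
    rintro _ _ ⟨i, rfl⟩ ⟨j, rfl⟩; obtain ⟨k, hk⟩ : ∃ k, C.hd (rep k) (rep i * rep j) ≠ 0 :=
      exists_hd_ne_zero_of_dim (by rw [dim_mul]; exact (mul_pos (dim_rep_pos i) (dim_rep_pos j)).ne')
    exact ⟨k, h _ _ _ hk⟩
  inv_mem' := by rintro _ ⟨i, rfl⟩; exact ⟨_, h.star i⟩

open Classical in
lemma sum_eq_card_mul {F : C.Irr -> ℕ} {m : ℕ} (T : Subgroup G) (hT : T ≤ h.range)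
    (hF : ∀ z ∈ T, ∑ i with χ i = z, F i = m)
    (hF' : ∀ z ∈ h.range, z ∉ T -> ∑ i with χ i = z, F i = 0) :
    ∑ i, F i = Nat.card T * m := by
  rw [<- Finset.sum_fiberwise_of_maps_to (g := χ)
    (fun i _ => mem_image_of_mem _ (mem_univ i))]
  have h1 : ∀ z ∈ Finset.univ.image χ, ∑ i with χ i = z, F i = if z ∈ T then m else 0 := by
    intro z hz; obtain ⟨i, -, hi⟩ := Finset.mem_image.1 hz; split_ifs with hzT
    . exact hF z hzT
    . exact hF' z ⟨i, hi⟩ hzT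
  rw [sum_congr rfl h1, <- sum_filter, Finset.sum_const, smul_eq_mul]; congr 1
  have h2 : (T : Set G) = ((Finset.univ.image χ).filter (· ∈ T) : Finset G) := by
    ext z; simp only [Finset.coe_filter, SetLike.mem_coe, Finset.mem_image, mem_univ, true_and]
    exact ⟨fun hz => ⟨hT hz, hz⟩, fun hz => hz.2⟩
  rw [<- Set.ncard_coe_finset, <- h2]; rfl

lemma gd_eq_card_mul : C.gd = Nat.card h.range * ggd χ 1 := by
  refine (Mdl.gd_eq).trans (h.sum_eq_card_mul h.range le_rfl ?_ fun z hz hz' => (hz' hz).elim)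
  rintro _ ⟨c, rfl⟩; rw [<- h.ggd_eq c, ggd, sum_gwt_mul]; exact sum_congr rfl fun i _ => pow_two _

end IsGrading
end Fus

namespace Mdl
open LCat Fus
variable {C : Fus N Δ} [C.Split] {O : Type w} [MulAction Δ O] (M : Mdl C O) [M.Split]

/-- Restriction of a module category to a fusion subcategory. -/
def restrict (K : C.Sub) : Mdl K.restrict O where
  toLCat := M.toLCat
  one_smul a := M.one_smul a.1
  lw ht a := M.lw ht a.1
  rw ht := M.rw ht
  tr_left ht := M.tr_left ht

instance (K : C.Sub) : (M.restrict K).Split := ‹M.Split›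

variable {M} {G : Type*} [Group G] {χ : C.Irr -> G} (h : IsGrading χ)
include h

lemma wt_restrict_ker (X Y : O) : (M.restrict h.ker).wt X Y = M.pair (gwt χ 1) X Y := by
  have h1 : M.pair (gwt χ 1) X Y = ∑ c ∈ h.ker.S, C.dim (rep c) * M.hd (rep c • X) Y := sum_gwt_mul _ _ _
  rw [h1]; refine sum_bij (fun i _ => h.ker.incl i) (fun i _ => Sub.incl_mem i)
    (fun i _ j _ e => Sub.incl_injective e) (fun k hk => ?_) (fun i _ => ?_)
  . obtain ⟨i, hi⟩ := Sub.exists_incl hk; exact ⟨i, mem_univ _, hi⟩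
  . beta_reduce
    rw [Sub.dim_restrict, (add_dim).iso (Sub.iso_incl i)]; congr 1
    exact (add_smul_right (add_hd_right Y) X).iso (Sub.iso_incl i)

lemma pair_gwt_smul (z : G) (c : C.Irr) (X Y : O) :
    M.pair (gwt χ z) (rep c • X) Y = C.dim (rep c) * M.pair (gwt χ (z * χ c)) X Y :=
  pair_smul (h.sum_gwt z c) X Y

lemma sum_pair_gwt (z y : G) (X Y : O) :
    ∑ Z : M.Irr, M.pair (gwt χ z) X (rep Z) * M.pair (gwt χ y) (rep Z) Y
      = ggd χ z * M.pair (gwt χ (y * z)) X Y := by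
  rw [sum_pair_mul_pair, ggd, sum_mul]; refine sum_congr rfl fun c _ => ?_
  rw [pair_gwt_smul h]; unfold gwt; split_ifs with hc
  . rw [hc]; ring
  . simp

lemma pair_gwt_inv (z : G) (X Y : O) : M.pair (gwt χ z) X Y = M.pair (gwt χ z⁻¹) Y X := by
  rw [pair_star]; congr 1; ext c; unfold gwt; rw [h.star, dim_star, inv_eq_iff_eq_inv]

lemma mem_range_of_pair {z : G} {X Y : O} (hz : M.pair (gwt χ z) X Y ≠ 0) : z ∈ h.range := by
  obtain ⟨c, -, hc⟩ := exists_ne_zero_of_sum_ne_zero hz; refine ⟨c, ?_⟩; by_contra h1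
  rw [gwt, if_neg h1, zero_mul] at hc; exact hc rfl

lemma pair_trans {z y : G} {X Y : O} (Z : M.Irr) (h1 : M.pair (gwt χ z) X (rep Z) ≠ 0)
    (h2 : M.pair (gwt χ y) (rep Z) Y ≠ 0) : M.pair (gwt χ (y * z)) X Y ≠ 0 := by
  intro h0; have h3 := sum_pair_gwt (M := M) h z y X Y; rw [h0, mul_zero, sum_eq_zero_iff] at h3
  exact mul_ne_zero h1 h2 (h3 Z (mem_univ Z))

lemma pair_one_ne_zero (X : M.Irr) : M.pair (gwt χ 1) (rep X) (rep X) ≠ 0 :=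
  pair_ne_zero (by rw [hd_rep_rep]; simp) (by rw [gwt, if_pos h.unit]; exact (dim_rep_pos _).ne')

lemma pair_gwt_self {z : G} (X : M.Irr) (hz : M.pair (gwt χ z) (rep X) (rep X) ≠ 0) :
    M.pair (gwt χ z) (rep X) (rep X) = M.pair (gwt χ 1) (rep X) (rep X) := by
  obtain ⟨c, rfl⟩ := mem_range_of_pair h hz
  have hsymm : ∀ i j : M.Irr, M.pair (gwt χ 1) (rep i) (rep j) = M.pair (gwt χ 1) (rep j) (rep i) :=
    fun i j => by rw [pair_gwt_inv h, inv_one]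
  have hsq : ∀ i j : M.Irr, ∑ k : M.Irr, M.pair (gwt χ 1) (rep i) (rep k) * M.pair (gwt χ 1) (rep k) (rep j)
      = ggd χ 1 * M.pair (gwt χ 1) (rep i) (rep j) := fun i j => by
    rw [sum_pair_gwt h, one_mul]
  have key : ∀ i : M.Irr, M.pair (gwt χ (χ c)) (rep X) (rep i) * M.pair (gwt χ 1) (rep X) (rep X)
      = M.pair (gwt χ (χ c)) (rep X) (rep X) * M.pair (gwt χ 1) (rep X) (rep i) := by
    intro i; by_cases hi : M.pair (gwt χ 1) (rep X) (rep i) = 0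
    . have h1 : M.pair (gwt χ (χ c)) (rep X) (rep i) = 0 := by
        by_contra h2
        rw [pair_gwt_inv h] at h2; have h3 := pair_trans h X h2 hz
        rw [mul_inv_cancel, pair_gwt_inv h, inv_one] at h3; exact h3 hi
      rw [h1, hi, zero_mul, mul_zero]
    . refine Matrix.mul_eq_mul_of_sq_eq hsymm hsq (fun i => pair_one_ne_zero h i)
        (f := fun i => M.pair (gwt χ (χ c)) (rep X) (rep i)) (fun j => ?_) hi
      have h1 := sum_pair_gwt (M := M) h (χ c) 1 (rep X) (rep j)
      rw [one_mul, h.ggd_eq] at h1; rw [<- h1]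
      exact sum_congr rfl fun k _ => by rw [hsymm, mul_comm]
  set κ := M.pair (gwt χ 1) (rep X) (rep X) with hκ
  set ν := M.pair (gwt χ (χ c)) (rep X) (rep X) with hν
  have hκ0 := pair_one_ne_zero h X
  have e1 : ∑ i : M.Irr, M.pair (gwt χ (χ c)) (rep X) (rep i) ^ 2 = ggd χ 1 * κ := by
    have h1 := sum_pair_gwt (M := M) h (χ c) (χ c)⁻¹ (rep X) (rep X)
    rw [inv_mul_cancel, h.ggd_eq] at h1; rw [<- h1]
    exact sum_congr rfl fun i _ => by rw [pair_gwt_inv h _ (rep X) (rep i)]; rw [pow_two, pair_gwt_inv h _ (rep i), inv_inv]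
  have e2 : ∑ i : M.Irr, M.pair (gwt χ 1) (rep X) (rep i) ^ 2 = ggd χ 1 * κ := by
    rw [<- hsq]; exact sum_congr rfl fun i _ => by rw [pow_two, hsymm i X]
  have e3 : (ggd χ 1 * κ) * κ ^ 2 = (ggd χ 1 * κ) * ν ^ 2 := by
    conv_lhs => rw [<- e1, sum_mul]
    conv_rhs => rw [<- e2, sum_mul]
    refine sum_congr rfl fun i _ => ?_
    rw [<- mul_pow, key, mul_comm ν, mul_pow]
  have hg : ggd χ 1 ≠ 0 := by rw [<- h.gdim_ker]; exact Sub.gdim_pos.ne'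
  have := Nat.eq_of_mul_eq_mul_left (Nat.pos_of_ne_zero (mul_ne_zero hg hκ0)) e3
  exact (Nat.pow_left_injective (by norm_num) this).symm

open Classical in
lemma wt_dvd_of_grading (X : M.Irr)
    (ih : (M.restrict h.ker).wt (rep X) (rep X) ∣ h.ker.restrict.gd ^ 2) :
    M.wt (rep X) (rep X) ∣ C.gd ^ 2 := by
  let T : Subgroup G :=
    { carrier := {z | M.pair (gwt χ z) (rep X) (rep X) ≠ 0}
      one_mem' := pair_one_ne_zero h X
      mul_mem' := fun {a b} ha hb => pair_trans h X hb ha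
      inv_mem' := fun {a} ha => by
        have := ha
        rw [Set.mem_ofPred_eq, pair_gwt_inv h] at this
        exact this }
  have hT : T ≤ h.range := fun z hz => mem_range_of_pair h hz
  have hsum : ∀ z, ∑ i : C.Irr with χ i = z, C.dim (rep i) * M.hd (rep i • rep X) (rep X)
      = M.pair (gwt χ z) (rep X) (rep X) := by
    exact fun z => (sum_gwt_mul _ _ _).symm
  have h1 : M.wt (rep X) (rep X) = Nat.card T * M.pair (gwt χ 1) (rep X) (rep X) := by
    refine h.sum_eq_card_mul T hT (fun z hz => ?_) (fun z _ hz => ?_)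
    . rw [hsum, pair_gwt_self h X hz]
    . rw [hsum]; by_contra h0; exact hz h0
  rw [wt_restrict_ker, Sub.gd_restrict, h.gdim_ker] at ih; rw [h1, h.gd_eq_card_mul, mul_pow]
  exact mul_dvd_mul ((Subgroup.card_dvd_of_le hT).trans (Dvd.intro_left (Nat.card h.range ^ 1) (by ring))) ih

end Mdl

namespace Fus
open LCat
variable {C : Fus N Δ} [C.Split]

namespace HB
variable {Z : HB C}

lemma exists_β_smul {x x' : N} (hx : x ∈ C.Hom 1 Z.a) (hx' : x' ∈ C.Hom Z.a 1)
    (h2 : x * x' = C.one Z.a) {c : Δ} (hc : C.Simple c) :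
    ∃ s : ℂ, Z.β c * x = s • C.ρ c x := by
  have hm := w_comp (Z.mem c) hx c rfl (one_mul c).symm
  obtain ⟨s, hs⟩ := hc.2 (C.ρ c x' * (Z.β c * x))
    (C.comp_mem (lw_eq hx' c rfl (mul_one c).symm) hm)
  refine ⟨s, ?_⟩
  have h3 := congrArg (C.ρ c x * ·) hs
  simp at h3
  rwa [<- mul_assoc, <- map_mul, h2, <- C.one_mul, C.one_comp hm, C.one_eq, <- map_mul, mul_one] at h3

lemma β_smul_mul {x x' : N} (hx : x ∈ C.Hom 1 Z.a) (h1 : x' * x = 1) {a b c : Δ} {r s t : ℂ}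
    (ha : Z.β a * x = r • C.ρ a x) (hb : Z.β b * x = s • C.ρ b x) (hc : Z.β c * x = t • C.ρ c x)
    {y : N} (hy : y ∈ C.Hom c (a * b)) (hy0 : y ≠ 0) : t = r * s := by
  have e1 : Z.β (a * b) * x = (r * s) • C.ρ (a * b) x := by
    rw [Z.mul, mul_assoc, ha, mul_smul_comm, <- map_mul, hb, map_smul, smul_smul, C.ρ_mul]
  have e2 : y * (Z.β c * x) = Z.β (a * b) * x * y := by
    rw [<- mul_assoc, Z.nat hy, mul_assoc, <- nat_one hx, mul_assoc]
  rw [hc, e1, mul_smul_comm, smul_mul_assoc, C.nat hy] at e2; have h0 : C.ρ (a * b) x * y ≠ 0 := by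
    intro h; have h3 := congrArg (C.ρ (a * b) x' * ·) h; simp [mul_zero] at h3
    rw [<- mul_assoc, <- map_mul, h1, <- C.one_eq, C.one_comp hy] at h3; exact hy0 h3
  exact smul_left_injective ℂ h0 e2

/-- An object of the centre over the unit object is a grading. -/
lemma exists_grading (hZ : C.Iso Z.a 1) (hne : ¬ C.Z.Iso Z 1) :
    ∃ χ : C.Irr -> ℂˣ, IsGrading χ ∧ ∃ i, χ i ≠ 1 := by
  obtain ⟨x', x, hx', hx, h2, h1⟩ := hZ; rw [C.one_one] at h1
  choose s hs using fun i => exists_β_smul hx hx' h2 (rep_simple i)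
  have h0 : ∀ i, s i ≠ 0 := by
    intro i h; obtain ⟨t, ht⟩ := exists_β_smul hx hx' h2 (simple_cj (rep_simple i))
    have hu : Z.β 1 * x = (1 : ℂ) • C.ρ 1 x := by rw [Z.one, C.one_comp hx, C.ρ_one, one_smul]
    have h3 := β_smul_mul hx h1 (hs i) ht hu (C.cv'_mem (rep i)) (by
      intro h4; have h5 := C.zag' (rep i); rw [h4, mul_zero] at h5
      exact (rep_simple i).1 h5.symm)
    rw [h, zero_mul] at h3; exact one_ne_zero h3
  refine ⟨fun i => Units.mk0 (s i) (h0 i), fun i j k hk => ?_, ?_⟩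
  . rw [Ne, hd_eq_zero] at hk
    push Not at hk
    obtain ⟨y, hy, hy0⟩ := hk; exact Units.ext (β_smul_mul hx h1 (hs i) (hs j) (hs k) hy hy0)
  . by_contra hcon
    push Not at hcon
    have hs1 : ∀ i, s i = 1 := fun i => congrArg Units.val (hcon i)
    have hall : ∀ c, Z.β c * x = C.ρ c x := by
      intro c; obtain ⟨n, l, t, t', ht⟩ := C.exists_dec c
      have hm := w_comp (Z.mem c) hx c rfl (one_mul c).symm
      have hm' := lw_eq hx c (mul_one c).symm rfl
      rw [<- ht.expand_right hm, <- ht.expand_right hm']; refine sum_congr rfl fun k _ => ?_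
      congr 1
      rw [mul_assoc, nat_one hx, <- mul_assoc, <- Z.nat (ht.mem k), mul_assoc, hs, hs1, one_smul,
        C.nat (ht.mem k)]
    have hxZ : x ∈ HB.Hom 1 Z := ⟨hx, fun c => by rw [hall, one_β, C.one_eq, <- map_mul, mul_one]⟩
    have hxZ' := inv_memHom hxZ hx' (h1.trans C.one_one.symm) h2
    exact hne ⟨x', x, hxZ', hxZ, h2, h1.trans C.one_one.symm⟩

end HB

lemma exists_pow_hd (x : Δ) (hx : C.dim x = 1) : ∃ j, j ≠ 0 ∧ C.hd 1 (x ^ j) ≠ 0 := by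
  have hdim : ∀ i, C.dim (x ^ i) = 1 := fun i => by
    induction i with
    | zero => rw [pow_zero, dim_one]
    | succ i ih => rw [pow_succ, dim_mul, ih, hx]
  obtain ⟨i, j, hij, h⟩ := Finite.exists_ne_map_eq_of_infinite
    fun i => cls (x ^ i) (simple_of_dim_eq_one (hdim i))
  wlog hlt : i < j generalizing i j
  . exact this j i hij.symm h.symm (lt_of_le_of_ne (not_lt.1 hlt) hij.symm)
  refine ⟨j - i, by omega, ?_⟩
  have hiso := (cls_eq_iff.1 h).trans (iso_rep_cls _).symm
  have h1 : C.hd (x ^ i * 1) (x ^ i * x ^ (j - i)) ≠ 0 := by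
    rw [mul_one, <- pow_add, Nat.add_sub_cancel' hlt.le, <- (add_hd_left _).iso hiso,
      hd_self_of_simple (simple_of_dim_eq_one (hdim i))]
    exact one_ne_zero
  rwa [hd_mul_left, <- mul_assoc, (add_mul_right (add_hd_left 1) _).iso (Mdl.iso_cj_mul (hdim i)),
    one_mul] at h1

end Fus

open LCat Fus in
/-- In a module category over a fusion category of dimension `n = p ^ a * q ^ b`, the weight of a
simple object divides `n ^ 2`. -/
lemma Mdl.wt_dvd_gd_sq {p q : ℕ} (hp : p.Prime) (hq : q.Prime) (n : ℕ) :
    ∀ {a b : ℕ} {N : Type u} [Ring N] [Algebra ℂ N] {Δ : Type u} [Monoid Δ] {C : Fus N Δ} [C.Split]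
      {O : Type u} [MulAction Δ O] (M : Mdl C O) [M.Split], C.gd = n -> n = p ^ a * q ^ b ->
      ∀ X, M.Simple X -> M.wt X X ∣ C.gd ^ 2 := by
  induction n using Nat.strong_induction_on with
  | _ n ih =>
    intro a b N _ _ Δ _ C _ O _ M _ hn hab X hX; have hgd0 : 0 < C.gd := Sub.gdim_pos
    have hpow : ∀ m, m ∣ n -> ∃ c e, m = p ^ c * q ^ e := by
      intro m hm; rw [hab] at hm; obtain ⟨x, y, hx, hy, hxy⟩ := (Nat.dvd_mul).1 hm
      obtain ⟨c, -, rfl⟩ := (Nat.dvd_prime_pow hp).1 hx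
      obtain ⟨e, -, rfl⟩ := (Nat.dvd_prime_pow hq).1 hy; exact ⟨c, e, hxy.symm⟩
    by_cases h1 : C.gd = 1
    . have hall : ∀ c, c = C.irr1 := by
        intro c; by_contra hc; have h2 : ∑ i ∈ {C.irr1, c}, C.dim (rep i) ^ 2 ≤ C.gd :=
          sum_le_sum_of_subset (subset_univ _)
        rw [sum_pair (Ne.symm hc), h1] at h2; have h3 := pow_pos (dim_rep_pos c) 2
        have h4 := pow_pos (dim_rep_pos C.irr1) 2
        omega
      have h2 : M.wt X X = 1 := by
        rw [Mdl.wt, Mdl.pair, sum_eq_single C.irr1 (fun c _ hc => (hc (hall c)).elim) (by simp),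
          HB.dim_irr1, one_mul,
          (Mdl.add_smul_right (add_hd_right X) X).iso unit_iso,
          MulAction.one_smul, hd_self_of_simple hX]
      rw [h2]; exact one_dvd _
    obtain ⟨k, hk, hkd, hkt⟩ := HB.exists_boson hp hq (hn.trans hab) h1
    set Z : HB C := rep k with hZ
    obtain ⟨j, hj⟩ := exists_pow_hd Z.a hkd; classical
    have hex : ∃ j, j ≠ 0 ∧ C.hd 1 (Z.a ^ j) ≠ 0 := ⟨j, hj⟩
    obtain ⟨hm0, hm1⟩ := Nat.find_spec hex
    have hmin : ∀ i, i ≠ 0 -> i < Nat.find hex -> C.hd 1 (Z ^ i).a = 0 := by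
      intro i hi0 hi; have := Nat.find_min hex hi
      push Not at this
      rw [HB.pow_a]; exact this hi0
    set m := Nat.find hex with hm
    have hdim : ∀ i, C.dim (Z.a ^ i) = 1 := fun i => by
      induction i with
      | zero => rw [pow_zero, dim_one]
      | succ i ih => rw [pow_succ, dim_mul, ih, hkd]
    by_cases hiso : C.Z.Iso (Z ^ m) 1
    . have hb : Z.β Z.a = C.one (Z.a * Z.a) := by rw [hZ, HB.β_self_eq hkd, hkt, _root_.one_smul]
      obtain ⟨A, hA, f, f', hs⟩ := HB.exists_calg hb hkd hm0 hiso hmin; have hmul := A.p_mul_gd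
      have hpne : A.p ≠ 1 := by
        rw [hA]; intro h; rw [h, pow_one] at hiso; exact hk (eq_irr1_of_iso hiso.symm)
      have h0 := A.p_ne
      have hlt : A.quot.gd < n := by
        rw [<- hn, <- hmul]; have : 0 < A.quot.gd := Sub.gdim_pos; nlinarith [show 2 ≤ A.p by omega]
      obtain ⟨c, e, hce⟩ := hpow A.quot.gd (by rw [<- hn, <- hmul]; exact dvd_mul_left _ _)
      exact A.wt_dvd hs (fun i => hdim i) hX (ih _ hlt (A.quotMdl M) rfl hce)
    . have hZ1 : C.Iso (Z ^ m).a 1 := by rw [HB.pow_a]; exact HB.iso_one_of_dim (hdim m) hm1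
      obtain ⟨χ, hχ, i, hi⟩ := HB.exists_grading hZ1 hiso; have hcard := hχ.gd_eq_card_mul
      rw [<- hχ.gdim_ker, <- Sub.gd_restrict] at hcard; have hlt : hχ.ker.restrict.gd < n := by
        rw [<- hn, Sub.gd_restrict]
        refine Finset.sum_lt_sum_of_subset (subset_univ _) (mem_univ i) ?_
          (pow_pos (dim_rep_pos i) 2) (fun _ _ _ => Nat.zero_le _)
        intro h; exact hi (by simpa [IsGrading.ker] using h)
      obtain ⟨c, e, hce⟩ := hpow hχ.ker.restrict.gd (by rw [<- hn, hcard]; exact dvd_mul_left _ _)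
      have hiX := iso_rep_cls hX
      have key := Mdl.wt_dvd_of_grading hχ (cls X hX)
        (ih _ hlt (M.restrict hχ.ker) rfl hce _ (rep_simple _))
      rwa [<- (Mdl.add_wt_left _).iso hiX, <- (Mdl.add_wt_right _).iso hiX] at key

namespace Fus
open LCat

/-- Dimensions of simple objects divide the dimension of a fusion category with at most two prime
factors. -/
lemma dim_dvd_gd {p q a b : ℕ} (hp : p.Prime) (hq : q.Prime) {N : Type u} [Ring N] [Algebra ℂ N]
    {Δ : Type u} [Monoid Δ] {C : Fus N Δ} [C.Split] (hn : C.gd = p ^ a * q ^ b) {X : Δ}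
    (hX : C.Simple X) : C.dim X ∣ C.gd := by
  have h := Mdl.wt_dvd_gd_sq hp hq _ (Mdl.regular C) rfl hn X hX
  have h2 : (Mdl.regular C).wt X X = C.dim X ^ 2 := by
    rw [pow_two]; nth_rw 2 [<- dim_cj X]; rw [<- dim_mul, add_dim.eq_sum]
    refine sum_congr rfl fun c _ => ?_
    rw [smul_eq_mul, mul_comm]; exact congrArg (· * _) (hd_mul_right X (rep c) X)
  rw [h2] at h; exact (Nat.pow_dvd_pow_iff two_ne_zero).1 h

end Fus

namespace Hopf
open TensorProduct Coalgebra HopfAlgebra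
variable {H : Type u} [Ring H] [HopfAlgebra ℂ H]

lemma sum_antipode_mul_comul (a : H) :
    ∑ i ∈ (ℛ ℂ a).index, (antipode ℂ ((ℛ ℂ a).left i) ⊗ₜ[ℂ] (1 : H)) *
      comul (R := ℂ) ((ℛ ℂ a).right i) = 1 ⊗ₜ a := by
  let Ψ : H ⊗[ℂ] (H ⊗[ℂ] H) →ₗ[ℂ] H ⊗[ℂ] H := TensorProduct.lift ((LinearMap.mul ℂ (H ⊗[ℂ] H)).comp
    (Algebra.TensorProduct.includeLeft.toLinearMap ∘ₗ antipode ℂ))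
  have key : Ψ ∘ₗ (TensorProduct.assoc ℂ H H H).toLinearMap =
      (LinearMap.mul' ℂ H ∘ₗ (antipode ℂ).rTensor H).rTensor H := by
    ext x y z; simp [Ψ]
  have h1 := congr(Ψ $(coassoc_apply a))
  have h2 := congr($key (comul.rTensor H (comul a)))
  rw [LinearMap.comp_apply, LinearEquiv.coe_coe, h1, <- rTensor_comp_apply,
    comp_assoc, mul_antipode_rTensor_comul, rTensor_comp_apply,
    rTensor_counit_comul] at h2
  conv_lhs at h2 => rw [<- (ℛ ℂ a).eq]
  simpa [Ψ] using h2

lemma sum_comul_mul_antipode (a : H) : ∑ i ∈ (ℛ ℂ a).index, comul (R := ℂ) ((ℛ ℂ a).left i) *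
      (1 ⊗ₜ[ℂ] antipode ℂ ((ℛ ℂ a).right i)) = a ⊗ₜ 1 := by
  let Ψ : (H ⊗[ℂ] H) ⊗[ℂ] H →ₗ[ℂ] H ⊗[ℂ] H := TensorProduct.lift
    ((LinearMap.mul ℂ (H ⊗[ℂ] H)).compl₂
      (includeRight.toLinearMap ∘ₗ antipode ℂ))
  have key : Ψ = (LinearMap.mul' ℂ H ∘ₗ (antipode ℂ).lTensor H).lTensor H ∘ₗ
      (TensorProduct.assoc ℂ H H H).toLinearMap := by
    ext x y z; simp [Ψ]
  have h2 := congr($key (comul.rTensor H (comul a)))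
  rw [LinearMap.comp_apply, LinearEquiv.coe_coe, coassoc_apply, <- lTensor_comp_apply,
    comp_assoc, mul_antipode_lTensor_comul, lTensor_comp_apply,
    lTensor_counit_comul] at h2
  conv_lhs at h2 => rw [<- (ℛ ℂ a).eq]
  simpa [Ψ] using h2

lemma exists_leftIntegral {R : Type u} [Ring R] [IsSemisimpleRing R] (ε : R →+* ℂ) :
    ∃ x : R, ε x = 1 ∧ ∀ a b, ε a = ε b -> a * x = b * x := by
  obtain ⟨J, hJ⟩ := exists_isCompl (RingHom.ker ε : Submodule R R)
  obtain ⟨k, hk, x, hx, h⟩ := Submodule.mem_sup.1 (hJ.codisjoint.eq_top.symm ▸ Submodule.mem_top : (1 : R) ∈ _)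
  refine ⟨x, ?_, fun a b hab => ?_⟩
  . have := congr(ε $h)
    rwa [map_add, (RingHom.mem_ker.1 hk : ε k = 0), zero_add, map_one] at this
  . rw [<- sub_eq_zero, <- sub_mul]
    refine (Submodule.disjoint_def.1 hJ.disjoint) _ ?_ (J.smul_mem (a - b) hx)
    change ε ((a - b) * x) = 0
    rw [map_mul, map_sub, hab, sub_self, zero_mul]

/-- A normalised two-sided integral. -/
structure Integral (Λ : H) : Prop where
  eps : counit (R := ℂ) Λ = 1
  mul_left : ∀ a, a * Λ = counit (R := ℂ) a • Λ
  mul_right : ∀ a, Λ * a = counit (R := ℂ) a • Λ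

lemma exists_integral [IsSemisimpleRing H] : ∃ Λ : H, Integral Λ := by
  let ε : H →+* ℂ := (Bialgebra.counitAlgHom ℂ H).toRingHom
  obtain ⟨x, hx, h⟩ := exists_leftIntegral ε; obtain ⟨y, hy, h'⟩ := exists_leftIntegral
    (ε.fromOpposite fun _ _ => mul_comm _ _)
  have hl : ∀ a, a * x = counit (R := ℂ) a • x := fun a => by
    rw [h a (algebraMap ℂ H (counit a)) (by simp [ε]), Algebra.smul_def]
  have hr : ∀ a, y.unop * a = counit (R := ℂ) a • y.unop := fun a => by
    have := congr(MulOpposite.unop $(h' (.op a) (.op (algebraMap ℂ H (counit a))) (by simp [ε])))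
    rw [MulOpposite.unop_mul, MulOpposite.unop_mul, MulOpposite.unop_op, MulOpposite.unop_op] at this
    rw [this, Algebra.smul_def, Algebra.commutes]
  have hx1 : counit (R := ℂ) x = 1 := hx
  have hy1 : counit (R := ℂ) y.unop = 1 := hy
  have hxy : y.unop = x := by
    have := hl y.unop
    rwa [hr, hx1, hy1, one_smul, one_smul] at this
  exact ⟨x, hx1, hl, hxy ▸ hr⟩

variable {Λ : H}

lemma sum_smul_counit (a : H) :
    ∑ i ∈ (ℛ ℂ a).index, counit (R := ℂ) ((ℛ ℂ a).right i) • (ℛ ℂ a).left i = a := by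
  have := congr(TensorProduct.rid ℂ H $(sum_tmul_counit_eq (ℛ ℂ a)))
  simpa only [map_sum, TensorProduct.rid_tmul, one_smul] using this

lemma Integral.tmul_comul (hΛ : Integral Λ) (a : H) :
    ((1 : H) ⊗ₜ[ℂ] a) * comul (R := ℂ) Λ = (antipode ℂ a ⊗ₜ 1) * comul Λ := by
  rw [<- sum_antipode_mul_comul, sum_mul]
  simp_rw [mul_assoc, <- Bialgebra.comul_mul, hΛ.mul_left, map_smul, mul_smul_comm,
    <- smul_mul_assoc, <- sum_mul, TensorProduct.smul_tmul', <- map_smul,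
    <- TensorProduct.sum_tmul, <- map_sum, sum_smul_counit]

lemma Integral.comul_tmul (hΛ : Integral Λ) (a : H) :
    comul (R := ℂ) Λ * (a ⊗ₜ[ℂ] 1) = comul Λ * (1 ⊗ₜ antipode ℂ a) := by
  rw [<- sum_comul_mul_antipode, mul_sum]
  simp_rw [<- mul_assoc, <- Bialgebra.comul_mul, hΛ.mul_right, map_smul, smul_mul_assoc,
    <- mul_smul_comm, <- mul_sum, <- TensorProduct.tmul_smul, <- map_smul,
    <- TensorProduct.tmul_sum, <- map_sum, sum_counit_smul]

/-- The slice map `a ⊗ b ↦ f b • a`. -/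
def lsl (f : H →ₗ[ℂ] ℂ) : H ⊗[ℂ] H →ₗ[ℂ] H := (TensorProduct.rid ℂ H).toLinearMap ∘ₗ f.lTensor H

/-- The slice map `a ⊗ b ↦ f a • b`. -/
def rsl (f : H →ₗ[ℂ] ℂ) : H ⊗[ℂ] H →ₗ[ℂ] H := (TensorProduct.lid ℂ H).toLinearMap ∘ₗ f.rTensor H

lemma lsl_tmul (f : H →ₗ[ℂ] ℂ) (a b : H) : lsl f (a ⊗ₜ b) = f b • a := by simp [lsl]

lemma rsl_tmul (f : H →ₗ[ℂ] ℂ) (a b : H) : rsl f (a ⊗ₜ b) = f a • b := by simp [rsl]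

lemma lsl_comp (f : H →ₗ[ℂ] ℂ) (g : H →ₗ[ℂ] H) (t : H ⊗[ℂ] H) :
    lsl (f ∘ₗ g) t = lsl f (g.lTensor H t) := by
  simp [lsl, LinearMap.lTensor_comp]

lemma lsl_smul (f : H →ₗ[ℂ] ℂ) (c : ℂ) (t : H ⊗[ℂ] H) : lsl (c • f) t = c • lsl f t := by
  simp [lsl, lTensor_smul]

lemma lsl_mul_mul (f : H →ₗ[ℂ] ℂ) (a b c d : H) (t : H ⊗[ℂ] H) : lsl f ((a ⊗ₜ b) * t * (c ⊗ₜ d)) =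
      a * lsl (f ∘ₗ mulLeft ℂ b ∘ₗ mulRight ℂ d) t * c := by
  induction t with
  | zero => simp
  | add x y hx hy => simp [mul_add, add_mul, map_add, hx, hy]
  | tmul x y => simp [lsl_tmul, mul_assoc]

lemma rsl_mul_mul (f : H →ₗ[ℂ] ℂ) (a b c d : H) (t : H ⊗[ℂ] H) : rsl f ((a ⊗ₜ b) * t * (c ⊗ₜ d)) =
      b * rsl (f ∘ₗ mulLeft ℂ a ∘ₗ mulRight ℂ c) t * d := by
  induction t with
  | zero => simp
  | add x y hx hy => simp [mul_add, add_mul, map_add, hx, hy]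
  | tmul x y => simp [rsl_tmul, mul_assoc]

lemma apply_lsl (f g : H →ₗ[ℂ] ℂ) (t : H ⊗[ℂ] H) : f (lsl g t) = g (rsl f t) := by
  induction t with
  | zero => simp
  | add x y hx hy => simp [map_add, hx, hy]
  | tmul x y => simp [rsl_tmul, lsl_tmul, mul_comm]

lemma comul_lsl (f : H →ₗ[ℂ] ℂ) (a : H) : comul (R := ℂ) (lsl f (comul a)) =
    (lsl f ∘ₗ comul).lTensor H (comul a) := by
  rw [lTensor_comp_apply, <- coassoc_apply]; generalize comul (R := ℂ) a = t; induction t with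
  | zero => simp
  | add x y hx hy => simp [map_add, hx, hy]
  | tmul x y =>
    simp [lsl_tmul, map_smul, LinearMap.rTensor_tmul]; generalize comul (R := ℂ) x = t
    induction t with
    | zero => simp
    | add x y hx hy => simp [map_add, hx, hy, TensorProduct.add_tmul, smul_add]
    | tmul x z => simp [lsl_tmul]

lemma comul_rsl (f : H →ₗ[ℂ] ℂ) (a : H) : comul (R := ℂ) (rsl f (comul a)) =
    (rsl f ∘ₗ comul).rTensor H (comul a) := by
  rw [rTensor_comp_apply, <- coassoc_symm_apply]; generalize comul (R := ℂ) a = t; induction t with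
  | zero => simp
  | add x y hx hy => simp [map_add, hx, hy]
  | tmul x y =>
    simp [rsl_tmul, map_smul, LinearMap.lTensor_tmul]; generalize comul (R := ℂ) y = t
    induction t with
    | zero => simp
    | add x y hx hy => simp [map_add, hx, hy, TensorProduct.tmul_add, smul_add]
    | tmul y z => simp [rsl_tmul, TensorProduct.smul_tmul']

variable [FiniteDimensional ℂ H]

lemma Integral.lsl_injective (hΛ : Integral Λ) {f g : H →ₗ[ℂ] ℂ}
    (h : lsl f (comul Λ) = lsl g (comul Λ)) : f = g := by
  have h1 : ∀ a, lsl (f ∘ₗ mulLeft ℂ a) (comul Λ) = lsl (g ∘ₗ mulLeft ℂ a) (comul Λ) := fun a => by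
    have key := fun f => by
      have := lsl_mul_mul f 1 a 1 1 (comul Λ)
      rw [hΛ.tmul_comul, lsl_mul_mul] at this; simpa [mulLeft_one, mulRight_one] using this.symm
    rw [key, key, h]
  let e := finBasis ℂ H
  have h2 : ∀ (f : H →ₗ[ℂ] ℂ) b, f b = ∑ i, e.coord i (antipode ℂ
      (lsl (f ∘ₗ mulLeft ℂ (b * e i)) (comul Λ))) := fun f b => by
    have h3 : f ∘ₗ mulLeft ℂ b ∘ₗ LinearMap.mul' ℂ H ∘ₗ (antipode ℂ).rTensor H =
        ∑ i, e.coord i ∘ₗ antipode ℂ ∘ₗ lsl (f ∘ₗ mulLeft ℂ (b * e i)) := by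
      ext x y; have := congr(f (b * $(e.sum_repr (antipode ℂ x)) * y))
      rw [mul_sum, sum_mul, map_sum] at this; simpa [lsl_tmul, mul_assoc, mul_comm] using this.symm
    have := congr($h3 (comul Λ))
    rw [LinearMap.comp_apply, LinearMap.comp_apply, LinearMap.comp_apply,
      mul_antipode_rTensor_comul_apply, hΛ.eps] at this
    simpa [LinearMap.sum_apply] using this
  ext b; rw [h2 f, h2 g]; simp_rw [h1]

lemma Integral.exists_dual (hΛ : Integral Λ) : ∃ φ : H →ₗ[ℂ] ℂ, lsl φ (comul Λ) = 1 := by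
  let J : (H →ₗ[ℂ] ℂ) →ₗ[ℂ] H :=
    { toFun := fun f => lsl f (comul Λ)
      map_add' := fun f g => by simp [lsl, LinearMap.lTensor_add]
      map_smul' := fun c f => by simp [lsl, lTensor_smul] }
  have hJ : Function.Injective J := fun f g h => hΛ.lsl_injective h
  exact (LinearMap.injective_iff_surjective_of_finrank_eq_finrank
    (Subspace.dual_finrank_eq)).1 hJ 1

variable {φ : H →ₗ[ℂ] ℂ}

section
variable (hΛ : Integral Λ) (hφ : lsl φ (comul Λ) = 1)
include hΛ hφ

lemma Integral.lsl_eq (a : H) : lsl φ (comul a) = φ a • 1 := by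
  have h1 : ∀ f, φ ∘ₗ rsl f ∘ₗ comul = f 1 • φ := fun f => by
    apply hΛ.lsl_injective
    have h2 : φ ∘ₗ rsl f ∘ₗ comul = f ∘ₗ lsl φ ∘ₗ comul := by ext x; exact (apply_lsl f φ _).symm
    have h3 := comul_lsl φ Λ
    rw [hφ, Bialgebra.comul_one] at h3; rw [h2, lsl_comp, <- h3, lsl_smul, hφ, one_def, lsl_tmul]
  let e := finBasis ℂ H
  refine e.ext_elem fun i => ?_
  have := congr($(h1 (e.coord i)) a)
  simpa [<- apply_lsl, mul_comm] using this

lemma Integral.apply_dual : φ Λ = 1 := by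
  have h := hΛ.lsl_eq hφ Λ
  have := congr(counit (R := ℂ) $h)
  rw [hφ] at this; simpa using this.symm

lemma Integral.lsl_mul_antipode (a : H) : lsl (φ ∘ₗ mulRight ℂ (antipode ℂ a)) (comul Λ) = a := by
  have := lsl_mul_mul φ 1 1 a 1 (comul Λ)
  rw [<- one_def, one_mul, hΛ.comul_tmul, <- one_mul (comul Λ), one_def, lsl_mul_mul] at this
  simpa only [mulLeft_one, mulRight_one, comp_id, id_comp,
    one_mul, mul_one, <- one_def, hφ] using this

lemma Integral.lsl_mul_left (a : H) : lsl (φ ∘ₗ mulLeft ℂ a) (comul Λ) = antipode ℂ a := by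
  have := lsl_mul_mul φ 1 a 1 1 (comul Λ)
  rw [hΛ.tmul_comul, lsl_mul_mul] at this; simpa [mulLeft_one, mulRight_one, hφ] using this.symm

lemma Integral.antipode_injective : Function.Injective (antipode ℂ (A := H)) := fun a b h => by
  rw [<- hΛ.lsl_mul_antipode hφ a, h, hΛ.lsl_mul_antipode hφ]

lemma Integral.apply_mul_sq (a b : H) : φ (b * antipode ℂ (antipode ℂ a)) = φ (a * b) := by
  have := hΛ.lsl_injective ((hΛ.lsl_mul_antipode hφ (antipode ℂ a)).trans
    (hΛ.lsl_mul_left hφ a).symm)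
  exact congr($this b)

lemma Integral.rsl_eq (a : H) : rsl φ (comul a) = φ a • rsl φ (comul Λ) := by
  have h1 : ∀ f, φ ∘ₗ lsl f ∘ₗ comul = f (rsl φ (comul Λ)) • φ := fun f => by
    apply hΛ.lsl_injective
    have h3 := congr(lsl φ $(comul_lsl f Λ))
    rw [hΛ.lsl_eq hφ, apply_lsl] at h3; rw [lsl_comp, <- h3, lsl_smul, hφ]
  let e := finBasis ℂ H
  refine e.ext_elem fun i => ?_
  have := congr($(h1 (e.coord i)) a)
  simpa [apply_lsl, mul_comm] using this

lemma Integral.isGroupLikeElem : IsGroupLikeElem ℂ (rsl φ (comul Λ)) where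
  counit_eq_one := by rw [<- apply_lsl, <- hΛ.apply_dual hφ]; simp [lsl]
  comul_eq_tmul_self := by
    have : rsl φ ∘ₗ comul = φ.smulRight (rsl φ (comul Λ)) := by ext a; exact hΛ.rsl_eq hφ a
    rw [comul_rsl, this]
    have h : ∀ (g : H) t, (φ.smulRight g).rTensor H t = g ⊗ₜ rsl φ t := fun g t => by
      induction t with
      | zero => simp
      | add x y hx hy => simp [map_add, hx, hy, TensorProduct.tmul_add]
      | tmul x y => simp [rsl_tmul, TensorProduct.smul_tmul]
    exact h _ _

lemma Integral.radford (a : H) : a * rsl φ (comul Λ) =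
    rsl φ (comul Λ) * antipode ℂ (antipode ℂ (antipode ℂ (antipode ℂ a))) := by
  have h1 := rsl_mul_mul φ 1 a 1 1 (comul Λ)
  rw [hΛ.tmul_comul, rsl_mul_mul] at h1
  have h2 := rsl_mul_mul φ 1 1 (antipode ℂ (antipode ℂ (antipode ℂ a))) 1 (comul Λ)
  rw [<- one_def, one_mul, hΛ.comul_tmul, <- one_mul (comul Λ), one_def, rsl_mul_mul] at h2
  have h3 : φ ∘ₗ mulLeft ℂ (antipode ℂ a) =
      φ ∘ₗ mulRight ℂ (antipode ℂ (antipode ℂ (antipode ℂ a))) := by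
    ext b; exact (hΛ.apply_mul_sq hφ _ _).symm
  simp [mulLeft_one, mulRight_one, comp_id, id_comp, one_mul, mul_one, <- one_def] at h1 h2
  rw [<- h1, h3, h2]

lemma Integral.exists_pow_antipode : ∃ m, 0 < m ∧ ((antipode ℂ (A := H)) ^ 2) ^ m = 1 := by
  set g := rsl φ (comul Λ)
  have hg := hΛ.isGroupLikeElem hφ
  have hfin := (linearIndepOn_isGroupLikeElem (R := ℂ) (A := H)).setFinite
  obtain ⟨i, j, hij, h⟩ : ∃ i j, i < j ∧ g ^ i = g ^ j := by
    obtain ⟨i, -, j, -, hij, h⟩ := Set.infinite_univ.exists_ne_map_eq_of_mapsTo (f := fun i => g ^ i)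
      (fun i _ => hg.pow) hfin
    rcases lt_or_gt_of_ne hij with h' | h'
    exacts [⟨i, j, h', h⟩, ⟨j, i, h', h.symm⟩]
  have h1 : ∀ k a, a * g ^ k = g ^ k * ((antipode ℂ ^ 4) ^ k) a := fun k => by
    induction k with
    | zero => simp
    | succ k ih =>
      intro a; rw [pow_succ, <- mul_assoc, ih, mul_assoc, hΛ.radford hφ, pow_succ' _ k, mul_assoc]
      rfl
  have hu := hg.isUnit
  have h2 : g ^ (j - i) = 1 := by
    refine (hu.pow i).mul_left_cancel ?_
    rw [<- pow_add, Nat.add_sub_cancel' hij.le, mul_one, h]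
  refine ⟨2 * (j - i), by omega, ?_⟩
  ext a; have := h1 (j - i) a; rw [h2, one_mul, mul_one] at this
  rw [pow_mul, <- pow_mul _ 2 2, <- this]; rfl
end
end Hopf

namespace Hopf
open TensorProduct Coalgebra HopfAlgebra
variable {H : Type u} [Ring H] [HopfAlgebra ℂ H]

lemma comul_antipode (a : H) : comul (R := ℂ) (antipode ℂ a) =
    TensorProduct.comm ℂ H H (TensorProduct.map (antipode ℂ) (antipode ℂ) (comul a)) := by
  open WithConv in
  let i₁ : H →ₗ[ℂ] H ⊗[ℂ] H := Algebra.TensorProduct.includeLeft.toLinearMap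
  let i₂ : H →ₗ[ℂ] H ⊗[ℂ] H := includeRight.toLinearMap
  have h1 : toConv (i₁ ∘ₗ antipode ℂ) * toConv (comul) = toConv i₂ := by
    ext a; rw [(ℛ ℂ a).convMul_apply]; exact sum_antipode_mul_comul a
  have h2 : toConv (i₂ ∘ₗ antipode ℂ) * toConv i₂ = 1 := by
    ext a; rw [(ℛ ℂ a).convMul_apply]
    have := congr(i₂ $(sum_antipode_mul_eq_algebraMap_counit (ℛ ℂ a)))
    rw [map_sum] at this
    refine Eq.trans ?_ (this.trans
      (AlgHom.commutes (includeRight : H →ₐ[ℂ] H ⊗[ℂ] H) _))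
    simp [i₂]
  have h3 := left_inv_eq_right_inv ((mul_assoc _ _ _).trans ((congr_arg _ h1).trans h2))
    (LinearMap.comul_right_inv)
  have h4 := congr(($h3).ofConv a)
  rw [(ℛ ℂ a).convMul_apply] at h4; simp [LinearMap.comp_apply] at h4; rw [<- h4]
  conv_rhs => rw [<- (ℛ ℂ a).eq]
  simp [i₁, i₂]

/-- A linear endomorphism compatible with the bialgebra operations. -/
structure IsBialg (T : H →ₗ[ℂ] H) : Prop where
  mul : ∀ a b, T (a * b) = T a * T b
  comul : ∀ a, comul (R := ℂ) (T a) = TensorProduct.map T T (comul (R := ℂ) a)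

lemma isBialg_antipode_sq : IsBialg (antipode ℂ (A := H) ^ 2) where
  mul a b := by simp [pow_two, antipode_mul_antidistrib]
  comul a := by
    rw [pow_two, Module.End.mul_apply, comul_antipode, comul_antipode]
    generalize comul (R := ℂ) a = t; induction t with
    | zero => simp
    | add x y hx hy => simp [map_add, hx, hy]
    | tmul x y => simp

lemma IsBialg.pow {T : H →ₗ[ℂ] H} (h : IsBialg T) (k : ℕ) : IsBialg (T ^ k) := by
  induction k with
  | zero => exact ⟨by simp, fun a => by simp [Module.End.one_eq_id]⟩
  | succ k ih =>
    refine ⟨fun a b => by simp [pow_succ, h.mul, ih.mul], fun a => ?_⟩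
    rw [pow_succ, Module.End.mul_apply, ih.comul, h.comul, <- LinearMap.comp_apply,
      <- TensorProduct.map_comp]
    rfl

section
variable [FiniteDimensional ℂ H]

/-- The character of the regular representation. -/
def regChar : H →ₗ[ℂ] ℂ := LinearMap.trace ℂ H ∘ₗ LinearMap.mul ℂ H

lemma regChar_apply (a : H) : regChar a = LinearMap.trace ℂ H (mulLeft ℂ a) := rfl

lemma regChar_lsl (t : H ⊗[ℂ] H) : regChar (lsl regChar t) =
    LinearMap.trace ℂ _ (LinearMap.mul ℂ _ t) := by
  induction t with
  | zero => simp
  | add x y hx hy => simp [map_add, hx, hy]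
  | tmul x y =>
    rw [lsl_tmul, map_smul, smul_eq_mul, mul_comm, regChar_apply, regChar_apply,
      <- LinearMap.trace_tensorProduct']
    congr 1; ext; simp

lemma regChar_lsl_comul (a : H) : regChar (lsl regChar (comul a)) = finrank ℂ H * regChar a := by
  let θ : H ⊗[ℂ] H →ₗ[ℂ] H ⊗[ℂ] H := TensorProduct.lift ((LinearMap.mul ℂ (H ⊗[ℂ] H)).compl₁₂
    (comul) includeRight.toLinearMap)
  have hθ : ∀ x y, θ (x ⊗ₜ y) = comul x * (1 ⊗ₜ y) := fun x y => by simp [θ]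
  have hs : Function.Surjective θ := by
    rw [<- LinearMap.range_eq_top, eq_top_iff, <- TensorProduct.span_tmul_eq_top, Submodule.span_le]
    rintro _ ⟨x, y, rfl⟩
    refine ⟨∑ i ∈ (ℛ ℂ x).index, (ℛ ℂ x).left i ⊗ₜ (antipode ℂ ((ℛ ℂ x).right i) * y), ?_⟩
    have := congr($(sum_comul_mul_antipode x) * (1 ⊗ₜ[ℂ] y))
    rw [sum_mul] at this; simpa [hθ, mul_assoc] using this
  let e := LinearEquiv.ofBijective θ ⟨LinearMap.injective_iff_surjective.2 hs, hs⟩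
  have h0 : LinearMap.mul ℂ _ (comul a) ∘ₗ θ = θ ∘ₗ LinearMap.mul ℂ _ (a ⊗ₜ[ℂ] 1) := by
    ext x y; simp [hθ, mul_assoc]
  have h1 : LinearMap.mul ℂ _ (comul a) = e.conj (LinearMap.mul ℂ _ (a ⊗ₜ[ℂ] 1)) := by
    refine LinearMap.ext fun z => ?_
    obtain ⟨w, rfl⟩ := e.surjective z
    rw [LinearEquiv.conj_apply_apply, LinearEquiv.symm_apply_apply]; exact congr($h0 w)
  rw [regChar_lsl, h1, trace_conj', <- regChar_lsl, lsl_tmul, map_smul, smul_eq_mul]; congr 1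
  simp [regChar_apply, mulLeft_one]

lemma Integral.regChar {Λ : H} (hΛ : Integral Λ) : regChar Λ = 1 := by
  have : mulLeft ℂ Λ = (counit).smulRight Λ := by ext a; simp [hΛ.mul_right]
  rw [regChar_apply, this, LinearMap.trace_smulRight, hΛ.eps]

lemma trace_comp_lsl {Λ : H} (hΛ : Integral Λ) {T : H →ₗ[ℂ] H} (hT : IsBialg T)
    (hinv : ∀ a, T (antipode ℂ (antipode ℂ a)) = a) (hinj : Function.Injective (antipode ℂ (A := H)))
    (hcomm : ∀ a, antipode ℂ (T a) = T (antipode ℂ a))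
    (f : H →ₗ[ℂ] ℂ) : LinearMap.trace ℂ H (T ∘ₗ lsl f ∘ₗ comul) = f Λ * LinearMap.trace ℂ H T := by
  have h1 : ∀ h : H, ∑ i ∈ (ℛ ℂ h).index, (ℛ ℂ h).right i * T (antipode ℂ ((ℛ ℂ h).left i)) =
      counit (R := ℂ) h • 1 := fun h => by
    apply hinj
    simp only [map_sum, antipode_mul_antidistrib, hcomm, hinv, map_smul, antipode_one]
    exact sum_mul_antipode_eq_smul _
  have h2 : ∀ h : H, LinearMap.trace ℂ H (T ∘ₗ lsl (f ∘ₗ mulLeft ℂ h) ∘ₗ comul) =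
      counit h * LinearMap.trace ℂ H (T ∘ₗ lsl f ∘ₗ comul) := fun h => by
    have h3 : T ∘ₗ lsl (f ∘ₗ mulLeft ℂ h) ∘ₗ comul = ∑ i ∈ (ℛ ℂ h).index,
        mulLeft ℂ (T (antipode ℂ ((ℛ ℂ h).left i))) * ((T ∘ₗ lsl f ∘ₗ comul) *
          mulLeft ℂ ((ℛ ℂ h).right i)) := by
      ext x; have := lsl_mul_mul f 1 h 1 1 (comul x)
      rw [<- sum_antipode_mul_comul, <- one_def, mul_one, sum_mul, map_sum] at this
      simp only [mulRight_one, comp_id, one_mul, mul_one] at this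
      rw [LinearMap.comp_apply, LinearMap.comp_apply, <- this, map_sum, LinearMap.sum_apply]
      refine sum_congr rfl fun i _ => ?_
      have := lsl_mul_mul f (antipode ℂ ((ℛ ℂ h).left i)) 1 1 1
        (comul ((ℛ ℂ h).right i * x))
      rw [<- one_def, mul_one] at this
      simp only [mulLeft_one, mulRight_one, comp_id, mul_one] at this
      rw [mul_assoc, <- Bialgebra.comul_mul, this, hT.mul]; rfl
    rw [h3, map_sum]
    have h4 : ∀ i, LinearMap.trace ℂ H (mulLeft ℂ (T (antipode ℂ ((ℛ ℂ h).left i))) *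
        ((T ∘ₗ lsl f ∘ₗ comul) * mulLeft ℂ ((ℛ ℂ h).right i))) =
        LinearMap.trace ℂ H ((T ∘ₗ lsl f ∘ₗ comul) *
          LinearMap.mul ℂ H ((ℛ ℂ h).right i * T (antipode ℂ ((ℛ ℂ h).left i)))) := fun i => by
      rw [LinearMap.trace_mul_comm, mul_assoc]; congr 2; ext; simp [mul_assoc]
    simp_rw [h4, <- map_sum, <- mul_sum, <- map_sum, h1, map_smul, mul_smul_comm, map_smul]; congr 2
    ext; simp
  have h5 : f ∘ₗ mulLeft ℂ Λ = f Λ • counit := by ext a; simp [hΛ.mul_right, mul_comm]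
  have h6 : lsl (counit (A := H)) ∘ₗ comul = LinearMap.id := by ext a; simp [lsl]
  have h7 : lsl (f ∘ₗ mulLeft ℂ Λ) = f Λ • lsl (counit) := by
    exact LinearMap.ext fun t => by rw [h5, lsl_smul]; rfl
  have := h2 Λ
  rw [hΛ.eps, one_mul, h7, LinearMap.smul_comp, h6, LinearMap.comp_smul, map_smul] at this
  rw [<- this]; rfl
end
end Hopf

namespace Hopf

open Polynomial in
lemma eval_eq_zero_of_mem_roots_charpoly {V : Type u} [AddCommGroup V] [Module ℂ V]
    [FiniteDimensional ℂ V] {f : End ℂ V} {p : ℂ[X]} (hp : aeval f p = 0) {μ : ℂ}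
    (hμ : μ ∈ f.charpoly.roots) : p.eval μ = 0 := by
  obtain ⟨x, hx⟩ := ((End.hasEigenvalue_iff_isRoot_charpoly f μ).2
    (isRoot_of_mem_roots hμ)).exists_hasEigenvector
  have := End.aeval_apply_of_hasEigenvector (p := p) hx
  rw [hp] at this; exact (smul_eq_zero.1 this.symm).resolve_right hx.2

lemma trace_eq_sum_roots {V : Type u} [AddCommGroup V] [Module ℂ V] [FiniteDimensional ℂ V]
    (f : End ℂ V) : LinearMap.trace ℂ V f = f.charpoly.roots.sum :=
  End.trace_eq_sum_roots_charpoly_of_splits (IsAlgClosed.splits _)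

lemma card_roots_charpoly {V : Type u} [AddCommGroup V] [Module ℂ V] [FiniteDimensional ℂ V]
    (f : End ℂ V) : Multiset.card f.charpoly.roots = finrank ℂ V := by
  rw [<- (IsAlgClosed.splits f.charpoly).natDegree_eq_card_roots, LinearMap.charpoly_natDegree]

lemma norm_eq_one_of_pow {m : ℕ} (hm : 0 < m) {μ : ℂ} (h : μ ^ m = 1) : ‖μ‖ = 1 :=
  Complex.norm_eq_one_of_pow_eq_one h hm.ne'

open Polynomial in
lemma eq_one_of_trace_eq {V : Type u} [AddCommGroup V] [Module ℂ V] [FiniteDimensional ℂ V]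
    {T : End ℂ V} {m : ℕ} (hm : 0 < m) (hT : T ^ m = 1)
    (htr : LinearMap.trace ℂ V T = finrank ℂ V) : T = 1 := by
  have h0 : aeval T (X ^ m - 1 : ℂ[X]) = 0 := by simp [hT]
  have h1 : ∀ μ ∈ T.charpoly.roots, μ ^ m = 1 := fun μ hμ => by
    simpa [sub_eq_zero] using eval_eq_zero_of_mem_roots_charpoly h0 hμ
  have h2 : (T.charpoly.roots.map fun μ => 1 - μ.re).sum = 0 := by
    rw [Multiset.sum_map_sub, Multiset.map_const', Multiset.sum_replicate, card_roots_charpoly,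
      nsmul_one, sub_eq_zero]
    have := congr(Complex.reAddGroupHom $htr)
    rw [trace_eq_sum_roots, map_multiset_sum] at this; simpa using this.symm
  have h3 : ∀ μ ∈ T.charpoly.roots, μ = 1 := fun μ hμ => by
    have hre : ∀ μ ∈ T.charpoly.roots, 0 ≤ 1 - μ.re := fun μ hμ => by
      rw [sub_nonneg, <- norm_eq_one_of_pow hm (h1 μ hμ)]; exact Complex.re_le_norm μ
    have h4 := Multiset.all_zero_of_le_zero_le_of_sum_eq_zero (fun x hx => by
      obtain ⟨ν, hν, rfl⟩ := Multiset.mem_map.1 hx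
      exact hre ν hν) h2 _ (Multiset.mem_map_of_mem (fun μ => 1 - μ.re) hμ)
    have h5 := Complex.sq_norm_sub_sq_re μ
    rw [norm_eq_one_of_pow hm (h1 μ hμ), <- sub_eq_zero.1 h4] at h5
    exact Complex.ext (by simpa using (sub_eq_zero.1 h4).symm)
      (by simpa using pow_eq_zero_iff (two_ne_zero) |>.1 (by linarith : μ.im ^ 2 = 0))
  have h4 : T.charpoly = (X - C 1) ^ finrank ℂ V := by
    rw [(IsAlgClosed.splits T.charpoly).eq_prod_roots_of_monic (LinearMap.charpoly_monic T),
      Multiset.eq_replicate.2 ⟨card_roots_charpoly T, h3⟩]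
    simp
  have hsq :=
    ((X_pow_sub_one_separable_iff.2 (by exact_mod_cast hm.ne')).squarefree).squarefree_of_dvd
      (minpoly.dvd _ _ h0)
  have h5 : minpoly ℂ T ∣ X - C 1 := by
    have h6 := h4 ▸ LinearMap.minpoly_dvd_charpoly T
    by_cases hn : finrank ℂ V = 0
    . rw [hn, pow_zero] at h6; exact h6.trans (one_dvd _)
    . exact (hsq.dvd_pow_iff_dvd hn).1 h6
  have := minpoly.dvd_iff.1 h5
  simpa [sub_eq_zero] using this

open Polynomial IntermediateField in
/-- An algebraic integer that is an average of roots of unity is `0` or has absolute value `1`. -/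
lemma norm_eq_one_of_average {m n : ℕ} (hm : 0 < m) (s : Multiset ℂ) (hs : ∀ μ ∈ s, μ ^ m = 1)
    (hc : Multiset.card s = n) {α : ℂ} (hα : IsIntegral ℤ α) (h : α = s.sum / n) :
    α = 0 ∨ ‖α‖ = 1 := by
  refine norm_eq_one_of_isIntegral hα (minpoly ℚ α) (minpoly.aeval _ _) fun z hz => ?_
  set R : Set ℂ := {μ | μ ^ m = 1}
  have hR : ∀ μ ∈ R, IsIntegral ℚ μ ∧ ((minpoly ℚ μ).map (algebraMap ℚ ℂ)).Splits := fun μ hμ =>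
    ⟨⟨X ^ m - 1, monic_X_pow_sub_C 1 hm.ne', by simp [show μ ^ m = 1 from hμ]⟩,
      IsAlgClosed.splits _⟩
  have hmem : ∀ μ ∈ s, μ ∈ adjoin ℚ R := fun μ hμ => subset_adjoin _ _ (hs μ hμ)
  have hαR : α ∈ adjoin ℚ R := by
    rw [h]; exact div_mem (multiset_sum_mem _ hmem) (IntermediateField.natCast_mem _ _)
  obtain ⟨σ, hσ⟩ := exists_algHom_adjoin_of_splits_of_aeval hR hαR hz
  have h1 : (⟨α, hαR⟩ : adjoin ℚ R) = (s.attach.map fun μ => ⟨μ.1, hmem _ μ.2⟩).sum / n := by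
    apply (adjoin ℚ R).val.injective
    rw [map_div₀, map_multiset_sum, Multiset.map_map]; simp [h, Function.comp_def]
  rw [<- hσ, h1, map_div₀, map_multiset_sum, Multiset.map_map, norm_div, map_natCast]
  refine div_le_one_of_le₀ ((norm_multiset_sum_le _).trans ?_) (norm_nonneg _)
  rw [Multiset.map_map, Complex.norm_natCast, <- hc, Multiset.map_congr rfl (g := fun _ => 1)]
  . simp
  . intro μ _; refine norm_eq_one_of_pow hm ?_; rw [Function.comp_apply, <- map_pow]
    exact (congr_arg σ (Subtype.ext (hs _ μ.2))).trans (map_one σ)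

open ComplexOrder in
/-- The inverse of a matrix of finite order has conjugate trace. -/
lemma trace_inv_of_pow {ι : Type*} [Fintype ι] [DecidableEq ι] {W V : Matrix ι ι ℂ} {m : ℕ}
    (hm : 0 < m) (hW : W ^ m = 1) (hV : W * V = 1) : V.trace = star W.trace := by
  set P := ∑ k ∈ Finset.range m, (W ^ k).conjTranspose * W ^ k with hP
  have hPW : W.conjTranspose * P * W = P := by
    have : W.conjTranspose * P * W = ∑ k ∈ Finset.range m, (W ^ (k + 1)).conjTranspose * W ^ (k + 1) := by
      rw [hP, mul_sum, sum_mul]; refine sum_congr rfl fun k _ => ?_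
      rw [pow_succ, Matrix.conjTranspose_mul]; simp [mul_assoc]
    have h2 := Finset.sum_range_succ' (fun k => (W ^ k).conjTranspose * W ^ k) m
    rw [Finset.sum_range_succ, hW, pow_zero, add_left_inj] at h2; rw [this, <- h2]
  have hpos : P.PosDef := by
    obtain ⟨m, rfl⟩ := Nat.exists_eq_succ_of_ne_zero hm.ne'
    rw [hP, Finset.sum_range_succ', pow_zero]
    refine Matrix.PosDef.posSemidef_add ?_ (by simpa using Matrix.PosDef.one)
    exact Matrix.posSemidef_sum _ fun k _ => Matrix.posSemidef_conjTranspose_mul_self _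
  obtain ⟨Q, hQ⟩ := hpos.isUnit.exists_right_inv; have h3 : V = Q * (W.conjTranspose * P) := by
    have hQ' := mul_eq_one_comm.1 hQ
    calc V = Q * P * V := by rw [hQ', one_mul]
      _ = Q * (W.conjTranspose * P * W) * V := by rw [hPW]
      _ = Q * (W.conjTranspose * P) * (W * V) := by simp [mul_assoc]
      _ = _ := by rw [hV, mul_one]
  rw [h3, Matrix.trace_mul_comm, mul_assoc, hQ, mul_one, Matrix.trace_conjTranspose]

lemma trace_mul_trace_inv {ι : Type*} [Fintype ι] [DecidableEq ι] [Nonempty ι]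
    {W V : Matrix ι ι ℂ} {m : ℕ} {c : ℂ}
    (hm : 0 < m) (hW : W ^ m = c • 1) (hV : W * V = 1) :
    ∃ r : ℝ, 0 ≤ r ∧ W.trace * V.trace = r ∧ (r = 0 -> W.trace = 0) := by
  have hc : c ≠ 0 := by
    rintro rfl; have : W ^ m * V ^ m = 1 := by
      rw [<- (show Commute W V from hV.trans (mul_eq_one_comm.1 hV).symm).mul_pow, hV, one_pow]
    rw [hW, zero_smul, zero_mul] at this; exact zero_ne_one this
  obtain ⟨b, hb⟩ := IsAlgClosed.exists_pow_nat_eq c hm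
  have hb0 : b ≠ 0 := by rintro rfl; rw [zero_pow hm.ne'] at hb; exact hc hb.symm
  have h := trace_inv_of_pow (W := b⁻¹ • W) hm
    (by rw [smul_pow, hW, smul_smul, inv_pow, hb, inv_mul_cancel₀ hc, one_smul])
    (by rw [smul_mul_smul_comm, inv_mul_cancel₀ hb0, one_smul, hV])
  refine ⟨Complex.normSq (b⁻¹ • W).trace, Complex.normSq_nonneg _, ?_, fun h0 => ?_⟩
  . rw [<- Complex.mul_conj, <- starRingEnd_apply, <- h] at *
    rw [Matrix.trace_smul, Matrix.trace_smul, smul_mul_smul_comm, inv_mul_cancel₀ hb0, one_smul]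
  . rw [Complex.normSq_eq_zero, Matrix.trace_smul, smul_eq_zero] at h0
    exact h0.resolve_left (inv_ne_zero hb0)

open Coalgebra HopfAlgebra
variable {H : Type u} [Ring H] [HopfAlgebra ℂ H] [FiniteDimensional ℂ H]

lemma exists_trace_mul {n : ℕ} {d : Fin n -> ℕ}
    (ψ : (∀ i, Matrix (Fin (d i)) (Fin (d i)) ℂ) →ₗ[ℂ] ℂ) :
    ∃ U : ∀ i, Matrix (Fin (d i)) (Fin (d i)) ℂ, ∀ a, ψ a = ∑ i, (a i * U i).trace := by
  refine ⟨fun i => Matrix.of fun k l => ψ (Pi.single i (Matrix.single l k 1)), fun a => ?_⟩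
  conv_lhs => rw [<- Finset.univ_sum_single a, map_sum]
  refine sum_congr rfl fun i _ => ?_
  conv_lhs => rw [Matrix.matrix_eq_sum_single (a i), <- LinearMap.coe_single (R := ℂ), <- LinearMap.comp_apply, map_sum]
  simp [Matrix.trace, Matrix.diag, Matrix.mul_apply, Matrix.of_apply, map_sum]
  refine sum_congr rfl fun k _ => sum_congr rfl fun l _ => ?_
  rw [<- smul_eq_mul, <- map_smul]
  change _ = ψ (a i k l • LinearMap.single ℂ (fun i => Matrix (Fin (d i)) (Fin (d i)) ℂ) i _)
  rw [<- map_smul, Matrix.smul_single, smul_eq_mul, mul_one]; rfl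

lemma trace_pi_conj {n : ℕ} {d : Fin n -> ℕ} (U V : ∀ i, Matrix (Fin (d i)) (Fin (d i)) ℂ)
    (T : (∀ i, Matrix (Fin (d i)) (Fin (d i)) ℂ) →ₗ[ℂ] (∀ i, Matrix (Fin (d i)) (Fin (d i)) ℂ))
    (hT : ∀ a i, T a i = V i * a i * U i) :
    LinearMap.trace ℂ _ T = ∑ i, (U i).trace * (V i).trace := by
  rw [LinearMap.trace_eq_matrix_trace ℂ (Pi.basis fun i => Matrix.stdBasis ℂ (Fin (d i)) (Fin (d i)))]
  simp [Matrix.trace, Matrix.diag, LinearMap.toMatrix_apply, sum_sigma, Pi.basis_repr,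
    Pi.basis_apply, hT, Pi.single_eq_same]
  refine sum_congr rfl fun i _ => ?_
  rw [sum_prod_type, Finset.sum_mul_sum, sum_comm]
  refine sum_congr rfl fun k _ => sum_congr rfl fun l _ => ?_
  rw [Matrix.stdBasis_eq_single]
  change (V i * Matrix.single l k 1 * U i : Matrix (Fin (d i)) (Fin (d i)) ℂ) l k = _
  simp [Matrix.mul_apply, Matrix.single_apply, ite_and, mul_comm]

lemma exists_scalar_of_commute {n : ℕ} {M : Matrix (Fin n) (Fin n) ℂ} (h : ∀ a, a * M = M * a) :
    ∃ c : ℂ, M = c • 1 := by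
  obtain ⟨c, hc⟩ := Matrix.mem_range_scalar_of_commute_single fun i j _ => h _
  exact ⟨c, by rw [<- hc, Matrix.smul_one_eq_diagonal]; rfl⟩

lemma Integral.trace_pos [IsSemisimpleRing H] {Λ : H} (hΛ : Integral Λ) {φ : H →ₗ[ℂ] ℂ}
    (hφ : lsl φ (comul Λ) = 1) {T : End ℂ H} (hT : ∀ a, antipode ℂ (antipode ℂ (T a)) = a)
    {m : ℕ} (hm : 0 < m) (hTm : T ^ m = 1) : ∃ r : ℝ, 0 < r ∧ LinearMap.trace ℂ H T = r := by
  obtain ⟨n, d, hd, ⟨e⟩⟩ := IsSemisimpleRing.exists_algEquiv_pi_matrix_of_isAlgClosed ℂ H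
  obtain ⟨U, hU⟩ := exists_trace_mul (φ ∘ₗ e.symm.toLinearMap)
  have hU' := fun a => by simpa using hU (e a)
  have hone : ∀ i (f : ∀ j, Matrix (Fin (d j)) (Fin (d j)) ℂ -> ℂ) (x : Matrix (Fin (d i)) (Fin (d i)) ℂ),
      (∀ j, f j 0 = 0) ->
      ∑ j, f j (Pi.single (M := fun j => Matrix (Fin (d j)) (Fin (d j)) ℂ) i x j) = f i x := fun i f x hf => by
    rw [sum_eq_single i (fun j _ hj => by rw [Pi.single_eq_of_ne hj, hf]) (by simp),
      Pi.single_eq_same]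
  have hsq : ∀ a i, e (antipode ℂ (antipode ℂ a)) i * U i = U i * e a i := fun a i => by
    refine Matrix.ext_iff_trace_mul_left.2 fun x => ?_
    have h := hΛ.apply_mul_sq hφ a (e.symm (Pi.single i x))
    simp only [hU', map_mul, Pi.mul_apply, AlgEquiv.apply_symm_apply] at h
    rw [hone i (fun j y => (y * e (antipode ℂ (antipode ℂ a)) j * U j).trace) x (by simp),
      hone i (fun j y => (e a j * y * U j).trace) x (by simp)] at h
    rw [<- mul_assoc, h, mul_assoc, Matrix.trace_mul_comm, mul_assoc]
  have hex : ∀ i, ∃ V, V * U i = 1 := fun i => by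
    have hinj : Function.Injective (mulRight ℂ (U i)) := by
      refine (injective_iff_map_eq_zero _).2 fun X hX => ?_
      obtain ⟨c, hc⟩ := LinearMap.injective_iff_surjective.1 (hΛ.antipode_injective hφ)
        (e.symm (Pi.single i X))
      have h0 : φ ∘ₗ mulRight ℂ (antipode ℂ c) = 0 := by
        ext h
        simp only [LinearMap.comp_apply, mulRight_apply, hc, hU', map_mul, Pi.mul_apply,
          AlgEquiv.apply_symm_apply]
        rw [hone i (fun j y => (e h j * y * U j).trace) X (by simp), mul_assoc,
          show X * U i = 0 from hX]
        simp
      have h1 := hΛ.lsl_mul_antipode hφ c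
      rw [h0] at h1; have h2 : c = 0 := by rw [<- h1]; simp [lsl]
      rw [h2, map_zero] at hc; simpa using congr(e $hc i).symm
    exact LinearMap.injective_iff_surjective.1 hinj 1
  choose V hV using hex
  have hTe : ∀ a i, e (T a) i = V i * e a i * U i := fun a i => by
    have := hsq (T a) i
    rw [hT] at this; rw [mul_assoc, this, <- mul_assoc, hV, one_mul]
  have htr : LinearMap.trace ℂ H T = ∑ i, (U i).trace * (V i).trace := by
    rw [<- trace_conj' T e.toLinearEquiv]
    exact trace_pi_conj U V _ fun a i => by simp [LinearEquiv.conj_apply, hTe]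
  have hpow : ∀ k a i, U i ^ k * e ((T ^ k) a) i = e a i * U i ^ k := fun k => by
    induction k with
    | zero => simp
    | succ k ih =>
      intro a i; rw [pow_succ, pow_succ' T, Module.End.mul_apply, hTe, <- mul_assoc (e a i), <- ih]
      have := mul_eq_one_comm.1 (hV i)
      calc _ = U i ^ k * (U i * V i) * e ((T ^ k) a) i * U i := by simp only [mul_assoc]
        _ = _ := by rw [this, mul_one]
  have hsc := fun i => exists_scalar_of_commute fun a => by
    have := hpow m (e.symm (Pi.single i a)) i
    rw [hTm] at this; simpa using this.symm
  choose c hc using hsc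
  have hne : ∀ i, Nonempty (Fin (d i)) := fun i => ⟨⟨0, Nat.pos_of_ne_zero (hd i).out⟩⟩
  choose r hr0 hr hr' using fun i => trace_mul_trace_inv hm (hc i) (mul_eq_one_comm.1 (hV i))
  refine ⟨∑ i, r i, (Finset.sum_nonneg fun i _ => hr0 i).lt_of_ne' fun h0 => ?_, ?_⟩
  . have hz := fun i =>
      hr' i ((Finset.sum_eq_zero_iff_of_nonneg fun i _ => hr0 i).1 h0 i (mem_univ i))
    have := hΛ.apply_dual hφ
    rw [hU'] at this; refine zero_ne_one (Eq.trans (sum_eq_zero fun i _ => ?_).symm this)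
    obtain ⟨c, hc⟩ := exists_scalar_of_commute fun a => by
      have h1 := congr(e $(hΛ.mul_left (e.symm (Pi.single i a))) i)
      rw [<- hΛ.mul_right, map_mul, map_mul] at h1; simpa using h1
    rw [hc, smul_mul_assoc, one_mul, Matrix.trace_smul, hz, smul_zero]
  . rw [htr, Complex.ofReal_sum]; exact sum_congr rfl fun i _ => hr i

lemma antipode_antipode [IsSemisimpleRing H] (a : H) : antipode ℂ (antipode ℂ a) = a := by
  obtain ⟨Λ, hΛ⟩ := exists_integral (H := H); obtain ⟨φ, hφ⟩ := hΛ.exists_dual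
  obtain ⟨m, hm, hS⟩ := hΛ.exists_pow_antipode hφ
  set T : End ℂ H := (antipode ℂ ^ 2) ^ (m - 1) with hT
  have h1 : antipode ℂ ^ 2 * T = 1 := by rw [hT, <- pow_succ', Nat.sub_add_cancel hm, hS]
  have h2 : T * antipode ℂ ^ 2 = 1 := by rw [hT, <- pow_succ, Nat.sub_add_cancel hm, hS]
  have hTm : T ^ m = 1 := by rw [hT, <- pow_mul, mul_comm, pow_mul, hS, one_pow]
  have hB : IsBialg T := isBialg_antipode_sq.pow _
  have h1' := fun a => congr($h1 a)
  have h2' := fun a => congr($h2 a)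
  have hcomm := fun a => by
    have : Commute (antipode ℂ) T := ((Commute.refl _).pow_right 2).pow_right _
    exact congr($(this.eq) a)
  obtain ⟨r, hr, htr⟩ := hΛ.trace_pos hφ h1' hm hTm; have hn : (finrank ℂ H : ℂ) ≠ 0 := by
    have : Nontrivial H := ⟨⟨Λ, 0, fun h => by simpa [h] using hΛ.eps⟩⟩
    exact_mod_cast (finrank_pos (R := ℂ) (M := H)).ne'
  set Q : End ℂ H := lsl regChar ∘ₗ comul with hQ
  have hQQ : Q * Q = (finrank ℂ H : ℂ) • Q := by
    ext a; change lsl regChar (comul (R := ℂ) (lsl regChar (comul a))) = _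
    rw [comul_lsl, <- lsl_comp]
    have : regChar ∘ₗ lsl regChar ∘ₗ comul = (finrank ℂ H : ℂ) • regChar (H := H) := by
      ext a; exact regChar_lsl_comul a
    rw [this, lsl_smul]; rfl
  have hreg : ∀ a, regChar (T a) = regChar a := fun a => by
    have : mulLeft ℂ (T a) = T * (mulLeft ℂ a * antipode ℂ ^ 2) := by
      ext x; have := hB.mul a ((antipode ℂ ^ 2 : End ℂ H) x); have h3 := congr($h2 x)
      simp only [Module.End.mul_apply, Module.End.one_apply] at h3; rw [h3] at this; exact this.symm
    rw [regChar_apply, this, LinearMap.trace_mul_comm, mul_assoc, h1, mul_one, regChar_apply]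
  have hTQ : Commute T Q := by
    have key : ∀ t, T (lsl regChar t) = lsl regChar (TensorProduct.map T T t) := fun t => by
      induction t with
      | zero => simp
      | add x y hx hy => simp only [map_add, hx, hy]
      | tmul x y => simp [lsl_tmul, hreg]
    ext a; change T (lsl regChar (comul a)) = lsl regChar (comul (T a)); rw [hB.comul, key]
  have htrQ : LinearMap.trace ℂ H (T * Q) = LinearMap.trace ℂ H T := by
    have := trace_comp_lsl hΛ hB h2' (hΛ.antipode_injective hφ) hcomm regChar
    rwa [hΛ.regChar, one_mul] at this
  set P : End ℂ H := (finrank ℂ H : ℂ)⁻¹ • Q with hP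
  have hPP : IsIdempotentElem P := by
    rw [IsIdempotentElem, hP, smul_mul_smul_comm, hQQ, smul_smul, mul_assoc, inv_mul_cancel₀ hn,
      mul_one]
  have hTP : (T * P) ^ (m + 1) = T * P := by
    rw [(hTQ.smul_right _).mul_pow, hPP.pow_succ_eq, pow_succ, hTm, one_mul]
  have hin : IsIntegral ℤ (LinearMap.trace ℂ H (T * P)) := by
    rw [trace_eq_sum_roots]; refine IsIntegral.multiset_sum fun μ hμ => ?_
    have : μ ^ (m + 1) - μ = 0 := by
      have := eval_eq_zero_of_mem_roots_charpoly (p := Polynomial.X ^ (m + 1) - Polynomial.X)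
        (by simp [hTP]) hμ
      simpa using this
    exact ⟨Polynomial.X ^ (m + 1) - Polynomial.X,
      Polynomial.monic_X_pow_sub (by rw [Polynomial.degree_X]; exact_mod_cast Nat.succ_lt_succ hm),
      by simpa using this⟩
  have hα : LinearMap.trace ℂ H (T * P) = (LinearMap.charpoly T).roots.sum / finrank ℂ H := by
    rw [hP, mul_smul_comm, map_smul, htrQ, <- trace_eq_sum_roots, smul_eq_mul, inv_mul_eq_div]
  have h3 := norm_eq_one_of_average hm _ (fun μ hμ => by
    have := eval_eq_zero_of_mem_roots_charpoly (f := T) (p := Polynomial.X ^ m - 1)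
      (by simp [hTm]) hμ
    simpa [sub_eq_zero] using this) (card_roots_charpoly T) hin hα
  rw [hα, <- trace_eq_sum_roots, htr] at h3; have h4 : r = finrank ℂ H := by
    rcases h3 with h3 | h3
    . rw [div_eq_zero_iff, or_iff_left hn, Complex.ofReal_eq_zero] at h3; exact absurd h3 hr.ne'
    . rwa [norm_div, div_eq_one_iff_eq (by simpa using hn), Complex.norm_real, Complex.norm_natCast,
        Real.norm_of_nonneg hr.le] at h3
  have h5 := eq_one_of_trace_eq hm hTm (by rw [htr, h4]; norm_cast)
  have := h1' a
  rwa [h5] at this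
end Hopf

namespace Hopf

/-- Operators on a vector space of countable dimension. -/
abbrev Op : Type u := Module.End ℂ (ULift.{u} ℕ →₀ ℂ)

def om : Op →ₗ[ℂ] ℂ := Finsupp.lapply ⟨0⟩ ∘ₗ LinearMap.applyₗ (Finsupp.single ⟨0⟩ 1)

lemma om_one : om (1 : Op) = 1 := by simp [om]

lemma eq_om_smul {t : Op} (h : ∀ x, t * x = x * t) : t = om t • 1 := by
  ext1 v
  have := congr($(h ((Finsupp.lapply ⟨0⟩).smulRight (Finsupp.single v 1))) (Finsupp.single ⟨0⟩ 1))
  ext1; simpa [om] using this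

/-- A finite family of isometries with orthogonal ranges. -/
structure Fam (ι : Type) where
  l : ι -> Op.{u}
  r : ι -> Op.{u}
  same : ∀ i, r i * l i = 1
  diff : ∀ i j, i ≠ j -> r i * l j = 0

lemma nonempty_fam : Nonempty (Fam.{u} ℕ) := by
  obtain ⟨e⟩ : Nonempty (ULift.{u} ℕ ≃ ℕ × ULift.{u} ℕ) :=
    ⟨Equiv.ulift.trans (Nat.pairEquiv.symm.trans (Equiv.prodCongrRight fun _ => Equiv.ulift.symm))⟩
  let f := (Finsupp.domLCongr (M := ℂ) e).trans (Finsupp.curryLinearEquiv ℂ)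
  refine ⟨⟨fun i => f.symm.toLinearMap ∘ₗ Finsupp.lsingle i, fun i => Finsupp.lapply i ∘ₗ f.toLinearMap,
    fun i => ?_, fun i j h => ?_⟩⟩ <;> ext1 v <;> ext1
  . simp
  . simp [Finsupp.single_eq_of_ne h]

def stdFam (n : ℕ) : Fam (Fin n) where
  l i := nonempty_fam.some.l i
  r i := nonempty_fam.some.r i
  same _ := nonempty_fam.some.same _
  diff _ _ h := nonempty_fam.some.diff _ _ fun h' => h (Fin.ext h')

namespace Fam
variable {ι κ η : Type} [Fintype ι] [Fintype κ] (F : Fam ι) (G : Fam κ)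

lemma sum_r_mul_l (f : ι -> Op) (i : ι) : ∑ j, f j * (F.r j * F.l i) = f i := by
  rw [sum_eq_single i (fun j _ h => by rw [F.diff j i h, mul_zero]) (by simp), F.same, mul_one]

lemma sum_r_mul_l' (f : ι -> Op) (i : ι) : ∑ j, F.r i * F.l j * f j = f i := by
  rw [sum_eq_single i (fun j _ h => by rw [F.diff i j h.symm, zero_mul]) (by simp), F.same,
    one_mul]

def dg (x : ι -> Op) : Op := ∑ i, F.l i * x i * F.r i

lemma r_dg (x : ι -> Op) (i : ι) : F.r i * F.dg x = x i * F.r i := by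
  rw [dg, mul_sum, <- F.sum_r_mul_l' (fun j => x j * F.r j)]; simp [mul_assoc]

lemma dg_l (x : ι -> Op) (i : ι) : F.dg x * F.l i = F.l i * x i := by
  rw [dg, sum_mul, <- F.sum_r_mul_l (fun j => F.l j * x j)]; simp [mul_assoc]

lemma dg_mul (x y : ι -> Op) : F.dg x * F.dg y = F.dg fun i => x i * y i := by
  rw [dg, sum_mul]; simp [mul_assoc, r_dg]; simp [dg, mul_assoc]

def ρ : Op →ₙₐ[ℂ] Op where
  toFun x := F.dg fun _ => x
  map_smul' c x := by simp [dg, smul_sum]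
  map_zero' := by simp [dg]
  map_add' x y := by simp [dg, mul_add, add_mul, sum_add_distrib]
  map_mul' x y := (F.dg_mul _ _).symm

lemma ρ_apply (x : Op) : F.ρ x = F.dg fun _ => x := rfl

lemma r_ρ (x : Op) (i : ι) : F.r i * F.ρ x = x * F.r i := F.r_dg _ i

lemma ρ_l (x : Op) (i : ι) : F.ρ x * F.l i = F.l i * x := F.dg_l _ i

lemma ρ_one : F.ρ 1 = ∑ i, F.l i * F.r i := by simp [ρ_apply, dg]

def prod : Fam (ι × κ) where
  l p := F.l p.1 * G.l p.2
  r p := G.r p.2 * F.r p.1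
  same p := by rw [mul_assoc, <- mul_assoc (F.r _), F.same, one_mul, G.same]
  diff p q h := by
    rw [mul_assoc, <- mul_assoc (F.r _)]; by_cases h1 : p.1 = q.1
    . rw [h1, F.same, one_mul, G.diff _ _ fun h2 => h (Prod.ext h1 h2)]
    . rw [F.diff _ _ h1, zero_mul, mul_zero]

lemma prod_ρ (x : Op) : (F.prod G).ρ x = F.ρ (G.ρ x) := by
  simp only [ρ_apply, dg, prod, sum_prod_type, mul_sum, sum_mul, mul_assoc]

def sigma {κ : ι -> Type} (G : ∀ i, Fam (κ i)) : Fam (Σ i, κ i) where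
  l p := F.l p.1 * (G p.1).l p.2
  r p := (G p.1).r p.2 * F.r p.1
  same p := by rw [mul_assoc, <- mul_assoc (F.r _), F.same, one_mul, (G _).same]
  diff := by
    rintro ⟨i, k⟩ ⟨j, k'⟩ h; rw [mul_assoc, <- mul_assoc (F.r _)]; by_cases h1 : i = j
    . subst h1; rw [F.same, one_mul, (G _).diff _ _ fun h2 : k = k' => h (by rw [h2])]
    . rw [F.diff _ _ h1, zero_mul, mul_zero]

end Fam

/-- Morphisms of the underlying vector spaces. -/
def VHom (ρ ρ' : Op →ₙₐ[ℂ] Op) : Submodule ℂ Op where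
  carrier := {t | t * ρ 1 = t ∧ ∀ x, t * ρ x = ρ' x * t}
  add_mem' h h' := ⟨by rw [add_mul, h.1, h'.1], fun x => by rw [add_mul, mul_add, h.2, h'.2]⟩
  zero_mem' := by simp
  smul_mem' c t h := ⟨by rw [smul_mul_assoc, h.1], fun x => by
    rw [smul_mul_assoc, mul_smul_comm, h.2]⟩

variable {ρ ρ' ρ'' : Op →ₙₐ[ℂ] Op} {s t : Op}

lemma VHom.comp (hs : s ∈ VHom ρ' ρ'') (ht : t ∈ VHom ρ ρ') : s * t ∈ VHom ρ ρ'' :=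
  ⟨by rw [mul_assoc, ht.1], fun x => by rw [mul_assoc, ht.2, <- mul_assoc, hs.2, mul_assoc]⟩

lemma VHom.one (ρ : Op →ₙₐ[ℂ] Op) : ρ 1 ∈ VHom ρ ρ :=
  ⟨by rw [<- map_mul, one_mul], fun x => by rw [<- map_mul, <- map_mul, one_mul, mul_one]⟩

lemma VHom.one_mul (h : t ∈ VHom ρ ρ') : ρ' 1 * t = t := by rw [<- h.2, h.1]

namespace Fam
variable {ι κ η : Type} [Fintype ι] [Fintype κ] [Fintype η] (F : Fam ι) (G : Fam κ) (K : Fam η)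

def mat (M : Matrix ι κ ℂ) : Op := ∑ i, ∑ j, M i j • (F.l i * G.r j)

def coef : Op →ₗ[ℂ] Matrix ι κ ℂ where
  toFun t := Matrix.of fun i j => om (F.r i * t * G.l j)
  map_add' s t := by ext; simp [mul_add, add_mul]
  map_smul' c t := by ext; simp

lemma mat_l (M : Matrix ι κ ℂ) (j : κ) : F.mat G M * G.l j = ∑ i, M i j • F.l i := by
  rw [mat, sum_mul]; refine sum_congr rfl fun i _ => ?_
  rw [sum_mul, <- G.sum_r_mul_l (fun j => M i j • F.l i)]; simp [mul_assoc]

lemma r_mat (M : Matrix ι κ ℂ) (i : ι) : F.r i * F.mat G M = ∑ j, M i j • G.r j := by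
  rw [mat, mul_sum, <- F.sum_r_mul_l' (fun i => ∑ j, M i j • G.r j)]; simp [mul_assoc, mul_sum]

lemma mat_mul (M : Matrix ι κ ℂ) (M' : Matrix κ η ℂ) :
    F.mat G M * G.mat K M' = F.mat K (M * M') := by
  have : G.mat K M' = ∑ j, G.l j * ∑ k, M' j k • K.r k := by simp [mat, mul_sum]
  rw [this, mul_sum]; simp [<- mul_assoc, mat_l]
  simp [sum_mul, mul_sum, mat, Matrix.mul_apply, Finset.sum_smul,
    smul_sum, smul_smul, mul_comm (M _ _)]
  rw [sum_comm, sum_comm (s := Finset.univ (α := ι))]; exact sum_congr rfl fun k _ => sum_comm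

lemma mat_mem (M : Matrix ι κ ℂ) : F.mat G M ∈ VHom G.ρ F.ρ := by
  have h : ∀ x, F.mat G M * G.ρ x = F.ρ x * F.mat G M := fun x => by
    simp [mat, sum_mul, mul_sum, mul_assoc, r_ρ]
    simp [<- mul_assoc, ρ_l]
  exact ⟨by simp [mat, sum_mul, mul_assoc, r_ρ, one_mul], h⟩

variable {F G K}

lemma coef_spec {t : Op} (ht : t ∈ VHom G.ρ F.ρ) (i : ι) (j : κ) :
    F.r i * t * G.l j = F.coef G t i j • 1 :=
  eq_om_smul fun x => by
    rw [mul_assoc, <- G.ρ_l, mul_assoc, <- mul_assoc t, ht.2, mul_assoc, <- mul_assoc, F.r_ρ]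
    simp [mul_assoc]

lemma mat_coef {t : Op} (ht : t ∈ VHom G.ρ F.ρ) : F.mat G (F.coef G t) = t := by
  conv_rhs => rw [<- VHom.one_mul ht, <- ht.1, F.ρ_one, G.ρ_one, sum_mul]
  refine sum_congr rfl fun i _ => ?_
  rw [mul_sum, mul_sum]; refine sum_congr rfl fun j _ => ?_
  have := congr(F.l i * $(coef_spec ht i j) * G.r j)
  simpa [mul_assoc] using this.symm

lemma coef_mul {s t : Op} (hs : s ∈ VHom G.ρ F.ρ) (ht : t ∈ VHom K.ρ G.ρ) :
    F.coef K (s * t) = F.coef G s * G.coef K t := by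
  ext i k; have : F.r i * (s * t) * K.l k = ∑ j, (F.r i * s * G.l j) * (G.r j * t * K.l k) := by
    conv_lhs => rw [<- VHom.one_mul ht, G.ρ_one]
    simp [mul_sum, sum_mul, mul_assoc]
  rw [coef, LinearMap.coe_mk, AddHom.coe_mk, Matrix.of_apply, this]
  simp only [coef_spec hs, coef_spec ht, Matrix.mul_apply, map_sum, smul_mul_smul_comm,
    map_smul, om_one, smul_eq_mul, mul_one]

lemma coef_mat (M : Matrix ι κ ℂ) : F.coef G (F.mat G M) = M := by
  ext i j; change om (_ * _ * _) = _; rw [r_mat, sum_mul, map_sum, sum_eq_single j _ (by simp)]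
  . simp [G.same, om_one]
  . intro k _ h; rw [smul_mul_assoc, G.diff _ _ h, smul_zero, map_zero]

lemma mat_one [DecidableEq ι] : F.mat F 1 = F.ρ 1 := by
  simp [mat, ρ_one, Matrix.one_apply, ite_smul]

lemma trace_coef_comm {s t : Op} (hs : s ∈ VHom G.ρ F.ρ) (ht : t ∈ VHom F.ρ G.ρ) :
    (F.coef F (s * t)).trace = (G.coef G (t * s)).trace := by
  rw [coef_mul hs ht, coef_mul ht hs, Matrix.trace_mul_comm]

variable (F) in
def ev : Op := ∑ i, F.r i * F.r i

variable (F) in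
def cv : Op := ∑ i, F.l i * F.l i

lemma r_cv (i : ι) : F.r i * F.cv = F.l i := by
  rw [cv, mul_sum, <- F.sum_r_mul_l' F.l i]; simp [mul_assoc]

lemma ev_l (i : ι) : F.ev * F.l i = F.r i := by
  rw [ev, sum_mul, <- F.sum_r_mul_l F.r i]; simp [mul_assoc]

lemma ev_ρ (x : Op) : F.ev * F.ρ x = ∑ i, F.r i * x * F.r i := by simp [ev, sum_mul, mul_assoc, r_ρ]

lemma ρ_cv (x : Op) : F.ρ x * F.cv = ∑ i, F.l i * x * F.l i := by
  simp [cv, mul_sum, <- mul_assoc, ρ_l]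

lemma ev_ρ_cv (x : Op) : F.ev * F.ρ x * F.cv = ∑ i, F.r i * x * F.l i := by
  simp [ev_ρ, sum_mul, mul_assoc, r_cv]

lemma ev_ρ_ρ (x : Op) : F.ev * F.ρ (F.ρ x) = x * F.ev := by
  simp [ev_ρ, r_ρ]; simp [ev, mul_sum, mul_assoc]

lemma ρ_ρ_cv (x : Op) : F.ρ (F.ρ x) * F.cv = F.cv * x := by
  simp [ρ_cv, mul_assoc, ρ_l]; simp [cv, sum_mul, mul_assoc]

lemma ev_mat (M : Matrix ι ι ℂ) : F.ev * F.ρ (F.mat F M.transpose) = F.ev * F.mat F M := by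
  rw [ev_ρ, ev, sum_mul]
  simp [mul_assoc, r_mat, sum_mul, mul_sum]; exact sum_comm

lemma mat_cv (M : Matrix ι ι ℂ) : F.ρ (F.mat F M.transpose) * F.cv = F.mat F M * F.cv := by
  rw [ρ_cv, cv, mul_sum]
  simp [mul_assoc, <- mul_assoc (F.mat _ _), mat_l, sum_mul, mul_sum]
  exact sum_comm

lemma om_ev_cv {x : Op} (hx : x ∈ VHom F.ρ F.ρ) :
    om (F.ev * x * F.cv) = ∑ i, om (F.r i * x * F.l i) := by
  have : F.ev * x * F.cv = ∑ i, ∑ j, F.r i * (F.r i * x * F.l j) * F.l j := by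
    simp [ev, cv, sum_mul, mul_sum, mul_assoc]; exact sum_comm
  rw [this, map_sum]; refine sum_congr rfl fun i _ => ?_
  simp only [coef_spec hx, mul_smul_comm, smul_mul_assoc, mul_one]
  rw [sum_eq_single i (fun j _ h => by rw [F.diff _ _ h.symm, smul_zero]) (by simp), F.same]

lemma ext_l {x y : Op} (hx : x * F.ρ 1 = x) (hy : y * F.ρ 1 = y) (h : ∀ i, x * F.l i = y * F.l i) :
    x = y := by
  rw [<- hx, <- hy, ρ_one, mul_sum, mul_sum]; simp [<- mul_assoc, h]
end Fam
end Hopf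

namespace Hopf
open TensorProduct Coalgebra HopfAlgebra
variable (H : Type u) [Ring H] [HopfAlgebra ℂ H]

/-- A finite-dimensional representation of `H` realised by operators. -/
@[ext]
structure Obj where
  ρ : Op.{u} →ₙₐ[ℂ] Op.{u}
  h : H →ₗ[ℂ] Op.{u}
  h_one : h 1 = ρ 1
  h_mul : ∀ x y, h (x * y) = h x * h y
  h_ρ : ∀ u x, h u * ρ x = ρ x * h u
  exists_fam : ∃ (ι : Type) (_ : Fintype ι) (_ : DecidableEq ι) (F : Fam ι), ρ = F.ρ

variable {H}
namespace Obj

def ι (a : Obj H) : Type := a.exists_fam.choose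
instance (a : Obj H) : Fintype a.ι := a.exists_fam.choose_spec.choose
instance (a : Obj H) : DecidableEq a.ι := a.exists_fam.choose_spec.choose_spec.choose
def F (a : Obj H) : Fam a.ι := a.exists_fam.choose_spec.choose_spec.choose_spec.choose
lemma ρ_eq (a : Obj H) : a.ρ = a.F.ρ := a.exists_fam.choose_spec.choose_spec.choose_spec.choose_spec

lemma h_mem (a : Obj H) (u : H) : a.h u ∈ VHom a.ρ a.ρ :=
  ⟨by rw [<- a.h_one, <- a.h_mul, mul_one], a.h_ρ u⟩

/-- `x ⊗ y ↦ x ⊗ y` acting on the tensor product. -/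
def m (a b : Obj H) : H ⊗[ℂ] H →ₗ[ℂ] Op :=
  LinearMap.mul' ℂ _ ∘ₗ TensorProduct.map a.h ((a.ρ : Op →ₗ[ℂ] Op) ∘ₗ b.h)

lemma m_tmul (a b : Obj H) (x y : H) : m a b (x ⊗ₜ y) = a.h x * a.ρ (b.h y) := rfl

lemma m_mul (a b : Obj H) (s t : H ⊗[ℂ] H) : m a b (s * t) = m a b s * m a b t := by
  induction s with
  | zero => simp
  | add x y hx hy => rw [add_mul, map_add, hx, hy, map_add, add_mul]
  | tmul x y =>
    induction t with
    | zero => simp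
    | add x y hx hy => rw [mul_add, map_add, hx, hy, map_add, mul_add]
    | tmul z w =>
      rw [tmul_mul_tmul, m_tmul, m_tmul, m_tmul, a.h_mul, b.h_mul, map_mul,
        mul_assoc, <- mul_assoc (a.h z), a.h_ρ]
      simp [mul_assoc]

instance : Mul (Obj H) where
  mul a b :=
    { ρ := a.ρ.comp b.ρ
      h := m a b ∘ₗ comul
      h_one := by
        rw [LinearMap.comp_apply, Bialgebra.comul_one, one_def, m_tmul,
          a.h_one, b.h_one, <- map_mul, one_mul]; rfl
      h_mul x y := by simp [LinearMap.comp_apply, Bialgebra.comul_mul, m_mul]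
      h_ρ u x := by
        change m a b (comul u) * a.ρ (b.ρ x) = a.ρ (b.ρ x) * m a b (comul u)
        generalize comul (R := ℂ) u = t; induction t with
        | zero => simp
        | add x y hx hy => rw [map_add, add_mul, mul_add, hx, hy]
        | tmul y z =>
          rw [m_tmul, mul_assoc, <- map_mul, b.h_ρ, map_mul, <- mul_assoc, a.h_ρ, mul_assoc]
      exists_fam := ⟨_, inferInstance, inferInstance, a.F.prod b.F, by
        ext1 x; rw [Fam.prod_ρ, <- a.ρ_eq, <- b.ρ_eq]; rfl⟩ }

def oneFam : Fam Unit := ⟨1, 1, by simp, by simp⟩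

instance : One (Obj H) where
  one :=
    { ρ := NonUnitalAlgHom.id ℂ _
      h := Algebra.linearMap ℂ _ ∘ₗ counit
      h_one := by simp
      h_mul x y := by simp
      h_ρ u x := Algebra.commutes (counit (R := ℂ) u) x
      exists_fam := ⟨Unit, inferInstance, inferInstance, oneFam, by
        ext1 x; simp [Fam.ρ_apply, Fam.dg, oneFam]⟩ }

lemma mul_ρ (a b : Obj H) (x : Op) : (a * b).ρ x = a.ρ (b.ρ x) := rfl
lemma mul_h (a b : Obj H) (u : H) : (a * b).h u = m a b (comul u) := rfl
lemma one_ρ (x : Op) : (1 : Obj H).ρ x = x := rfl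
lemma one_h (u : H) : (1 : Obj H).h u = counit (R := ℂ) u • 1 :=
  Algebra.algebraMap_eq_smul_one (counit (R := ℂ) u)

instance : Monoid (Obj H) where
  mul_assoc a b c := by
    refine Obj.ext rfl (LinearMap.ext fun u => ?_)
    rw [mul_h, mul_h]; have h1 : m (a * b) c = LinearMap.mul' ℂ _ ∘ₗ TensorProduct.map (m a b)
        ((a.ρ : Op →ₗ[ℂ] Op) ∘ₗ (b.ρ : Op →ₗ[ℂ] Op) ∘ₗ c.h) ∘ₗ comul.rTensor H := by
      ext x y; simp [m_tmul, mul_h, mul_ρ]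
    have h2 : m a (b * c) = LinearMap.mul' ℂ _ ∘ₗ TensorProduct.map a.h
        ((a.ρ : Op →ₗ[ℂ] Op) ∘ₗ m b c) ∘ₗ comul.lTensor H := by
      ext x y; simp [m_tmul, mul_h]
    have h3 : LinearMap.mul' ℂ _ ∘ₗ TensorProduct.map (m a b)
        ((a.ρ : Op →ₗ[ℂ] Op) ∘ₗ (b.ρ : Op →ₗ[ℂ] Op) ∘ₗ c.h) = (LinearMap.mul' ℂ _ ∘ₗ TensorProduct.map a.h
        ((a.ρ : Op →ₗ[ℂ] Op) ∘ₗ m b c)) ∘ₗ (TensorProduct.assoc ℂ H H H).toLinearMap := by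
      ext x y z; simp [m_tmul, mul_assoc]
    rw [h1, h2, LinearMap.comp_apply, LinearMap.comp_apply, LinearMap.comp_apply,
      LinearMap.comp_apply, <- coassoc_apply]
    exact congr($h3 (comul.rTensor H (comul u)))
  one_mul a := by
    refine Obj.ext rfl (LinearMap.ext fun u => ?_)
    rw [mul_h, <- (ℛ ℂ u).eq, map_sum]
    simp only [m_tmul, one_ρ, one_h, smul_mul_assoc, one_mul, <- map_smul, <- map_sum, sum_counit_smul]
  mul_one a := by
    refine Obj.ext rfl (LinearMap.ext fun u => ?_)
    rw [mul_h, <- (ℛ ℂ u).eq, map_sum]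
    simp only [m_tmul, one_h, map_smul, (a.h_mem _).1, mul_smul_comm]
    simp only [<- map_smul, <- map_sum, sum_smul_counit]

/-- Intertwiners. -/
def Hom (a b : Obj H) : Submodule ℂ Op where
  carrier := {t | t ∈ VHom a.ρ b.ρ ∧ ∀ u, t * a.h u = b.h u * t}
  add_mem' h h' := ⟨add_mem h.1 h'.1, fun x => by rw [add_mul, mul_add, h.2, h'.2]⟩
  zero_mem' := ⟨zero_mem _, by simp⟩
  smul_mem' c t h := ⟨Submodule.smul_mem _ c h.1, fun x => by
    rw [smul_mul_assoc, mul_smul_comm, h.2]⟩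

def tr (a : Obj H) : Op →ₗ[ℂ] ℂ := Matrix.traceLinearMap _ ℂ ℂ ∘ₗ a.F.coef a.F

variable {a b c : Obj H} {s t : Op}

lemma mem_F (ht : t ∈ VHom a.ρ b.ρ) : t ∈ VHom a.F.ρ b.F.ρ := by rwa [<- a.ρ_eq, <- b.ρ_eq]

lemma tr_comm (hs : s ∈ VHom b.ρ a.ρ) (ht : t ∈ VHom a.ρ b.ρ) : a.tr (s * t) = b.tr (t * s) :=
  Fam.trace_coef_comm (mem_F hs) (mem_F ht)

lemma tr_eq {ι : Type} [Fintype ι] {F : Fam ι} (hF : a.ρ = F.ρ) (ht : t ∈ VHom a.ρ a.ρ) :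
    a.tr t = ∑ i, om (F.r i * t * F.l i) := by
  have h1 := ht.1
  have h2 := VHom.one_mul ht
  have h := Fam.trace_coef_comm (F := a.F)
    (by rwa [<- hF, <- a.ρ_eq]) (by rw [<- hF, <- a.ρ_eq]; exact VHom.one _)
  rwa [h1, h2] at h

lemma sum_antipode_mul (hS : ∀ x : H, antipode ℂ (antipode ℂ x) = x) (u : H) :
    ∑ i ∈ (ℛ ℂ u).index, antipode ℂ ((ℛ ℂ u).right i) * (ℛ ℂ u).left i = counit (R := ℂ) u • 1 := by
  have := congr(antipode ℂ $(sum_antipode_mul_eq_smul (ℛ ℂ u)))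
  simpa only [map_sum, antipode_mul_antidistrib, hS, map_smul, antipode_one] using this

lemma tr_nondeg {Λ : H} (hΛ : Integral Λ) (hS : ∀ x : H, antipode ℂ (antipode ℂ x) = x)
    (ht : t ∈ Hom a b) (h : ∀ s ∈ Hom b a, a.tr (s * t) = 0) : t = 0 := by
  have key : ∀ s ∈ VHom b.ρ a.ρ, a.tr (s * t) = 0 := fun s hs => by
    let n : H ⊗[ℂ] H →ₗ[ℂ] Op := LinearMap.mul' ℂ _ ∘ₗ TensorProduct.map (mulRight ℂ s ∘ₗ a.h)
      (b.h ∘ₗ antipode ℂ)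
    have hn : ∀ x y, n (x ⊗ₜ y) = a.h x * s * b.h (antipode ℂ y) := fun x y => rfl
    have h1 : ∀ u z, a.h u * n z = n ((u ⊗ₜ 1) * z) := fun u z => by
      induction z with
      | zero => simp
      | add x y hx hy => simp [map_add, mul_add, hx, hy]
      | tmul x y => simp [hn, a.h_mul, mul_assoc]
    have h2 : ∀ u z, n z * b.h u = n ((1 ⊗ₜ antipode ℂ u) * z) := fun u z => by
      induction z with
      | zero => simp
      | add x y hx hy => simp only [map_add, mul_add, add_mul, hx, hy]
      | tmul x y => simp [hn, b.h_mul, mul_assoc, antipode_mul_antidistrib, hS]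
    have h3 : ∀ z, n z ∈ VHom b.ρ a.ρ := fun z => by
      induction z with
      | zero => simp
      | add x y hx hy => rw [map_add]; exact add_mem hx hy
      | tmul x y => exact VHom.comp (VHom.comp (a.h_mem x) hs) (b.h_mem _)
    have h4 := h _ ⟨h3 (comul Λ), fun u => by rw [h2, h1, hΛ.tmul_comul, hS]⟩
    rw [<- (ℛ ℂ Λ).eq, map_sum, sum_mul, map_sum] at h4; rw [<- h4, eq_comm]
    calc _ = ∑ i ∈ (ℛ ℂ Λ).index, a.tr (s * t * a.h (antipode ℂ ((ℛ ℂ Λ).right i) * (ℛ ℂ Λ).left i)) := by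
          refine sum_congr rfl fun i _ => ?_
          rw [hn, mul_assoc, <- ht.2, mul_assoc, tr_comm (a.h_mem _)
            (VHom.comp hs (VHom.comp ht.1 (a.h_mem _))), a.h_mul]
          simp [mul_assoc]
      _ = _ := by
        rw [<- map_sum, <- mul_sum, <- map_sum, sum_antipode_mul hS, hΛ.eps, one_smul, a.h_one,
          mul_assoc, ht.1.1]
  have h0 : b.F.coef a.F t = 0 := Matrix.ext_iff_trace_mul_left.2 fun M => by
    have hM := Fam.mat_mem a.F b.F M
    have := key _ (by rwa [a.ρ_eq, b.ρ_eq])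
    rw [tr, LinearMap.comp_apply, Fam.coef_mul hM (mem_F ht.1), Fam.coef_mat] at this
    simpa using this
  rw [<- Fam.mat_coef (mem_F ht.1), h0]; simp [Fam.mat]

lemma tr_nilp (ht : t ∈ VHom a.ρ a.ρ) (h : IsNilpotent t) : a.tr t = 0 := by
  obtain ⟨k, hk⟩ := h; have h1 : ∀ n, t ^ (n + 1) ∈ VHom a.F.ρ a.F.ρ ∧ a.F.coef a.F (t ^ (n + 1)) =
      a.F.coef a.F t ^ (n + 1) := fun n => by
    induction n with
    | zero => simpa using mem_F ht
    | succ n ih =>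
      rw [pow_succ t]
      exact ⟨VHom.comp ih.1 (mem_F ht), by rw [Fam.coef_mul ih.1 (mem_F ht), ih.2, <- pow_succ]⟩
  exact (Matrix.isNilpotent_trace_of_isNilpotent
    ⟨k + 1, by rw [<- (h1 k).2, pow_succ, hk, zero_mul, map_zero]⟩).eq_zero
end Obj

namespace Obj
variable {a b c : Obj H} {s t : Op} {ι : Type} [Fintype ι] {F : Fam ι}

/-- The object defined by a matrix representation. -/
def mk' [DecidableEq ι] (F : Fam ι) (π : H →ₐ[ℂ] Matrix ι ι ℂ) : Obj H where
  ρ := F.ρ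
  h := { toFun := fun u => F.mat F (π u)
         map_add' := fun x y => by simp [Fam.mat, add_smul, sum_add_distrib]
         map_smul' := fun x y => by simp [Fam.mat, smul_smul, smul_sum] }
  h_one := by change F.mat F (π 1) = _; rw [map_one, Fam.mat_one]
  h_mul x y := by change F.mat F (π (x * y)) = F.mat F (π x) * F.mat F (π y); rw [map_mul, Fam.mat_mul]
  h_ρ u := (Fam.mat_mem F F (π u)).2
  exists_fam := ⟨ι, inferInstance, inferInstance, F, rfl⟩

lemma mk'_h [DecidableEq ι] (F : Fam ι) (π : H →ₐ[ℂ] Matrix ι ι ℂ) (u : H) :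
    (mk' F π).h u = F.mat F (π u) := rfl

/-- The dual object. -/
def cj (a : Obj H) : Obj H := mk' a.F (AlgHom.ofLinearMap
  ((Matrix.transposeLinearEquiv _ _ ℂ ℂ).toLinearMap ∘ₗ a.F.coef a.F ∘ₗ a.h ∘ₗ antipode ℂ)
  (by simp [a.h_one, a.ρ_eq, <- Fam.mat_one, Fam.coef_mat])
  (fun x y => by
    simp [antipode_mul_antidistrib, a.h_mul, Fam.coef_mul (mem_F (a.h_mem _)) (mem_F (a.h_mem _))]))

lemma ev_mem (hS : ∀ x : H, antipode ℂ (antipode ℂ x) = x) (ha : a.ρ = F.ρ) (hb : b.ρ = F.ρ)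
    (hM : ∀ u, ∃ M, a.h (antipode ℂ u) = F.mat F M ∧ b.h u = F.mat F M.transpose) :
    F.ev ∈ Hom (a * b) 1 := by
  have h1 : ∀ x, F.ev * (a * b).ρ x = x * F.ev := fun x => by rw [mul_ρ, ha, hb, Fam.ev_ρ_ρ]
  refine ⟨⟨by rw [h1, one_mul], h1⟩, fun u => ?_⟩
  rw [mul_h, one_h, <- (ℛ ℂ u).eq, map_sum, mul_sum]
  have h2 : ∀ x y, F.ev * m a b (x ⊗ₜ y) = F.ev * a.h (antipode ℂ y * x) := fun x y => by
    obtain ⟨M, h3, h4⟩ := hM y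
    rw [m_tmul, a.h_ρ, a.h_mul, h3, h4, ha, <- mul_assoc, Fam.ev_mat, mul_assoc]
  simp only [h2]
  rw [<- mul_sum, <- map_sum, sum_antipode_mul hS, map_smul, a.h_one, mul_smul_comm,
    smul_mul_assoc, one_mul, ha]
  congr 1; have := h1 1; rw [mul_ρ, ha, hb, one_mul] at this
  rw [<- this, mul_assoc, <- map_mul, mul_one]

lemma cv_mem (ha : a.ρ = F.ρ) (hb : b.ρ = F.ρ)
    (hM : ∀ u, ∃ M, a.h (antipode ℂ u) = F.mat F M ∧ b.h u = F.mat F M.transpose) :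
    F.cv ∈ Hom 1 (a * b) := by
  have h1 : ∀ x, (a * b).ρ x * F.cv = F.cv * x := fun x => by rw [mul_ρ, ha, hb, Fam.ρ_ρ_cv]
  refine ⟨⟨mul_one _, fun x => (h1 x).symm⟩, fun u => ?_⟩
  rw [mul_h, one_h, <- (ℛ ℂ u).eq, map_sum, sum_mul]
  have h2 : ∀ x y, m a b (x ⊗ₜ y) * F.cv = a.h (x * antipode ℂ y) * F.cv := fun x y => by
    obtain ⟨M, h3, h4⟩ := hM y; rw [m_tmul, a.h_mul, h3, h4, ha, mul_assoc, Fam.mat_cv, mul_assoc]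
  simp only [h2]
  rw [<- sum_mul, <- map_sum, sum_mul_antipode_eq_smul, map_smul, a.h_one, mul_smul_comm,
    smul_mul_assoc, mul_one, ha]
  congr 1; have := h1 1; rw [mul_ρ, ha, hb, mul_one] at this
  rw [<- this, <- mul_assoc, <- map_mul, one_mul]

lemma exists_mat (u : H) : ∃ M, a.h (antipode ℂ u) = a.F.mat a.F M ∧
    (cj a).h u = a.F.mat a.F M.transpose :=
  ⟨_, (Fam.mat_coef (mem_F (a.h_mem _))).symm, rfl⟩

lemma exists_mat' (hS : ∀ x : H, antipode ℂ (antipode ℂ x) = x) (u : H) :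
    ∃ M, (cj a).h (antipode ℂ u) = a.F.mat a.F M ∧ a.h u = a.F.mat a.F M.transpose :=
  ⟨(a.F.coef a.F (a.h (antipode ℂ (antipode ℂ u)))).transpose, rfl, by
    rw [Matrix.transpose_transpose, hS, Fam.mat_coef (mem_F (a.h_mem _))]⟩

lemma zig : F.ev * F.ρ F.cv = F.ρ 1 := by simp [Fam.ev_ρ, Fam.r_cv, Fam.ρ_one]

lemma zag : F.ρ F.ev * F.cv = F.ρ 1 := by simp [Fam.ρ_cv, mul_assoc, Fam.ev_l, Fam.ρ_one]

lemma tr_apply (a : Obj H) (t : Op) : a.tr t = ∑ i, om (a.F.r i * t * a.F.l i) := rfl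

lemma tr_left (ha : a.ρ = F.ρ) (ht : t ∈ VHom (a * b).ρ (a * b).ρ) :
    (a * b).tr t = b.tr (F.ev * F.ρ t * F.cv) := by
  rw [tr_eq (F := F.prod b.F) (by ext1 x; rw [mul_ρ, ha, b.ρ_eq, Fam.prod_ρ]) ht, tr_apply,
    sum_prod_type, sum_comm, Fam.ev_ρ_cv]
  simp [mul_sum, sum_mul, map_sum, Fam.prod, mul_assoc]

lemma tr_right (ha : a.ρ = F.ρ) (ht : t ∈ VHom (b * a).ρ (b * a).ρ) :
    (b * a).tr t = b.tr (b.ρ F.ev * t * b.ρ F.cv) := by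
  have hx : ∀ k, b.F.r k * t * b.F.l k ∈ VHom F.ρ F.ρ := fun k => by
    have h : ∀ x, b.F.r k * t * b.F.l k * F.ρ x = b.F.r k * (t * (b * a).ρ x) * b.F.l k := fun x => by
      rw [mul_ρ, b.ρ_eq, ha, mul_assoc, <- b.F.ρ_l]; simp [mul_assoc]
    refine ⟨by rw [h, ht.1], fun x => ?_⟩
    rw [h, ht.2, mul_ρ, b.ρ_eq, ha, <- mul_assoc, b.F.r_ρ]; simp [mul_assoc]
  rw [tr_eq (F := b.F.prod F) (by ext1 x; rw [mul_ρ, ha, b.ρ_eq, Fam.prod_ρ]) ht, tr_apply,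
    sum_prod_type]
  refine sum_congr rfl fun k _ => ?_
  have : b.F.r k * (b.ρ F.ev * t * b.ρ F.cv) * b.F.l k = F.ev * (b.F.r k * t * b.F.l k) * F.cv := by
    rw [b.ρ_eq, mul_assoc, mul_assoc, b.F.ρ_l, mul_assoc, <- mul_assoc, b.F.r_ρ]
    simp only [mul_assoc]
  rw [this, Fam.om_ev_cv (hx k)]; simp [Fam.prod, mul_assoc]

lemma tr_one (ha : a.ρ = F.ρ) : a.tr (a.ρ 1) = Fintype.card ι := by
  rw [tr_eq ha (VHom.one _), ha]; simp [mul_assoc, Fam.ρ_l, F.same, om_one]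

lemma lw (ht : t ∈ Hom a b) (c : Obj H) : c.ρ t ∈ Hom (c * a) (c * b) := by
  refine ⟨⟨by rw [mul_ρ, <- map_mul, ht.1.1], fun x => by
    rw [mul_ρ, mul_ρ, <- map_mul, ht.1.2, map_mul]⟩, fun u => ?_⟩
  rw [mul_h, mul_h]; generalize comul (R := ℂ) u = z; induction z with
  | zero => simp
  | add x y hx hy => rw [map_add, map_add, mul_add, add_mul, hx, hy]
  | tmul x y => rw [m_tmul, m_tmul, <- mul_assoc, <- c.h_ρ, mul_assoc, <- map_mul, ht.2, map_mul, mul_assoc]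

lemma rw (ht : t ∈ Hom a b) (c : Obj H) : t * a.ρ (c.ρ 1) ∈ Hom (a * c) (b * c) := by
  have h1 : ∀ x, c.ρ 1 * c.ρ x = c.ρ x := fun x => by rw [<- map_mul, one_mul]
  refine ⟨⟨by rw [mul_ρ, mul_assoc, <- map_mul, h1], fun x => by
    rw [mul_ρ, mul_ρ, mul_assoc, <- map_mul, h1, <- mul_assoc, <- ht.1.2, mul_assoc, <- map_mul,
      <- map_mul, mul_one]⟩, fun u => ?_⟩
  rw [mul_h, mul_h]; generalize comul (R := ℂ) u = z; induction z with
  | zero => simp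
  | add x y hx hy => rw [map_add, map_add, mul_add, add_mul, hx, hy]
  | tmul x y =>
    rw [m_tmul, m_tmul, mul_assoc, <- mul_assoc _ (a.h x), <- a.h_ρ, mul_assoc, <- map_mul,
      VHom.one_mul (c.h_mem y), <- mul_assoc, ht.2, mul_assoc, mul_assoc, <- mul_assoc (b.ρ _) t, <- ht.1.2,
      mul_assoc, <- map_mul, (c.h_mem y).1]

lemma exists_sum {n : ℕ} (Y : Fin n -> Obj H) : ∃ (X : Obj H) (s s' : Fin n -> Op),
    (∀ k, s k ∈ Hom (Y k) X) ∧ (∀ k, s' k ∈ Hom X (Y k)) ∧ (∀ k, s' k * s k = (Y k).ρ 1) ∧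
    (∀ k l, k ≠ l -> s' k * s l = 0) ∧ ∑ k, s k * s' k = X.ρ 1 := by
  let B := stdFam.{u} n
  let X : Obj H :=
    { ρ := { toFun := fun x => B.dg fun k => (Y k).ρ x
             map_smul' := fun c x => by simp [Fam.dg, smul_sum]
             map_zero' := by simp [Fam.dg]
             map_add' := fun x y => by simp [Fam.dg, mul_add, add_mul, sum_add_distrib]
             map_mul' := fun x y => by simp [Fam.dg_mul] }
      h := { toFun := fun u => B.dg fun k => (Y k).h u
             map_add' := fun x y => by simp [Fam.dg, mul_add, add_mul, sum_add_distrib]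
             map_smul' := fun c x => by simp [Fam.dg, smul_sum] }
      h_one := by simp [h_one]
      h_mul := fun x y => by simp [h_mul, Fam.dg_mul]
      h_ρ := fun u x => by simp [Fam.dg_mul, h_ρ]
      exists_fam := ⟨_, inferInstance, inferInstance, B.sigma fun k => (Y k).F, by
        ext1 x
        simp [Fam.ρ_apply, Fam.dg, Fam.sigma, sum_sigma, ρ_eq, mul_sum, sum_mul, mul_assoc]⟩ }
  have hρ : ∀ x, X.ρ x = B.dg fun k => (Y k).ρ x := fun x => rfl
  have hh : ∀ x, X.h x = B.dg fun k => (Y k).h x := fun x => rfl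
  refine ⟨X, fun k => B.l k * (Y k).ρ 1, fun k => (Y k).ρ 1 * B.r k, fun k => ?_, fun k => ?_,
    fun k => ?_, fun k l h => ?_, ?_⟩
  . refine ⟨⟨by rw [mul_assoc, <- map_mul, one_mul], fun x => ?_⟩, fun u => ?_⟩
    . rw [hρ, <- mul_assoc, B.dg_l, mul_assoc, mul_assoc, <- map_mul, <- map_mul, one_mul, mul_one]
    . rw [hh, <- mul_assoc, B.dg_l, mul_assoc, mul_assoc, ((Y k).h_mem u).1, VHom.one_mul ((Y k).h_mem u)]
  . have : ∀ x, (Y k).ρ 1 * B.r k * X.ρ x = (Y k).ρ x * ((Y k).ρ 1 * B.r k) := fun x => by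
      rw [hρ, mul_assoc, B.r_dg, <- mul_assoc, <- mul_assoc, <- map_mul, <- map_mul, one_mul, mul_one]
    refine ⟨⟨by rw [this, <- mul_assoc, <- map_mul, one_mul], this⟩, fun u => ?_⟩
    rw [hh, mul_assoc, B.r_dg, <- mul_assoc, <- mul_assoc, ((Y k).h_mem u).1, VHom.one_mul ((Y k).h_mem u)]
  . rw [mul_assoc, <- mul_assoc (B.r k), B.same, one_mul, <- map_mul, one_mul]
  . rw [mul_assoc, <- mul_assoc (B.r k), B.diff _ _ h, zero_mul, mul_zero]
  . rw [hρ, Fam.dg]; refine sum_congr rfl fun k _ => ?_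
    rw [mul_assoc, <- mul_assoc _ _ (B.r k), <- map_mul, one_mul, mul_assoc]

lemma _root_.Matrix.exists_eq_mul_of_idempotent [DecidableEq ι] {E : Matrix ι ι ℂ} (h : E * E = E) :
    ∃ (n : ℕ) (A : Matrix ι (Fin n) ℂ) (B : Matrix (Fin n) ι ℂ), A * B = E ∧ B * A = 1 := by
  let f := Matrix.toLin' E
  have hf : ∀ x : LinearMap.range f, f.rangeRestrict x = x := by
    rintro ⟨_, x, rfl⟩; apply Subtype.ext; change (f ∘ₗ f) x = f x; rw [<- Matrix.toLin'_mul, h]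
  let e := finBasis ℂ (LinearMap.range f)
  refine ⟨_, LinearMap.toMatrix e (Pi.basisFun ℂ ι) (LinearMap.range f).subtype,
    LinearMap.toMatrix (Pi.basisFun ℂ ι) e f.rangeRestrict, ?_, ?_⟩
  . rw [<- toMatrix_comp]; exact LinearMap.toMatrix'_toLin' E
  . rw [<- toMatrix_comp, <- LinearMap.toMatrix_id e]; congr 1; exact LinearMap.ext fun x => hf x

lemma exists_split {e : Op} (he : e ∈ Hom a a) (hee : e * e = e) : ∃ (Y : Obj H),
    e ∈ Hom Y a ∧ e ∈ Hom a Y ∧ e = Y.ρ 1 := by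
  obtain ⟨n, A, B, hAB, hBA⟩ := Matrix.exists_eq_mul_of_idempotent
    (by rw [<- Fam.coef_mul (mem_F he.1) (mem_F he.1), hee])
  have h1 : a.F.mat (stdFam.{u} n) A * (stdFam.{u} n).mat a.F B = e := by
    rw [Fam.mat_mul, hAB, Fam.mat_coef (mem_F he.1)]
  have h2 : (stdFam.{u} n).mat a.F B * a.F.mat (stdFam.{u} n) A = (stdFam.{u} n).ρ 1 := by
    rw [Fam.mat_mul, hBA, Fam.mat_one]
  generalize stdFam.{u} n = K at h1 h2; have hA := Fam.mat_mem a.F K A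
  have hB := Fam.mat_mem K a.F B
  generalize a.F.mat K A = s at *; generalize K.mat a.F B = s' at *; have h3 := he.1.2
  let Y : Obj H :=
    { ρ := { toFun := fun x => e * a.ρ x
             map_smul' := fun c x => by simp
             map_zero' := by simp
             map_add' := fun x y => by simp [mul_add]
             map_mul' := fun x y => by
              rw [map_mul, mul_assoc, <- mul_assoc (a.ρ x) e, <- h3, <- mul_assoc e (e * _), <- mul_assoc e e, hee, mul_assoc] }
      h := mulLeft ℂ e ∘ₗ a.h
      h_one := congr(e * $a.h_one)
      h_mul := fun x y => by
        change e * a.h (x * y) = e * a.h x * (e * a.h y)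
        rw [a.h_mul, he.2 x, mul_assoc, <- mul_assoc e e, hee, <- mul_assoc, <- mul_assoc, he.2 x]
      h_ρ := fun u x => by
        change e * a.h u * (e * a.ρ x) = e * a.ρ x * (e * a.h u)
        rw [he.2 u, mul_assoc, <- mul_assoc e e, hee, h3, <- mul_assoc, a.h_ρ, mul_assoc, mul_assoc, <- he.2, <- mul_assoc e e, hee]
      exists_fam := ⟨Fin n, inferInstance, inferInstance, ⟨fun k => s * K.l k, fun k => K.r k * s', fun i => by
          rw [mul_assoc, <- mul_assoc s', h2, <- mul_assoc, K.r_ρ, one_mul, K.same], fun i j h => by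
          rw [mul_assoc, <- mul_assoc s', h2, <- mul_assoc, K.r_ρ, one_mul, K.diff _ _ h]⟩, by
        ext1 x; change e * a.ρ x = ∑ k, s * K.l k * x * (K.r k * s')
        rw [h3, <- h1, <- mul_assoc, a.ρ_eq, <- hA.2, Fam.ρ_apply, Fam.dg, mul_sum, sum_mul]
        simp [mul_assoc]⟩ }
  have hρ : ∀ x, Y.ρ x = e * a.ρ x := fun _ => rfl
  have hh : ∀ x, Y.h x = e * a.h x := fun _ => rfl
  have h4 : e = Y.ρ 1 := by rw [hρ, he.1.1]
  refine ⟨Y, ⟨⟨by rw [<- h4, hee], fun x => ?_⟩, fun u => ?_⟩, ⟨⟨he.1.1, fun x => ?_⟩, fun u => ?_⟩, h4⟩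
  . rw [hρ, <- mul_assoc, hee, h3]
  . rw [hh, <- mul_assoc, hee, he.2]
  . rw [hρ, mul_assoc, <- h3, <- mul_assoc, hee]
  . rw [hh, mul_assoc, <- he.2, <- mul_assoc, hee]
end Obj

namespace Obj
variable [FiniteDimensional ℂ H] {a b : Obj H} {w t : Op.{u}}

variable (H) in
/-- The regular representation. -/
def reg : Obj H := mk' (stdFam _) (Algebra.leftMulMatrix (finBasis ℂ H))

variable (H) in
/-- The embedding of the underlying space of the regular representation into the operators. -/
def vec : H →ₗ[ℂ] Op.{u} := (finBasis ℂ H).constr ℂ (stdFam _).l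

lemma vec_basis (j) : vec H (finBasis ℂ H j) = (stdFam _).l j := Basis.constr_basis _ _ _ _

lemma reg_h_vec (x y : H) : (reg H).h x * vec H y = vec H (x * y) := by
  have : mulLeft ℂ ((reg H).h x) ∘ₗ vec H = vec H ∘ₗ mulLeft ℂ x := by
    refine (finBasis ℂ H).ext fun j => ?_
    simp [LinearMap.comp_apply, mulLeft_apply, vec_basis]
    rw [reg, mk'_h, Fam.mat_l, vec, Basis.constr_apply_fintype]
    simp [Algebra.leftMulMatrix_eq_repr_mul, Basis.equivFun_apply]
  exact congr($this y)

lemma ρ_vec (x : Op) (y : H) : (reg H).ρ x * vec H y = vec H y * x := by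
  have : mulLeft ℂ ((reg H).ρ x) ∘ₗ vec H = mulRight ℂ x ∘ₗ vec H := by
    refine (finBasis ℂ H).ext fun j => ?_
    simp [LinearMap.comp_apply, mulLeft_apply, mulRight_apply, vec_basis]; exact Fam.ρ_l _ _ _
  exact congr($this y)

/-- The regular representation is free on one generator. -/
lemma exists_lift (hw : ∀ x, a.ρ x * w = w * x) : ∃ t ∈ Hom (reg H) a, ∀ y, t * vec H y = a.h y * w := by
  let K := stdFam.{u} (finrank ℂ H)
  let t := ∑ k, a.h (finBasis ℂ H k) * w * K.r k
  have h1 : ∀ j, t * K.l j = a.h (finBasis ℂ H j) * w := fun j => by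
    rw [<- K.sum_r_mul_l (fun j => a.h (finBasis ℂ H j) * w), sum_mul]; simp [mul_assoc]
  have h2 : ∀ y, t * vec H y = a.h y * w := fun y => by
    have : mulLeft ℂ t ∘ₗ vec H = mulRight ℂ w ∘ₗ a.h :=
      (finBasis ℂ H).ext fun j => by
        simpa only [LinearMap.comp_apply, mulLeft_apply, mulRight_apply, vec_basis] using h1 j
    exact congr($this y)
  have h3 : t * K.ρ 1 = t := by simp [t, sum_mul, mul_assoc, K.r_ρ, one_mul]
  refine ⟨t, ⟨⟨h3, fun x => ?_⟩, fun u => K.ext_l ?_ ?_ fun j => ?_⟩, h2⟩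
  . change t * K.ρ x = _
    simp [t, sum_mul, mul_sum, mul_assoc, K.r_ρ]; refine sum_congr rfl fun k _ => ?_
    rw [<- mul_assoc w, <- hw, <- mul_assoc (a.ρ x), <- a.h_ρ]; simp [mul_assoc]
  . rw [mul_assoc]; exact congr(t * $(((reg H).h_mem u).1))
  . rw [mul_assoc, h3]
  . rw [<- vec_basis, mul_assoc, reg_h_vec, h2, mul_assoc, h2, a.h_mul, mul_assoc]

lemma ρ_F_l (a : Obj H) (i : a.ι) (x : Op) : a.ρ x * a.F.l i = a.F.l i * x := by
  rw [a.ρ_eq, Fam.ρ_l]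

lemma one_mul_of_comm (hw : ∀ x, a.ρ x * w = w * x) : a.h 1 * w = w := by rw [a.h_one, hw, mul_one]

lemma exists_reg (ht : t ∈ Hom a b) (h0 : t ≠ 0) : ∃ s ∈ Hom (reg H) a, t * s ≠ 0 := by
  by_contra! hc
  refine h0 (a.F.ext_l (mem_F ht.1).1 (zero_mul _) fun i => ?_)
  obtain ⟨s, hs, h⟩ := exists_lift (a.ρ_F_l i)
  rw [<- one_mul_of_comm (a.ρ_F_l i), <- h 1, <- mul_assoc, hc s hs, zero_mul, zero_mul]

lemma finrank_hom_reg (a : Obj H) : finrank ℂ (Hom (reg H) a) = Fintype.card a.ι := by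
  let f : Hom (reg H) a →ₗ[ℂ] a.ι -> ℂ := LinearMap.pi fun i =>
    om ∘ₗ mulLeft ℂ (a.F.r i) ∘ₗ mulRight ℂ (vec H 1) ∘ₗ (Hom (reg H) a).subtype
  have hf : ∀ t i, f t i = om (a.F.r i * (t * vec H 1)) := fun _ _ => rfl
  have hb : Function.Bijective f := by
    refine ⟨fun s t h => ?_, fun c => ?_⟩
    . have h1 : ∀ t i, a.F.r i * (t.1 * vec H 1) = f t i • 1 := fun t i => eq_om_smul fun x => by
        rw [mul_assoc, mul_assoc, <- ρ_vec, <- mul_assoc t.1, t.2.1.2, a.ρ_eq, <- mul_assoc,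
          <- mul_assoc, a.F.r_ρ]
        simp [mul_assoc]
      have h2 : ∀ t, t.1 * vec H 1 = ∑ i, a.F.l i * f t i • 1 := fun t => by
        rw [<- VHom.one_mul t.2.1, a.ρ_eq, Fam.ρ_one, mul_assoc, sum_mul]; simp [mul_assoc, h1]
      refine Subtype.ext ((stdFam _).ext_l s.2.1.1 t.2.1.1 fun j => ?_)
      rw [<- vec_basis, <- mul_one (finBasis ℂ H j), <- reg_h_vec, <- mul_assoc, s.2.2, mul_assoc, h2, h,
        <- h2, <- mul_assoc, <- t.2.2, mul_assoc]
    . have hw : ∀ x, a.ρ x * (∑ i, c i • a.F.l i) = (∑ i, c i • a.F.l i) * x := fun x => by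
        simp [mul_sum, sum_mul, ρ_F_l]
      obtain ⟨t, ht, h⟩ := exists_lift hw; refine ⟨⟨t, ht⟩, funext fun i => ?_⟩
      rw [hf, h, one_mul_of_comm hw, mul_sum, sum_eq_single i _ (by simp)]
      . rw [mul_smul_comm, a.F.same, map_smul, om_one, smul_eq_mul, mul_one]
      . intro j _ hj; rw [mul_smul_comm, a.F.diff _ _ hj.symm, smul_zero]
  rw [(LinearEquiv.ofBijective f hb).finrank_eq, finrank_fintype_fun_eq_card]

lemma tr_one' (a : Obj H) : a.tr (a.ρ 1) = Fintype.card a.ι := tr_one a.ρ_eq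

variable (H) in
/-- The fusion category of representations. -/
def rep [IsSemisimpleRing H] : Fus Op.{u} (Obj H) where
  one a := a.ρ 1
  Hom := Hom
  one_mem a := ⟨VHom.one _, fun u => by rw [VHom.one_mul (a.h_mem u), (a.h_mem u).1]⟩
  comp_mem hs ht := ⟨VHom.comp hs.1 ht.1, fun u => by
    rw [mul_assoc, ht.2, <- mul_assoc, hs.2, mul_assoc]⟩
  comp_one ht := ht.1.1
  one_comp ht := VHom.one_mul ht.1
  fin a b := Module.Finite.of_injective (b.F.coef a.F ∘ₗ (Hom a b).subtype) fun s t h =>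
    Subtype.ext (by
      rw [<- Fam.mat_coef (mem_F s.2.1), <- Fam.mat_coef (mem_F t.2.1)]
      exact congr(b.F.mat a.F $h))
  tr := tr
  tr_comm hs ht := tr_comm hs.1 ht.1
  tr_nondeg ht h := tr_nondeg exists_integral.choose_spec antipode_antipode ht h
  tr_nilp ht h := tr_nilp ht.1 h
  gen := ⟨{reg H}, fun a b s hs h0 => ⟨_, by simp, exists_reg hs h0⟩⟩
  ρ := Obj.ρ
  ρ_one _ := rfl
  ρ_mul _ _ _ := rfl
  one_eq _ := rfl
  nat ht := ht.1.2
  lw := lw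
  rw := rw
  unit t ht := ⟨_, eq_om_smul ht.1.2⟩
  one_ne h := by simpa [om_one] using congr(om $h)
  tr_unit := by
    have := tr_one (a := (1 : Obj H)) (F := oneFam) (by ext1 x; simp [Fam.ρ_apply, Fam.dg, oneFam, one_ρ])
    simpa [one_ρ] using this
  sum Y := by
    obtain ⟨X, s, s', h1, h2, h3, h4, h5⟩ := exists_sum Y; exact ⟨X, s, s', h1, h2, h3, h4, h5⟩
  rat a := ⟨Fintype.card a.ι, by positivity, by rw [tr_one']; simp⟩
  cj := cj
  cv a := a.F.cv
  ev a := a.F.ev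
  cv' a := a.F.cv
  ev' a := a.F.ev
  cv_mem a := cv_mem rfl a.ρ_eq (exists_mat' antipode_antipode)
  ev_mem a := ev_mem antipode_antipode a.ρ_eq rfl exists_mat
  cv'_mem a := cv_mem a.ρ_eq rfl exists_mat
  ev'_mem a := ev_mem antipode_antipode rfl a.ρ_eq (exists_mat' antipode_antipode)
  zig a := by rw [a.ρ_eq]; exact zig
  zag a := zag
  zig' a := zig
  zag' a := by rw [a.ρ_eq]; exact zag
  tr_left {a b t} ht := tr_left a.ρ_eq ht.1
  tr_left' {a b t} ht := by rw [a.ρ_eq]; exact tr_left rfl ht.1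
  tr_right {a b t} ht := tr_right a.ρ_eq ht.1
  tr_right' ht := tr_right rfl ht.1

variable [IsSemisimpleRing H]

instance : (rep H).Split := ⟨fun {a e} he hee => by
  obtain ⟨Y, h1, h2, h3⟩ := exists_split he hee
  exact ⟨Y, e, e, h1, h2, hee.trans h3, hee⟩⟩

lemma dim_eq {ι : Type} [Fintype ι] {F : Fam ι} (ha : a.ρ = F.ρ) :
    (rep H).dim a = Fintype.card ι := by
  have := (rep H).d_eq a
  rw [Fus.d] at this; exact_mod_cast this.symm.trans (tr_one ha)

variable (H) in
lemma gd_rep : (rep H).gd = finrank ℂ H := by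
  have h := (Fus.add_dim (C := rep H)).eq_sum (reg H)
  rw [dim_eq rfl, card_fin] at h; rw [h, Mdl.gd_eq]; refine sum_congr rfl fun i _ => ?_
  rw [LCat.hd_comm, pow_two, smul_eq_mul]; congr 1; rw [dim_eq (ρ_eq _)]
  exact (finrank_hom_reg _).symm

lemma finrank_dvd {V : Type*} [AddCommGroup V] [Module ℂ V] [Module H V] [IsScalarTower ℂ H V]
    [IsSimpleModule H V] {p q r s : ℕ} (hp : p.Prime) (hq : q.Prime)
    (hdim : finrank ℂ H = p ^ r * q ^ s) : finrank ℂ V ∣ finrank ℂ H := by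
  have : Module.Finite ℂ V := Module.Finite.trans H V
  let β := finBasis ℂ V
  let K := stdFam.{u} (finrank ℂ V)
  let π : H →ₐ[ℂ] Matrix (Fin (finrank ℂ V)) (Fin (finrank ℂ V)) ℂ :=
    (LinearMap.toMatrixAlgEquiv β).toAlgHom.comp (Algebra.lsmul ℂ ℂ V)
  have hX : (rep H).Simple (mk' K π) := by
    constructor
    . change K.ρ 1 ≠ 0
      intro h; have := IsSimpleModule.nontrivial H V; let i : Fin (finrank ℂ V) := ⟨0, finrank_pos⟩
      have h1 := K.ρ_l 1 i
      rw [h, zero_mul, mul_one] at h1; have h2 := K.same i; rw [<- h1, mul_zero] at h2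
      simpa [om_one] using congr(om $h2)
    . intro t ht; have ht' := ht.1; let φ := Matrix.toLin β β (K.coef K t)
      have h1 := fun u v => by
        have h2 := congr(K.coef K $(ht.2 u))
        rw [mk'_h, Fam.coef_mul ht' (Fam.mat_mem _ _ _), Fam.coef_mul (Fam.mat_mem _ _ _) ht',
          Fam.coef_mat] at h2
        have h3 := congr(Matrix.toLin β β $h2 v)
        rw [Matrix.toLin_mul β β β, Matrix.toLin_mul β β β] at h3
        have h4 : Matrix.toLin β β (π u) = Algebra.lsmul ℂ ℂ V u := Matrix.toLin_toMatrix _ _ _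
        rw [h4] at h3; exact h3
      obtain ⟨c, hc⟩ := (IsSimpleModule.algebraMap_end_bijective_of_isAlgClosed ℂ).2
        { φ with map_smul' := h1 }
      refine ⟨c, ?_⟩
      have h5 : φ = c • LinearMap.id := LinearMap.ext fun v => congr($hc v).symm
      have h6 : K.coef K t = c • 1 := by
        apply (Matrix.toLin β β).injective
        rw [map_smul, Matrix.toLin_one, <- h5]
      rw [<- Fam.mat_coef ht', h6]; change _ = c • K.ρ 1; rw [<- Fam.mat_one]
      simp [Fam.mat, smul_sum, smul_smul]
  have h := Fus.dim_dvd_gd hp hq (gd_rep H ▸ hdim) hX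
  rwa [gd_rep, dim_eq rfl, card_fin] at h
end Obj
end Hopf

end

/-- Kaplansky's sixth conjecture for semisimple Hopf algebras over ℂ of dimension
`p^r * q^s`: the dimension of any simple module divides the dimension of the Hopf
algebra. -/
theorem kaplansky_sixth_for_dim_prime_power_product
    (p q r s : ℕ) (hp : p.Prime) (hq : q.Prime)
    (H : Type*) [Ring H] [HopfAlgebra ℂ H]
    [FiniteDimensional ℂ H] [IsSemisimpleRing H]
    (hdim : Module.finrank ℂ H = p ^ r * q ^ s)
    (V : Type*) [AddCommGroup V] [Module ℂ V] [Module H V] [IsScalarTower ℂ H V]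
    [IsSimpleModule H V] :
    Module.finrank ℂ V ∣ Module.finrank ℂ H :=
  Hopf.Obj.finrank_dvd hp hq hdim
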